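/- Let ω ∈ Ω be slowly varying, i.e. for every λ > 0, lim_{x→∞} ω(λx)/ω(x) = 1. Then for every real t, lim_{X→∞} (1/X)·Leb{x ∈ (X,2X) : Ê(x;ω)/σ(X;ω) < t} = (1/√(2π))·∫_{−∞}^{t} exp(−α²/2) dα; that is, the limiting distribution of Ê(x;ω)/σ(X;ω) is the standard Gaussian measure. -/

import Mathlib

open MeasureTheory Filter Real

noncomputable section

/-- The Cygan–Korányi norm on `ℝ³`. -/
def cyganNorm (u : ℝ × ℝ × ℝ) : ℝ :=
  ((u.1 ^ 2 + u.2.1 ^ 2) ^ 2 + u.2.2 ^ 2) ^ ((1 : ℝ) / 4)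

/-- The unit ball for the Cygan–Korányi norm. -/
def cyganBall : Set (ℝ × ℝ × ℝ) := {u | cyganNorm u ≤ 1}

/-- The Heisenberg dilation `δ_x`. -/
def heisDil (x : ℝ) (u : ℝ × ℝ × ℝ) : ℝ × ℝ × ℝ := (x * u.1, x * u.2.1, x ^ 2 * u.2.2)

/-- Euclidean volume of the Cygan–Korányi unit ball. -/
def volB : ℝ := (volume cyganBall).toReal

/-- `N(x)`: the number of integer lattice points inside `δ_x B`. -/
def latticeCount (x : ℝ) : ℕ :=
  Set.ncard {p : ℤ × ℤ × ℤ | ((p.1 : ℝ), (p.2.1 : ℝ), (p.2.2 : ℝ)) ∈ heisDil x '' cyganBall}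

/-- The error term `E(x;ω)` for the shell count. -/
def Eshell (ω : ℝ → ℝ) (x : ℝ) : ℝ :=
  ((latticeCount (x + ω x) : ℝ) - (latticeCount x : ℝ))
    - volB * ∑ j ∈ Finset.Icc 1 4, (Nat.choose 4 j : ℝ) * x ^ (4 - j) * ω x ^ j

/-- The normalized error term `Ê(x;ω) = E(x;ω)/x²`. -/
def Ehat (ω : ℝ → ℝ) (x : ℝ) : ℝ := Eshell ω x / x ^ 2

/-- `σ(X;ω)`, the square root of the variance of `Ê(x;ω)` over `[X,2X]`. -/
def sigmaShell (ω : ℝ → ℝ) (X : ℝ) : ℝ :=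
  Real.sqrt ((1 / X) * ∫ x in X..(2 * X), Ehat ω x ^ 2)

/-- `M_j(X;ω) = (1/X)·∫_X^{2X} (ω(x)·log ω(x))^j dx`. -/
def Mom (j : ℕ) (X : ℝ) (ω : ℝ → ℝ) : ℝ :=
  (1 / X) * ∫ x in X..(2 * X), (ω x * Real.log (ω x)) ^ j

/-- `L_j(ω) = lim_{X→∞} M_j(X;ω)/M_2(X;ω)^{j/2}`. -/
def Llim (ω : ℝ → ℝ) (j : ℕ) : ℝ :=
  limUnder atTop fun X => Mom j X ω / Mom 2 X ω ^ (j / 2)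

/-- The Gaussian moment factor `j!/(2^{j/2}·(j/2)!)`. -/
def gaussMoment (j : ℕ) : ℝ :=
  (Nat.factorial j : ℝ) / (2 ^ (j / 2) * (Nat.factorial (j / 2) : ℝ))

/-- The regularity class `Ω` of gap width functions. -/
structure OmegaClass (ω : ℝ → ℝ) : Prop where
  contDiff : ContDiffOn ℝ 2 ω (Set.Ioi 0)
  pos : ∀ x, 0 < x → 0 < ω x
  tendsto_zero : Tendsto ω atTop (nhds 0)
  deriv_small : ∀ᶠ x in atTop, |deriv ω x| < 1 / 2
  zeros_bound : ∃ C > (0 : ℝ), ∃ ξ > (0 : ℝ), ∀ᶠ X in atTop,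
    {x ∈ Set.Icc X (2 * X) | deriv ω x = 0}.Finite ∧
    {x ∈ Set.Icc X (2 * X) | deriv (deriv ω) x = 0}.Finite ∧
    ({x ∈ Set.Icc X (2 * X) | deriv ω x = 0}.ncard : ℝ) *
        sSup (ω '' Set.Icc X (2 * X)) ≤ C * X ^ ((1 : ℝ) / 2) ∧
    ({x ∈ Set.Icc X (2 * X) | deriv (deriv ω) x = 0}.ncard : ℝ) ≤ C * X ^ (1 - ξ)
  mom2_lower : ∀ α > (0 : ℝ), ∃ c > (0 : ℝ), ∀ᶠ X in atTop, c * X ^ (-α) ≤ Mom 2 X ω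
  Llim_exists : ∀ j : ℕ, Even j →
    Tendsto (fun X => Mom j X ω / Mom 2 X ω ^ (j / 2)) atTop (nhds (Llim ω j))
  carleman : Tendsto (fun n => ∑ k ∈ Finset.range n,
      (gaussMoment (2 * (k + 1)) * Llim ω (2 * (k + 1))) ^
        ((-1 : ℝ) / (2 * ((k : ℝ) + 1)))) atTop atTop

/-- `r₂(m)`: the number of representations of `m` as a sum of two integer squares. -/
def r2 (m : ℕ) : ℕ := Set.ncard {p : ℤ × ℤ | p.1 ^ 2 + p.2 ^ 2 = (m : ℤ)}

/-- The sawtooth function `ψ(t) = t − ⌊t⌋ − 1/2`. -/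
def sawtooth (t : ℝ) : ℝ := t - ⌊t⌋ - 1 / 2

/-- The sawtooth sum `Ξ_ψ(x;ω)`. -/
def XiPsi (ω : ℝ → ℝ) (x : ℝ) : ℝ :=
  (∑ m ∈ Finset.Icc 1 ⌊(x + ω x) ^ 2⌋₊,
      (r2 m : ℝ) * sawtooth (Real.sqrt ((x + ω x) ^ 4 - (m : ℝ) ^ 2)))
    - ∑ m ∈ Finset.Icc 1 ⌊x ^ 2⌋₊, (r2 m : ℝ) * sawtooth (Real.sqrt (x ^ 4 - (m : ℝ) ^ 2))

/-! ### Representations by sums of two squares -/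

def reps (m : ℕ) : Finset (ℤ × ℤ) :=
  ((Finset.Icc (-(m:ℤ)) m) ×ˢ (Finset.Icc (-(m:ℤ)) m)).filter
    (fun p => p.1 ^ 2 + p.2 ^ 2 = (m : ℤ))

lemma mem_reps {m : ℕ} {p : ℤ × ℤ} : p ∈ reps m ↔ p.1 ^ 2 + p.2 ^ 2 = (m : ℤ) := by
  unfold reps
  simp only [Finset.mem_filter, Finset.mem_product, Finset.mem_Icc, and_iff_right_iff_imp]
  intro h
  refine ⟨⟨?_, ?_⟩, ?_, ?_⟩ <;> nlinarith [sq_nonneg p.1, sq_nonneg p.2, sq_nonneg (p.1 + 1),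
    sq_nonneg (p.1 - 1), sq_nonneg (p.2 + 1), sq_nonneg (p.2 - 1)]

lemma r2_eq_card (m : ℕ) : r2 m = (reps m).card := by
  unfold r2
  rw [← Set.ncard_coe_finset]
  congr 1
  ext p
  simp [mem_reps]

lemma r2_zero : r2 0 = 1 := by
  rw [r2_eq_card]
  rw [Finset.card_eq_one]
  refine ⟨(0, 0), ?_⟩
  ext p
  rw [mem_reps, Finset.mem_singleton, Prod.ext_iff]
  constructor
  · intro h
    have h1 := sq_nonneg p.1
    have h2 := sq_nonneg p.2
    constructor
    · apply pow_eq_zero_iff (two_ne_zero) |>.1; push_cast at h; linarith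
    · apply pow_eq_zero_iff (two_ne_zero) |>.1; push_cast at h; linarith
  · rintro ⟨h1, h2⟩
    simp only at h1 h2
    rw [h1, h2]; simp

/-- lattice points in the disc -/
def disc (T : ℕ) : Finset (ℤ × ℤ) :=
  ((Finset.Icc (-(T.sqrt:ℤ)) T.sqrt) ×ˢ (Finset.Icc (-(T.sqrt:ℤ)) T.sqrt)).filter
    (fun p => p.1 ^ 2 + p.2 ^ 2 ≤ (T : ℤ))

lemma sq_le_imp_sqrt {a : ℤ} {T : ℕ} (h : a ^ 2 ≤ (T:ℤ)) : -(T.sqrt:ℤ) ≤ a ∧ a ≤ T.sqrt := by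
  have h1 : a.natAbs ≤ T.sqrt := by
    rw [Nat.le_sqrt]
    zify
    rw [← sq, sq_abs]; exact h
  constructor <;> omega

lemma mem_disc {T : ℕ} {p : ℤ × ℤ} : p ∈ disc T ↔ p.1 ^ 2 + p.2 ^ 2 ≤ (T : ℤ) := by
  unfold disc
  simp only [Finset.mem_filter, Finset.mem_product, Finset.mem_Icc, and_iff_right_iff_imp]
  intro h
  exact ⟨sq_le_imp_sqrt (by nlinarith [sq_nonneg p.2]), sq_le_imp_sqrt (by nlinarith [sq_nonneg p.1])⟩

lemma sum_r2_eq_sum_disc (T : ℕ) (g : ℕ → ℝ) :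
    ∑ m ∈ Finset.range (T + 1), (r2 m : ℝ) * g m
      = ∑ p ∈ disc T, g ((p.1 ^ 2 + p.2 ^ 2).toNat) := by
  have hmaps : ∀ p ∈ disc T, (p.1 ^ 2 + p.2 ^ 2).toNat ∈ Finset.range (T + 1) := by
    intro p hp
    rw [mem_disc] at hp
    rw [Finset.mem_range]; omega
  rw [← Finset.sum_fiberwise_of_maps_to hmaps]
  apply Finset.sum_congr rfl
  intro m hm
  have : (disc T).filter (fun p => (p.1 ^ 2 + p.2 ^ 2).toNat = m) = reps m := by
    ext p
    rw [Finset.mem_filter, mem_disc, mem_reps]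
    rw [Finset.mem_range] at hm
    have := sq_nonneg p.1
    have := sq_nonneg p.2
    constructor
    · rintro ⟨h1, h2⟩; omega
    · intro h; constructor <;> omega
  rw [this, r2_eq_card]
  rw [Finset.sum_congr rfl (g := fun _ => g m)]
  · simp
  · intro p hp
    rw [mem_reps] at hp
    congr 1
    omega

lemma card_disc_le (T : ℕ) (hT : 1 ≤ T) : ((disc T).card : ℝ) ≤ 9 * T := by
  have h1 : (disc T).card ≤ (2 * T.sqrt + 1) ^ 2 := by
    refine (Finset.card_filter_le _ _).trans ?_
    rw [Finset.card_product, Int.card_Icc]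
    apply le_of_eq
    have : ((T.sqrt:ℤ) + 1 - -(T.sqrt:ℤ)).toNat = 2 * T.sqrt + 1 := by omega
    rw [this]; ring
  have h2 : 1 ≤ T.sqrt := by rw [Nat.le_sqrt]; omega
  have h3 : T.sqrt * T.sqrt ≤ T := Nat.sqrt_le T
  have : (disc T).card ≤ 9 * T := by nlinarith
  exact_mod_cast this

lemma sum_r2_le (T : ℕ) (hT : 1 ≤ T) : ∑ m ∈ Finset.range (T + 1), (r2 m : ℝ) ≤ 9 * T := by
  have := sum_r2_eq_sum_disc T (fun _ => 1)
  simp only [mul_one, Finset.sum_const, nsmul_eq_mul] at this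
  rw [this]
  exact card_disc_le T hT

lemma sum_Icc_r2_le (T : ℕ) : ∑ m ∈ Finset.Icc 1 T, (r2 m : ℝ) ≤ 9 * T := by
  rcases Nat.eq_zero_or_pos T with h | h
  · subst h; simp
  · refine le_trans ?_ (sum_r2_le T h)
    apply Finset.sum_le_sum_of_subset_of_nonneg
    · intro m; simp only [Finset.mem_Icc, Finset.mem_range]; omega
    · intros; positivity

/-- the key convolution inequality -/
lemma r2_sq_le (n : ℕ) (hn : 1 ≤ n) :
    r2 n ^ 2 ≤ ∑ jk ∈ (4 * n).divisorsAntidiagonal, r2 jk.1 * r2 jk.2 := by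
  have e1 : r2 n ^ 2 = (reps n ×ˢ reps n).card := by
    rw [Finset.card_product, r2_eq_card, sq]
  have e2 : ∑ jk ∈ (4 * n).divisorsAntidiagonal, r2 jk.1 * r2 jk.2
      = ((4 * n).divisorsAntidiagonal.sigma (fun jk => reps jk.1 ×ˢ reps jk.2)).card := by
    rw [Finset.card_sigma]
    apply Finset.sum_congr rfl
    intro jk _
    rw [Finset.card_product, r2_eq_card, r2_eq_card]
  rw [e1, e2]
  -- parametrization
  have key : ∀ q : (ℤ × ℤ) × (ℤ × ℤ), q ∈ reps n ×ˢ reps n → ∃ z w : ℤ × ℤ,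
      (z.1 ^ 2 + z.2 ^ 2) * (w.1 ^ 2 + w.2 ^ 2) = 4 * n ∧
      q.1.1 - q.2.1 = w.1 * z.1 ∧ q.2.2 - q.1.2 = w.1 * z.2 ∧
      q.1.1 + q.2.1 = w.2 * z.2 ∧ q.2.2 + q.1.2 = w.2 * z.1 := by
    rintro ⟨⟨a, b⟩, ⟨c, d⟩⟩ hq
    rw [Finset.mem_product, mem_reps, mem_reps] at hq
    obtain ⟨h1, h2⟩ := hq
    simp only at h1 h2 ⊢
    have hpq : (a - c) * (a + c) = (d - b) * (d + b) := by nlinarith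
    have h4 : (a - c) ^ 2 + (a + c) ^ 2 + (d - b) ^ 2 + (d + b) ^ 2 = 4 * n := by nlinarith
    have hn' : (1:ℤ) ≤ n := by exact_mod_cast hn
    by_cases hz : a - c = 0 ∧ d - b = 0
    · obtain ⟨hz1, hz2⟩ := hz
      refine ⟨(d + b, a + c), (0, 1), ?_, ?_, ?_, ?_, ?_⟩ <;> simp only <;>
        first | linarith | (rw [hz1, hz2] at h4; linarith)
    · have hg : 0 < Int.gcd (a - c) (d - b) := by
        rw [Nat.pos_iff_ne_zero, Ne, Int.gcd_eq_zero_iff]; exact hz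
      obtain ⟨al, be, hcop, hal, hbe⟩ := Int.exists_gcd_one hg
      set g : ℤ := (Int.gcd (a - c) (d - b) : ℤ) with hgdef
      have hg0 : g ≠ 0 := by
        rw [hgdef]; exact_mod_cast hg.ne'
      have h5 : al * (a + c) = be * (d + b) := by
        apply mul_left_cancel₀ hg0
        rw [hal, hbe] at hpq
        linarith
      have h6 : be ∣ a + c := by
        have : be ∣ al * (a + c) := ⟨d + b, h5⟩
        exact (Int.isCoprime_iff_gcd_eq_one.2 hcop).symm.dvd_of_dvd_mul_left this
      obtain ⟨t0, ht0⟩ := h6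
      by_cases hbe0 : be = 0
      · -- then al = ±1
        have hal0 : al ≠ 0 := by
          intro h; rw [h, hbe0] at hcop; simp at hcop
        have hal1 : al ^ 2 = 1 := by
          rw [hbe0] at hcop
          simp at hcop
          rcases Int.natAbs_eq al with h | h <;> rw [h, hcop] <;> simp
        have hac : a + c = 0 := by rw [ht0, hbe0]; ring
        have e1 : (a - c) = g * al := by linarith
        have e2 : d - b = 0 := by rw [hbe, hbe0]; ring
        refine ⟨(al, be), (g, al * (d + b)), ?_, ?_, ?_, ?_, ?_⟩ <;> simp only
        · rw [hbe0]; rw [e1, hac, e2] at h4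
          have : (al ^ 2 + 0 ^ 2) * (g ^ 2 + (al * (d + b)) ^ 2)
            = (g * al) ^ 2 + al ^ 2 * al ^ 2 * (d + b) ^ 2 := by ring
          rw [this, hal1]; linarith
        · linarith
        · rw [hbe0]; linarith
        · rw [hbe0, hac]; ring
        · have : al * (d + b) * al = al ^ 2 * (d + b) := by ring
          rw [this, hal1]; ring
      · have ht1 : d + b = t0 * al := by
          apply mul_left_cancel₀ hbe0
          rw [ht0] at h5; linarith
        refine ⟨(al, be), (g, t0), ?_, ?_, ?_, ?_, ?_⟩ <;> simp only
        · have e1 : (a - c) = g * al := by linarith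
          have e2 : (d - b) = g * be := by linarith
          rw [e1, ht0, e2, ht1] at h4
          linarith
        all_goals linarith
  choose! z w hzw using key
  let f : (ℤ × ℤ) × (ℤ × ℤ) → (_ : ℕ × ℕ) × ((ℤ × ℤ) × (ℤ × ℤ)) := fun q =>
    ⟨(((z q).1 ^ 2 + (z q).2 ^ 2).toNat, ((w q).1 ^ 2 + (w q).2 ^ 2).toNat), (z q, w q)⟩
  apply Finset.card_le_card_of_injOn f
  · intro q hq
    have hq' := hzw q (Finset.mem_coe.1 hq)
    simp only [f, Finset.coe_sigma, Set.mem_sigma_iff, Finset.mem_coe, Nat.mem_divisorsAntidiagonal,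
      Finset.mem_product, mem_reps]
    have p1 : 0 ≤ (z q).1 ^ 2 + (z q).2 ^ 2 := by positivity
    have p2 : 0 ≤ (w q).1 ^ 2 + (w q).2 ^ 2 := by positivity
    refine ⟨⟨?_, by omega⟩, ?_, ?_⟩
    · zify
      rw [Int.toNat_of_nonneg p1, Int.toNat_of_nonneg p2]
      exact hq'.1
    · rw [Int.toNat_of_nonneg p1]
    · rw [Int.toNat_of_nonneg p2]
  · intro q hq q' hq' hff
    have h := (hzw q (Finset.mem_coe.1 hq)).2
    have h' := (hzw q' (Finset.mem_coe.1 hq')).2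
    simp only [f, Sigma.mk.injEq, heq_eq_eq, Prod.mk.injEq] at hff
    obtain ⟨_, hz, hw⟩ := hff
    rw [hz, hw] at h
    ext <;> omega

/-! ### Summatory bounds for `r2` and its square -/

lemma abel_eq (a φ : ℕ → ℝ) (Y N : ℕ) (h : Y ≤ N) :
    ∑ n ∈ Finset.Ioc Y N, a n * φ n
      = ∑ n ∈ Finset.Ioc Y N, (∑ k ∈ Finset.Icc 1 n, a k) * (φ n - φ (n + 1))
        + (∑ k ∈ Finset.Icc 1 N, a k) * φ (N + 1) - (∑ k ∈ Finset.Icc 1 Y, a k) * φ (Y + 1) := by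
  induction N, h using Nat.le_induction with
  | base => simp
  | succ N hN ih =>
    rw [Finset.sum_Ioc_succ_top (by omega), ih, Finset.sum_Ioc_succ_top (by omega),
      Finset.sum_Icc_succ_top (by omega : 1 ≤ N + 1)]
    ring

lemma abel_le (a φ : ℕ → ℝ) (ha : ∀ n, 0 ≤ a n) (hφ : ∀ n, 0 ≤ φ n) (Y N : ℕ) (h : Y ≤ N) :
    ∑ n ∈ Finset.Ioc Y N, a n * φ n
      ≤ ∑ n ∈ Finset.Ioc Y N, (∑ k ∈ Finset.Icc 1 n, a k) * (φ n - φ (n + 1))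
        + (∑ k ∈ Finset.Icc 1 N, a k) * φ (N + 1) := by
  rw [abel_eq a φ Y N h]
  have : 0 ≤ (∑ k ∈ Finset.Icc 1 Y, a k) * φ (Y + 1) :=
    mul_nonneg (Finset.sum_nonneg fun i _ => ha i) (hφ _)
  linarith

lemma sum_inv_le (M : ℕ) : ∑ n ∈ Finset.Icc 1 M, (1:ℝ) / n ≤ 1 + Real.log M := by
  have := harmonic_le_one_add_log M
  rw [harmonic_eq_sum_Icc] at this
  push_cast at this
  simpa [one_div] using this

lemma sum_inv_succ_le (M : ℕ) : ∑ n ∈ Finset.Icc 1 M, (1:ℝ) / (n + 1) ≤ 1 + Real.log M := by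
  refine le_trans (Finset.sum_le_sum fun n hn => ?_) (sum_inv_le M)
  have : (1:ℝ) ≤ n := by exact_mod_cast (Finset.mem_Icc.1 hn).1
  apply one_div_le_one_div_of_le <;> linarith

lemma Icc_one_eq_Ioc (M : ℕ) : Finset.Icc 1 M = Finset.Ioc 0 M := by
  ext; simp [Finset.mem_Icc, Finset.mem_Ioc]; omega

lemma one_le_one_add_log (M : ℕ) : (1:ℝ) ≤ 1 + Real.log M := by
  have : 0 ≤ Real.log M := Real.log_natCast_nonneg M
  linarith

lemma sum_r2_div_le (M : ℕ) :
    ∑ n ∈ Finset.Icc 1 M, (r2 n : ℝ) * (1 / n) ≤ 18 * (1 + Real.log M) := by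
  rw [Icc_one_eq_Ioc]
  refine (abel_le (fun n => (r2 n : ℝ)) (fun n => (1:ℝ) / n) (fun n => by positivity)
    (fun n => by positivity) 0 M (Nat.zero_le _)).trans ?_
  rw [← Icc_one_eq_Ioc]
  have h1 : ∑ n ∈ Finset.Icc 1 M, (∑ k ∈ Finset.Icc 1 n, (r2 k : ℝ)) * ((1:ℝ) / n - 1 / ((n + 1 : ℕ):ℝ))
      ≤ 9 * (1 + Real.log M) := by
    refine le_trans (Finset.sum_le_sum fun n hn => ?_)
      (le_trans (le_of_eq (Finset.mul_sum _ _ _).symm)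
        (mul_le_mul_of_nonneg_left (sum_inv_succ_le M) (by norm_num : (0:ℝ) ≤ 9)))
    have hn1 : (1:ℝ) ≤ n := by exact_mod_cast (Finset.mem_Icc.1 hn).1
    have e : (1:ℝ) / n - 1 / ((n + 1 : ℕ):ℝ) = 1 / (n * (n + 1)) := by
      push_cast; field_simp; ring
    rw [e]
    calc (∑ k ∈ Finset.Icc 1 n, (r2 k : ℝ)) * (1 / (n * (n + 1)))
        ≤ (9 * n) * (1 / (n * (n + 1))) :=
          mul_le_mul_of_nonneg_right (sum_Icc_r2_le n) (by positivity)
      _ = 9 * (1 / (n + 1)) := by field_simp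
  have h2 : (∑ k ∈ Finset.Icc 1 M, (r2 k : ℝ)) * ((1:ℝ) / ((M + 1 : ℕ):ℝ)) ≤ 9 := by
    rw [mul_one_div, div_le_iff₀ (by positivity)]
    refine (sum_Icc_r2_le M).trans ?_
    push_cast; linarith
  have := one_le_one_add_log M
  linarith

lemma sum_r2_sq_le (T : ℕ) (hT : 1 ≤ T) :
    ∑ n ∈ Finset.Icc 1 T, (r2 n : ℝ) ^ 2 ≤ 2000 * T * (1 + Real.log T) := by
  have h1 : ∑ n ∈ Finset.Icc 1 T, (r2 n : ℝ) ^ 2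
      ≤ ∑ n ∈ Finset.Icc 1 T, ∑ jk ∈ (4 * n).divisorsAntidiagonal, (r2 jk.1 : ℝ) * r2 jk.2 := by
    apply Finset.sum_le_sum
    intro n hn
    have := r2_sq_le n (Finset.mem_Icc.1 hn).1
    exact_mod_cast this
  refine h1.trans ?_
  rw [← Finset.sum_biUnion]
  · have h2 : (Finset.Icc 1 T).biUnion (fun n => (4 * n).divisorsAntidiagonal)
        ⊆ ((Finset.Icc 1 (4 * T)).sigma (fun j => Finset.Icc 1 (4 * T / j))).image
          (fun x => (x.1, x.2)) := by
      intro ⟨j, k⟩ hjk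
      rw [Finset.mem_biUnion] at hjk
      obtain ⟨n, hn, hd⟩ := hjk
      rw [Nat.mem_divisorsAntidiagonal] at hd
      obtain ⟨hd1, hd2⟩ := hd
      simp only at hd1
      rw [Finset.mem_Icc] at hn
      have hj : j ≠ 0 := by rintro rfl; simp at hd1; omega
      have hk : k ≠ 0 := by rintro rfl; simp at hd1; omega
      rw [Finset.mem_image]
      refine ⟨⟨j, k⟩, ?_, rfl⟩
      rw [Finset.mem_sigma, Finset.mem_Icc, Finset.mem_Icc]
      simp only
      refine ⟨⟨by omega, ?_⟩, by omega, ?_⟩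
      · nlinarith [Nat.pos_of_ne_zero hk]
      · rw [Nat.le_div_iff_mul_le (Nat.pos_of_ne_zero hj)]; nlinarith
    refine (Finset.sum_le_sum_of_subset_of_nonneg h2 (fun _ _ _ => by positivity)).trans ?_
    rw [Finset.sum_image, Finset.sum_sigma]
    · have h3 : ∀ j ∈ Finset.Icc 1 (4 * T), ∑ k ∈ Finset.Icc 1 (4 * T / j), (r2 j : ℝ) * r2 k
          ≤ (36 * T) * ((r2 j : ℝ) * (1 / j)) := by
        intro j hj
        have hj1 : (1:ℝ) ≤ j := by exact_mod_cast (Finset.mem_Icc.1 hj).1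
        rw [← Finset.mul_sum]
        have : ∑ k ∈ Finset.Icc 1 (4 * T / j), (r2 k : ℝ) ≤ 9 * (4 * T / j) := by
          refine (sum_Icc_r2_le _).trans ?_
          have : ((4 * T / j : ℕ) : ℝ) ≤ (4 * T : ℕ) / (j:ℝ) := Nat.cast_div_le
          push_cast at this
          linarith
        calc (r2 j : ℝ) * ∑ k ∈ Finset.Icc 1 (4 * T / j), (r2 k : ℝ)
            ≤ (r2 j : ℝ) * (9 * (4 * T / j)) := mul_le_mul_of_nonneg_left this (by positivity)
          _ = _ := by field_simp; ring
      refine (Finset.sum_le_sum h3).trans ?_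
      rw [← Finset.mul_sum]
      have h4 := sum_r2_div_le (4 * T)
      have hT' : (1:ℝ) ≤ T := by exact_mod_cast hT
      have h5 : Real.log ((4 * T : ℕ):ℝ) ≤ 1.4 + Real.log T := by
        push_cast
        rw [Real.log_mul (by norm_num) (by positivity)]
        have : Real.log 4 = 2 * Real.log 2 := by
          rw [show (4:ℝ) = 2 ^ 2 by norm_num, Real.log_pow]; norm_num
        have := Real.log_two_lt_d9
        linarith
      have h6 : 0 ≤ Real.log T := Real.log_natCast_nonneg T
      calc 36 * (T:ℝ) * ∑ i ∈ Finset.Icc 1 (4 * T), (r2 i : ℝ) * (1 / i)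
          ≤ 36 * (T:ℝ) * (18 * (2.4 * (1 + Real.log T))) := by
            apply mul_le_mul_of_nonneg_left _ (by positivity)
            linarith
        _ ≤ 2000 * T * (1 + Real.log T) := by nlinarith
    · rintro ⟨j, k⟩ _ ⟨j', k'⟩ _ h
      simp only [Prod.mk.injEq] at h
      obtain ⟨rfl, rfl⟩ := h
      rfl
  · intro n _ n' _ hne
    simp only [Function.onFun]
    rw [Finset.disjoint_left]
    intro jk h h'
    rw [Nat.mem_divisorsAntidiagonal] at h h'
    omega

lemma sum_r2_sq_div_sq_le (Y N : ℕ) (hY : 1 ≤ Y) :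
    ∑ n ∈ Finset.Ioc Y N, (r2 n : ℝ) ^ 2 / (n:ℝ) ^ 2 ≤ 8000 * (1 + Real.log Y) / Y := by
  rcases Nat.lt_or_ge N Y with hN | hN
  · rw [Finset.Ioc_eq_empty (by omega)]
    have := one_le_one_add_log Y
    simp only [Finset.sum_empty]
    positivity
  let u : ℕ → ℝ := fun n => (2 + Real.log n) / n
  have hu : ∀ n : ℕ, 1 ≤ n → (1 + Real.log n) / (n * (n + 1)) ≤ u n - u (n + 1) := by
    intro n hn
    have hn1 : (1:ℝ) ≤ n := by exact_mod_cast hn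
    have e : u n - u (n + 1)
        = (2 + Real.log n - n * (Real.log (n + 1) - Real.log n)) / (n * (n + 1)) := by
      simp only [u]; push_cast; field_simp; ring
    rw [e]
    apply div_le_div_of_nonneg_right _ (by positivity)
    have : Real.log (n + 1) - Real.log n ≤ 1 / n := by
      rw [← Real.log_div (by positivity) (by positivity)]
      refine (Real.log_le_sub_one_of_pos (by positivity)).trans (le_of_eq ?_)
      field_simp; ring
    have : n * (Real.log (n + 1) - Real.log n) ≤ 1 := by
      calc n * (Real.log (n + 1) - Real.log n) ≤ n * (1 / n) :=
            mul_le_mul_of_nonneg_left this (by positivity)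
        _ = 1 := by field_simp
    linarith
  have h0 : ∑ n ∈ Finset.Ioc Y N, (r2 n : ℝ) ^ 2 / (n:ℝ) ^ 2
      = ∑ n ∈ Finset.Ioc Y N, (r2 n : ℝ) ^ 2 * (1 / (n:ℝ) ^ 2) := by
    apply Finset.sum_congr rfl; intros; ring
  rw [h0]
  refine (abel_le (fun n => (r2 n : ℝ) ^ 2) (fun n => (1:ℝ) / (n:ℝ) ^ 2) (fun n => by positivity)
    (fun n => by positivity) Y N hN).trans ?_
  have h1 : ∑ n ∈ Finset.Ioc Y N, (∑ k ∈ Finset.Icc 1 n, (r2 k : ℝ) ^ 2) *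
      ((1:ℝ) / (n:ℝ) ^ 2 - 1 / ((n + 1 : ℕ):ℝ) ^ 2) ≤ ∑ n ∈ Finset.Ioc Y N, 4000 * (u n - u (n + 1)) := by
    apply Finset.sum_le_sum
    intro n hn
    have hn0 : 1 ≤ n := by have := (Finset.mem_Ioc.1 hn).1; omega
    have hn1 : (1:ℝ) ≤ n := by exact_mod_cast hn0
    have hl := one_le_one_add_log n
    have e : (1:ℝ) / (n:ℝ) ^ 2 - 1 / ((n + 1 : ℕ):ℝ) ^ 2 = (2 * n + 1) / (n ^ 2 * (n + 1) ^ 2) := by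
      push_cast; field_simp; ring
    rw [e]
    calc _ ≤ (2000 * n * (1 + Real.log n)) * ((2 * n + 1) / ((n:ℝ) ^ 2 * (n + 1) ^ 2)) :=
          mul_le_mul_of_nonneg_right (sum_r2_sq_le n hn0) (by positivity)
      _ ≤ (2000 * n * (1 + Real.log n)) * ((2 * (n + 1)) / ((n:ℝ) ^ 2 * (n + 1) ^ 2)) := by
          gcongr; linarith
      _ = 4000 * ((1 + Real.log n) / (n * (n + 1))) := by field_simp; ring
      _ ≤ 4000 * (u n - u (n + 1)) := by linarith [hu n hn0]
  have h2 : ∑ n ∈ Finset.Ioc Y N, 4000 * (u n - u (n + 1)) = 4000 * (u (Y + 1) - u (N + 1)) := by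
    clear h1 h0
    induction N, hN using Nat.le_induction with
    | base => simp
    | succ N hN ih => rw [Finset.sum_Ioc_succ_top (by omega), ih]; ring
  have h3 : (∑ k ∈ Finset.Icc 1 N, (r2 k : ℝ) ^ 2) * ((1:ℝ) / ((N + 1 : ℕ):ℝ) ^ 2) ≤ 2000 * u (N + 1) := by
    have hN1 : (1:ℝ) ≤ N := by exact_mod_cast hY.trans hN
    have hl := one_le_one_add_log N
    calc _ ≤ (2000 * N * (1 + Real.log N)) * ((1:ℝ) / ((N + 1 : ℕ):ℝ) ^ 2) :=
          mul_le_mul_of_nonneg_right (sum_r2_sq_le N (by omega)) (by positivity)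
      _ ≤ (2000 * (N + 1 : ℕ) * (2 + Real.log (N + 1 : ℕ))) * ((1:ℝ) / ((N + 1 : ℕ):ℝ) ^ 2) := by
          gcongr
          · push_cast; linarith
          · norm_num
          · push_cast; linarith
      _ = 2000 * u (N + 1) := by simp only [u]; push_cast; field_simp
  have h4 : 0 ≤ u (N + 1) := by
    have := one_le_one_add_log (N + 1)
    simp only [u]
    apply div_nonneg <;> [linarith; positivity]
  have h5 : u (Y + 1) ≤ u Y := by
    have := hu Y hY
    have hl := one_le_one_add_log Y
    have : 0 ≤ (1 + Real.log Y) / (Y * ((Y:ℝ) + 1)) := by positivity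
    linarith
  have h6 : 4000 * u Y ≤ 8000 * (1 + Real.log Y) / Y := by
    simp only [u]
    rw [← mul_div_assoc]
    apply div_le_div_of_nonneg_right _ (by positivity)
    linarith [Real.log_natCast_nonneg Y]
  linarith

lemma sum_r2_sq_div_le (T : ℕ) (hT : 1 ≤ T) :
    ∑ n ∈ Finset.Icc 1 T, (r2 n : ℝ) ^ 2 / (n:ℝ) ≤ 4000 * (1 + Real.log T) ^ 2 := by
  have h0 : ∑ n ∈ Finset.Icc 1 T, (r2 n : ℝ) ^ 2 / (n:ℝ)
      = ∑ n ∈ Finset.Ioc 0 T, (r2 n : ℝ) ^ 2 * (1 / (n:ℝ)) := by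
    rw [Icc_one_eq_Ioc]
    apply Finset.sum_congr rfl; intros; ring
  rw [h0]
  refine (abel_le (fun n => (r2 n : ℝ) ^ 2) (fun n => (1:ℝ) / (n:ℝ)) (fun n => by positivity)
    (fun n => by positivity) 0 T (by omega)).trans ?_
  rw [← Icc_one_eq_Ioc]
  have hl := one_le_one_add_log T
  have h1 : ∑ n ∈ Finset.Icc 1 T, (∑ k ∈ Finset.Icc 1 n, (r2 k : ℝ) ^ 2) * ((1:ℝ) / n - 1 / ((n + 1 : ℕ):ℝ))
      ≤ (2000 * (1 + Real.log T)) * (1 + Real.log T) := by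
    refine le_trans (Finset.sum_le_sum fun n hn => ?_)
      (le_trans (le_of_eq (Finset.mul_sum _ _ _).symm)
        (mul_le_mul_of_nonneg_left (sum_inv_succ_le T) (by positivity)))
    have hn0 := (Finset.mem_Icc.1 hn)
    have hn1 : (1:ℝ) ≤ n := by exact_mod_cast hn0.1
    have hnT : (n:ℝ) ≤ T := by exact_mod_cast hn0.2
    have e : (1:ℝ) / n - 1 / ((n + 1 : ℕ):ℝ) = 1 / (n * (n + 1)) := by
      push_cast; field_simp; ring
    rw [e]
    calc (∑ k ∈ Finset.Icc 1 n, (r2 k : ℝ) ^ 2) * (1 / (n * (n + 1)))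
        ≤ (2000 * n * (1 + Real.log n)) * (1 / (n * (n + 1))) :=
          mul_le_mul_of_nonneg_right (sum_r2_sq_le n hn0.1) (by positivity)
      _ ≤ (2000 * n * (1 + Real.log T)) * (1 / (n * (n + 1))) := by gcongr
      _ = 2000 * (1 + Real.log T) * (1 / (n + 1)) := by field_simp
  have h2 : (∑ k ∈ Finset.Icc 1 T, (r2 k : ℝ) ^ 2) * ((1:ℝ) / ((T + 1 : ℕ):ℝ))
      ≤ 2000 * (1 + Real.log T) := by
    rw [mul_one_div, div_le_iff₀ (by positivity)]
    refine (sum_r2_sq_le T hT).trans ?_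
    push_cast; nlinarith
  nlinarith

lemma summable_r2_sq : Summable (fun n : ℕ => (r2 n : ℝ) ^ 2 / (n:ℝ) ^ ((5:ℝ)/4)) := by
  have h := LSeriesSummable_of_sum_norm_bigO (f := fun n => (((r2 n : ℝ) ^ 2 : ℝ) : ℂ)) (r := 9/8)
    (s := ((5/4 : ℝ) : ℂ)) ?_ (by norm_num) (by rw [Complex.ofReal_re]; norm_num)
  · have h2 := h.norm
    rw [← summable_nat_add_iff 1] at h2 ⊢
    refine h2.congr ?_
    intro n
    rw [LSeries.norm_term_eq]
    simp only [Nat.add_eq_zero_iff, one_ne_zero, and_false, if_false, Complex.ofReal_re]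
    congr 1
    rw [Complex.norm_real, Real.norm_of_nonneg (by positivity)]
  · have hlog : (fun n : ℕ => 1 + Real.log n) =O[atTop] fun n : ℕ => (n:ℝ) ^ ((1:ℝ)/8) := by
      have h1 : (fun x : ℝ => 1 + Real.log x) =O[atTop] fun x : ℝ => x ^ ((1:ℝ)/8) := by
        apply Asymptotics.IsBigO.add
        · apply Asymptotics.IsBigO.of_bound 1
          filter_upwards [eventually_ge_atTop 1] with x hx
          rw [norm_one, one_mul, Real.norm_of_nonneg (by positivity)]
          exact Real.one_le_rpow hx (by norm_num)
        · exact (isLittleO_log_rpow_atTop (by norm_num)).isBigO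
      exact h1.comp_tendsto tendsto_natCast_atTop_atTop
    have h2 : (fun n : ℕ => ∑ k ∈ Finset.Icc 1 n, ‖(((r2 k : ℝ) ^ 2 : ℝ) : ℂ)‖)
        =O[atTop] fun n : ℕ => (n:ℝ) * (1 + Real.log n) := by
      apply Asymptotics.IsBigO.of_bound 2000
      filter_upwards [eventually_ge_atTop 1] with n hn
      have := one_le_one_add_log n
      rw [Real.norm_of_nonneg (by positivity), Real.norm_of_nonneg (by positivity), ← mul_assoc]
      refine le_trans (le_of_eq ?_) (sum_r2_sq_le n hn)
      apply Finset.sum_congr rfl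
      intro k _
      rw [Complex.norm_real, Real.norm_of_nonneg (by positivity)]
    refine h2.trans ?_
    have h3 := (Asymptotics.isBigO_refl (fun n : ℕ => (n:ℝ)) atTop).mul hlog
    refine h3.trans ?_
    apply Asymptotics.IsBigO.of_bound 1
    filter_upwards [eventually_ge_atTop 1] with n hn
    have hn1 : (0:ℝ) < n := by exact_mod_cast hn
    rw [one_mul]
    apply le_of_eq
    congr 1
    nth_rewrite 1 [← Real.rpow_one (n:ℝ)]
    rw [← Real.rpow_add hn1]; norm_num

lemma log_le_sum_inv (R : ℕ) : Real.log (R + 1) ≤ ∑ n ∈ Finset.Icc 1 R, (1:ℝ) / n := by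
  have := log_add_one_le_harmonic R
  rw [harmonic_eq_sum_Icc] at this
  push_cast at this
  simpa [one_div] using this

def fullSum (R : ℕ) : ℝ :=
  ∑ p ∈ Finset.Icc 1 R ×ˢ Finset.Icc 1 R, (1:ℝ) / ((p.1:ℝ) ^ 2 + (p.2:ℝ) ^ 2)

def copSet (R : ℕ) : Finset (ℕ × ℕ) :=
  (Finset.Icc 1 R ×ˢ Finset.Icc 1 R).filter (fun p => Nat.Coprime p.1 p.2)

def copSum (R : ℕ) : ℝ := ∑ p ∈ copSet R, (1:ℝ) / ((p.1:ℝ) ^ 2 + (p.2:ℝ) ^ 2)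

lemma fullSum_ge (R : ℕ) : Real.log (R + 1) / 2 ≤ fullSum R := by
  have h : ∀ b ∈ Finset.Icc 1 R, (1:ℝ) / 2 * (1 / b)
      ≤ ∑ a ∈ Finset.Icc 1 R, (1:ℝ) / ((b:ℝ) ^ 2 + (a:ℝ) ^ 2) := by
    intro b hb
    rw [Finset.mem_Icc] at hb
    have hb1 : (1:ℝ) ≤ b := by exact_mod_cast hb.1
    calc (1:ℝ) / 2 * (1 / b) = ∑ a ∈ Finset.Icc 1 b, (1:ℝ) / ((b:ℝ) ^ 2 + (b:ℝ) ^ 2) := by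
          rw [Finset.sum_const, Nat.card_Icc]; simp; field_simp
          norm_num
      _ ≤ ∑ a ∈ Finset.Icc 1 b, (1:ℝ) / ((b:ℝ) ^ 2 + (a:ℝ) ^ 2) := by
          apply Finset.sum_le_sum
          intro a ha
          have : (a:ℝ) ≤ b := by exact_mod_cast (Finset.mem_Icc.1 ha).2
          gcongr
      _ ≤ _ := by
          apply Finset.sum_le_sum_of_subset_of_nonneg
          · exact Finset.Icc_subset_Icc le_rfl hb.2
          · intros; positivity
  have h2 := Finset.sum_le_sum h
  rw [← Finset.mul_sum] at h2
  rw [fullSum, Finset.sum_product]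
  linarith [log_le_sum_inv R]

lemma sum_inv_sq_le (R : ℕ) : ∑ d ∈ Finset.Icc 1 R, (1:ℝ) / (d:ℝ) ^ 2 ≤ 2 := by
  have h : ∀ R : ℕ, ∑ d ∈ Finset.Icc 1 (R + 1), (1:ℝ) / (d:ℝ) ^ 2 ≤ 2 - 1 / (R + 1 : ℝ) := by
    intro R
    induction R with
    | zero => norm_num
    | succ R ih =>
      rw [Finset.sum_Icc_succ_top (by omega)]
      have : (1:ℝ) / ((R + 1 + 1 : ℕ) : ℝ) ^ 2 ≤ 1 / (R + 1 : ℝ) - 1 / ((R + 1 : ℕ) + 1 : ℝ) := by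
        push_cast
        rw [div_sub_div _ _ (by positivity) (by positivity), div_le_div_iff₀ (by positivity) (by positivity)]
        ring_nf
        nlinarith [(Nat.cast_nonneg R : (0:ℝ) ≤ R)]
      linarith
  rcases R with _ | R
  · norm_num
  · refine (h R).trans ?_
    have : (0:ℝ) ≤ 1 / (R + 1 : ℝ) := by positivity
    linarith

/-! ### Lower bound for the weighted second moment of `r2` -/

lemma sum_le_sum_of_inj {ι κ : Type*} [DecidableEq κ] (s : Finset ι) (t : Finset κ) (f : ι → ℝ)
    (g : κ → ℝ) (i : ι → κ) (hi : ∀ a ∈ s, i a ∈ t) (hinj : Set.InjOn i s)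
    (hfg : ∀ a ∈ s, f a ≤ g (i a)) (hg : ∀ b ∈ t, 0 ≤ g b) : ∑ a ∈ s, f a ≤ ∑ b ∈ t, g b := by
  calc ∑ a ∈ s, f a ≤ ∑ a ∈ s, g (i a) := Finset.sum_le_sum hfg
    _ = ∑ b ∈ s.image i, g b := (Finset.sum_image hinj).symm
    _ ≤ _ := Finset.sum_le_sum_of_subset_of_nonneg
        (by intro b hb; obtain ⟨a, ha, rfl⟩ := Finset.mem_image.1 hb; exact hi a ha)
        (fun b hb _ => hg b hb)

lemma fullSum_le (R : ℕ) : fullSum R ≤ 2 * copSum R := by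
  have h : fullSum R ≤ ∑ x ∈ Finset.Icc 1 R ×ˢ copSet R,
      (1:ℝ) / (x.1:ℝ) ^ 2 * (1 / ((x.2.1:ℝ) ^ 2 + (x.2.2:ℝ) ^ 2)) := by
    apply sum_le_sum_of_inj _ _ _ _
      (fun p : ℕ × ℕ => (Nat.gcd p.1 p.2, (p.1 / Nat.gcd p.1 p.2, p.2 / Nat.gcd p.1 p.2)))
    · rintro ⟨a, b⟩ hab
      simp only [Finset.mem_product, Finset.mem_Icc, copSet, Finset.mem_filter] at hab ⊢
      have hg : 0 < Nat.gcd a b := Nat.gcd_pos_of_pos_left _ (by omega)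
      have h1 : Nat.gcd a b ≤ a := Nat.gcd_le_left _ (by omega)
      have h2 : Nat.gcd a b ≤ b := Nat.gcd_le_right _ (by omega)
      refine ⟨⟨hg, by omega⟩, ⟨⟨?_, ?_⟩, ?_, ?_⟩, Nat.coprime_div_gcd_div_gcd hg⟩
      · exact Nat.div_pos h1 hg
      · exact (Nat.div_le_self _ _).trans hab.1.2
      · exact Nat.div_pos h2 hg
      · exact (Nat.div_le_self _ _).trans hab.2.2
    · rintro ⟨a, b⟩ _ ⟨a', b'⟩ _ h
      simp only [Prod.mk.injEq] at h ⊢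
      obtain ⟨h1, h2, h3⟩ := h
      have e1 := Nat.div_mul_cancel (Nat.gcd_dvd_left a b)
      have e2 := Nat.div_mul_cancel (Nat.gcd_dvd_right a b)
      have e3 := Nat.div_mul_cancel (Nat.gcd_dvd_left a' b')
      have e4 := Nat.div_mul_cancel (Nat.gcd_dvd_right a' b')
      exact ⟨e1.symm.trans ((congrArg₂ (· * ·) h2 h1).trans e3),
        e2.symm.trans ((congrArg₂ (· * ·) h3 h1).trans e4)⟩
    · rintro ⟨a, b⟩ hab
      simp only [Finset.mem_product, Finset.mem_Icc] at hab ⊢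
      have hg : 0 < Nat.gcd a b := Nat.gcd_pos_of_pos_left _ (by omega)
      have hg' : (0:ℝ) < Nat.gcd a b := by exact_mod_cast hg
      have e1 : (a:ℝ) = (a / Nat.gcd a b : ℕ) * Nat.gcd a b := by
        exact_mod_cast (Nat.div_mul_cancel (Nat.gcd_dvd_left a b)).symm
      have e2 : (b:ℝ) = (b / Nat.gcd a b : ℕ) * Nat.gcd a b := by
        exact_mod_cast (Nat.div_mul_cancel (Nat.gcd_dvd_right a b)).symm
      have : (a:ℝ) ^ 2 + (b:ℝ) ^ 2 = (Nat.gcd a b : ℝ) ^ 2 *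
          (((a / Nat.gcd a b : ℕ) : ℝ) ^ 2 + ((b / Nat.gcd a b : ℕ) : ℝ) ^ 2) := by
        calc (a:ℝ) ^ 2 + (b:ℝ) ^ 2 = ((a / Nat.gcd a b : ℕ) * Nat.gcd a b) ^ 2
              + ((b / Nat.gcd a b : ℕ) * Nat.gcd a b) ^ 2 := by rw [← e1, ← e2]
          _ = _ := by ring
      rw [this, one_div_mul_one_div]
    · intros; positivity
  refine h.trans ?_
  rw [Finset.sum_product]
  simp only [← Finset.mul_sum]
  rw [← Finset.sum_mul]
  exact mul_le_mul_of_nonneg_right (sum_inv_sq_le R) (Finset.sum_nonneg fun _ _ => by positivity)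

lemma cop_full_le (R : ℕ) :
    copSum R * fullSum R ≤ ∑ n ∈ Finset.Icc 1 (4 * R ^ 4), (r2 n : ℝ) ^ 2 / (n:ℝ) := by
  have e : ∀ n ∈ Finset.Icc 1 (4 * R ^ 4), (r2 n : ℝ) ^ 2 / (n:ℝ)
      = ∑ q ∈ reps n ×ˢ reps n, (1:ℝ) / n := by
    intro n _
    rw [Finset.sum_const, Finset.card_product, ← r2_eq_card, nsmul_eq_mul]
    push_cast; ring
  rw [Finset.sum_congr rfl e, ← Finset.sum_sigma (Finset.Icc 1 (4 * R ^ 4))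
    (fun n => reps n ×ˢ reps n) (fun x => (1:ℝ) / x.1), copSum, fullSum, Finset.sum_mul_sum,
    ← Finset.sum_product']
  apply sum_le_sum_of_inj _ _ _ _
    (fun x : (ℕ × ℕ) × (ℕ × ℕ) =>
      (⟨(x.1.1 ^ 2 + x.1.2 ^ 2) * (x.2.1 ^ 2 + x.2.2 ^ 2),
        (((x.2.1:ℤ) * x.1.1 + x.1.2 * x.2.2, (x.1.1:ℤ) * x.2.2 - x.2.1 * x.1.2),
         ((x.1.2:ℤ) * x.2.2 - x.2.1 * x.1.1, (x.2.1:ℤ) * x.1.2 + x.1.1 * x.2.2))⟩ :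
        Σ _ : ℕ, (ℤ × ℤ) × (ℤ × ℤ)))
  · rintro ⟨⟨α, β⟩, ⟨g, t⟩⟩ hx
    simp only [Finset.mem_product, copSet, Finset.mem_filter, Finset.mem_Icc, Finset.mem_sigma,
      mem_reps] at hx ⊢
    obtain ⟨⟨⟨⟨h1, h2⟩, h3, h4⟩, h5⟩, ⟨h6, h7⟩, h8, h9⟩ := hx
    refine ⟨⟨?_, ?_⟩, ?_, ?_⟩
    · apply Nat.mul_pos <;> positivity
    · calc (α ^ 2 + β ^ 2) * (g ^ 2 + t ^ 2) ≤ (R ^ 2 + R ^ 2) * (R ^ 2 + R ^ 2) := by gcongr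
        _ = 4 * R ^ 4 := by ring
    · push_cast; ring
    · push_cast; ring
  · rintro ⟨⟨α, β⟩, ⟨g, t⟩⟩ hx ⟨⟨α', β'⟩, ⟨g', t'⟩⟩ hx' h
    simp only [Finset.coe_product, Set.mem_prod, Finset.mem_coe, copSet, Finset.mem_filter,
      Finset.mem_product, Finset.mem_Icc] at hx hx'
    obtain ⟨⟨⟨⟨h1, h2⟩, h3, h4⟩, h5⟩, ⟨h6, h7⟩, h8, h9⟩ := hx
    obtain ⟨⟨⟨⟨h1', h2'⟩, h3', h4'⟩, h5'⟩, ⟨h6', h7'⟩, h8', h9'⟩ := hx'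
    rw [Sigma.mk.injEq] at h
    obtain ⟨-, h⟩ := h
    rw [heq_eq_eq, Prod.mk.injEq, Prod.mk.injEq, Prod.mk.injEq] at h
    obtain ⟨⟨ha, hb⟩, hc, hd⟩ := h
    simp only at ha hb hc hd
    have k1 : g * α = g' * α' := by zify; linarith
    have k2 : g * β = g' * β' := by zify; linarith
    have k3 : β * t = β' * t' := by zify; linarith
    have hg : g = g' := by
      have := Nat.gcd_mul_left g α β
      have h' := Nat.gcd_mul_left g' α' β'
      rw [Nat.Coprime] at h5 h5'
      rw [k1, k2, h5, h', h5'] at this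
      omega
    subst hg
    have hα := Nat.eq_of_mul_eq_mul_left (by omega) k1
    have hβ := Nat.eq_of_mul_eq_mul_left (by omega) k2
    subst hα hβ
    have ht := Nat.eq_of_mul_eq_mul_left (by omega) k3
    subst ht
    rfl
  · rintro ⟨⟨α, β⟩, ⟨g, t⟩⟩ hx
    simp only
    push_cast
    rw [one_div_mul_one_div]
  · intros; positivity

lemma sum_r2_sq_div_ge (T : ℕ) (hT : 256 ≤ T) :
    Real.log T ^ 2 / 512 ≤ ∑ n ∈ Finset.Icc 1 T, (r2 n : ℝ) ^ 2 / (n:ℝ) := by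
  let R := T.sqrt.sqrt / 2
  have h1 : 4 * R ^ 4 ≤ T := by
    have a1 : T.sqrt.sqrt ^ 2 ≤ T.sqrt := Nat.sqrt_le' _
    have a2 : T.sqrt ^ 2 ≤ T := Nat.sqrt_le' _
    have a3 : 2 * R ≤ T.sqrt.sqrt := Nat.mul_div_le _ _
    have a4 : (2 * R) ^ 2 ≤ T.sqrt := (Nat.pow_le_pow_left a3 2).trans a1
    have a5 : ((2 * R) ^ 2) ^ 2 ≤ T := (Nat.pow_le_pow_left a4 2).trans a2
    nlinarith [Nat.zero_le (R ^ 4)]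
  have h2 : T ≤ (2 * (R + 1)) ^ 4 := by
    have a1 : T < (T.sqrt + 1) ^ 2 := Nat.lt_succ_sqrt' _
    have a2 : T.sqrt < (T.sqrt.sqrt + 1) ^ 2 := Nat.lt_succ_sqrt' _
    have a3 : T.sqrt.sqrt + 1 ≤ 2 * (R + 1) := by omega
    calc T ≤ (T.sqrt + 1) ^ 2 := a1.le
      _ ≤ ((T.sqrt.sqrt + 1) ^ 2) ^ 2 := Nat.pow_le_pow_left a2 2
      _ ≤ ((2 * (R + 1)) ^ 2) ^ 2 := by gcongr
      _ = _ := by ring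
  have hlT : 8 * Real.log 2 ≤ Real.log T := by
    have : (2:ℝ) ^ 8 ≤ T := by norm_num; exact_mod_cast hT
    have := Real.log_le_log (by norm_num) this
    rwa [Real.log_pow] at this
  have h3 : Real.log T / 8 ≤ Real.log (R + 1) := by
    have : (T:ℝ) ≤ (2 * (R + 1)) ^ 4 := by exact_mod_cast h2
    have := Real.log_le_log (by positivity) this
    rw [Real.log_pow, Real.log_mul (by norm_num) (by positivity)] at this
    push_cast at this
    linarith
  have hl0 : 0 ≤ Real.log T := Real.log_natCast_nonneg T
  have h4 := fullSum_ge R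
  have h5 := fullSum_le R
  have h6 : Real.log T / 16 ≤ fullSum R := by linarith
  have h7 : Real.log T / 32 ≤ copSum R := by linarith
  calc Real.log T ^ 2 / 512 = (Real.log T / 32) * (Real.log T / 16) := by ring
    _ ≤ copSum R * fullSum R := by gcongr; linarith
    _ ≤ _ := cop_full_le R
    _ ≤ _ := Finset.sum_le_sum_of_subset_of_nonneg (Finset.Icc_subset_Icc le_rfl h1)
        (fun _ _ _ => by positivity)

/-! ### `r2 n ≪ n ^ ε` -/

lemma card_divisors_bound (ε : ℝ) (hε : 0 < ε) :
    ∃ C : ℝ, 1 ≤ C ∧ ∀ n : ℕ, 1 ≤ n → (n.divisors.card : ℝ) ≤ C * (n:ℝ) ^ ε := by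
  obtain ⟨P, hP⟩ := exists_nat_ge ((2:ℝ) ^ (1 / ε))
  set K : ℝ := 1 + 1 / (ε * Real.log 2) with hK
  have hl2 : 0 < Real.log 2 := Real.log_pos (by norm_num)
  have hel : 0 < ε * Real.log 2 := by positivity
  have hK1 : 1 ≤ K := by
    have : 0 ≤ 1 / (ε * Real.log 2) := by positivity
    linarith
  refine ⟨K ^ P, one_le_pow₀ hK1, ?_⟩
  intro n hn
  have hn0 : n ≠ 0 := by omega
  rw [Nat.card_divisors hn0]
  have hprod : (n:ℝ) ^ ε = ∏ p ∈ n.primeFactors, ((p:ℝ) ^ ε) ^ (n.factorization p) := by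
    conv_lhs => rw [← Nat.prod_factorization_pow_eq_self hn0]
    rw [Finsupp.prod, Nat.support_factorization]
    push_cast
    rw [← Real.finsetProd_rpow _ _ (fun i _ => by positivity)]
    apply Finset.prod_congr rfl
    intro p _
    rw [← Real.rpow_natCast, ← Real.rpow_natCast, ← Real.rpow_mul (by positivity),
      ← Real.rpow_mul (by positivity), mul_comm]
  have hpt : ∀ p ∈ n.primeFactors, ((n.factorization p + 1 : ℕ) : ℝ)
      ≤ (if p < P then K else 1) * ((p:ℝ) ^ ε) ^ (n.factorization p) := by
    intro p hp
    have hp2 : (2:ℝ) ≤ p := by exact_mod_cast (Nat.prime_of_mem_primeFactors hp).two_le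
    set e := n.factorization p
    split_ifs with h
    · have h1 : 1 + ε * Real.log 2 ≤ (p:ℝ) ^ ε := by
        calc 1 + ε * Real.log 2 ≤ Real.exp (ε * Real.log 2) := by
              linarith [Real.add_one_le_exp (ε * Real.log 2)]
          _ = (2:ℝ) ^ ε := by rw [Real.rpow_def_of_pos (by norm_num), mul_comm]
          _ ≤ _ := Real.rpow_le_rpow (by norm_num) hp2 hε.le
      have h2 : 1 + e * (ε * Real.log 2) ≤ ((p:ℝ) ^ ε) ^ e :=
        (one_add_mul_le_pow (by linarith) e).trans (pow_le_pow_left₀ (by linarith) h1 e)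
      calc ((e + 1 : ℕ) : ℝ) ≤ K * (1 + e * (ε * Real.log 2)) := by
            rw [hK]; push_cast
            have : (1 + 1 / (ε * Real.log 2)) * (1 + e * (ε * Real.log 2))
                = 1 + e + e * (ε * Real.log 2) + 1 / (ε * Real.log 2) := by
              field_simp; ring
            rw [this]
            have : 0 ≤ 1 / (ε * Real.log 2) := by positivity
            have : 0 ≤ e * (ε * Real.log 2) := by positivity
            linarith
        _ ≤ _ := by gcongr
    · rw [one_mul]
      have h1 : (2:ℝ) ≤ (p:ℝ) ^ ε := by
        have : (2:ℝ) ^ (1 / ε) ≤ p := hP.trans (by exact_mod_cast not_lt.1 h)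
        calc (2:ℝ) = ((2:ℝ) ^ (1 / ε)) ^ ε := by
              rw [← Real.rpow_mul (by norm_num)]; field_simp; simp
          _ ≤ _ := Real.rpow_le_rpow (by positivity) this hε.le
      calc ((e + 1 : ℕ) : ℝ) ≤ 2 ^ e := by exact_mod_cast Nat.lt_two_pow_self
        _ ≤ _ := pow_le_pow_left₀ (by norm_num) h1 e
  push_cast
  calc ∏ p ∈ n.primeFactors, ((n.factorization p : ℝ) + 1)
      ≤ ∏ p ∈ n.primeFactors, (if p < P then K else 1) * ((p:ℝ) ^ ε) ^ (n.factorization p) := by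
        apply Finset.prod_le_prod (fun _ _ => by positivity)
        intro p hp; have := hpt p hp; push_cast at this; exact this
    _ = (∏ p ∈ n.primeFactors, (if p < P then K else 1)) * (n:ℝ) ^ ε := by
        rw [Finset.prod_mul_distrib, hprod]
    _ ≤ K ^ P * (n:ℝ) ^ ε := by
        apply mul_le_mul_of_nonneg_right _ (by positivity)
        rw [Finset.prod_ite]
        simp only [Finset.prod_const, one_pow, mul_one]
        apply pow_le_pow_right₀ hK1
        calc _ ≤ (Finset.range P).card := by
              apply Finset.card_le_card
              intro p hp
              rw [Finset.mem_filter] at hp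
              exact Finset.mem_range.2 hp.2
          _ = P := Finset.card_range P

lemma r2_le_nine (n : ℕ) (hn : 1 ≤ n) : (r2 n : ℝ) ≤ 9 * n := by
  refine le_trans ?_ (sum_Icc_r2_le n)
  exact Finset.single_le_sum (f := fun m => (r2 m : ℝ)) (fun _ _ => by positivity)
    (Finset.mem_Icc.2 ⟨hn, le_rfl⟩)

lemma r2_boot (θ : ℝ) (hθ : 0 ≤ θ) (C : ℝ) (hC : 1 ≤ C)
    (h : ∀ n : ℕ, 1 ≤ n → (r2 n : ℝ) ≤ C * (n:ℝ) ^ θ) (ε : ℝ) (hε : 0 < ε) :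
    ∃ C' : ℝ, 1 ≤ C' ∧ ∀ n : ℕ, 1 ≤ n → (r2 n : ℝ) ≤ C' * (n:ℝ) ^ ((θ + ε) / 2) := by
  obtain ⟨D, hD1, hD⟩ := card_divisors_bound ε hε
  set M := D * C ^ 2 * (4:ℝ) ^ (θ + ε) with hM
  have h4 : 1 ≤ (4:ℝ) ^ (θ + ε) := Real.one_le_rpow (by norm_num) (by linarith)
  have hM1 : 1 ≤ M := by
    have := one_le_pow₀ hC (n := 2)
    have := one_le_mul_of_one_le_of_one_le hD1 this
    exact one_le_mul_of_one_le_of_one_le this h4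
  refine ⟨Real.sqrt M, Real.one_le_sqrt.2 hM1, ?_⟩
  intro n hn
  have hn0 : (0:ℝ) < n := by exact_mod_cast hn
  have h1 : (r2 n : ℝ) ^ 2 ≤ M * (n:ℝ) ^ (θ + ε) := by
    have a : (r2 n : ℝ) ^ 2 ≤ ∑ jk ∈ (4 * n).divisorsAntidiagonal, (r2 jk.1 : ℝ) * r2 jk.2 := by
      exact_mod_cast r2_sq_le n hn
    refine a.trans ?_
    have b : ∀ jk ∈ (4 * n).divisorsAntidiagonal, (r2 jk.1 : ℝ) * r2 jk.2
        ≤ C ^ 2 * ((4 * n : ℕ) : ℝ) ^ θ := by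
      rintro ⟨j, k⟩ hjk
      rw [Nat.mem_divisorsAntidiagonal] at hjk
      obtain ⟨hjk, hne⟩ := hjk
      simp only at hjk ⊢
      have hj : 1 ≤ j := by
        rcases Nat.eq_zero_or_pos j with h | h
        · subst h; simp at hjk; omega
        · exact h
      have hk : 1 ≤ k := by
        rcases Nat.eq_zero_or_pos k with h | h
        · subst h; simp at hjk; omega
        · exact h
      calc (r2 j : ℝ) * r2 k ≤ (C * (j:ℝ) ^ θ) * (C * (k:ℝ) ^ θ) := by
            gcongr <;> [exact h j hj; exact h k hk]
        _ = C ^ 2 * ((j:ℝ) * k) ^ θ := by rw [Real.mul_rpow (by positivity) (by positivity)]; ring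
        _ = _ := by rw [← hjk]; push_cast; rfl
    refine (Finset.sum_le_card_nsmul _ _ _ b).trans ?_
    rw [nsmul_eq_mul, show (4 * n).divisorsAntidiagonal.card = (4 * n).divisors.card by
      rw [← Nat.map_div_right_divisors]; simp]
    calc ((4 * n).divisors.card : ℝ) * (C ^ 2 * ((4 * n : ℕ) : ℝ) ^ θ)
        ≤ (D * ((4 * n : ℕ):ℝ) ^ ε) * (C ^ 2 * ((4 * n : ℕ) : ℝ) ^ θ) := by
          gcongr; exact hD (4 * n) (by omega)
      _ = M * (n:ℝ) ^ (θ + ε) := by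
          rw [hM]; push_cast
          rw [Real.mul_rpow (by norm_num) hn0.le, Real.mul_rpow (by norm_num) hn0.le,
            Real.rpow_add (by norm_num), Real.rpow_add hn0]; ring
  rw [← Real.sqrt_sq (Nat.cast_nonneg (r2 n) : (0:ℝ) ≤ r2 n)]
  refine (Real.sqrt_le_sqrt h1).trans (le_of_eq ?_)
  rw [Real.sqrt_mul (by linarith), Real.sqrt_eq_rpow ((n:ℝ) ^ _), ← Real.rpow_mul hn0.le]
  congr 2; ring

lemma r2_le_rpow (ε : ℝ) (hε : 0 < ε) :
    ∃ C : ℝ, 1 ≤ C ∧ ∀ n : ℕ, 1 ≤ n → (r2 n : ℝ) ≤ C * (n:ℝ) ^ ε := by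
  have key : ∀ j : ℕ, ∃ C : ℝ, 1 ≤ C ∧ ∀ n : ℕ, 1 ≤ n →
      (r2 n : ℝ) ≤ C * (n:ℝ) ^ ((1/2:ℝ) ^ j + ε / 2) := by
    intro j
    induction j with
    | zero =>
      refine ⟨9, by norm_num, fun n hn => (r2_le_nine n hn).trans ?_⟩
      have hn1 : (1:ℝ) ≤ n := by exact_mod_cast hn
      have : (n:ℝ) ^ (1:ℝ) ≤ (n:ℝ) ^ ((1/2:ℝ) ^ 0 + ε / 2) :=
        Real.rpow_le_rpow_of_exponent_le hn1 (by simp; linarith)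
      rw [Real.rpow_one] at this
      linarith
    | succ j ih =>
      obtain ⟨C, hC, h⟩ := ih
      obtain ⟨C', hC', h'⟩ := r2_boot _ (by positivity) C hC h (ε / 2) (by linarith)
      refine ⟨C', hC', fun n hn => (h' n hn).trans (le_of_eq ?_)⟩
      congr 2; rw [pow_succ]; ring
  obtain ⟨j, hj⟩ := exists_pow_lt_of_lt_one (show 0 < ε / 2 by linarith) (show (1/2:ℝ) < 1 by norm_num)
  obtain ⟨C, hC, h⟩ := key j
  refine ⟨C, hC, fun n hn => (h n hn).trans ?_⟩
  have hn1 : (1:ℝ) ≤ n := by exact_mod_cast hn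
  gcongr
  linarith

/-! ### Oscillatory integrals -/

lemma vdc (a b : ℝ) (hab : a ≤ b) (φ g φ' : ℝ → ℝ) (hφc : ContinuousOn φ (Set.Icc a b))
    (hgc : ContinuousOn g (Set.Icc a b)) (hφ : ∀ x ∈ Set.Ioo a b, HasDerivAt φ (φ' x) x)
    (hg : ∀ x ∈ Set.Ioo a b, DifferentiableAt ℝ g x) (hmono : MonotoneOn g (Set.Icc a b))
    (hg0 : 0 ≤ g a) (hgφ : ∀ x ∈ Set.Ioo a b, g x * φ' x = 1) :
    ‖∫ x in a..b, Complex.exp (Complex.I * φ x)‖ ≤ 2 * g b := by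
  have hga : g a ≤ g b := hmono (Set.left_mem_Icc.2 hab) (Set.right_mem_Icc.2 hab) hab
  have hderiv0 : ∀ x ∈ Set.Ioo a b, 0 ≤ deriv g x := by
    intro x hx
    have h1 : MonotoneOn g (Set.Ioo a b) := hmono.mono Set.Ioo_subset_Icc_self
    have h2 := h1.derivWithin_nonneg (x := x)
    rwa [derivWithin_of_isOpen isOpen_Ioo hx] at h2
  have hgI : IntervalIntegrable (deriv g) volume a b := by
    rw [intervalIntegrable_iff_integrableOn_Ioc_of_le hab]
    exact intervalIntegral.integrableOn_deriv_of_nonneg hgc (fun x hx => (hg x hx).hasDerivAt) hderiv0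
  have hec : ContinuousOn (fun x => Complex.exp (Complex.I * φ x)) (Set.Icc a b) := by
    apply Complex.continuous_exp.comp_continuousOn
    exact continuousOn_const.mul (Complex.continuous_ofReal.comp_continuousOn hφc)
  have heI : IntervalIntegrable (fun x => Complex.exp (Complex.I * φ x)) volume a b :=
    ContinuousOn.intervalIntegrable_of_Icc hab hec
  have hnorm : ∀ x, ‖Complex.exp (Complex.I * φ x)‖ = 1 := by
    intro x; rw [mul_comm]; exact Complex.norm_exp_ofReal_mul_I _
  have hgeI : IntervalIntegrable (fun x => ((deriv g x : ℝ) : ℂ) * Complex.exp (Complex.I * φ x)) volume a b := by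
    have : IntervalIntegrable (fun x => ((deriv g x : ℝ) : ℂ)) volume a b := by
      rw [intervalIntegrable_iff] at hgI ⊢
      exact hgI.ofReal
    apply this.mul_continuousOn
    rwa [Set.uIcc_of_le hab]
  have hFD : ∀ x ∈ Set.Ioo a b, HasDerivAt (fun x => (g x : ℂ) * Complex.exp (Complex.I * φ x))
      (((deriv g x : ℝ) : ℂ) * Complex.exp (Complex.I * φ x)
        + Complex.I * Complex.exp (Complex.I * φ x)) x := by
    intro x hx
    have h1 := (hg x hx).hasDerivAt.ofReal_comp
    have h2 := (((hφ x hx).ofReal_comp).const_mul Complex.I).cexp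
    refine (h1.mul h2).congr_deriv ?_
    have : (g x : ℂ) * (φ' x : ℂ) = 1 := by exact_mod_cast hgφ x hx
    linear_combination (Complex.I * Complex.exp (Complex.I * φ x)) * this
  have hFc : ContinuousOn (fun x => (g x : ℂ) * Complex.exp (Complex.I * φ x)) (Set.Icc a b) :=
    (Complex.continuous_ofReal.comp_continuousOn hgc).mul hec
  have key := intervalIntegral.integral_eq_sub_of_hasDerivAt_of_le hab hFc hFD
    (hgeI.add (heI.const_mul _))
  rw [intervalIntegral.integral_add hgeI (heI.const_mul _), intervalIntegral.integral_const_mul] at key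
  have hgi : ∫ x in a..b, deriv g x = g b - g a :=
    intervalIntegral.integral_eq_sub_of_hasDerivAt_of_le hab hgc (fun x hx => (hg x hx).hasDerivAt) hgI
  have hb1 : ‖∫ x in a..b, ((deriv g x : ℝ) : ℂ) * Complex.exp (Complex.I * φ x)‖ ≤ g b - g a := by
    rw [← hgi]
    apply intervalIntegral.norm_integral_le_of_norm_le hab _ hgI
    rw [← MeasureTheory.ae_restrict_iff' measurableSet_Ioc, ← restrict_Ioo_eq_restrict_Ioc]
    filter_upwards [ae_restrict_mem measurableSet_Ioo] with x hx
    rw [norm_mul, hnorm, mul_one, Complex.norm_real, Real.norm_of_nonneg (hderiv0 x hx)]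
  have hE : Complex.I * ∫ x in a..b, Complex.exp (Complex.I * φ x)
      = (g b : ℂ) * Complex.exp (Complex.I * φ b) - (g a : ℂ) * Complex.exp (Complex.I * φ a)
        - ∫ x in a..b, ((deriv g x : ℝ) : ℂ) * Complex.exp (Complex.I * φ x) := by
    rw [← key]; ring
  have hN : ‖∫ x in a..b, Complex.exp (Complex.I * φ x)‖
      = ‖Complex.I * ∫ x in a..b, Complex.exp (Complex.I * φ x)‖ := by
    rw [norm_mul, Complex.norm_I, one_mul]
  rw [hN, hE]
  refine (norm_sub_le _ _).trans ?_
  have h3 : ‖(g b : ℂ) * Complex.exp (Complex.I * φ b) - (g a : ℂ) * Complex.exp (Complex.I * φ a)‖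
      ≤ g b + g a := by
    refine (norm_sub_le _ _).trans ?_
    rw [norm_mul, norm_mul, hnorm, hnorm, mul_one, mul_one, Complex.norm_real, Complex.norm_real,
      Real.norm_of_nonneg hg0, Real.norm_of_nonneg (hg0.trans hga)]
  linarith

/-- the phase function -/
def fph (m : ℕ) (x : ℝ) : ℝ := Real.sqrt (x ^ 4 - (m:ℝ) ^ 2)

/-- auxiliary monotone factor -/
def pph (m : ℕ) (x : ℝ) : ℝ := Real.sqrt (x ^ 2 - (m:ℝ) ^ 2 / x ^ 2)

lemma fph_cont (m : ℕ) : Continuous (fph m) := by unfold fph; fun_prop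

lemma fph_eq (m : ℕ) (x : ℝ) (hx : 0 < x) : fph m x = x * pph m x := by
  unfold fph pph
  rw [← Real.sqrt_sq hx.le, ← Real.sqrt_mul (by positivity), Real.sqrt_sq hx.le]
  congr 1
  field_simp

lemma pph_mono (m : ℕ) {x y : ℝ} (hx : 0 < x) (hxy : x ≤ y) : pph m x ≤ pph m y := by
  unfold pph
  apply Real.sqrt_le_sqrt
  gcongr

lemma osc_bound (X : ℝ) (hX : 1 ≤ X) (k m m' : ℕ) (hk : 1 ≤ k) (hmm : m' < m) (a : ℝ)
    (haX : X ≤ a) (ha : (m:ℝ) ≤ a ^ 2) (ha3 : a ≤ 3 * X) :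
    ‖∫ x in a..(3 * X), Complex.exp (Complex.I * ((2 * π * k * (fph m x - fph m' x) : ℝ) : ℂ))‖
      ≤ 20 * X ^ 3 / ((m:ℝ) ^ 2 - (m':ℝ) ^ 2) := by
  have hmm' : (m':ℝ) + 1 ≤ m := by exact_mod_cast hmm
  have hm'0 : (0:ℝ) ≤ m' := Nat.cast_nonneg _
  have hk1 : (1:ℝ) ≤ k := by exact_mod_cast hk
  have hd : 0 < (m:ℝ) ^ 2 - (m':ℝ) ^ 2 := by nlinarith
  set c : ℝ := 1 / (4 * π * k * ((m:ℝ) ^ 2 - (m':ℝ) ^ 2)) with hc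
  have hc0 : 0 < c := by have := Real.pi_pos; positivity
  have hpos : ∀ x ∈ Set.Icc a (3 * X), 0 < x := fun x hx => by linarith [hx.1]
  have hA : ∀ x ∈ Set.Ioo a (3 * X), 0 < x ^ 4 - (m:ℝ) ^ 2 := by
    intro x hx
    have h1 : a ^ 2 < x ^ 2 := by nlinarith [hx.1]
    have : (m:ℝ) < x ^ 2 := by linarith
    nlinarith
  have hA' : ∀ x ∈ Set.Ioo a (3 * X), 0 < x ^ 4 - (m':ℝ) ^ 2 := by
    intro x hx; have := hA x hx; linarith
  set g : ℝ → ℝ := fun x => c * (pph m x * pph m' x * (pph m x + pph m' x)) with hg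
  have hp0 : ∀ m x, 0 ≤ pph m x := fun m x => Real.sqrt_nonneg _
  have hpc : ∀ m, ContinuousOn (pph m) (Set.Icc a (3 * X)) := by
    intro m
    unfold pph
    apply Real.continuous_sqrt.comp_continuousOn
    apply ContinuousOn.sub (by fun_prop)
    apply ContinuousOn.div continuousOn_const (by fun_prop)
    intro x hx; have := hpos x hx; positivity
  have hpd : ∀ m : ℕ, ∀ x, 0 < x → 0 < x ^ 4 - (m:ℝ) ^ 2 → DifferentiableAt ℝ (pph m) x := by
    intro m x hx h
    unfold pph
    apply DifferentiableAt.sqrt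
    · apply DifferentiableAt.sub (by fun_prop)
      apply DifferentiableAt.div (by fun_prop) (by fun_prop) (by positivity)
    · have : x ^ 2 - (m:ℝ) ^ 2 / x ^ 2 = (x ^ 4 - (m:ℝ) ^ 2) / x ^ 2 := by field_simp
      rw [this]; positivity
  have hfd : ∀ m : ℕ, ∀ x, 0 < x ^ 4 - (m:ℝ) ^ 2 →
      HasDerivAt (fph m) (2 * x ^ 3 / fph m x) x := by
    intro m x h
    have h1 : HasDerivAt (fun x : ℝ => x ^ 4 - (m:ℝ) ^ 2) (4 * x ^ 3) x := by
      simpa using (hasDerivAt_pow 4 x).sub_const ((m:ℝ) ^ 2)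
    refine (h1.sqrt h.ne').congr_deriv ?_
    have : fph m x = Real.sqrt (x ^ 4 - (m:ℝ) ^ 2) := rfl
    rw [this]; ring
  have key := vdc a (3 * X) ha3 (fun x => 2 * π * k * (fph m x - fph m' x)) g
    (fun x => 2 * π * k * (2 * x ^ 3 / fph m x - 2 * x ^ 3 / fph m' x)) ?_ ?_ ?_ ?_ ?_ ?_ ?_
  · refine key.trans ?_
    have hb : ∀ m, pph m (3 * X) ≤ 3 * X := by
      intro m
      unfold pph
      rw [Real.sqrt_le_left (by linarith)]
      have : 0 ≤ (m:ℝ) ^ 2 / (3 * X) ^ 2 := by positivity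
      linarith
    have h1 : pph m (3 * X) * pph m' (3 * X) * (pph m (3 * X) + pph m' (3 * X))
        ≤ (3 * X) * (3 * X) * (3 * X + 3 * X) := by
      have := hp0 m (3 * X); have := hp0 m' (3 * X); have := hb m; have := hb m'
      gcongr
    calc 2 * g (3 * X) ≤ 2 * (c * ((3 * X) * (3 * X) * (3 * X + 3 * X))) := by
          simp only [hg]; gcongr
      _ = (27 / (π * k)) * X ^ 3 / ((m:ℝ) ^ 2 - (m':ℝ) ^ 2) := by
          rw [hc]; have := Real.pi_pos; field_simp; ring
      _ ≤ _ := by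
          gcongr
          rw [div_le_iff₀ (by have := Real.pi_pos; positivity)]
          have : 3 ≤ π * k := by nlinarith [Real.pi_gt_three]
          linarith
  · exact (continuous_const.mul ((fph_cont m).sub (fph_cont m'))).continuousOn
  · exact continuousOn_const.mul (((hpc m).mul (hpc m')).mul ((hpc m).add (hpc m')))
  · intro x hx
    exact ((hfd m x (hA x hx)).sub (hfd m' x (hA' x hx))).const_mul _
  · intro x hx
    have hx0 := hpos x ⟨hx.1.le, hx.2.le⟩
    have d1 := hpd m x hx0 (hA x hx)
    have d2 := hpd m' x hx0 (hA' x hx)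
    exact (((d1.mul d2).mul (d1.add d2)).const_mul c)
  · intro x hx y hy hxy
    have hx0 := hpos x hx
    have h1 := pph_mono m hx0 hxy
    have h2 := pph_mono m' hx0 hxy
    have := hp0 m x; have := hp0 m' x; have := hp0 m y; have := hp0 m' y
    simp only [hg]
    gcongr
  · have := hp0 m a; have := hp0 m' a
    simp only [hg]; positivity
  · intro x hx
    have hx0 := hpos x ⟨hx.1.le, hx.2.le⟩
    have q1 : fph m x ^ 2 = x ^ 4 - (m:ℝ) ^ 2 := Real.sq_sqrt (hA x hx).le
    have q2 : fph m' x ^ 2 = x ^ 4 - (m':ℝ) ^ 2 := Real.sq_sqrt (hA' x hx).le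
    have f1 : 0 < fph m x := Real.sqrt_pos.2 (hA x hx)
    have f2 : 0 < fph m' x := Real.sqrt_pos.2 (hA' x hx)
    have e1 : pph m x = fph m x / x := by rw [fph_eq m x hx0]; field_simp
    have e2 : pph m' x = fph m' x / x := by rw [fph_eq m' x hx0]; field_simp
    simp only [hg]
    rw [e1, e2]
    have e3 : (m:ℝ) ^ 2 - (m':ℝ) ^ 2 = (fph m' x - fph m x) * (fph m x + fph m' x) := by
      have : (fph m' x - fph m x) * (fph m x + fph m' x) = fph m' x ^ 2 - fph m x ^ 2 := by ring
      rw [this, q1, q2]; ring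
    have e4 : fph m' x - fph m x ≠ 0 := by
      intro h; rw [h, zero_mul] at e3; linarith
    rw [hc, e3]
    have := Real.pi_pos
    field_simp
    ring

/-! ### Mean square of exponential sums -/

lemma sum_invdist (T m : ℕ) (hm : m ≤ T) :
    ∑ m' ∈ Finset.range (T + 1), (if m = m' then (0:ℝ) else 1 / |(m:ℝ) - m'|)
      ≤ 2 * (1 + Real.log T) := by
  have h1 : ∑ m' ∈ (Finset.range (T + 1)).filter (fun m' => m' < m), (1:ℝ) / |(m:ℝ) - m'|
      ≤ ∑ d ∈ Finset.Icc 1 T, (1:ℝ) / d := by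
    apply sum_le_sum_of_inj _ _ _ _ (fun m' => m - m')
    · intro m' h
      rw [Finset.mem_filter] at h
      rw [Finset.mem_Icc]; omega
    · intro a ha b hb h
      simp only [Finset.coe_filter, Set.mem_setOf_eq] at ha hb h
      omega
    · intro a ha
      rw [Finset.mem_filter] at ha
      have : (a:ℝ) ≤ m := by exact_mod_cast ha.2.le
      rw [abs_of_nonneg (by linarith), Nat.cast_sub ha.2.le]
    · intros; positivity
  have h2 : ∑ m' ∈ (Finset.range (T + 1)).filter (fun m' => m < m'), (1:ℝ) / |(m:ℝ) - m'|
      ≤ ∑ d ∈ Finset.Icc 1 T, (1:ℝ) / d := by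
    apply sum_le_sum_of_inj _ _ _ _ (fun m' => m' - m)
    · intro m' h
      rw [Finset.mem_filter, Finset.mem_range] at h
      rw [Finset.mem_Icc]; omega
    · intro a ha b hb h
      simp only [Finset.coe_filter, Set.mem_setOf_eq] at ha hb h
      omega
    · intro a ha
      rw [Finset.mem_filter] at ha
      have : (m:ℝ) ≤ a := by exact_mod_cast ha.2.le
      rw [abs_of_nonpos (by linarith), Nat.cast_sub ha.2.le, neg_sub]
    · intros; positivity
  have h3 := sum_inv_le T
  have h4 : ∑ m' ∈ Finset.range (T + 1), (if m = m' then (0:ℝ) else 1 / |(m:ℝ) - m'|)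
      = ∑ m' ∈ (Finset.range (T + 1)).filter (fun m' => m' < m), (1:ℝ) / |(m:ℝ) - m'|
       + ∑ m' ∈ (Finset.range (T + 1)).filter (fun m' => m < m'), (1:ℝ) / |(m:ℝ) - m'| := by
    rw [Finset.sum_filter, Finset.sum_filter, ← Finset.sum_add_distrib]
    apply Finset.sum_congr rfl
    intro m' _
    rcases lt_trichotomy m m' with h | h | h
    · rw [if_neg h.ne, if_neg (by omega), if_pos h, zero_add]
    · rw [if_pos h, if_neg (by omega), if_neg (by omega), zero_add]
    · rw [if_neg h.ne', if_pos h, if_neg (by omega), add_zero]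
  rw [h4]; linarith

lemma double_sum_symm (s : Finset ℕ) (r : ℕ → ℝ) (K : ℕ → ℕ → ℝ) (hK : ∀ m m', 0 ≤ K m m')
    (hs : ∀ m m', K m m' = K m' m) :
    ∑ m ∈ s, ∑ m' ∈ s, r m * r m' * K m m' ≤ ∑ m ∈ s, r m ^ 2 * ∑ m' ∈ s, K m m' := by
  have h1 : ∑ m ∈ s, ∑ m' ∈ s, r m * r m' * K m m'
      ≤ ∑ m ∈ s, ∑ m' ∈ s, ((r m ^ 2 * K m m') / 2 + (r m' ^ 2 * K m m') / 2) := by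
    apply Finset.sum_le_sum; intro m _
    apply Finset.sum_le_sum; intro m' _
    have := mul_nonneg (sq_nonneg (r m - r m')) (hK m m')
    nlinarith
  refine h1.trans (le_of_eq ?_)
  simp only [Finset.sum_add_distrib]
  have h2 : ∑ m ∈ s, ∑ m' ∈ s, (r m' ^ 2 * K m m') / 2 = ∑ m ∈ s, ∑ m' ∈ s, (r m ^ 2 * K m m') / 2 := by
    rw [Finset.sum_comm]
    apply Finset.sum_congr rfl; intro m _
    apply Finset.sum_congr rfl; intro m' _
    rw [hs]
  rw [h2, ← Finset.sum_add_distrib]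
  apply Finset.sum_congr rfl; intro m _
  rw [← Finset.sum_add_distrib, Finset.mul_sum]
  apply Finset.sum_congr rfl; intro m' _
  ring

def Bmm (X : ℝ) (m m' : ℕ) : ℝ :=
  if m = m' then 2 * X else 20 * X ^ 3 / |(m:ℝ) ^ 2 - (m':ℝ) ^ 2|

lemma range_eq_insert (T : ℕ) : Finset.range (T + 1) = insert 0 (Finset.Icc 1 T) := by
  ext m; simp [Finset.mem_range, Finset.mem_Icc]; omega

lemma sum_range_r2_sq (T : ℕ) (hT : 1 ≤ T) :
    ∑ m ∈ Finset.range (T + 1), (r2 m : ℝ) ^ 2 ≤ 2001 * T * (1 + Real.log T) := by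
  rw [range_eq_insert, Finset.sum_insert (by simp), r2_zero]
  have := sum_r2_sq_le T hT
  have h1 := one_le_one_add_log T
  have h2 : (1:ℝ) ≤ T := by exact_mod_cast hT
  push_cast
  nlinarith

lemma sum_Bmm (X : ℝ) (hX : 1 ≤ X) (T : ℕ) (hT : 1 ≤ T) (hTX : (T:ℝ) ≤ 9 * X ^ 2) :
    ∑ m ∈ Finset.range (T + 1), ∑ m' ∈ Finset.range (T + 1), (r2 m : ℝ) * r2 m' * Bmm X m m'
      ≤ 10 ^ 6 * X ^ 3 * (1 + Real.log T) ^ 3 := by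
  have hL := one_le_one_add_log T
  set L := 1 + Real.log T
  have hB0 : ∀ m m', 0 ≤ Bmm X m m' := by
    intro m m'; unfold Bmm; split_ifs <;> positivity
  refine (double_sum_symm _ (fun m => (r2 m : ℝ)) (Bmm X) hB0 ?_).trans ?_
  · intro m m'; unfold Bmm
    simp only [eq_comm (a := m) (b := m'), abs_sub_comm ((m:ℝ) ^ 2)]
  have hinner : ∀ m ∈ Finset.range (T + 1), ∑ m' ∈ Finset.range (T + 1), Bmm X m m'
      ≤ 2 * X + 40 * X ^ 3 * L / (max m 1 : ℕ) := by
    intro m hm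
    have hmT : m ≤ T := by rw [Finset.mem_range] at hm; omega
    have hmx : (1:ℝ) ≤ (max m 1 : ℕ) := by exact_mod_cast le_max_right _ _
    have h1 : ∀ m' ∈ Finset.range (T + 1), Bmm X m m' ≤ (if m = m' then 2 * X else 0)
        + 20 * X ^ 3 / (max m 1 : ℕ) * (if m = m' then (0:ℝ) else 1 / |(m:ℝ) - m'|) := by
      intro m' _
      unfold Bmm
      split_ifs with h
      · simp
      · rw [zero_add, div_mul_div_comm, mul_one]
        have hne : (m:ℝ) - m' ≠ 0 := by
          intro h'; apply h; exact_mod_cast sub_eq_zero.1 h'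
        have hp := abs_pos.2 hne
        apply div_le_div_of_nonneg_left (by positivity) (by positivity)
        rw [sq_sub_sq, abs_mul]
        apply mul_le_mul_of_nonneg_right _ hp.le
        refine le_trans ?_ (le_abs_self _)
        have : max m 1 ≤ m + m' := by omega
        exact_mod_cast this
    refine (Finset.sum_le_sum h1).trans ?_
    rw [Finset.sum_add_distrib, Finset.sum_ite_eq, if_pos hm, ← Finset.mul_sum]
    have h2 := sum_invdist T m hmT
    calc _ ≤ 2 * X + 20 * X ^ 3 / (max m 1 : ℕ) * (2 * L) := by gcongr
      _ = _ := by ring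
  have h1 : ∑ m ∈ Finset.range (T + 1), (r2 m : ℝ) ^ 2 * ∑ m' ∈ Finset.range (T + 1), Bmm X m m'
      ≤ ∑ m ∈ Finset.range (T + 1), ((r2 m : ℝ) ^ 2 * (2 * X)
        + 40 * X ^ 3 * L * ((r2 m : ℝ) ^ 2 / (max m 1 : ℕ))) := by
    apply Finset.sum_le_sum
    intro m hm
    calc _ ≤ (r2 m : ℝ) ^ 2 * (2 * X + 40 * X ^ 3 * L / (max m 1 : ℕ)) := by
          gcongr; exact hinner m hm
      _ = _ := by ring
  refine h1.trans ?_
  rw [Finset.sum_add_distrib, ← Finset.sum_mul, ← Finset.mul_sum]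
  have h2 := sum_range_r2_sq T hT
  have h3 : ∑ m ∈ Finset.range (T + 1), (r2 m : ℝ) ^ 2 / (max m 1 : ℕ) ≤ 4001 * L ^ 2 := by
    rw [range_eq_insert, Finset.sum_insert (by simp), r2_zero]
    have : ∑ m ∈ Finset.Icc 1 T, (r2 m : ℝ) ^ 2 / (max m 1 : ℕ) = ∑ m ∈ Finset.Icc 1 T, (r2 m : ℝ) ^ 2 / m := by
      apply Finset.sum_congr rfl
      intro m hm
      rw [max_eq_left (Finset.mem_Icc.1 hm).1]
    rw [this]
    have := sum_r2_sq_div_le T hT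
    have : 1 ≤ L ^ 2 := one_le_pow₀ hL
    norm_num
    linarith
  have hL3 : L ≤ L ^ 3 := by nlinarith [sq_nonneg L, mul_self_nonneg (L-1)]
  calc _ ≤ (2001 * T * L) * (2 * X) + 40 * X ^ 3 * L * (4001 * L ^ 2) := by gcongr
    _ ≤ (2001 * (9 * X ^ 2) * L ^ 3) * (2 * X) + 40 * X ^ 3 * L * (4001 * L ^ 2) := by gcongr
    _ = (36018 + 160040) * (X ^ 3 * L ^ 3) := by ring
    _ ≤ _ := by nlinarith [show 0 ≤ X ^ 3 * L ^ 3 by positivity]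

/-- truncated phase exponential -/
def ek (k m : ℕ) (x : ℝ) : ℂ :=
  if (m:ℝ) ≤ x ^ 2 then Complex.exp (Complex.I * ((2 * π * k * fph m x : ℝ) : ℂ)) else 0

lemma ek_meas (k m : ℕ) : Measurable (ek k m) := by
  unfold ek
  apply Measurable.ite
  · exact measurableSet_le measurable_const (by fun_prop)
  · have := (fph_cont m).measurable
    fun_prop
  · fun_prop

lemma ek_norm (k m : ℕ) (x : ℝ) : ‖ek k m x‖ ≤ 1 := by
  unfold ek
  split_ifs
  · rw [mul_comm, Complex.norm_exp_ofReal_mul_I]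
  · simp

lemma ek_prod (k m m' : ℕ) (x : ℝ) : ek k m x * (starRingEnd ℂ) (ek k m' x)
    = if ((max m m' : ℕ) : ℝ) ≤ x ^ 2 then
      Complex.exp (Complex.I * ((2 * π * k * (fph m x - fph m' x) : ℝ) : ℂ)) else 0 := by
  have hmax : ((max m m' : ℕ) : ℝ) ≤ x ^ 2 ↔ (m:ℝ) ≤ x ^ 2 ∧ (m':ℝ) ≤ x ^ 2 := by
    rw [Nat.cast_max]; exact max_le_iff
  unfold ek
  by_cases h1 : (m:ℝ) ≤ x ^ 2
  · by_cases h2 : (m':ℝ) ≤ x ^ 2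
    · rw [if_pos h1, if_pos h2, if_pos (hmax.2 ⟨h1, h2⟩), ← Complex.exp_conj,
        ← Complex.exp_add]
      congr 1
      simp only [map_mul, Complex.conj_I, Complex.conj_ofReal]
      push_cast; ring
    · rw [if_neg h2, if_neg (fun h => h2 (hmax.1 h).2)]; simp
  · rw [if_neg h1, if_neg (fun h => h1 (hmax.1 h).1)]; simp

lemma ek_prod_int (k m m' : ℕ) (a b : ℝ) :
    IntervalIntegrable (fun x => ek k m x * (starRingEnd ℂ) (ek k m' x)) volume a b := by
  have hm : Measurable (fun x => ek k m x * (starRingEnd ℂ) (ek k m' x)) := by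
    have := ek_meas k m; have := ek_meas k m'
    have h2 : Measurable (fun x => (starRingEnd ℂ) (ek k m' x)) :=
      Complex.continuous_conj.measurable.comp this
    fun_prop
  refine (intervalIntegrable_const (c := (1:ℝ))).mono_fun hm.aestronglyMeasurable ?_
  filter_upwards with x
  rw [norm_mul, RCLike.norm_conj]
  have := ek_norm k m x; have := ek_norm k m' x
  simp only [norm_one]
  exact mul_le_one₀ (ek_norm k m x) (norm_nonneg _) (ek_norm k m' x)

lemma ek_osc (X : ℝ) (hX : 1 ≤ X) (k m m' : ℕ) (hk : 1 ≤ k)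
    (hm : (m:ℝ) ≤ 9 * X ^ 2) (hm' : (m':ℝ) ≤ 9 * X ^ 2) :
    ‖∫ x in X..(3 * X), ek k m x * (starRingEnd ℂ) (ek k m' x)‖ ≤ Bmm X m m' := by
  unfold Bmm
  split_ifs with h
  · refine (intervalIntegral.norm_integral_le_of_norm_le_const (C := 1) ?_).trans ?_
    · intro x _
      rw [norm_mul, RCLike.norm_conj]
      exact mul_le_one₀ (ek_norm k m x) (norm_nonneg _) (ek_norm k m' x)
    · rw [abs_of_nonneg (by linarith)]; linarith
  · set M : ℕ := max m m' with hM
    have hM9 : (M:ℝ) ≤ 9 * X ^ 2 := by rw [hM]; push_cast; exact max_le hm hm'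
    set a := max X (Real.sqrt M) with ha
    have haX : X ≤ a := le_max_left _ _
    have ha3 : a ≤ 3 * X := by
      apply max_le (by linarith)
      rw [Real.sqrt_le_left (by linarith)]; linarith
    have haM : (M:ℝ) ≤ a ^ 2 := by
      calc (M:ℝ) = Real.sqrt M ^ 2 := (Real.sq_sqrt (Nat.cast_nonneg _)).symm
        _ ≤ a ^ 2 := by gcongr; exact le_max_right _ _
    have e : ∫ x in X..(3 * X), ek k m x * (starRingEnd ℂ) (ek k m' x)
        = ∫ x in a..(3 * X), Complex.exp (Complex.I * ((2 * π * k * (fph m x - fph m' x) : ℝ) : ℂ)) := by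
      rw [← intervalIntegral.integral_add_adjacent_intervals (ek_prod_int k m m' X a)
        (ek_prod_int k m m' a (3 * X))]
      have z1 : ∫ x in X..a, ek k m x * (starRingEnd ℂ) (ek k m' x) = 0 := by
        apply intervalIntegral.integral_zero_ae
        have : ∀ᵐ x : ℝ, x ≠ a := by
          rw [ae_iff]; simp
        filter_upwards [this] with x hxa hx
        rw [Set.uIoc_of_le haX] at hx
        have hlt : x < a := lt_of_le_of_ne hx.2 hxa
        have hlt2 : x < Real.sqrt M := by
          rcases lt_max_iff.1 hlt with h' | h'
          · linarith [hx.1]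
          · exact h'
        rw [ek_prod, if_neg]
        rw [not_le, ← hM]
        exact (Real.lt_sqrt (by linarith [hx.1])).1 hlt2
      rw [z1, zero_add]
      apply intervalIntegral.integral_congr
      intro x hx
      rw [Set.uIcc_of_le ha3] at hx
      simp only
      rw [ek_prod, if_pos]
      rw [← hM]
      refine haM.trans ?_
      have := hx.1
      gcongr
    rw [e]
    rcases lt_or_gt_of_ne h with hlt | hlt
    · have hMm : (m':ℝ) ≤ a ^ 2 := by
        refine le_trans ?_ haM
        exact_mod_cast le_max_right _ _
      have := osc_bound X hX k m' m hk hlt a haX hMm ha3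
      have hh : (m:ℝ) < m' := by exact_mod_cast hlt
      have h0 : (0:ℝ) ≤ m := Nat.cast_nonneg _
      rw [abs_of_nonpos (by nlinarith), neg_sub]
      refine le_trans (le_of_eq ?_) this
      rw [← RCLike.norm_conj, intervalIntegral.integral_of_le ha3, intervalIntegral.integral_of_le ha3,
        ← integral_conj]
      congr 2
      ext x
      rw [← Complex.exp_conj]
      congr 1
      simp only [map_mul, Complex.conj_I, Complex.conj_ofReal]
      push_cast; ring
    · have hMm : (m:ℝ) ≤ a ^ 2 := by
        refine le_trans ?_ haM
        exact_mod_cast le_max_left _ _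
      have := osc_bound X hX k m m' hk hlt a haX hMm ha3
      have hh : (m':ℝ) < m := by exact_mod_cast hlt
      have h0 : (0:ℝ) ≤ m' := Nat.cast_nonneg _
      rw [abs_of_nonneg (by nlinarith)]
      exact this

/-- truncated exponential sum -/
def GT (T k : ℕ) (x : ℝ) : ℂ := ∑ m ∈ Finset.range (T + 1), (r2 m : ℂ) * ek k m x

lemma GT_sq (T k : ℕ) (x : ℝ) : ((‖GT T k x‖ ^ 2 : ℝ) : ℂ)
    = ∑ m ∈ Finset.range (T + 1), ∑ m' ∈ Finset.range (T + 1),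
      ((r2 m : ℂ) * r2 m') * (ek k m x * (starRingEnd ℂ) (ek k m' x)) := by
  rw [Complex.ofReal_pow, ← Complex.mul_conj', GT, map_sum, Finset.sum_mul_sum]
  apply Finset.sum_congr rfl; intro m _
  apply Finset.sum_congr rfl; intro m' _
  rw [map_mul, Complex.conj_natCast]; ring

lemma GT_mean (X : ℝ) (hX : 1 ≤ X) (k : ℕ) (hk : 1 ≤ k) (T : ℕ) (hT : 1 ≤ T)
    (hTX : (T:ℝ) ≤ 9 * X ^ 2) :
    ∫ x in X..(3 * X), ‖GT T k x‖ ^ 2 ≤ 10 ^ 6 * X ^ 3 * (1 + Real.log T) ^ 3 := by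
  refine le_trans ?_ (sum_Bmm X hX T hT hTX)
  have h0 : 0 ≤ ∫ x in X..(3 * X), ‖GT T k x‖ ^ 2 := by
    apply intervalIntegral.integral_nonneg (by linarith); intros; positivity
  have e : ((∫ x in X..(3 * X), ‖GT T k x‖ ^ 2 : ℝ) : ℂ)
      = ∑ m ∈ Finset.range (T + 1), ∑ m' ∈ Finset.range (T + 1),
      ((r2 m : ℂ) * r2 m') * ∫ x in X..(3 * X), (ek k m x * (starRingEnd ℂ) (ek k m' x)) := by
    rw [← intervalIntegral.integral_ofReal]
    simp only [GT_sq]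
    rw [intervalIntegral.integral_finset_sum]
    · apply Finset.sum_congr rfl; intro m _
      rw [intervalIntegral.integral_finset_sum]
      · apply Finset.sum_congr rfl; intro m' _
        rw [intervalIntegral.integral_const_mul]
      · intro m' _; exact (ek_prod_int _ _ _ _ _).const_mul _
    · intro m _
      have := IntervalIntegrable.sum (μ := volume) (a := X) (b := 3 * X) (Finset.range (T + 1))
        (f := fun m' x => ((r2 m : ℂ) * r2 m') * (ek k m x * (starRingEnd ℂ) (ek k m' x)))
        (fun m' _ => (ek_prod_int _ _ _ _ _).const_mul _)
      have e2 : (fun x => ∑ m' ∈ Finset.range (T + 1),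
          ((r2 m : ℂ) * r2 m') * (ek k m x * (starRingEnd ℂ) (ek k m' x)))
          = ∑ m' ∈ Finset.range (T + 1), fun x =>
          ((r2 m : ℂ) * r2 m') * (ek k m x * (starRingEnd ℂ) (ek k m' x)) := by
        funext x; simp [Finset.sum_apply]
      rw [e2]; exact this
  rw [← Real.norm_of_nonneg h0, ← Complex.norm_real, e]
  refine (norm_sum_le _ _).trans (Finset.sum_le_sum fun m hm => ?_)
  refine (norm_sum_le _ _).trans (Finset.sum_le_sum fun m' hm' => ?_)
  rw [Finset.mem_range] at hm hm'
  have a1 : (m:ℝ) ≤ T := by exact_mod_cast (by omega : m ≤ T)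
  have a2 : (m':ℝ) ≤ T := by exact_mod_cast (by omega : m' ≤ T)
  rw [norm_mul, norm_mul, Complex.norm_natCast, Complex.norm_natCast]
  gcongr
  exact ek_osc X hX k m m' hk (a1.trans hTX) (a2.trans hTX)

/-- Periodic second Bernoulli function. -/
def bper (t : ℝ) : ℝ := Int.fract t ^ 2 - Int.fract t + 1 / 6

lemma bper_hasSum (t : ℝ) :
    HasSum (fun n : ℕ => 1 / (n:ℝ) ^ 2 * Real.cos (2 * π * n * t)) (π ^ 2 * bper t) := by
  have h := hasSum_one_div_nat_pow_mul_cos (k := 1) one_ne_zero (x := Int.fract t)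
    ⟨Int.fract_nonneg t, (Int.fract_lt_one t).le⟩
  have e : (-1 : ℝ) ^ (1 + 1) * (2 * π) ^ (2 * 1) / 2 / ((2 * 1).factorial : ℝ) *
      (Polynomial.map (algebraMap ℚ ℝ) (Polynomial.bernoulli (2 * 1))).eval (Int.fract t)
      = π ^ 2 * bper t := by
    simp only [Polynomial.bernoulli, bper, Finset.sum_range_succ, Finset.sum_range_zero]
    simp [bernoulli, bernoulli'_two, Nat.choose]
    ring
  rw [e] at h
  have e2 : (fun n : ℕ => 1 / (n:ℝ) ^ 2 * Real.cos (2 * π * n * t))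
      = fun n : ℕ => 1 / (n:ℝ) ^ (2 * 1) * Real.cos (2 * π * n * Int.fract t) := by
    funext n
    have : 2 * π * n * t = 2 * π * n * Int.fract t + ((n * ⌊t⌋ : ℤ) : ℝ) * (2 * π) := by
      rw [← Int.self_sub_floor t]; push_cast; ring
    rw [this, Real.cos_add_int_mul_two_pi]
  rw [e2]; exact h

lemma bper_approx (ε : ℝ) (hε : 0 < ε) : ∃ K : ℕ, ∀ t : ℝ,
    |π ^ 2 * bper t - ∑ n ∈ Finset.range K, 1 / (n:ℝ) ^ 2 * Real.cos (2 * π * n * t)| ≤ ε := by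
  have hs : Summable (fun n : ℕ => 1 / (n:ℝ) ^ 2) := Real.summable_one_div_nat_pow.2 (by norm_num)
  have ht := tendsto_sum_nat_add (fun n : ℕ => 1 / (n:ℝ) ^ 2)
  obtain ⟨K, hK⟩ := ((ht.eventually (gt_mem_nhds hε))).exists
  refine ⟨K, fun t => ?_⟩
  have h := bper_hasSum t
  have h2 := h.summable.sum_add_tsum_nat_add K
  rw [h.tsum_eq] at h2
  rw [← h2, add_sub_cancel_left]
  have hs' : Summable (fun n : ℕ => 1 / ((n + K : ℕ):ℝ) ^ 2) := (summable_nat_add_iff K).2 hs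
  rw [← Real.norm_eq_abs]
  refine (tsum_of_norm_bounded hs'.hasSum ?_).trans hK.le
  intro n
  rw [norm_mul, Real.norm_of_nonneg (by positivity), Real.norm_eq_abs]
  exact mul_le_of_le_one_right (by positivity) (Real.abs_cos_le_one _)

/-- Smoothed sawtooth. -/
def psih (h t : ℝ) : ℝ := (bper (t + h) - bper t) / (2 * h)

lemma psih_good (h t : ℝ) (h0 : 0 < h) (_h1 : h < 1) (hg : Int.fract t + h < 1) :
    psih h t - sawtooth t = h / 2 := by
  have e : Int.fract (t + h) = Int.fract t + h := by
    rw [Int.fract_eq_iff]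
    refine ⟨by linarith [Int.fract_nonneg t], hg, ⌊t⌋, ?_⟩
    linarith [Int.self_sub_floor t]
  have e2 : sawtooth t = Int.fract t - 1 / 2 := by
    unfold sawtooth; linarith [Int.self_sub_floor t]
  unfold psih bper
  rw [e, e2]; field_simp; ring

lemma psih_bad (h t : ℝ) (h0 : 0 < h) (h1 : h < 1) (hg : ¬ Int.fract t + h < 1) :
    |psih h t - sawtooth t| ≤ 1 := by
  have hf := Int.fract_lt_one t
  have hf0 := Int.fract_nonneg t
  have e : Int.fract (t + h) = Int.fract t + h - 1 := by
    rw [Int.fract_eq_iff]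
    refine ⟨by linarith, by linarith, ⌊t⌋ + 1, ?_⟩
    push_cast
    linarith [Int.self_sub_floor t]
  have e2 : sawtooth t = Int.fract t - 1 / 2 := by
    unfold sawtooth; linarith [Int.self_sub_floor t]
  unfold psih bper
  rw [e, e2]
  set u := Int.fract t
  have e3 : ((u + h - 1) ^ 2 - (u + h - 1) + 1 / 6 - (u ^ 2 - u + 1 / 6)) / (2 * h)
      - (u - 1 / 2) = ((1 - u) * (1 - h)) / h + (h / 2 - u) + 0 := by
    field_simp; ring
  rw [e3]
  have a1 : ((1 - u) * (1 - h)) / h ≤ 1 - h := by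
    rw [div_le_iff₀ h0]; nlinarith
  have a2 : 0 ≤ ((1 - u) * (1 - h)) / h := by
    apply div_nonneg _ h0.le; nlinarith
  rw [abs_le]; constructor <;> linarith

lemma psih_err (h t : ℝ) (h0 : 0 < h) (h1 : h < 1) :
    (psih h t - sawtooth t) ^ 2 ≤ h ^ 2 / 4 + (if 1 - h ≤ Int.fract t then 1 else 0) := by
  by_cases hg : Int.fract t + h < 1
  · rw [psih_good h t h0 h1 hg, if_neg (by linarith)]; apply le_of_eq; ring
  · rw [if_pos (by linarith)]
    have := psih_bad h t h0 h1 hg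
    have h3 := sq_le_one_iff_abs_le_one _ |>.2 this
    nlinarith [sq_nonneg h]

/-- Indicator of `m ≤ x²`. -/
def ind (m : ℕ) (x : ℝ) : ℝ := if (m:ℝ) ≤ x ^ 2 then 1 else 0

lemma ind_nonneg (m : ℕ) (x : ℝ) : 0 ≤ ind m x := by unfold ind; split_ifs <;> norm_num
lemma ind_le_one (m : ℕ) (x : ℝ) : ind m x ≤ 1 := by unfold ind; split_ifs <;> norm_num

lemma ind_meas (m : ℕ) : Measurable (ind m) := by
  unfold ind
  exact Measurable.ite (measurableSet_le measurable_const (by fun_prop)) measurable_const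
    measurable_const

lemma bper_meas : Measurable bper := by
  unfold bper
  have := measurable_fract (R := ℝ)
  fun_prop

lemma sawtooth_meas : Measurable sawtooth := by
  have : sawtooth = fun t => Int.fract t - 1 / 2 := by
    funext t; unfold sawtooth; linarith [Int.self_sub_floor t]
  rw [this]
  have := measurable_fract (R := ℝ)
  fun_prop

lemma psih_meas (h : ℝ) : Measurable (psih h) := by
  unfold psih
  have := bper_meas
  exact ((this.comp (by fun_prop)).sub this).div_const _

lemma GT_meas (T k : ℕ) : Measurable (GT T k) := by
  unfold GT
  exact Finset.measurable_sum _ fun m _ => (ek_meas k m).const_mul _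

lemma GT_bound (T k : ℕ) (x : ℝ) : ‖GT T k x‖ ≤ ∑ m ∈ Finset.range (T + 1), (r2 m : ℝ) := by
  unfold GT
  refine (norm_sum_le _ _).trans (Finset.sum_le_sum fun m _ => ?_)
  rw [norm_mul, Complex.norm_natCast]
  exact mul_le_of_le_one_right (by positivity) (ek_norm k m x)

lemma GT_re (T k : ℕ) (x h : ℝ) :
    ∑ m ∈ Finset.range (T + 1), (r2 m : ℝ) * (ind m x * Real.cos (2 * π * k * (fph m x + h)))
      = (Complex.exp (Complex.I * ((2 * π * k * h : ℝ) : ℂ)) * GT T k x).re := by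
  unfold GT
  rw [Finset.mul_sum, Complex.re_sum]
  refine Finset.sum_congr rfl fun m _ => ?_
  unfold ek ind
  split_ifs
  · have : Complex.exp (Complex.I * ((2 * π * k * h : ℝ) : ℂ)) * ((r2 m : ℂ) *
        Complex.exp (Complex.I * ((2 * π * k * fph m x : ℝ) : ℂ)))
        = ((r2 m : ℝ) : ℂ) * Complex.exp (((2 * π * k * (fph m x + h) : ℝ) : ℂ) * Complex.I) := by
      rw [mul_left_comm, ← Complex.exp_add]
      push_cast; ring_nf
    rw [this, Complex.re_ofReal_mul, Complex.exp_ofReal_mul_I_re]; ring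
  · simp

lemma GT_re_le (T k : ℕ) (x h : ℝ) :
    |∑ m ∈ Finset.range (T + 1), (r2 m : ℝ) * (ind m x * Real.cos (2 * π * k * (fph m x + h)))|
      ≤ ‖GT T k x‖ := by
  rw [GT_re]
  refine (Complex.abs_re_le_norm _).trans ?_
  rw [norm_mul, mul_comm Complex.I, Complex.norm_exp_ofReal_mul_I, one_mul]

/-- Smoothed sum bounded by finitely many exponential sums. -/
lemma Fh_bound (T : ℕ) (h : ℝ) (h0 : 0 < h) : ∃ K : ℕ, ∀ x : ℝ,
    |∑ m ∈ Finset.range (T + 1), (r2 m : ℝ) * (ind m x * psih h (fph m x))|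
      ≤ (1 / h) * (∑ n ∈ Finset.range K, 1 / (n:ℝ) ^ 2 * ‖GT T n x‖ + 1) := by
  set M := ∑ m ∈ Finset.range (T + 1), (r2 m : ℝ) with hM
  have hM0 : 0 ≤ M := Finset.sum_nonneg fun m _ => by positivity
  obtain ⟨K, hK⟩ := bper_approx (1 / (M + 1)) (by positivity)
  refine ⟨K, fun x => ?_⟩
  have key : ∀ h' : ℝ, |∑ m ∈ Finset.range (T + 1), (r2 m : ℝ) * (ind m x *
      (π ^ 2 * bper (fph m x + h')))| ≤ ∑ n ∈ Finset.range K, 1 / (n:ℝ) ^ 2 * ‖GT T n x‖ + 1 := by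
    intro h'
    have e : ∑ m ∈ Finset.range (T + 1), (r2 m : ℝ) * (ind m x * (π ^ 2 * bper (fph m x + h')))
        = ∑ m ∈ Finset.range (T + 1), (r2 m : ℝ) * (ind m x * (π ^ 2 * bper (fph m x + h') -
            ∑ n ∈ Finset.range K, 1 / (n:ℝ) ^ 2 * Real.cos (2 * π * n * (fph m x + h'))))
        + ∑ n ∈ Finset.range K, 1 / (n:ℝ) ^ 2 * ∑ m ∈ Finset.range (T + 1), (r2 m : ℝ) *
            (ind m x * Real.cos (2 * π * n * (fph m x + h'))) := by
      simp_rw [Finset.mul_sum]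
      rw [Finset.sum_comm (s := Finset.range K), ← Finset.sum_add_distrib]
      refine Finset.sum_congr rfl fun m _ => ?_
      rw [mul_sub, mul_sub, Finset.mul_sum, Finset.mul_sum, sub_add_eq_add_sub,
        eq_sub_iff_add_eq, add_right_inj]
      refine Finset.sum_congr rfl fun n _ => ?_
      ring
    rw [e]
    refine (abs_add_le _ _).trans ?_
    rw [add_comm]
    refine add_le_add ?_ ?_
    · refine (Finset.abs_sum_le_sum_abs _ _).trans (Finset.sum_le_sum fun n _ => ?_)
      rw [abs_mul, abs_of_nonneg (by positivity : (0:ℝ) ≤ 1 / (n:ℝ) ^ 2)]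
      exact mul_le_mul_of_nonneg_left (GT_re_le _ _ _ _) (by positivity)
    · refine (Finset.abs_sum_le_sum_abs _ _).trans ?_
      calc _ ≤ ∑ m ∈ Finset.range (T + 1), (r2 m : ℝ) * (1 / (M + 1)) := by
            refine Finset.sum_le_sum fun m _ => ?_
            rw [abs_mul, abs_mul, abs_of_nonneg (by positivity : (0:ℝ) ≤ r2 m),
              abs_of_nonneg (ind_nonneg m x)]
            refine mul_le_mul_of_nonneg_left ?_ (by positivity)
            exact (mul_le_of_le_one_left (abs_nonneg _) (ind_le_one m x)).trans (hK _)
        _ = M / (M + 1) := by rw [← Finset.sum_mul, ← hM]; ring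
        _ ≤ 1 := by rw [div_le_one (by positivity)]; linarith
  have e : ∑ m ∈ Finset.range (T + 1), (r2 m : ℝ) * (ind m x * psih h (fph m x))
      = (1 / (2 * h * π ^ 2)) * (∑ m ∈ Finset.range (T + 1), (r2 m : ℝ) * (ind m x *
      (π ^ 2 * bper (fph m x + h))) - ∑ m ∈ Finset.range (T + 1), (r2 m : ℝ) * (ind m x *
      (π ^ 2 * bper (fph m x + 0)))) := by
    rw [← Finset.sum_sub_distrib, Finset.mul_sum]
    refine Finset.sum_congr rfl fun m _ => ?_
    unfold psih
    rw [add_zero]; field_simp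
  rw [e, abs_mul, abs_of_nonneg (by positivity)]
  set S := ∑ n ∈ Finset.range K, 1 / (n:ℝ) ^ 2 * ‖GT T n x‖ + 1
  have k1 := key h
  have k2 := key 0
  have hS : 0 ≤ S := (abs_nonneg _).trans k1
  calc _ ≤ (1 / (2 * h * π ^ 2)) * (2 * S) := by
        refine mul_le_mul_of_nonneg_left ?_ (by positivity)
        refine (abs_sub _ _).trans ?_
        linarith
    _ = (1 / h) * S * (1 / π ^ 2) := by field_simp
    _ ≤ (1 / h) * S * 1 := by
        refine mul_le_mul_of_nonneg_left ?_ (by positivity)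
        rw [div_le_one (by positivity)]
        nlinarith [Real.pi_gt_three]
    _ = _ := by ring

lemma ii_of_bdd {f : ℝ → ℝ} (hf : Measurable f) (C a b : ℝ) (h : ∀ x, |f x| ≤ C) :
    IntervalIntegrable f volume a b := by
  rw [intervalIntegrable_iff]
  refine Measure.integrableOn_of_bounded (M := C) ?_ hf.aestronglyMeasurable ?_
  · simp [Set.uIoc, Real.volume_Ioc]
  · exact Eventually.of_forall fun x => by simpa using h x

lemma sum_range_inv_sq_le (K : ℕ) : ∑ n ∈ Finset.range K, 1 / (n:ℝ) ^ 2 ≤ 2 := by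
  rcases K with _ | K
  · simp
  · rw [range_eq_insert, Finset.sum_insert (by simp)]
    have := sum_inv_sq_le K
    simpa using this

lemma Fh_mean (X : ℝ) (hX : 1 ≤ X) (T : ℕ) (hT : 1 ≤ T) (hTX : (T:ℝ) ≤ 9 * X ^ 2)
    (h : ℝ) (h0 : 0 < h) :
    ∫ x in X..(3 * X), (∑ m ∈ Finset.range (T + 1), (r2 m : ℝ) * (ind m x * psih h (fph m x))) ^ 2
      ≤ (1 / h ^ 2) * (10 ^ 7 * X ^ 3 * (1 + Real.log T) ^ 3) := by
  obtain ⟨K, hK⟩ := Fh_bound T h h0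
  set M := ∑ m ∈ Finset.range (T + 1), (r2 m : ℝ) with hM
  have hM0 : 0 ≤ M := Finset.sum_nonneg fun m _ => by positivity
  have hpt : ∀ x, (∑ m ∈ Finset.range (T + 1), (r2 m : ℝ) * (ind m x * psih h (fph m x))) ^ 2
      ≤ (2 / h ^ 2) * (2 * ∑ n ∈ Finset.range K, 1 / (n:ℝ) ^ 2 * ‖GT T n x‖ ^ 2 + 1) := by
    intro x
    set A := ∑ n ∈ Finset.range K, 1 / (n:ℝ) ^ 2 * ‖GT T n x‖ with hA
    have hA0 : 0 ≤ A := Finset.sum_nonneg fun m _ => by positivity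
    have hCS : A ^ 2 ≤ 2 * ∑ n ∈ Finset.range K, 1 / (n:ℝ) ^ 2 * ‖GT T n x‖ ^ 2 := by
      have := Finset.sum_mul_sq_le_sq_mul_sq (Finset.range K) (fun n : ℕ => 1 / (n:ℝ))
        (fun n => 1 / (n:ℝ) * ‖GT T n x‖)
      have e1 : ∑ n ∈ Finset.range K, 1 / (n:ℝ) * (1 / (n:ℝ) * ‖GT T n x‖) = A :=
        Finset.sum_congr rfl fun n _ => by rw [← mul_assoc, div_mul_div_comm, one_mul, sq]
      have e2 : ∑ n ∈ Finset.range K, (1 / (n:ℝ) * ‖GT T n x‖) ^ 2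
          = ∑ n ∈ Finset.range K, 1 / (n:ℝ) ^ 2 * ‖GT T n x‖ ^ 2 :=
        Finset.sum_congr rfl fun n _ => by rw [mul_pow, div_pow, one_pow]
      have e3 : ∑ n ∈ Finset.range K, (1 / (n:ℝ)) ^ 2 = ∑ n ∈ Finset.range K, 1 / (n:ℝ) ^ 2 :=
        Finset.sum_congr rfl fun n _ => by rw [div_pow, one_pow]
      rw [e1, e2, e3] at this
      refine this.trans (mul_le_mul_of_nonneg_right (sum_range_inv_sq_le K) ?_)
      exact Finset.sum_nonneg fun m _ => by positivity
    have h1 := sq_le_sq' (by linarith [hK x, neg_abs_le (∑ m ∈ Finset.range (T + 1), (r2 m : ℝ) * (ind m x * psih h (fph m x)))]) ((le_abs_self _).trans (hK x))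
    refine h1.trans ?_
    have : ((1 / h) * (A + 1)) ^ 2 = (1 / h ^ 2) * (A + 1) ^ 2 := by field_simp
    rw [this]
    have h3 : (2 / h ^ 2) = (1 / h ^ 2) * 2 := by ring
    rw [h3, mul_assoc]
    refine mul_le_mul_of_nonneg_left ?_ (by positivity)
    nlinarith [sq_nonneg (A - 1)]
  have hGm : ∀ n, Measurable (fun x => ‖GT T n x‖ ^ 2) := fun n => (GT_meas T n).norm.pow_const 2
  have hGi : ∀ n, IntervalIntegrable (fun x => ‖GT T n x‖ ^ 2) volume X (3 * X) := fun n =>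
    ii_of_bdd (hGm n) (M ^ 2) _ _ fun x => by
      rw [abs_of_nonneg (by positivity)]
      exact pow_le_pow_left₀ (norm_nonneg _) (GT_bound T n x) 2
  have hsi : IntervalIntegrable (fun x => ∑ n ∈ Finset.range K, 1 / (n:ℝ) ^ 2 * ‖GT T n x‖ ^ 2)
      volume X (3 * X) := by
    have := IntervalIntegrable.sum (μ := volume) (a := X) (b := 3 * X) (Finset.range K)
        (f := fun n x => 1 / (n:ℝ) ^ 2 * ‖GT T n x‖ ^ 2) (fun n _ => (hGi n).const_mul _)
    have e2 : (fun x => ∑ n ∈ Finset.range K, 1 / (n:ℝ) ^ 2 * ‖GT T n x‖ ^ 2)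
        = ∑ n ∈ Finset.range K, fun x => 1 / (n:ℝ) ^ 2 * ‖GT T n x‖ ^ 2 := by
      funext x; simp [Finset.sum_apply]
    rw [e2]; exact this
  have hri : IntervalIntegrable (fun x => (2 / h ^ 2) *
      (2 * ∑ n ∈ Finset.range K, 1 / (n:ℝ) ^ 2 * ‖GT T n x‖ ^ 2 + 1)) volume X (3 * X) :=
    ((hsi.const_mul 2).add intervalIntegrable_const).const_mul _
  have hlm : Measurable (fun x => (∑ m ∈ Finset.range (T + 1), (r2 m : ℝ) *
      (ind m x * psih h (fph m x))) ^ 2) := by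
    refine (Finset.measurable_sum _ fun m _ => ?_).pow_const 2
    exact ((ind_meas m).mul ((psih_meas h).comp (fph_cont m).measurable)).const_mul _
  have hli : IntervalIntegrable (fun x => (∑ m ∈ Finset.range (T + 1), (r2 m : ℝ) *
      (ind m x * psih h (fph m x))) ^ 2) volume X (3 * X) := by
    refine hri.mono_fun' hlm.aestronglyMeasurable (Eventually.of_forall fun x => ?_)
    simp only []
    rw [Real.norm_of_nonneg (by positivity)]; exact hpt x
  have hX3 : X ≤ 3 * X := by linarith
  have hl : 1 ≤ 1 + Real.log T := by
    have := Real.log_nonneg (by exact_mod_cast hT : (1:ℝ) ≤ T); linarith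
  calc _ ≤ ∫ x in X..(3 * X), (2 / h ^ 2) *
      (2 * ∑ n ∈ Finset.range K, 1 / (n:ℝ) ^ 2 * ‖GT T n x‖ ^ 2 + 1) :=
        intervalIntegral.integral_mono_on hX3 hli hri fun x _ => hpt x
    _ = (2 / h ^ 2) * (2 * ∑ n ∈ Finset.range K, 1 / (n:ℝ) ^ 2 *
        (∫ x in X..(3 * X), ‖GT T n x‖ ^ 2) + 2 * X) := by
        rw [intervalIntegral.integral_const_mul, intervalIntegral.integral_add
          (hsi.const_mul 2) intervalIntegrable_const, intervalIntegral.integral_const_mul,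
          intervalIntegral.integral_finsetSum (fun n _ => (hGi n).const_mul _)]
        simp_rw [intervalIntegral.integral_const_mul]
        simp; ring_nf; simp
    _ ≤ (2 / h ^ 2) * (2 * (2 * (10 ^ 6 * X ^ 3 * (1 + Real.log T) ^ 3)) + 2 * X) := by
        refine mul_le_mul_of_nonneg_left ?_ (by positivity)
        gcongr
        calc _ ≤ ∑ n ∈ Finset.range K, 1 / (n:ℝ) ^ 2 * (10 ^ 6 * X ^ 3 * (1 + Real.log T) ^ 3) := by
              refine Finset.sum_le_sum fun n _ => ?_
              rcases Nat.eq_zero_or_pos n with rfl | hn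
              · simp
              · exact mul_le_mul_of_nonneg_left (GT_mean X hX n hn T hT hTX) (by positivity)
          _ ≤ _ := by
              rw [← Finset.sum_mul]
              exact mul_le_mul_of_nonneg_right (sum_range_inv_sq_le K) (by positivity)
    _ ≤ _ := by
        have h5 : 1 ≤ (1 + Real.log T) ^ 3 := one_le_pow₀ hl
        have h6 : X ≤ X ^ 3 := le_self_pow₀ hX (by norm_num)
        have h7 : X ≤ X ^ 3 * (1 + Real.log T) ^ 3 := h6.trans (le_mul_of_one_le_right (by positivity) h5)
        have h3 : (2 / h ^ 2) = (1 / h ^ 2) * 2 := by ring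
        rw [h3, mul_assoc]
        refine mul_le_mul_of_nonneg_left ?_ (by positivity)
        linarith

lemma fph_diff (m : ℕ) {x y : ℝ} (hx : 0 < x) (hxy : x ≤ y) (hm : (m:ℝ) ≤ x ^ 2) :
    y ^ 2 - x ^ 2 ≤ fph m y - fph m x := by
  have hm0 : (0:ℝ) ≤ m := by positivity
  have hxy2 : x ^ 2 ≤ y ^ 2 := pow_le_pow_left₀ hx.le hxy 2
  have a1 : 0 ≤ x ^ 4 - (m:ℝ) ^ 2 := by nlinarith
  have a2 : 0 ≤ y ^ 4 - (m:ℝ) ^ 2 := by nlinarith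
  have b1 : fph m x ^ 2 = x ^ 4 - (m:ℝ) ^ 2 := Real.sq_sqrt a1
  have b2 : fph m y ^ 2 = y ^ 4 - (m:ℝ) ^ 2 := Real.sq_sqrt a2
  have c1 : 0 ≤ fph m x := Real.sqrt_nonneg _
  have c2 : 0 ≤ fph m y := Real.sqrt_nonneg _
  have d1 : fph m x ≤ x ^ 2 := by
    apply Real.sqrt_le_iff.2; constructor; positivity; nlinarith
  have d2 : fph m y ≤ y ^ 2 := by
    apply Real.sqrt_le_iff.2; constructor; positivity; nlinarith
  have e : (fph m y - fph m x) * (fph m y + fph m x) = (y ^ 2 - x ^ 2) * (y ^ 2 + x ^ 2) := by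
    nlinarith
  by_contra hc
  push Not at hc
  have hd : 0 ≤ y ^ 2 - x ^ 2 := by linarith
  have hlt : 0 < y ^ 2 - x ^ 2 := by
    rcases hd.eq_or_lt with h | h
    · have : fph m y = fph m x := by
        have : fph m y ^ 2 = fph m x ^ 2 := by rw [b1, b2]; nlinarith
        exact (pow_left_inj₀ c2 c1 (by norm_num)).1 this
      linarith
    · exact h
  have h1 : (fph m y - fph m x) * (fph m y + fph m x) ≤ (y ^ 2 - x ^ 2) * (fph m y + fph m x) :=
    mul_le_mul_of_nonneg_right hc.le (by linarith)
  have hp : 0 < fph m y + fph m x := by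
    have : 0 < (y ^ 2 - x ^ 2) * (y ^ 2 + x ^ 2) := by positivity
    rw [← e] at this
    by_contra h0
    have : fph m y + fph m x = 0 := le_antisymm (not_lt.1 h0) (by linarith)
    rw [this] at e; nlinarith
  nlinarith

def badset (X h : ℝ) (m : ℕ) : Set ℝ :=
  {x ∈ Set.Ioc X (3 * X) | (m:ℝ) ≤ x ^ 2 ∧ 1 - h ≤ Int.fract (fph m x)}

lemma badset_meas (X h : ℝ) (m : ℕ) : MeasurableSet (badset X h m) := by
  unfold badset
  have h1 : MeasurableSet {x : ℝ | (m:ℝ) ≤ x ^ 2} := measurableSet_le measurable_const (by fun_prop)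
  have h2 : MeasurableSet {x : ℝ | 1 - h ≤ Int.fract (fph m x)} :=
    measurableSet_le measurable_const (measurable_fract.comp (fph_cont m).measurable)
  exact measurableSet_Ioc.inter (h1.inter h2)

lemma badset_vol (X h : ℝ) (hX : 1 ≤ X) (h0 : 0 < h) (m : ℕ) :
    volume (badset X h m) ≤ ENNReal.ofReal (5 * h * X) := by
  set J := ⌊9 * X ^ 2⌋₊ with hJ
  have hsub : badset X h m ⊆ ⋃ j ∈ Finset.range (J + 1),
      {x ∈ badset X h m | ⌊fph m x⌋ = (j:ℤ)} := by
    intro x hx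
    have c1 : 0 ≤ fph m x := Real.sqrt_nonneg _
    have d1 : fph m x ≤ 9 * X ^ 2 := by
      obtain ⟨⟨hx1, hx2⟩, -⟩ := hx
      have hx3 : x ^ 2 ≤ 9 * X ^ 2 := by nlinarith
      refine le_trans ?_ hx3
      apply Real.sqrt_le_iff.2; constructor; positivity; nlinarith [sq_nonneg (m:ℝ)]
    simp only [Set.mem_iUnion]
    refine ⟨⌊fph m x⌋₊, ?_, hx, ?_⟩
    · rw [Finset.mem_range, Nat.lt_succ_iff]; exact Nat.floor_le_floor d1
    · exact (Int.natCast_floor_eq_floor c1).symm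
  have hpiece : ∀ j : ℕ, volume {x ∈ badset X h m | ⌊fph m x⌋ = (j:ℤ)}
      ≤ ENNReal.ofReal (h / (2 * X)) := by
    intro j
    refine (Real.volume_le_diam _).trans ?_
    refine Metric.ediam_le_of_forall_dist_le ?_
    have key : ∀ x ∈ {x ∈ badset X h m | ⌊fph m x⌋ = (j:ℤ)},
      ∀ y ∈ {x ∈ badset X h m | ⌊fph m x⌋ = (j:ℤ)}, x ≤ y → y - x ≤ h / (2 * X) := by
      rintro x ⟨⟨⟨hx1, hx2⟩, hx3, hx4⟩, hx5⟩ y ⟨⟨⟨hy1, hy2⟩, hy3, hy4⟩, hy5⟩ hxy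
      have := fph_diff m (by linarith) hxy hx3
      have ex : fph m x = j + Int.fract (fph m x) := by
        have := Int.floor_add_fract (fph m x); rw [hx5] at this; simpa using this.symm
      have ey : fph m y = j + Int.fract (fph m y) := by
        have := Int.floor_add_fract (fph m y); rw [hy5] at this; simpa using this.symm
      have := Int.fract_lt_one (fph m y)
      rw [le_div_iff₀ (by linarith)]
      nlinarith
    intro x hx y hy
    rw [Real.dist_eq]
    rcases le_total x y with hxy | hxy
    · rw [abs_sub_comm, abs_of_nonneg (by linarith)]; exact key x hx y hy hxy
    · rw [abs_of_nonneg (by linarith)]; exact key y hy x hx hxy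
  calc volume (badset X h m) ≤ _ := measure_mono hsub
    _ ≤ ∑ j ∈ Finset.range (J + 1), volume {x ∈ badset X h m | ⌊fph m x⌋ = (j:ℤ)} :=
      measure_biUnion_finset_le _ _
    _ ≤ ∑ j ∈ Finset.range (J + 1), ENNReal.ofReal (h / (2 * X)) :=
      Finset.sum_le_sum fun j _ => hpiece j
    _ = ENNReal.ofReal ((J + 1) * (h / (2 * X))) := by
      rw [Finset.sum_const, Finset.card_range, nsmul_eq_mul, ENNReal.ofReal_mul (by positivity)]
      congr 1
      rw [← Nat.cast_succ, ENNReal.ofReal_natCast]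
    _ ≤ _ := by
      apply ENNReal.ofReal_le_ofReal
      have : (J:ℝ) ≤ 9 * X ^ 2 := Nat.floor_le (by positivity)
      rw [mul_div_assoc', div_le_iff₀ (by linarith)]
      nlinarith [mul_pos h0 (by linarith : 0 < X)]

/-- The sawtooth sum. -/
def Dsum (T : ℕ) (x : ℝ) : ℝ :=
  ∑ m ∈ Finset.range (T + 1), (r2 m : ℝ) * (ind m x * sawtooth (fph m x))

lemma Dsum_meas (T : ℕ) : Measurable (Dsum T) := by
  unfold Dsum
  refine Finset.measurable_sum _ fun m _ => ?_
  exact ((ind_meas m).mul (sawtooth_meas.comp (fph_cont m).measurable)).const_mul _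

lemma badind_int (X h : ℝ) (hX : 1 ≤ X) (h0 : 0 < h) (m : ℕ) :
    ∫ x in X..(3 * X), (badset X h m).indicator (fun _ => (1:ℝ)) x ≤ 5 * h * X := by
  rw [intervalIntegral.integral_of_le (by linarith)]
  have e : (badset X h m).indicator (fun _ => (1:ℝ)) = (badset X h m).indicator 1 := rfl
  rw [e, integral_indicator_one (badset_meas X h m)]
  refine ENNReal.toReal_le_of_le_ofReal (by positivity) ?_
  exact (Measure.restrict_apply_le _ _).trans (badset_vol X h hX h0 m)

lemma Derr_mean (X : ℝ) (hX : 1 ≤ X) (T : ℕ) (hT : 1 ≤ T) (hTX : (T:ℝ) ≤ 9 * X ^ 2)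
    (h : ℝ) (h0 : 0 < h) (h1 : h < 1) :
    IntervalIntegrable (fun x => (∑ m ∈ Finset.range (T + 1), (r2 m : ℝ) *
      (ind m x * (psih h (fph m x) - sawtooth (fph m x)))) ^ 2) volume X (3 * X) ∧
    ∫ x in X..(3 * X), (∑ m ∈ Finset.range (T + 1), (r2 m : ℝ) *
      (ind m x * (psih h (fph m x) - sawtooth (fph m x)))) ^ 2
      ≤ 10 ^ 5 * X ^ 5 * h := by
  set M := ∑ m ∈ Finset.range (T + 1), (r2 m : ℝ) with hM
  have hM0 : 0 ≤ M := Finset.sum_nonneg fun m _ => by positivity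
  have hMX : M ≤ 81 * X ^ 2 := (sum_r2_le T hT).trans (by linarith)
  have hpt : ∀ x ∈ Set.Ioc X (3 * X), (∑ m ∈ Finset.range (T + 1), (r2 m : ℝ) *
      (ind m x * (psih h (fph m x) - sawtooth (fph m x)))) ^ 2
      ≤ M * ∑ m ∈ Finset.range (T + 1), (r2 m : ℝ) * (h ^ 2 / 4 +
        (badset X h m).indicator (fun _ => (1:ℝ)) x) := by
    intro x hx
    have := Finset.sum_sq_le_sum_mul_sum_of_sq_le_mul (Finset.range (T + 1))
      (r := fun m => (r2 m : ℝ) * (ind m x * (psih h (fph m x) - sawtooth (fph m x))))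
      (f := fun m => (r2 m : ℝ))
      (g := fun m => (r2 m : ℝ) * (ind m x * (psih h (fph m x) - sawtooth (fph m x))) ^ 2)
      (fun _ _ => by positivity) (fun _ _ => by positivity) (fun _ _ => le_of_eq (by ring))
    refine this.trans (mul_le_mul_of_nonneg_left ?_ hM0)
    refine Finset.sum_le_sum fun m _ => mul_le_mul_of_nonneg_left ?_ (by positivity)
    unfold ind
    split_ifs with hm
    · rw [one_mul]
      refine (psih_err h _ h0 h1).trans (add_le_add le_rfl ?_)
      split_ifs with hf
      · rw [Set.indicator_of_mem]; exact ⟨hx, hm, hf⟩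
      · exact Set.indicator_nonneg (fun _ _ => by norm_num) _
    · rw [zero_mul, zero_pow two_ne_zero]
      have : 0 ≤ (badset X h m).indicator (fun _ => (1:ℝ)) x :=
        Set.indicator_nonneg (fun _ _ => by norm_num) _
      positivity
  have hbi : ∀ m, IntervalIntegrable ((badset X h m).indicator (fun _ => (1:ℝ))) volume X (3 * X) :=
    fun m => ii_of_bdd (measurable_const.indicator (badset_meas X h m)) 1 _ _ fun x => by
      by_cases hx : x ∈ badset X h m <;> simp [hx]
  have hmi : ∀ m, IntervalIntegrable (fun x => (r2 m : ℝ) * (h ^ 2 / 4 +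
        (badset X h m).indicator (fun _ => (1:ℝ)) x)) volume X (3 * X) := fun m =>
    ((intervalIntegrable_const).add (hbi m)).const_mul _
  have hsi : IntervalIntegrable (fun x => ∑ m ∈ Finset.range (T + 1), (r2 m : ℝ) * (h ^ 2 / 4 +
        (badset X h m).indicator (fun _ => (1:ℝ)) x)) volume X (3 * X) := by
    have := IntervalIntegrable.sum (μ := volume) (a := X) (b := 3 * X) (Finset.range (T + 1))
        (f := fun m x => (r2 m : ℝ) * (h ^ 2 / 4 +
        (badset X h m).indicator (fun _ => (1:ℝ)) x)) (fun n _ => hmi n)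
    have e2 : (fun x => ∑ m ∈ Finset.range (T + 1), (r2 m : ℝ) * (h ^ 2 / 4 +
        (badset X h m).indicator (fun _ => (1:ℝ)) x))
        = ∑ m ∈ Finset.range (T + 1), fun x => (r2 m : ℝ) * (h ^ 2 / 4 +
        (badset X h m).indicator (fun _ => (1:ℝ)) x) := by
      funext x; simp [Finset.sum_apply]
    rw [e2]; exact this
  have hlm : Measurable (fun x => (∑ m ∈ Finset.range (T + 1), (r2 m : ℝ) *
      (ind m x * (psih h (fph m x) - sawtooth (fph m x)))) ^ 2) := by
    refine (Finset.measurable_sum _ fun m _ => ?_).pow_const 2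
    exact ((ind_meas m).mul (((psih_meas h).comp (fph_cont m).measurable).sub
      (sawtooth_meas.comp (fph_cont m).measurable))).const_mul _
  have hX3 : X ≤ 3 * X := by linarith
  have hli : IntervalIntegrable (fun x => (∑ m ∈ Finset.range (T + 1), (r2 m : ℝ) *
      (ind m x * (psih h (fph m x) - sawtooth (fph m x)))) ^ 2) volume X (3 * X) := by
    refine (hsi.const_mul M).mono_fun' hlm.aestronglyMeasurable ?_
    rw [Set.uIoc_of_le hX3]
    filter_upwards [ae_restrict_mem measurableSet_Ioc] with x hx
    rw [Real.norm_of_nonneg (by positivity)]; exact hpt x hx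
  refine ⟨hli, ?_⟩
  calc _ ≤ ∫ x in X..(3 * X), M * ∑ m ∈ Finset.range (T + 1), (r2 m : ℝ) * (h ^ 2 / 4 +
        (badset X h m).indicator (fun _ => (1:ℝ)) x) := by
        rw [intervalIntegral.integral_of_le hX3, intervalIntegral.integral_of_le hX3]
        refine setIntegral_mono_on ?_ ?_ measurableSet_Ioc hpt
        · exact (intervalIntegrable_iff_integrableOn_Ioc_of_le hX3).1 hli
        · exact (intervalIntegrable_iff_integrableOn_Ioc_of_le hX3).1 (hsi.const_mul M)
    _ = M * ∑ m ∈ Finset.range (T + 1), (r2 m : ℝ) * (h ^ 2 / 4 * (2 * X) +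
        ∫ x in X..(3 * X), (badset X h m).indicator (fun _ => (1:ℝ)) x) := by
        rw [intervalIntegral.integral_const_mul, intervalIntegral.integral_finsetSum
          (fun n _ => hmi n)]
        congr 1
        refine Finset.sum_congr rfl fun m _ => ?_
        rw [intervalIntegral.integral_const_mul, intervalIntegral.integral_add
          intervalIntegrable_const (hbi m), intervalIntegral.integral_const]
        simp only [smul_eq_mul]; ring
    _ ≤ M * ∑ m ∈ Finset.range (T + 1), (r2 m : ℝ) * (6 * h * X) := by
        refine mul_le_mul_of_nonneg_left ?_ hM0
        refine Finset.sum_le_sum fun m _ => mul_le_mul_of_nonneg_left ?_ (by positivity)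
        have := badind_int X h hX h0 m
        have h2 : h ^ 2 ≤ h := by nlinarith
        nlinarith
    _ = M * M * (6 * h * X) := by rw [← Finset.sum_mul]; ring
    _ ≤ (81 * X ^ 2) * (81 * X ^ 2) * (6 * h * X) := by gcongr
    _ ≤ _ := by
        have : 0 < X ^ 5 * h := by positivity
        nlinarith

lemma Dsum_mean : ∃ C : ℝ, 0 < C ∧ ∀ X : ℝ, 1 ≤ X → ∀ T : ℕ, 1 ≤ T → (T:ℝ) ≤ 9 * X ^ 2 →
    ∫ x in X..(3 * X), Dsum T x ^ 2 ≤ C * (X ^ 4 * X ^ ((1:ℝ) / 2)) := by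
  refine ⟨10 ^ 13, by positivity, fun X hX T hT hTX => ?_⟩
  have hX0 : 0 < X := by linarith
  set q := X ^ ((1:ℝ) / 2) with hq
  have hq1 : 1 ≤ q := Real.one_le_rpow hX (by norm_num)
  have hq2 : q ^ 2 = X := by
    rw [hq, ← Real.rpow_natCast, ← Real.rpow_mul hX0.le]; norm_num
  set h := 1 / (2 * q) with hh
  have h0 : 0 < h := by positivity
  have h1 : h < 1 := by rw [hh, div_lt_one (by positivity)]; linarith
  obtain ⟨hei, he⟩ := Derr_mean X hX T hT hTX h h0 h1
  have hF := Fh_mean X hX T hT hTX h h0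
  have hX3 : X ≤ 3 * X := by linarith
  have hT1 : (1:ℝ) ≤ T := by exact_mod_cast hT
  have hlog : (1 + Real.log T) ^ 3 ≤ 15625 * q := by
    have hl0 : 0 ≤ Real.log T := Real.log_nonneg hT1
    have h2 : Real.log T ≤ 24 * X ^ ((1:ℝ) / 6) := by
      refine (Real.log_le_rpow_div (by positivity) (by norm_num : (0:ℝ) < 1 / 12)).trans ?_
      have h3 : (T:ℝ) ^ ((1:ℝ) / 12) ≤ (9 * X ^ 2) ^ ((1:ℝ) / 12) :=
        Real.rpow_le_rpow (by positivity) hTX (by norm_num)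
      rw [Real.mul_rpow (by norm_num) (by positivity), ← Real.rpow_natCast X 2,
        ← Real.rpow_mul hX0.le] at h3
      have h4 : (9:ℝ) ^ ((1:ℝ) / 12) ≤ 2 := by
        have : (9:ℝ) ^ ((1:ℝ) / 12) ≤ (2 ^ (12:ℝ)) ^ ((1:ℝ) / 12) :=
          Real.rpow_le_rpow (by norm_num) (by norm_num) (by norm_num)
        rw [← Real.rpow_mul (by norm_num)] at this
        norm_num at this ⊢; linarith
      have h5 : X ^ (((2:ℕ):ℝ) * (1 / 12)) = X ^ ((1:ℝ) / 6) := by norm_num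
      rw [h5] at h3
      have h6 : 0 ≤ X ^ ((1:ℝ) / 6) := by positivity
      have : (T:ℝ) ^ ((1:ℝ) / 12) ≤ 2 * X ^ ((1:ℝ) / 6) :=
        h3.trans (mul_le_mul_of_nonneg_right h4 h6)
      rw [div_le_iff₀ (by norm_num)]
      linarith
    have h7 : 1 ≤ X ^ ((1:ℝ) / 6) := Real.one_le_rpow hX (by norm_num)
    have h8 : (X ^ ((1:ℝ) / 6)) ^ 3 = q := by
      rw [hq, ← Real.rpow_natCast, ← Real.rpow_mul hX0.le]; norm_num
    calc (1 + Real.log T) ^ 3 ≤ (25 * X ^ ((1:ℝ) / 6)) ^ 3 := by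
          apply pow_le_pow_left₀ (by linarith); linarith
      _ = _ := by rw [mul_pow, h8]; norm_num
  have hFm : Measurable (fun x => (∑ m ∈ Finset.range (T + 1), (r2 m : ℝ) *
      (ind m x * psih h (fph m x)))) := by
    refine (Finset.measurable_sum _ fun m _ => ?_)
    exact ((ind_meas m).mul ((psih_meas h).comp (fph_cont m).measurable)).const_mul _
  set F := (fun x => (∑ m ∈ Finset.range (T + 1), (r2 m : ℝ) *
      (ind m x * psih h (fph m x)))) with hFdef
  set G := (fun x => (∑ m ∈ Finset.range (T + 1), (r2 m : ℝ) *
      (ind m x * (psih h (fph m x) - sawtooth (fph m x))))) with hGdef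
  have hD : ∀ x, Dsum T x = F x - G x := by
    intro x
    simp only [hFdef, hGdef, Dsum]
    rw [← Finset.sum_sub_distrib]
    refine Finset.sum_congr rfl fun m _ => ?_
    ring
  have hDb : ∀ x, |Dsum T x| ≤ ∑ m ∈ Finset.range (T + 1), (r2 m : ℝ) := by
    intro x
    unfold Dsum
    refine (Finset.abs_sum_le_sum_abs _ _).trans (Finset.sum_le_sum fun m _ => ?_)
    rw [abs_mul, abs_mul, abs_of_nonneg (by positivity : (0:ℝ) ≤ r2 m),
              abs_of_nonneg (ind_nonneg m x)]
    refine mul_le_of_le_one_right (by positivity) (mul_le_one₀ (ind_le_one m x) (abs_nonneg _) ?_)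
    unfold sawtooth
    have := Int.fract_lt_one (fph m x)
    have := Int.fract_nonneg (fph m x)
    rw [Int.self_sub_floor, abs_le]; constructor <;> linarith
  have hDi : IntervalIntegrable (fun x => Dsum T x ^ 2) volume X (3 * X) := by
    refine ii_of_bdd ((Dsum_meas T).pow_const 2) ((∑ m ∈ Finset.range (T + 1), (r2 m : ℝ)) ^ 2) _ _
      fun x => ?_
    rw [abs_pow]
    exact pow_le_pow_left₀ (abs_nonneg _) (hDb x) 2
  have hFi : IntervalIntegrable (fun x => F x ^ 2) volume X (3 * X) := by
    have : IntervalIntegrable (fun x => 2 * Dsum T x ^ 2 + 2 * G x ^ 2) volume X (3 * X) :=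
      (hDi.const_mul 2).add (hei.const_mul 2)
    refine this.mono_fun' (hFm.pow_const 2).aestronglyMeasurable (Eventually.of_forall fun x => ?_)
    simp only []
    rw [Real.norm_of_nonneg (by positivity)]
    have : F x = Dsum T x + G x := by rw [hD]; ring
    rw [this]
    nlinarith [sq_nonneg (Dsum T x - G x)]
  calc ∫ x in X..(3 * X), Dsum T x ^ 2 ≤ ∫ x in X..(3 * X), (2 * F x ^ 2 + 2 * G x ^ 2) := by
        refine intervalIntegral.integral_mono_on hX3 hDi
          ((hFi.const_mul 2).add (hei.const_mul 2)) fun x _ => ?_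
        rw [hD]; nlinarith [sq_nonneg (F x + G x)]
    _ = 2 * (∫ x in X..(3 * X), F x ^ 2) + 2 * ∫ x in X..(3 * X), G x ^ 2 := by
        rw [intervalIntegral.integral_add (hFi.const_mul 2) (hei.const_mul 2),
          intervalIntegral.integral_const_mul, intervalIntegral.integral_const_mul]
    _ ≤ 2 * ((1 / h ^ 2) * (10 ^ 7 * X ^ 3 * (1 + Real.log T) ^ 3)) + 2 * (10 ^ 5 * X ^ 5 * h) := by
        linarith
    _ ≤ 2 * ((1 / h ^ 2) * (10 ^ 7 * X ^ 3 * (15625 * q))) + 2 * (10 ^ 5 * X ^ 5 * h) := by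
        gcongr
    _ = 2 * (4 * 10 ^ 7 * 15625) * (X ^ 4 * q) + 10 ^ 5 * (X ^ 4 * q) := by
        have e1 : 1 / h ^ 2 = 4 * X := by
          rw [hh, ← hq2]; field_simp; norm_num
        have e2 : X * h = q / 2 := by
          rw [hh, ← hq2]; field_simp
        have e3 : 10 ^ 5 * X ^ 5 * h = 10 ^ 5 * X ^ 4 * (X * h) := by ring
        rw [e1, e3, e2]; ring
    _ ≤ _ := by
        have : 0 < X ^ 4 * q := by positivity
        nlinarith

/-- Main term sum. -/
def MainS (T : ℕ) (x : ℝ) : ℝ := ∑ m ∈ Finset.range (T + 1), (r2 m : ℝ) * (2 * fph m x)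

lemma mem_ball_iff (u : ℝ × ℝ × ℝ) :
    u ∈ cyganBall ↔ (u.1 ^ 2 + u.2.1 ^ 2) ^ 2 + u.2.2 ^ 2 ≤ 1 := by
  have h0 : 0 ≤ (u.1 ^ 2 + u.2.1 ^ 2) ^ 2 + u.2.2 ^ 2 := by positivity
  change cyganNorm u ≤ 1 ↔ _
  unfold cyganNorm
  have h1 := Real.rpow_le_rpow_iff h0 (by norm_num : (0:ℝ) ≤ 1) (by norm_num : (0:ℝ) < 1 / 4)
  rwa [Real.one_rpow] at h1

lemma mem_dil_iff (x : ℝ) (hx : 0 < x) (p : ℝ × ℝ × ℝ) :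
    p ∈ heisDil x '' cyganBall ↔ (p.1 ^ 2 + p.2.1 ^ 2) ^ 2 + p.2.2 ^ 2 ≤ x ^ 4 := by
  obtain ⟨a, b, c⟩ := p
  constructor
  · rintro ⟨⟨u, v, w⟩, hu, he⟩
    rw [mem_ball_iff] at hu
    simp only [heisDil, Prod.mk.injEq] at he hu ⊢
    obtain ⟨rfl, rfl, rfl⟩ := he
    calc _ = x ^ 4 * ((u ^ 2 + v ^ 2) ^ 2 + w ^ 2) := by ring
      _ ≤ x ^ 4 * 1 := by gcongr
      _ = x ^ 4 := by ring
  · intro h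
    refine ⟨(a / x, b / x, c / x ^ 2), ?_, ?_⟩
    · rw [mem_ball_iff]
      simp only at h ⊢
      have : ((a / x) ^ 2 + (b / x) ^ 2) ^ 2 + (c / x ^ 2) ^ 2
          = ((a ^ 2 + b ^ 2) ^ 2 + c ^ 2) / x ^ 4 := by field_simp
      rw [this, div_le_one (by positivity)]; exact h
    · simp only [heisDil, Prod.mk.injEq]
      refine ⟨?_, ?_, ?_⟩ <;> field_simp

lemma count_aux (x : ℝ) (m : ℕ) (hm : (m:ℝ) ≤ x ^ 2) (z : ℤ) :
    z ∈ Finset.Icc (-⌊fph m x⌋) ⌊fph m x⌋ ↔ (m:ℝ) ^ 2 + (z:ℝ) ^ 2 ≤ x ^ 4 := by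
  have hm0 : (0:ℝ) ≤ m := by positivity
  have a1 : 0 ≤ x ^ 4 - (m:ℝ) ^ 2 := by nlinarith
  rw [Finset.mem_Icc, neg_le, Int.le_floor, Int.le_floor]
  have h1 : (m:ℝ) ^ 2 + (z:ℝ) ^ 2 ≤ x ^ 4 ↔ |(z:ℝ)| ≤ fph m x := by
    unfold fph
    rw [Real.le_sqrt (abs_nonneg _) a1, sq_abs]
    constructor <;> intro <;> linarith
  rw [h1, abs_le]
  push_cast
  constructor
  · rintro ⟨h, h'⟩; exact ⟨by linarith, h'⟩
  · rintro ⟨h, h'⟩; exact ⟨by linarith, h'⟩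

lemma latticeCount_eq (x : ℝ) (hx : 0 < x) (T : ℕ) (hT : x ^ 2 < T + 1) :
    (latticeCount x : ℝ) = MainS T x - 2 * Dsum T x := by
  classical
  set S : Finset ((_ : ℤ × ℤ) × ℤ) := (disc T).sigma (fun p =>
    if (((p.1 ^ 2 + p.2 ^ 2).toNat : ℕ) : ℝ) ≤ x ^ 2 then
      Finset.Icc (-⌊fph (p.1 ^ 2 + p.2 ^ 2).toNat x⌋) ⌊fph (p.1 ^ 2 + p.2 ^ 2).toNat x⌋ else ∅) with hS
  have hcast : ∀ a b : ℤ, (((a ^ 2 + b ^ 2).toNat : ℕ) : ℝ) = (a:ℝ) ^ 2 + (b:ℝ) ^ 2 := by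
    intro a b
    have : (((a ^ 2 + b ^ 2).toNat : ℕ) : ℤ) = a ^ 2 + b ^ 2 := Int.toNat_of_nonneg (by positivity)
    have h2 : (((a ^ 2 + b ^ 2).toNat : ℤ) : ℝ) = ((a ^ 2 + b ^ 2 : ℤ) : ℝ) := by rw [this]
    push_cast at h2
    exact_mod_cast h2
  have e1 : {p : ℤ × ℤ × ℤ | ((p.1 : ℝ), (p.2.1 : ℝ), (p.2.2 : ℝ)) ∈ heisDil x '' cyganBall}
      = (fun s : (_ : ℤ × ℤ) × ℤ => (s.1.1, s.1.2, s.2)) '' (S : Set ((_ : ℤ × ℤ) × ℤ)) := by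
    ext ⟨a, b, c⟩
    have hm : ((a, b, c) : ℤ × ℤ × ℤ) ∈ {p : ℤ × ℤ × ℤ | ((p.1 : ℝ), (p.2.1 : ℝ), (p.2.2 : ℝ)) ∈
        heisDil x '' cyganBall} ↔ ((a:ℝ), (b:ℝ), (c:ℝ)) ∈ heisDil x '' cyganBall := Iff.rfl
    rw [hm, mem_dil_iff x hx]
    simp only [Set.mem_image, Finset.mem_coe]
    constructor
    · intro h
      have h1 : (a:ℝ) ^ 2 + (b:ℝ) ^ 2 ≤ x ^ 2 := by
        have : ((a:ℝ) ^ 2 + (b:ℝ) ^ 2) ^ 2 ≤ (x ^ 2) ^ 2 := by nlinarith [sq_nonneg (c:ℝ)]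
        exact (pow_le_pow_iff_left₀ (by positivity) (by positivity) two_ne_zero).1 this
      refine ⟨⟨(a, b), c⟩, ?_, rfl⟩
      rw [hS, Finset.mem_sigma]
      refine ⟨?_, ?_⟩
      · rw [mem_disc]
        have : ((a ^ 2 + b ^ 2 : ℤ) : ℝ) < ((T + 1 : ℤ) : ℝ) := by push_cast; linarith
        have := Int.cast_lt.1 this
        simp only; omega
      · simp only
        have h2 : (((a ^ 2 + b ^ 2).toNat : ℕ) : ℝ) ≤ x ^ 2 := by rw [hcast]; exact h1
        rw [if_pos h2, count_aux x _ h2, hcast]; exact h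
    · rintro ⟨⟨⟨a', b'⟩, c'⟩, hs, he⟩
      simp only [Prod.mk.injEq] at he
      obtain ⟨rfl, rfl, rfl⟩ := he
      rw [hS, Finset.mem_sigma] at hs
      have h2 := hs.2
      simp only at h2
      split_ifs at h2 with h3
      · rw [count_aux x _ h3, hcast] at h2; exact h2
      · simp at h2
  have e2 : latticeCount x = S.card := by
    unfold latticeCount
    rw [e1, Set.ncard_image_of_injective, Set.ncard_coe_finset]
    rintro ⟨⟨a, b⟩, c⟩ ⟨⟨a', b'⟩, c'⟩ h
    simp only [Prod.mk.injEq] at h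
    obtain ⟨rfl, rfl, rfl⟩ := h
    rfl
  rw [e2, hS, Finset.card_sigma]
  push_cast
  have e3 : ∀ m : ℕ, (2 * fph m x - 2 * (ind m x * sawtooth (fph m x)))
      = ((if (m:ℝ) ≤ x ^ 2 then Finset.Icc (-⌊fph m x⌋) ⌊fph m x⌋ else ∅).card : ℝ) := by
    intro m
    unfold ind
    have c1 : 0 ≤ fph m x := Real.sqrt_nonneg _
    split_ifs with h
    · rw [Int.card_Icc]
      have h0 : 0 ≤ ⌊fph m x⌋ := Int.floor_nonneg.2 c1
      have : ((⌊fph m x⌋ + 1 - -⌊fph m x⌋).toNat : ℤ) = ⌊fph m x⌋ + 1 - -⌊fph m x⌋ :=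
        Int.toNat_of_nonneg (by omega)
      have h2 : (((⌊fph m x⌋ + 1 - -⌊fph m x⌋).toNat : ℤ) : ℝ)
        = ((⌊fph m x⌋ + 1 - -⌊fph m x⌋ : ℤ) : ℝ) := by rw [this]
      rw [Int.cast_natCast] at h2
      rw [h2]; unfold sawtooth; push_cast; ring
    · have : fph m x = 0 := by
        unfold fph
        apply Real.sqrt_eq_zero_of_nonpos
        nlinarith [sq_nonneg x]
      rw [this]; simp
  have e4 := sum_r2_eq_sum_disc T (fun m => (2 * fph m x - 2 * (ind m x * sawtooth (fph m x))))
  unfold MainS Dsum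
  rw [Finset.mul_sum, ← Finset.sum_sub_distrib]
  have e5 : ∑ m ∈ Finset.range (T + 1), ((r2 m : ℝ) * (2 * fph m x) - 2 * ((r2 m : ℝ) *
      (ind m x * sawtooth (fph m x)))) = ∑ m ∈ Finset.range (T + 1), (r2 m : ℝ) *
      (2 * fph m x - 2 * (ind m x * sawtooth (fph m x))) :=
    Finset.sum_congr rfl fun m _ => by ring
  rw [e5, e4]
  refine Finset.sum_congr rfl fun p _ => ?_
  rw [e3]

open scoped FourierTransform

lemma poisson1 (f : ℝ → ℂ) (hc : Continuous f) (M : ℝ) (hM : ∀ x, M < |x| → f x = 0)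
    (hs : Summable fun n : ℤ => 𝓕 f (n:ℝ)) : ∑' n : ℤ, f n = ∑' n : ℤ, 𝓕 f (n:ℝ) := by
  have hO : f =O[cocompact ℝ] (fun x : ℝ => |x| ^ (-(2:ℝ))) := by
    refine (Asymptotics.isBigO_zero _ _).congr' ?_ EventuallyEq.rfl
    have : (Metric.closedBall (0:ℝ) M)ᶜ ∈ cocompact ℝ :=
      (isCompact_closedBall (0:ℝ) M).compl_mem_cocompact
    filter_upwards [this] with x hx
    rw [hM x]
    · simp only [Set.mem_compl_iff, Metric.mem_closedBall, dist_zero_right, Real.norm_eq_abs,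
        not_le] at hx
      exact hx
  have := Real.tsum_eq_tsum_fourier_of_rpow_decay_of_summable hc (b := 2) (by norm_num) hO hs 0
  simpa using this

lemma int_supp (f : ℝ → ℂ) (M : ℝ) (hM : ∀ x, M < |x| → f x = 0) :
    ∫ x, f x = ∫ x in Set.Icc (-M) M, f x := by
  symm
  apply setIntegral_eq_integral_of_forall_compl_eq_zero
  intro x hx
  apply hM
  by_contra h
  push Not at h
  exact hx (abs_le.1 h)

lemma tsum_supp (f : ℝ → ℂ) (M : ℕ) (hM : ∀ x, (M:ℝ) < |x| → f x = 0) :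
    ∑' n : ℤ, f n = ∑ n ∈ Finset.Icc (-(M:ℤ)) M, f n := by
  refine tsum_eq_sum fun n hn => hM _ ?_
  rw [Finset.mem_Icc, ← abs_le, not_le] at hn
  exact_mod_cast hn

lemma poisson2 (G : ℝ → ℝ → ℂ) (hc : Continuous (Function.uncurry G)) (M : ℕ)
    (hM : ∀ a b, ((M:ℝ) < |a| ∨ (M:ℝ) < |b|) → G a b = 0)
    (hs : Summable fun p : ℤ × ℤ => 𝓕 (fun a => 𝓕 (fun b => G a b) (p.2:ℝ)) (p.1:ℝ)) :
    ∑ a ∈ Finset.Icc (-(M:ℤ)) M, ∑ b ∈ Finset.Icc (-(M:ℤ)) M, G a b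
      = ∑' p : ℤ × ℤ, 𝓕 (fun a => 𝓕 (fun b => G a b) (p.2:ℝ)) (p.1:ℝ) := by
  have hs' : Summable fun p : ℤ × ℤ => 𝓕 (fun a => 𝓕 (fun b => G a b) (p.1:ℝ)) (p.2:ℝ) :=
    hs.prod_symm
  have hGb : ∀ a, Continuous (G a) := fun a =>
    hc.comp (f := fun b => (a, b)) (by fun_prop)
  have hGb' : ∀ b, Continuous (fun a => G a b) := fun b =>
    hc.comp (f := fun a => (a, b)) (by fun_prop)
  have hIntg : ∀ a l, Integrable (fun b => 𝐞 (-(b * l)) • G a b) := by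
    intro a l
    have hcont : Continuous (fun b => 𝐞 (-(b * l)) • G a b) := by
      have := hGb a
      fun_prop
    refine hcont.integrable_of_hasCompactSupport ?_
    refine HasCompactSupport.intro (isCompact_Icc (a := -(M:ℝ)) (b := M)) fun b hb => ?_
    rw [hM a b, smul_zero]
    right
    by_contra h; push Not at h; exact hb (abs_le.1 h)
  have hg0 : ∀ l a, (M:ℝ) < |a| → 𝓕 (fun b => G a b) l = 0 := by
    intro l a ha
    have : (fun b => G a b) = fun _ => 0 := by funext b; exact hM a b (Or.inl ha)
    rw [this, Real.fourier_real_eq]; simp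
  have hgc : ∀ l : ℝ, Continuous (fun a => 𝓕 (fun b => G a b) l) := by
    intro l
    have e : (fun a => 𝓕 (fun b => G a b) l)
        = fun a => ∫ b in Set.Icc (-(M:ℝ)) M, 𝐞 (-(b * l)) • G a b := by
      funext a
      rw [Real.fourier_real_eq]
      apply int_supp
      intro x hx
      rw [hM a x (Or.inr hx), smul_zero]
    rw [e]
    refine continuous_parametric_integral_of_continuous ?_ isCompact_Icc
    have : Continuous (fun p : ℝ × ℝ => 𝐞 (-(p.2 * l)) • G p.1 p.2) := by
      have h1 : Continuous (fun p : ℝ × ℝ => G p.1 p.2) := hc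
      fun_prop
    exact this
  have h1 : ∀ l : ℤ, ∑ a ∈ Finset.Icc (-(M:ℤ)) M, 𝓕 (fun b => G a b) (l:ℝ)
      = ∑' k : ℤ, 𝓕 (fun a => 𝓕 (fun b => G a b) (l:ℝ)) (k:ℝ) := by
    intro l
    rw [← poisson1 _ (hgc l) M (hg0 l) (hs'.prod_factor l)]
    exact (tsum_supp _ M (hg0 l)).symm
  set S : ℝ → ℂ := fun b => ∑ a ∈ Finset.Icc (-(M:ℤ)) M, G a b with hS
  have hSF : ∀ l : ℝ, 𝓕 S l = ∑ a ∈ Finset.Icc (-(M:ℤ)) M, 𝓕 (fun b => G a b) l := by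
    intro l
    simp only [Real.fourier_real_eq, hS, Finset.smul_sum]
    rw [integral_finsetSum]
    intro a _; exact hIntg a l
  have hSs : ∀ x, (M:ℝ) < |x| → S x = 0 := fun x hx =>
    Finset.sum_eq_zero fun a _ => hM _ _ (Or.inr hx)
  have hSc : Continuous S := by
    refine continuous_finsetSum _ fun a _ => hGb a
  have hSsum : Summable fun l : ℤ => 𝓕 S (l:ℝ) := by
    simp_rw [hSF, h1]
    exact hs'.prod
  have := poisson1 S hSc M hSs hSsum
  rw [tsum_supp S M hSs] at this
  simp_rw [hSF, h1] at this
  rw [Finset.sum_comm]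
  rw [this, ← hs'.tsum_prod]
  exact (Equiv.prodComm ℤ ℤ).tsum_eq
    (fun p : ℤ × ℤ => 𝓕 (fun a => 𝓕 (fun b => G a b) (p.2:ℝ)) (p.1:ℝ))

lemma ibp3 (Q Q1 Q2 Q3 : ℝ → ℝ) (h0 : ∀ y, HasDerivAt Q (Q1 y) y) (h1 : ∀ y, HasDerivAt Q1 (Q2 y) y)
    (h2 : ∀ y, HasDerivAt Q2 (Q3 y) y) (h3 : Continuous Q3) (K d : ℝ)
    (hK2 : ∀ y ∈ Set.Icc (-1:ℝ) 1, |Q2 y| ≤ K) (hK3 : ∀ y ∈ Set.Icc (-1:ℝ) 1, |Q3 y| ≤ K)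
    (q1 : Q 1 = 0) (q2 : Q (-1) = 0) (q3 : Q1 1 = -d) (q4 : Q1 (-1) = d) (t : ℝ) (ht : 0 < t) :
    |(∫ y in (-1:ℝ)..1, Q y * Real.cos (t * y)) + 2 * d * Real.cos t / t ^ 2| ≤ 4 * K / t ^ 3 := by
  have hK0 : 0 ≤ K := (abs_nonneg _).trans (hK2 0 (by norm_num))
  have hd : ∀ y, HasDerivAt (fun y => Q y * Real.sin (t * y) / t + Q1 y * Real.cos (t * y) / t ^ 2
      - Q2 y * Real.sin (t * y) / t ^ 3) (Q y * Real.cos (t * y) - Q3 y * Real.sin (t * y) / t ^ 3) y := by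
    intro y
    have ht1 : HasDerivAt (fun y => t * y) t y := by simpa using (hasDerivAt_id y).const_mul t
    have hs := ht1.sin
    have hc := ht1.cos
    have := ((((h0 y).mul hs).div_const t).add (((h1 y).mul hc).div_const (t ^ 2))).sub
      (((h2 y).mul hs).div_const (t ^ 3))
    refine this.congr_deriv ?_
    field_simp; ring
  have cQ : Continuous Q := continuous_iff_continuousAt.2 fun y => (h0 y).continuousAt
  have i1 : IntervalIntegrable (fun y => Q y * Real.cos (t * y)) volume (-1) 1 :=
    (by fun_prop : Continuous fun y => Q y * Real.cos (t * y)).intervalIntegrable _ _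
  have i2 : IntervalIntegrable (fun y => Q3 y * Real.sin (t * y) / t ^ 3) volume (-1) 1 :=
    (by fun_prop : Continuous fun y => Q3 y * Real.sin (t * y) / t ^ 3).intervalIntegrable _ _
  have e := intervalIntegral.integral_eq_sub_of_hasDerivAt (a := -1) (b := 1)
    (fun y _ => hd y) (i1.sub i2)
  rw [intervalIntegral.integral_sub i1 i2] at e
  simp only [q1, q2, q3, q4, mul_neg, mul_one, Real.sin_neg, Real.cos_neg, zero_mul, zero_div] at e
  have hb : ‖∫ y in (-1:ℝ)..1, Q3 y * Real.sin (t * y) / t ^ 3‖ ≤ (K / t ^ 3) * |1 - (-1)| := by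
    apply intervalIntegral.norm_integral_le_of_norm_le_const
    intro y hy
    rw [Set.uIoc_of_le (by norm_num)] at hy
    rw [norm_div, norm_mul, Real.norm_eq_abs, Real.norm_eq_abs, Real.norm_of_nonneg (by positivity : 0 ≤ t ^ 3)]
    apply div_le_div_of_nonneg_right _ (by positivity)
    exact (mul_le_of_le_one_right (abs_nonneg _) (Real.abs_sin_le_one _)).trans
      (hK3 y ⟨hy.1.le, hy.2⟩)
  have e2 : (∫ y in (-1:ℝ)..1, Q y * Real.cos (t * y)) + 2 * d * Real.cos t / t ^ 2
      = (∫ y in (-1:ℝ)..1, Q3 y * Real.sin (t * y) / t ^ 3) - (Q2 1 + Q2 (-1)) * Real.sin t / t ^ 3 := by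
    have : (∫ y in (-1:ℝ)..1, Q y * Real.cos (t * y)) = (∫ y in (-1:ℝ)..1, Q3 y * Real.sin (t * y) / t ^ 3) + (∫ y in (-1:ℝ)..1, Q y * Real.cos (t * y)) - (∫ y in (-1:ℝ)..1, Q3 y * Real.sin (t * y) / t ^ 3) := by ring
    rw [this, add_sub_assoc, e]
    field_simp
    ring
  rw [e2]
  have hb2 : |(Q2 1 + Q2 (-1)) * Real.sin t / t ^ 3| ≤ 2 * K / t ^ 3 := by
    rw [abs_div, abs_mul, abs_of_nonneg (by positivity : 0 ≤ t ^ 3)]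
    apply div_le_div_of_nonneg_right _ (by positivity)
    refine (mul_le_of_le_one_right (abs_nonneg _) (Real.abs_sin_le_one _)).trans ?_
    have a1 := hK2 1 (by norm_num)
    have a2 := hK2 (-1) (by norm_num)
    exact (abs_add_le _ _).trans (by linarith)
  rw [Real.norm_eq_abs] at hb
  rw [show |(1:ℝ) - (-1)| = 2 by norm_num] at hb
  refine (abs_sub _ _).trans ?_
  have : 4 * K / t ^ 3 = K / t ^ 3 * 2 + 2 * K / t ^ 3 := by ring
  rw [this]; exact add_le_add hb hb2

def gw (w y : ℝ) : ℝ := √((1 + w ^ 2) + (1 - w ^ 2) * y ^ 2)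

lemma gw_arg (w : ℝ) (hw : w ∈ Set.Icc (-1:ℝ) 1) (y : ℝ) : 1 ≤ (1 + w ^ 2) + (1 - w ^ 2) * y ^ 2 := by
  have : w ^ 2 ≤ 1 := by nlinarith [hw.1, hw.2]
  nlinarith [sq_nonneg w, mul_nonneg (sub_nonneg.2 this) (sq_nonneg y)]

lemma gw_ge (w : ℝ) (hw : w ∈ Set.Icc (-1:ℝ) 1) (y : ℝ) : 1 ≤ gw w y := Real.one_le_sqrt.2 (gw_arg w hw y)

lemma gw_deriv (w : ℝ) (hw : w ∈ Set.Icc (-1:ℝ) 1) (y : ℝ) : HasDerivAt (gw w) ((1 - w ^ 2) * y / gw w y) y := by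
  have h1 : HasDerivAt (fun y : ℝ => (1 + w ^ 2) + (1 - w ^ 2) * y ^ 2) ((1 - w ^ 2) * (2 * y)) y := by
    have := ((hasDerivAt_pow 2 y).const_mul (1 - w ^ 2)).const_add (1 + w ^ 2)
    refine this.congr_deriv ?_
    norm_num
  have := h1.sqrt (by linarith [gw_arg w hw y])
  refine this.congr_deriv ?_
  have := gw_ge w hw y
  unfold gw at *
  field_simp

lemma gw_le (w : ℝ) (hw : w ∈ Set.Icc (-1:ℝ) 1) (y : ℝ) (hy : y ∈ Set.Icc (-1:ℝ) 1) :
    gw w y ≤ 2 := by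
  have : w ^ 2 ≤ 1 := by nlinarith [hw.1, hw.2]
  have : y ^ 2 ≤ 1 := by nlinarith [hy.1, hy.2]
  apply Real.sqrt_le_iff.2 ⟨by norm_num, ?_⟩
  nlinarith

lemma gw_sq (w : ℝ) (hw : w ∈ Set.Icc (-1:ℝ) 1) (y : ℝ) :
    gw w y ^ 2 = (1 + w ^ 2) + (1 - w ^ 2) * y ^ 2 :=
  Real.sq_sqrt (by linarith [gw_arg w hw y])

lemma gw_deriv2 (w : ℝ) (hw : w ∈ Set.Icc (-1:ℝ) 1) (y : ℝ) :
    HasDerivAt (fun y => (1 - w ^ 2) * y / gw w y) ((1 + w ^ 2) * (1 - w ^ 2) / gw w y ^ 3) y := by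
  have hg := gw_ge w hw y
  have hg0 : gw w y ≠ 0 := by linarith
  have := ((hasDerivAt_id y).const_mul (1 - w ^ 2)).div (gw_deriv w hw y) hg0
  refine this.congr_deriv ?_
  have := gw_sq w hw y
  simp only [id]
  field_simp
  rw [this]; ring

lemma gw_deriv3 (w : ℝ) (hw : w ∈ Set.Icc (-1:ℝ) 1) (y : ℝ) :
    HasDerivAt (fun y => (1 + w ^ 2) * (1 - w ^ 2) / gw w y ^ 3)
      (-3 * (1 + w ^ 2) * (1 - w ^ 2) ^ 2 * y / gw w y ^ 5) y := by
  have hg := gw_ge w hw y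
  have hg0 : gw w y ≠ 0 := by linarith
  have := (hasDerivAt_const y ((1 + w ^ 2) * (1 - w ^ 2))).div ((gw_deriv w hw y).pow 3)
    (pow_ne_zero 3 hg0)
  refine this.congr_deriv ?_
  simp only [Pi.pow_apply]
  field_simp
  ring

lemma gw_cont : Continuous (Function.uncurry gw) := by
  unfold gw Function.uncurry; fun_prop

lemma Jw_bound (w : ℝ) (hw : w ∈ Set.Icc (-1:ℝ) 1) (t : ℝ) (ht : 0 < t) :
    |(∫ y in (-1:ℝ)..1, (2 * (1 - y ^ 2) * gw w y) * Real.cos (t * y))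
      + 2 * (4 * √2) * Real.cos t / t ^ 2| ≤ 4 * 36 / t ^ 3 := by
  have hg := gw_ge w hw
  have hg0 : ∀ y, gw w y ≠ 0 := fun y => by linarith [hg y]
  have cg : Continuous (gw w) := by unfold gw; fun_prop
  have hw2 : w ^ 2 ≤ 1 := by nlinarith [hw.1, hw.2]
  have hw0 : 0 ≤ w ^ 2 := sq_nonneg w
  have hpoly : ∀ y : ℝ, HasDerivAt (fun y : ℝ => 2 * (1 - y ^ 2)) (-4 * y) y := fun y => by
    refine (((hasDerivAt_pow 2 y).const_sub 1).const_mul 2).congr_deriv ?_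
    norm_num; ring
  have g1 : gw w 1 = √2 := by unfold gw; congr 1; ring
  have gm1 : gw w (-1) = √2 := by unfold gw; congr 1; ring
  set D1 := fun y => (1 - w ^ 2) * y / gw w y with hD1
  set D2 := fun y => (1 + w ^ 2) * (1 - w ^ 2) / gw w y ^ 3 with hD2
  set D3 := fun y => -3 * (1 + w ^ 2) * (1 - w ^ 2) ^ 2 * y / gw w y ^ 5 with hD3
  have b1 : ∀ y ∈ Set.Icc (-1:ℝ) 1, |D1 y| ≤ 1 := by
    intro y hy
    rw [hD1]; simp only
    rw [abs_div, abs_of_pos (by linarith [hg y] : 0 < gw w y), div_le_one (by linarith [hg y]), abs_mul,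
      abs_of_nonneg (by linarith : 0 ≤ 1 - w ^ 2)]
    have : |y| ≤ 1 := abs_le.2 hy
    nlinarith [hg y, abs_nonneg y]
  have b2 : ∀ y ∈ Set.Icc (-1:ℝ) 1, |D2 y| ≤ 1 := by
    intro y hy
    have h3 : 1 ≤ gw w y ^ 3 := one_le_pow₀ (hg y)
    rw [hD2]; simp only
    rw [abs_div, abs_of_pos (by linarith : 0 < gw w y ^ 3), div_le_one (by linarith),
      abs_of_nonneg (by nlinarith)]
    nlinarith
  have b3 : ∀ y ∈ Set.Icc (-1:ℝ) 1, |D3 y| ≤ 6 := by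
    intro y hy
    have h3 : 1 ≤ gw w y ^ 5 := one_le_pow₀ (hg y)
    have hy1 : |y| ≤ 1 := abs_le.2 hy
    rw [hD3]; simp only
    rw [abs_div, abs_of_pos (by linarith : 0 < gw w y ^ 5), div_le_iff₀ (by linarith), abs_mul]
    have : |-3 * (1 + w ^ 2) * (1 - w ^ 2) ^ 2| ≤ 6 := by
      rw [abs_le]; constructor <;> nlinarith [mul_nonneg hw0 (sub_nonneg.2 hw2), sq_nonneg (1 - w ^ 2)]
    nlinarith [abs_nonneg y, abs_nonneg (-3 * (1 + w ^ 2) * (1 - w ^ 2) ^ 2)]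
  have cD3 : Continuous D3 := by
    rw [hD3]
    exact Continuous.div (by fun_prop) (by fun_prop) fun y => pow_ne_zero 5 (hg0 y)
  have cD1 : Continuous D1 := continuous_iff_continuousAt.2 fun y => (gw_deriv2 w hw y).continuousAt
  have cD2 : Continuous D2 := continuous_iff_continuousAt.2 fun y => (gw_deriv3 w hw y).continuousAt
  have hq : ∀ y ∈ Set.Icc (-1:ℝ) 1, 0 ≤ 1 - y ^ 2 ∧ 1 - y ^ 2 ≤ 1 := by
    intro y hy
    constructor <;> nlinarith [hy.1, hy.2]
  refine ibp3 (fun y => 2 * (1 - y ^ 2) * gw w y)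
    (fun y => -4 * y * gw w y + 2 * (1 - y ^ 2) * D1 y)
    (fun y => -4 * gw w y + (-4 * y * D1 y + (-4 * y * D1 y + 2 * (1 - y ^ 2) * D2 y)))
    (fun y => -12 * D1 y + -12 * y * D2 y + 2 * (1 - y ^ 2) * D3 y)
    (fun y => (hpoly y).mul (gw_deriv w hw y)) ?_ ?_ (by fun_prop) 36 (4 * √2) ?_ ?_ (by norm_num)
    (by norm_num) (by rw [g1]; ring) (by rw [gm1]; ring) t ht
  · intro y
    have h4 : HasDerivAt (fun y : ℝ => -4 * y) (-4) y := by
      simpa using (hasDerivAt_id y).const_mul (-4)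
    refine ((h4.mul (gw_deriv w hw y)).add ((hpoly y).mul (gw_deriv2 w hw y))).congr_deriv ?_
    simp only [hD1, hD2]; ring
  · intro y
    have h4 : HasDerivAt (fun y : ℝ => -4 * y) (-4) y := by
      simpa using (hasDerivAt_id y).const_mul (-4)
    refine (((gw_deriv w hw y).const_mul (-4)).add ((h4.mul (gw_deriv2 w hw y)).add
      ((h4.mul (gw_deriv2 w hw y)).add ((hpoly y).mul (gw_deriv3 w hw y))))).congr_deriv ?_
    simp only [hD1, hD2, hD3]; ring
  · intro y hy
    have a1 := abs_le.1 (b1 y hy)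
    have a2 := abs_le.1 (b2 y hy)
    have hy1 : |y| ≤ 1 := abs_le.2 hy
    have hm : |y * D1 y| ≤ 1 := by rw [abs_mul]; exact mul_le_one₀ hy1 (abs_nonneg _) (b1 y hy)
    have hm2 : |(1 - y ^ 2) * D2 y| ≤ 1 := by
      rw [abs_mul, abs_of_nonneg (hq y hy).1]; exact mul_le_one₀ (hq y hy).2 (abs_nonneg _) (b2 y hy)
    have hm' := abs_le.1 hm
    have hm2' := abs_le.1 hm2
    have := gw_le w hw y hy
    have := hg y
    rw [abs_le]; constructor <;> nlinarith
  · intro y hy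
    have a1 := abs_le.1 (b1 y hy)
    have hy1 : |y| ≤ 1 := abs_le.2 hy
    have hm : |y * D2 y| ≤ 1 := by rw [abs_mul]; exact mul_le_one₀ hy1 (abs_nonneg _) (b2 y hy)
    have hm2 : |(1 - y ^ 2) * D3 y| ≤ 1 * 6 := by
      rw [abs_mul, abs_of_nonneg (hq y hy).1]
      exact mul_le_mul (hq y hy).2 (b3 y hy) (abs_nonneg _) (by norm_num)
    have hm' := abs_le.1 hm
    have hm2' := abs_le.1 hm2
    rw [abs_le]; constructor <;> nlinarith

lemma ft_iter (f : ℂ → ℂ) (hf : Integrable f) (k l : ℝ) :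
    𝓕 f (⟨k, l⟩ : ℂ) = 𝓕 (fun a : ℝ => 𝓕 (fun b : ℝ => f ⟨a, b⟩) l) k := by
  have hmp := Complex.volume_preserving_equiv_real_prod.symm
  rw [Real.fourier_eq, ← hmp.integral_comp', Real.fourier_real_eq]
  simp only [Complex.measurableEquivRealProd_symm_apply]
  have hIntg : Integrable (fun p : ℝ × ℝ => 𝐞 (-inner ℝ (⟨p.1, p.2⟩ : ℂ) (⟨k, l⟩ : ℂ)) • f ⟨p.1, p.2⟩) := by
    have h1 : Integrable (fun v : ℂ => 𝐞 (-inner ℝ v (⟨k, l⟩ : ℂ)) • f v) := by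
      have hc : Continuous (fun v : ℂ => (innerₗ ℂ) v (⟨k, l⟩ : ℂ)) := by
        simp only [innerₗ_apply_apply]; fun_prop
      exact (VectorFourier.fourierIntegral_convergent_iff (e := 𝐞) (L := innerₗ ℂ)
        Real.continuous_fourierChar (by simp only [innerₗ_apply_apply]; fun_prop) (⟨k, l⟩ : ℂ)).2 hf
    exact (hmp.integrable_comp_emb (MeasurableEquiv.measurableEmbedding _)).2 h1
  have : (volume : Measure (ℝ × ℝ)) = volume.prod volume := rfl
  rw [this, integral_prod _ (by rw [← this]; exact hIntg)]
  congr 1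
  funext a
  rw [Real.fourier_real_eq, Circle.smul_def, smul_eq_mul, ← integral_const_mul]
  congr 1
  funext b
  rw [Circle.smul_def, Circle.smul_def, smul_eq_mul, smul_eq_mul, ← mul_assoc, ← Circle.coe_mul,
    ← AddChar.map_add_eq_mul]
  congr 3
  rw [Complex.inner]
  simp [Complex.mul_re]
  ring

/-- The profile function. -/
def f1 (v : ℂ) : ℝ := 2 * √(1 - ‖v‖ ^ 4)

lemma f1_cont : Continuous f1 := by unfold f1; fun_prop

lemma f1_zero (v : ℂ) (hv : 1 ≤ ‖v‖) : f1 v = 0 := by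
  unfold f1
  rw [Real.sqrt_eq_zero_of_nonpos, mul_zero]
  have : 1 ≤ ‖v‖ ^ 4 := one_le_pow₀ hv
  linarith

lemma f1_nonneg (v : ℂ) : 0 ≤ f1 v := by unfold f1; positivity

lemma f1_le (v : ℂ) : f1 v ≤ 2 := by
  unfold f1
  have : √(1 - ‖v‖ ^ 4) ≤ 1 := by
    apply Real.sqrt_le_iff.2 ⟨by norm_num, ?_⟩
    have : 0 ≤ ‖v‖ ^ 4 := by positivity
    linarith
  linarith

def f1c (v : ℂ) : ℂ := (f1 v : ℂ)

lemma f1c_cont : Continuous f1c := Complex.continuous_ofReal.comp f1_cont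

lemma f1c_int : Integrable f1c := by
  refine f1c_cont.integrable_of_hasCompactSupport ?_
  refine HasCompactSupport.intro (isCompact_closedBall (0:ℂ) 1) fun v hv => ?_
  rw [Metric.mem_closedBall, dist_zero_right, not_le] at hv
  unfold f1c; rw [f1_zero v hv.le]; simp

lemma f1c_radial (w : ℂ) : 𝓕 f1c w = 𝓕 f1c ((‖w‖ : ℝ) : ℂ) := by
  by_cases hw : w = 0
  · subst hw; simp
  have hn : ‖w‖ ≠ 0 := norm_ne_zero_iff.2 hw
  set a : Circle := ⟨w / (‖w‖:ℝ), by
    change _ ∈ Metric.sphere (0:ℂ) 1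
    rw [mem_sphere_zero_iff_norm, norm_div, Complex.norm_real, norm_norm, div_self hn]⟩ with ha
  have h := Real.fourier_comp_linearIsometry (rotation a) f1c ((‖w‖ : ℝ) : ℂ)
  have e1 : (rotation a) ((‖w‖ : ℝ) : ℂ) = w := by
    rw [rotation_apply, ha]
    simp only
    have : ((‖w‖ : ℝ) : ℂ) ≠ 0 := by exact_mod_cast hn
    field_simp
  have e2 : f1c ∘ (rotation a) = f1c := by
    funext v
    simp only [Function.comp_apply, f1c, f1, LinearIsometryEquiv.norm_map]
  rw [e1, e2] at h
  exact h.symm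

/-- Radial Fourier transform of the profile. -/
def Phi (s : ℝ) : ℝ := (𝓕 f1c (s : ℂ)).re

lemma Phi_cont : Continuous Phi := by
  have h : Continuous (𝓕 f1c) :=
    VectorFourier.fourierIntegral_continuous (e := 𝐞) (L := innerₗ ℂ)
        Real.continuous_fourierChar (by simp only [innerₗ_apply_apply]; fun_prop) f1c_int
  unfold Phi
  exact Complex.continuous_re.comp (h.comp Complex.continuous_ofReal)

/-- Slice integral. -/
lemma slice (y : ℝ) (hy : y ∈ Set.Icc (-1:ℝ) 1) :
    ∫ z : ℝ, f1 ⟨y, z⟩ = ∫ w in (-1:ℝ)..1, √(1 - w ^ 2) * (2 * (1 - y ^ 2) * gw w y) := by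
  have hy2 : 0 ≤ 1 - y ^ 2 := by nlinarith [hy.1, hy.2]
  set r := √(1 - y ^ 2) with hr
  have hr0 : 0 ≤ r := Real.sqrt_nonneg _
  have hr2 : r ^ 2 = 1 - y ^ 2 := Real.sq_sqrt hy2
  have hnorm : ∀ z : ℝ, ‖(⟨y, z⟩ : ℂ)‖ ^ 2 = y ^ 2 + z ^ 2 := fun z => by
    rw [← Complex.normSq_eq_norm_sq, Complex.normSq_mk]; ring
  have e1 : ∫ z : ℝ, f1 ⟨y, z⟩ = ∫ z in (-r)..r, f1 ⟨y, z⟩ := by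
    rw [intervalIntegral.integral_of_le (by linarith), ← integral_Icc_eq_integral_Ioc]
    symm
    apply setIntegral_eq_integral_of_forall_compl_eq_zero
    intro z hz
    apply f1_zero
    have : r < |z| := by
      by_contra h; push Not at h; exact hz (abs_le.1 h)
    have h2 : r ^ 2 < |z| ^ 2 := pow_lt_pow_left₀ this hr0 two_ne_zero
    rw [sq_abs, hr2] at h2
    have := hnorm z
    by_contra h; push Not at h
    nlinarith [norm_nonneg (⟨y, z⟩ : ℂ)]
  have e2 : r * ∫ w in (-1:ℝ)..1, f1 ⟨y, r * w⟩ = ∫ z in (-r)..r, f1 ⟨y, z⟩ := by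
    have := intervalIntegral.mul_integral_comp_mul_left (a := -1) (b := 1) (f := fun z => f1 ⟨y, z⟩) r
    simpa using this
  rw [e1, ← e2, ← intervalIntegral.integral_const_mul]
  apply intervalIntegral.integral_congr
  intro w hw
  rw [Set.uIcc_of_le (by norm_num)] at hw
  have hw2 : 0 ≤ 1 - w ^ 2 := by nlinarith [hw.1, hw.2]
  simp only
  unfold f1 gw
  have e3 : 1 - ‖(⟨y, r * w⟩ : ℂ)‖ ^ 4 = r ^ 2 * ((1 - w ^ 2) * ((1 + w ^ 2) + (1 - w ^ 2) * y ^ 2)) := by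
    have : ‖(⟨y, r * w⟩ : ℂ)‖ ^ 4 = (‖(⟨y, r * w⟩ : ℂ)‖ ^ 2) ^ 2 := by ring
    rw [this, hnorm, mul_pow, hr2]; ring
  rw [e3, Real.sqrt_mul (by positivity), Real.sqrt_sq hr0, Real.sqrt_mul hw2, ← hr2]
  ring

lemma Phi_eq (s : ℝ) : Phi s = ∫ w in (-1:ℝ)..1, √(1 - w ^ 2) *
    ∫ y in (-1:ℝ)..1, (2 * (1 - y ^ 2) * gw w y) * Real.cos (2 * π * s * y) := by
  unfold Phi
  have h0 : (s:ℂ) = (⟨s, 0⟩ : ℂ) := rfl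
  rw [h0, ft_iter _ f1c_int, Real.fourier_real_eq]
  have e1 : ∀ a : ℝ, 𝓕 (fun b : ℝ => f1c ⟨a, b⟩) 0 = ((∫ z : ℝ, f1 ⟨a, z⟩ : ℝ) : ℂ) := by
    intro a
    rw [Real.fourier_real_eq]
    simp only [mul_zero, neg_zero, AddChar.map_zero_eq_one, one_smul]
    exact integral_ofReal
  simp_rw [e1]
  have e2 : ∫ v : ℝ, 𝐞 (-(v * s)) • ((∫ z : ℝ, f1 ⟨v, z⟩ : ℝ) : ℂ)
      = ∫ v in (-1:ℝ)..1, 𝐞 (-(v * s)) • ((∫ z : ℝ, f1 ⟨v, z⟩ : ℝ) : ℂ) := by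
    rw [intervalIntegral.integral_of_le (by norm_num), ← integral_Icc_eq_integral_Ioc]
    symm
    apply setIntegral_eq_integral_of_forall_compl_eq_zero
    intro v hv
    have hv1 : 1 < |v| := by
      by_contra h; push Not at h; exact hv (abs_le.1 h)
    have : (fun z : ℝ => f1 ⟨v, z⟩) = fun _ => 0 := by
      funext z
      apply f1_zero
      exact hv1.le.trans (Complex.abs_re_le_norm (⟨v, z⟩ : ℂ))
    rw [this]; simp
  have gc := gw_cont
  rw [e2]
  have e3 : ∫ v in (-1:ℝ)..1, 𝐞 (-(v * s)) • ((∫ z : ℝ, f1 ⟨v, z⟩ : ℝ) : ℂ)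
      = ∫ v in (-1:ℝ)..1, 𝐞 (-(v * s)) • ((∫ w in (-1:ℝ)..1, √(1 - w ^ 2) * (2 * (1 - v ^ 2) * gw w v) : ℝ) : ℂ) := by
    apply intervalIntegral.integral_congr
    intro v hv
    rw [Set.uIcc_of_le (by norm_num)] at hv
    simp only
    rw [slice v hv]
  have cp : Continuous (fun v : ℝ => ∫ w in (-1:ℝ)..1, √(1 - w ^ 2) * (2 * (1 - v ^ 2) * gw w v)) := by
    apply intervalIntegral.continuous_parametric_intervalIntegral_of_continuous'
    have h1 : Continuous (fun p : ℝ × ℝ => gw p.2 p.1) := by unfold gw; fun_prop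
    unfold Function.uncurry; fun_prop
  have hre : (∫ v in (-1:ℝ)..1, 𝐞 (-(v * s)) • ((∫ w in (-1:ℝ)..1, √(1 - w ^ 2) * (2 * (1 - v ^ 2) * gw w v) : ℝ) : ℂ)).re
      = ∫ v in (-1:ℝ)..1, (𝐞 (-(v * s)) • ((∫ w in (-1:ℝ)..1, √(1 - w ^ 2) * (2 * (1 - v ^ 2) * gw w v) : ℝ) : ℂ)).re := by
    have hi : IntervalIntegrable (fun v => 𝐞 (-(v * s)) • ((∫ w in (-1:ℝ)..1, √(1 - w ^ 2) * (2 * (1 - v ^ 2) * gw w v) : ℝ) : ℂ)) volume (-1) 1 := by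
      apply Continuous.intervalIntegrable
      have := Complex.continuous_ofReal.comp cp
      simp only [Function.comp_def] at this
      fun_prop
    have := Complex.reCLM.intervalIntegral_comp_comm hi
    simpa using this.symm
  rw [e3, hre]
  have e4 : ∀ v : ℝ, (𝐞 (-(v * s)) • ((∫ w in (-1:ℝ)..1, √(1 - w ^ 2) * (2 * (1 - v ^ 2) * gw w v) : ℝ) : ℂ)).re
      = ∫ w in (-1:ℝ)..1, √(1 - w ^ 2) * ((2 * (1 - v ^ 2) * gw w v) * Real.cos (2 * π * s * v)) := by
    intro v
    rw [Circle.smul_def, Real.fourierChar_apply, smul_eq_mul, Complex.re_mul_ofReal,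
      Complex.exp_ofReal_mul_I_re, mul_comm, ← intervalIntegral.integral_mul_const]
    congr 1
    funext w
    rw [show 2 * π * -(v * s) = -(2 * π * s * v) by ring, Real.cos_neg]; ring
  simp_rw [e4]
  rw [MeasureTheory.intervalIntegral_intervalIntegral_swap]
  · simp_rw [intervalIntegral.integral_const_mul]
  · have hcc : Continuous (Function.uncurry fun v w : ℝ => √(1 - w ^ 2) * ((2 * (1 - v ^ 2) * gw w v) * Real.cos (2 * π * s * v))) := by
      have h1 : Continuous (fun p : ℝ × ℝ => gw p.2 p.1) := by unfold gw; fun_prop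
      unfold Function.uncurry; fun_prop
    exact (hcc.continuousOn.integrableOn_compact (isCompact_uIcc.prod isCompact_uIcc)).mono_set
      (Set.prod_mono Set.uIoc_subset_uIcc Set.uIoc_subset_uIcc)

lemma Phi_asym (s : ℝ) (hs : 0 < s) :
    |Phi s + (√2 / π) * Real.cos (2 * π * s) / s ^ 2| ≤ 2 / s ^ 3 := by
  have ht : 0 < 2 * π * s := by positivity
  set t := 2 * π * s with htd
  have hcJ : Continuous (fun w : ℝ => ∫ y in (-1:ℝ)..1, (2 * (1 - y ^ 2) * gw w y) * Real.cos (t * y)) := by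
    apply intervalIntegral.continuous_parametric_intervalIntegral_of_continuous'
    have h1 : Continuous (fun p : ℝ × ℝ => gw p.1 p.2) := by unfold gw; fun_prop
    unfold Function.uncurry; fun_prop
  have e : Phi s + (√2 / π) * Real.cos t / s ^ 2
      = ∫ w in (-1:ℝ)..1, √(1 - w ^ 2) * ((∫ y in (-1:ℝ)..1, (2 * (1 - y ^ 2) * gw w y) * Real.cos (t * y))
        + 2 * (4 * √2) * Real.cos t / t ^ 2) := by
    simp_rw [mul_add]
    rw [intervalIntegral.integral_add, intervalIntegral.integral_mul_const, integral_sqrt_one_sub_sq, Phi_eq]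
    · congr 1
      rw [htd]
      have := Real.pi_ne_zero
      field_simp
      ring
    · apply Continuous.intervalIntegrable; fun_prop
    · apply Continuous.intervalIntegrable; fun_prop
  rw [e, ← Real.norm_eq_abs]
  have hb := intervalIntegral.norm_integral_le_of_norm_le_const (a := (-1:ℝ)) (b := 1)
    (f := fun w : ℝ => √(1 - w ^ 2) * ((∫ y in (-1:ℝ)..1, (2 * (1 - y ^ 2) * gw w y) * Real.cos (t * y))
        + 2 * (4 * √2) * Real.cos t / t ^ 2)) (C := 4 * 36 / t ^ 3) (by
      intro w hw
      rw [Set.uIoc_of_le (by norm_num)] at hw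
      have h1 := Jw_bound w ⟨hw.1.le, hw.2⟩ t ht
      have h2 : √(1 - w ^ 2) ≤ 1 := Real.sqrt_le_iff.2 ⟨by norm_num, by nlinarith [sq_nonneg w]⟩
      rw [norm_mul, Real.norm_eq_abs, Real.norm_eq_abs, abs_of_nonneg (Real.sqrt_nonneg _)]
      calc _ ≤ 1 * (4 * 36 / t ^ 3) := mul_le_mul h2 h1 (abs_nonneg _) (by norm_num)
        _ = _ := one_mul _)
  refine hb.trans ?_
  have h6 : 6 * s ≤ t := by rw [htd]; nlinarith [Real.pi_gt_three]
  have h7 : (6 * s) ^ 3 ≤ t ^ 3 := pow_le_pow_left₀ (by positivity) h6 3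
  have : |(1:ℝ) - -1| = 2 := by norm_num
  rw [this, div_mul_eq_mul_div, div_le_div_iff₀ (by positivity) (by positivity)]
  nlinarith [pow_pos hs 3]

lemma Phi_zero_int : Phi 0 = ∫ v : ℂ, f1 v := by
  unfold Phi
  rw [Real.fourier_eq]
  simp only [Complex.ofReal_zero, inner_zero_right, neg_zero, AddChar.map_zero_eq_one, one_smul]
  have h : ∫ v : ℂ, f1c v = ((∫ v : ℂ, f1 v : ℝ) : ℂ) := integral_ofReal
  rw [h, Complex.ofReal_re]

lemma Phi_abs (s : ℝ) : |Phi s| ≤ Phi 0 := by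
  rw [Phi_zero_int]
  unfold Phi
  refine (Complex.abs_re_le_norm _).trans ?_
  rw [Real.fourier_eq]
  refine (norm_integral_le_integral_norm _).trans ?_
  apply le_of_eq
  congr 1
  funext v
  rw [Circle.norm_smul, f1c, Complex.norm_real, Real.norm_eq_abs, abs_of_nonneg (f1_nonneg v)]

lemma vol_slice (k : ℝ) : volume {c : ℝ | c ^ 2 ≤ k} = ENNReal.ofReal (2 * √k) := by
  rcases le_or_gt 0 k with h | h
  · have : {c : ℝ | c ^ 2 ≤ k} = Set.Icc (-√k) (√k) := by
      ext c
      simp only [Set.mem_ofPred_eq, Set.mem_Icc]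
      rw [← abs_le]
      exact ⟨fun h => Real.abs_le_sqrt h, fun h1 => by
        rw [← sq_abs, ← Real.sq_sqrt h]; exact pow_le_pow_left₀ (abs_nonneg _) h1 2⟩
    rw [this, Real.volume_Icc]; congr 1; ring
  · have : {c : ℝ | c ^ 2 ≤ k} = ∅ := by
      ext c; simp only [Set.mem_ofPred_eq, Set.mem_empty_iff_false, iff_false, not_le]
      nlinarith [sq_nonneg c]
    rw [this, Real.sqrt_eq_zero_of_nonpos h.le]; simp

lemma Phi_zero : Phi 0 = volB := by
  rw [Phi_zero_int]
  have hmp := Complex.volume_preserving_equiv_real_prod.symm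
  rw [← hmp.integral_comp']
  simp only [Complex.measurableEquivRealProd_symm_apply]
  have hnorm : ∀ y z : ℝ, f1 ⟨y, z⟩ = 2 * √(1 - (y ^ 2 + z ^ 2) ^ 2) := fun y z => by
    unfold f1
    have h : ‖(⟨y, z⟩ : ℂ)‖ ^ 2 = y ^ 2 + z ^ 2 := by
      rw [← Complex.normSq_eq_norm_sq, Complex.normSq_mk]; ring
    rw [show ‖(⟨y, z⟩ : ℂ)‖ ^ 4 = (‖(⟨y, z⟩ : ℂ)‖ ^ 2) ^ 2 by ring, h]
  simp_rw [hnorm]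
  have hset : cyganBall = {u : ℝ × ℝ × ℝ | (u.1 ^ 2 + u.2.1 ^ 2) ^ 2 + u.2.2 ^ 2 ≤ 1} := by
    ext u; exact mem_ball_iff u
  have hmeas : MeasurableSet {u : ℝ × ℝ × ℝ | (u.1 ^ 2 + u.2.1 ^ 2) ^ 2 + u.2.2 ^ 2 ≤ 1} := by
    apply measurableSet_le <;> fun_prop
  have hc : Continuous (fun p : ℝ × ℝ => 2 * √(1 - (p.1 ^ 2 + p.2 ^ 2) ^ 2)) := by fun_prop
  have hv : volume cyganBall = ∫⁻ p : ℝ × ℝ, ENNReal.ofReal (2 * √(1 - (p.1 ^ 2 + p.2 ^ 2) ^ 2)) := by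
    rw [hset, Measure.volume_eq_prod, Measure.prod_apply hmeas, Measure.volume_eq_prod ℝ ℝ,
      lintegral_prod _ (by exact (hc.measurable.ennreal_ofReal).aemeasurable)]
    congr 1
    funext a
    rw [Measure.prod_apply (hmeas.preimage (by fun_prop))]
    congr 1
    funext b
    rw [← vol_slice]
    congr 1
    ext c
    simp only [Set.mem_preimage, Set.mem_ofPred_eq]
    constructor <;> intro h <;> linarith
  rw [volB, hv, integral_eq_lintegral_of_nonneg_ae]
  · exact Eventually.of_forall fun p => by positivity
  · exact hc.aestronglyMeasurable

lemma f1c_ft (w : ℂ) : 𝓕 f1c w = ((Phi ‖w‖ : ℝ) : ℂ) := by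
  have hneg : 𝓕 f1c (-w) = 𝓕 f1c w := by rw [f1c_radial, f1c_radial w, norm_neg]
  have hconj : (starRingEnd ℂ) (𝓕 f1c w) = 𝓕 f1c (-w) := by
    rw [Real.fourier_eq, Real.fourier_eq, ← integral_conj]
    congr 1
    funext v
    rw [Circle.smul_def, Circle.smul_def, smul_eq_mul, smul_eq_mul, map_mul]
    congr 1
    · rw [inner_neg_right, neg_neg, ← Circle.coe_inv_eq_conj, ← AddChar.map_neg_eq_inv, neg_neg]
    · unfold f1c; exact Complex.conj_ofReal _
  have := Complex.conj_eq_iff_re.1 (hconj.trans hneg)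
  rw [← this, f1c_radial]
  simp [Phi]

/-- Smoothed sum kernel. -/
def Gc (x1 x2 : ℝ) (v : ℂ) : ℂ := ∫ u in x1..x2, f1c ((max u x1)⁻¹ • v)

lemma Gk_cont (x1 : ℝ) (h1 : 0 < x1) :
    Continuous (fun p : ℝ × ℂ => f1c ((max p.1 x1)⁻¹ • p.2)) := by
  have : Continuous (fun p : ℝ × ℂ => (max p.1 x1)⁻¹ • p.2) := by
    have hi : Continuous (fun p : ℝ × ℂ => (max p.1 x1)⁻¹) := by
      apply Continuous.inv₀ (by fun_prop)
      intro p
      exact (lt_of_lt_of_le h1 (le_max_right _ _)).ne'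
    fun_prop
  exact f1c_cont.comp this

lemma Gc_cont (x1 x2 : ℝ) (h1 : 0 < x1) : Continuous (Gc x1 x2) := by
  unfold Gc
  apply intervalIntegral.continuous_parametric_intervalIntegral_of_continuous'
  have := (Gk_cont x1 h1).comp continuous_swap
  exact this

lemma f1c_zero (v : ℂ) (hv : 1 ≤ ‖v‖) : f1c v = 0 := by
  unfold f1c; rw [f1_zero v hv]; simp

lemma Gk_zero (x1 x2 : ℝ) (h1 : 0 < x1) (h12 : x1 ≤ x2) (v : ℂ) (hv : x2 ≤ ‖v‖) (u : ℝ) (hu : u ≤ x2) :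
    f1c ((max u x1)⁻¹ • v) = 0 := by
  apply f1c_zero
  have : 0 < max u x1 := lt_of_lt_of_le h1 (le_max_right _ _)
  rw [norm_smul, norm_inv, Real.norm_eq_abs, abs_of_pos this, ← div_eq_inv_mul, le_div_iff₀ this, one_mul]
  exact (max_le hu h12).trans hv

lemma Gc_zero (x1 x2 : ℝ) (h1 : 0 < x1) (h12 : x1 ≤ x2) (v : ℂ) (hv : x2 ≤ ‖v‖) : Gc x1 x2 v = 0 := by
  unfold Gc
  rw [intervalIntegral.integral_congr (g := fun _ => 0)]
  · simp
  · intro u hu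
    rw [Set.uIcc_of_le h12] at hu
    exact Gk_zero x1 x2 h1 h12 v hv u hu.2

lemma Gc_int (x1 x2 : ℝ) (h1 : 0 < x1) (h12 : x1 ≤ x2) : Integrable (Gc x1 x2) := by
  refine (Gc_cont x1 x2 h1).integrable_of_hasCompactSupport ?_
  refine HasCompactSupport.intro (isCompact_closedBall (0:ℂ) x2) fun v hv => ?_
  rw [Metric.mem_closedBall, dist_zero_right, not_le] at hv
  exact Gc_zero x1 x2 h1 h12 v hv.le

/-- The transformed term. -/
def hn (n : ℕ) (u : ℝ) : ℝ := u ^ 2 * Phi (u * √n)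

lemma hn_cont (n : ℕ) : Continuous (hn n) := by
  unfold hn
  have := Phi_cont
  fun_prop

lemma ft_scale (r : ℝ) (hr : 0 < r) (w : ℂ) :
    𝓕 (fun v : ℂ => f1c (r⁻¹ • v)) w = ((r ^ 2 * Phi (r * ‖w‖) : ℝ) : ℂ) := by
  rw [Real.fourier_eq]
  have h := Measure.integral_comp_smul (volume : Measure ℂ)
    (fun v => 𝐞 (-inner ℝ v (r • w)) • f1c v) r⁻¹
  have e : (fun v : ℂ => 𝐞 (-inner ℝ (r⁻¹ • v) (r • w)) • f1c (r⁻¹ • v))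
      = fun v : ℂ => 𝐞 (-inner ℝ v w) • f1c (r⁻¹ • v) := by
    funext v
    rw [inner_smul_left, inner_smul_right]
    congr 3
    simp; field_simp
  rw [e] at h
  rw [h, ← Real.fourier_eq, f1c_ft, Complex.finrank_real_complex, norm_smul, Real.norm_eq_abs,
    abs_of_pos hr, inv_pow, inv_inv, abs_of_pos (by positivity)]
  simp

lemma Gc_ft (x1 x2 : ℝ) (h1 : 0 < x1) (h12 : x1 ≤ x2) (w : ℂ) :
    𝓕 (Gc x1 x2) w = ((∫ u in x1..x2, u ^ 2 * Phi (u * ‖w‖) : ℝ) : ℂ) := by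
  rw [Real.fourier_eq]
  have e0 : ∀ v : ℂ, 𝐞 (-inner ℝ v w) • Gc x1 x2 v
      = ∫ u in x1..x2, 𝐞 (-inner ℝ v w) • f1c ((max u x1)⁻¹ • v) := by
    intro v
    unfold Gc
    simp_rw [Circle.smul_def]
    rw [intervalIntegral.integral_smul]
  simp_rw [e0]
  rw [← intervalIntegral_integral_swap]
  · rw [← intervalIntegral.integral_ofReal]
    apply intervalIntegral.integral_congr
    intro u hu
    rw [Set.uIcc_of_le h12] at hu
    simp only
    rw [max_eq_left hu.1, ← ft_scale u (by linarith [hu.1]), Real.fourier_eq]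
  · have hc : Continuous (Function.uncurry fun (u:ℝ) (v:ℂ) => 𝐞 (-inner ℝ v w) • f1c ((max u x1)⁻¹ • v)) := by
      have := Gk_cont x1 h1
      unfold Function.uncurry
      fun_prop
    have hm : (volume.restrict (Set.uIoc x1 x2)).prod (volume : Measure ℂ)
        = ((volume : Measure ℝ).prod (volume : Measure ℂ)).restrict (Set.uIoc x1 x2 ×ˢ Set.univ) := by
      rw [← Measure.prod_restrict, Measure.restrict_univ]
    rw [hm, ← IntegrableOn]
    have hK : IntegrableOn (Function.uncurry fun (u:ℝ) (v:ℂ) => 𝐞 (-inner ℝ v w) • f1c ((max u x1)⁻¹ • v))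
        (Set.uIcc x1 x2 ×ˢ Metric.closedBall (0:ℂ) x2) ((volume : Measure ℝ).prod (volume : Measure ℂ)) :=
      hc.continuousOn.integrableOn_compact (isCompact_uIcc.prod (isCompact_closedBall 0 x2))
    have hK2 := hK.mono_set (Set.prod_mono (Set.uIoc_subset_uIcc (a := x1) (b := x2)) subset_rfl)
    refine hK2.of_forall_sdiff_eq_zero (measurableSet_uIoc.prod MeasurableSet.univ) ?_
    rintro ⟨u, v⟩ ⟨⟨hu, -⟩, hnot⟩
    simp only [Set.mem_prod, not_and, Metric.mem_closedBall, dist_zero_right, not_le] at hnot hu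
    have hv := hnot hu
    rw [Set.uIoc_of_le h12] at hu
    simp only [Function.uncurry]
    rw [Gk_zero x1 x2 h1 h12 v hv.le u hu.2, smul_zero]

lemma cos_int_bound (t a b : ℝ) (ht : 0 < t) : |∫ u in a..b, Real.cos (t * u)| ≤ 2 / t := by
  have h := intervalIntegral.integral_comp_mul_left (a := a) (b := b) (f := Real.cos) ht.ne'
  rw [h, integral_cos, smul_eq_mul, abs_mul, abs_inv, abs_of_pos ht, ← div_eq_inv_mul]
  gcongr
  have := abs_sub (Real.sin (t * b)) (Real.sin (t * a))
  linarith [Real.abs_sin_le_one (t * b), Real.abs_sin_le_one (t * a)]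

lemma Phi_err (u ρ : ℝ) (hu : 0 < u) (hρ : 0 < ρ) :
    |u ^ 2 * Phi (u * ρ) + (√2 / π) / ρ ^ 2 * Real.cos (2 * π * ρ * u)| ≤ 2 / (u * ρ ^ 3) := by
  have h := Phi_asym (u * ρ) (by positivity)
  have e : u ^ 2 * Phi (u * ρ) + (√2 / π) / ρ ^ 2 * Real.cos (2 * π * ρ * u)
      = u ^ 2 * (Phi (u * ρ) + (√2 / π) * Real.cos (2 * π * (u * ρ)) / (u * ρ) ^ 2) := by
    rw [show 2 * π * (u * ρ) = 2 * π * ρ * u by ring]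
    field_simp
  rw [e, abs_mul, abs_of_pos (by positivity : 0 < u ^ 2)]
  calc _ ≤ u ^ 2 * (2 / (u * ρ) ^ 3) := by gcongr
    _ = _ := by field_simp

lemma Gc_decay (x1 x2 : ℝ) (h1 : 0 < x1) (h12 : x1 ≤ x2) (ρ : ℝ) (hρ : 0 < ρ) :
    |∫ u in x1..x2, u ^ 2 * Phi (u * ρ)| ≤ (1 + 2 / x1 * (x2 - x1)) / ρ ^ 3 := by
  have hP := Phi_cont
  have e : ∫ u in x1..x2, u ^ 2 * Phi (u * ρ)
      = (∫ u in x1..x2, (u ^ 2 * Phi (u * ρ) + (√2 / π) / ρ ^ 2 * Real.cos (2 * π * ρ * u)))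
        - (√2 / π) / ρ ^ 2 * ∫ u in x1..x2, Real.cos (2 * π * ρ * u) := by
    rw [← intervalIntegral.integral_const_mul, ← intervalIntegral.integral_sub]
    · congr 1; funext u; ring
    · apply Continuous.intervalIntegrable; fun_prop
    · apply Continuous.intervalIntegrable; fun_prop
  have b1 : |∫ u in x1..x2, (u ^ 2 * Phi (u * ρ) + (√2 / π) / ρ ^ 2 * Real.cos (2 * π * ρ * u))|
      ≤ 2 / (x1 * ρ ^ 3) * |x2 - x1| := by
    rw [← Real.norm_eq_abs]
    apply intervalIntegral.norm_integral_le_of_norm_le_const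
    intro u hu
    rw [Set.uIoc_of_le h12] at hu
    have hu0 : 0 < u := h1.trans hu.1
    refine (Phi_err u ρ hu0 hρ).trans ?_
    have := hu.1.le
    gcongr
  have b2 := cos_int_bound (2 * π * ρ) x1 x2 (by positivity)
  rw [abs_of_nonneg (by linarith : 0 ≤ x2 - x1)] at b1
  have hs2 : √2 ≤ 2 := by rw [Real.sqrt_le_left (by norm_num)]; norm_num
  have hpi := Real.pi_gt_three
  rw [e]
  refine (abs_sub _ _).trans ?_
  rw [abs_mul, abs_of_nonneg (by positivity : 0 ≤ (√2 / π) / ρ ^ 2)]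
  calc _ ≤ 2 / (x1 * ρ ^ 3) * (x2 - x1) + (√2 / π) / ρ ^ 2 * (2 / (2 * π * ρ)) := by gcongr
    _ = (√2 / π ^ 2 + 2 / x1 * (x2 - x1)) / ρ ^ 3 := by field_simp; ring
    _ ≤ _ := by
      gcongr
      rw [div_le_one (by positivity)]
      nlinarith

lemma summable_Z2 (K : ℝ) (F : ℤ × ℤ → ℝ)
    (hF : ∀ p : ℤ × ℤ, p ≠ 0 → |F p| ≤ K / √((p.1:ℝ) ^ 2 + (p.2:ℝ) ^ 2) ^ 3) : Summable F := by
  have hs : Summable (fun p : ℤ × ℤ => |K| * ‖(finTwoArrowEquiv ℤ).symm p‖ ^ (-(3:ℝ))) := by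
    apply Summable.mul_left
    exact ((finTwoArrowEquiv ℤ).symm.summable_iff (f := fun x : Fin 2 → ℤ => ‖x‖ ^ (-(3:ℝ)))).2
      (EisensteinSeries.summable_one_div_norm_rpow (by norm_num))
  refine Summable.of_norm_bounded_eventually hs ?_
  have h0 : ∀ᶠ p : ℤ × ℤ in cofinite, p ≠ 0 := by
    rw [Filter.eventually_cofinite]; simp
  filter_upwards [h0] with p hp
  rw [Real.norm_eq_abs]
  refine (hF p hp).trans ?_
  set x := (finTwoArrowEquiv ℤ).symm p with hx
  have hx0 : x ≠ 0 := by
    intro h; apply hp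
    have := congrArg (finTwoArrowEquiv ℤ) h
    rw [hx, Equiv.apply_symm_apply] at this
    rw [this]; rfl
  have hxn : 0 < ‖x‖ := norm_pos_iff.2 hx0
  have hle : ‖x‖ ≤ √((p.1:ℝ) ^ 2 + (p.2:ℝ) ^ 2) := by
    rw [pi_norm_le_iff_of_nonneg (Real.sqrt_nonneg _)]
    intro i
    fin_cases i
    · change ‖p.1‖ ≤ _
      rw [Int.norm_eq_abs]; apply Real.abs_le_sqrt; nlinarith [sq_nonneg (p.2:ℝ)]
    · change ‖p.2‖ ≤ _
      rw [Int.norm_eq_abs]; apply Real.abs_le_sqrt; nlinarith [sq_nonneg (p.1:ℝ)]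
  rw [Real.rpow_neg hxn.le, ← div_eq_mul_inv, show (3:ℝ) = ((3:ℕ):ℝ) by norm_num, Real.rpow_natCast]
  have h3 : ‖x‖ ^ 3 ≤ √((p.1:ℝ) ^ 2 + (p.2:ℝ) ^ 2) ^ 3 := pow_le_pow_left₀ hxn.le hle 3
  calc K / √((p.1:ℝ) ^ 2 + (p.2:ℝ) ^ 2) ^ 3 ≤ |K| / √((p.1:ℝ) ^ 2 + (p.2:ℝ) ^ 2) ^ 3 := by
        gcongr; exact le_abs_self K
    _ ≤ _ := by gcongr

lemma toNat_cast (p : ℤ × ℤ) : (((p.1 ^ 2 + p.2 ^ 2).toNat : ℕ) : ℝ) = (p.1:ℝ) ^ 2 + (p.2:ℝ) ^ 2 := by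
  have h : ((p.1 ^ 2 + p.2 ^ 2).toNat : ℤ) = p.1 ^ 2 + p.2 ^ 2 := Int.toNat_of_nonneg (by positivity)
  have : (((p.1 ^ 2 + p.2 ^ 2).toNat : ℤ) : ℝ) = ((p.1 ^ 2 + p.2 ^ 2 : ℤ) : ℝ) := by rw [h]
  push_cast at this
  exact_mod_cast this

lemma norm_mk (a b : ℝ) : ‖(⟨a, b⟩ : ℂ)‖ = √(a ^ 2 + b ^ 2) := by
  rw [Complex.norm_def, Complex.normSq_mk]; congr 1; ring

lemma Gc_term (x1 x2 : ℝ) (h1 : 0 < x1) (h12 : x1 ≤ x2) (p : ℤ × ℤ) :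
    Gc x1 x2 ⟨p.1, p.2⟩ = ((∫ u in x1..x2, 2 * fph ((p.1 ^ 2 + p.2 ^ 2).toNat) u / u ^ 2 : ℝ) : ℂ) := by
  unfold Gc
  rw [← intervalIntegral.integral_ofReal]
  apply intervalIntegral.integral_congr
  intro u hu
  rw [Set.uIcc_of_le h12] at hu
  have hu0 : 0 < u := by linarith [hu.1]
  simp only
  rw [max_eq_left hu.1, f1c, f1, fph, toNat_cast, norm_smul, norm_mk, norm_inv, Real.norm_eq_abs, abs_of_pos hu0]
  congr 1
  have hq : 0 ≤ (p.1:ℝ) ^ 2 + (p.2:ℝ) ^ 2 := by positivity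
  have e : 1 - (u⁻¹ * √((p.1:ℝ) ^ 2 + (p.2:ℝ) ^ 2)) ^ 4 = (u ^ 4 - ((p.1:ℝ) ^ 2 + (p.2:ℝ) ^ 2) ^ 2) / (u ^ 2) ^ 2 := by
    have : √((p.1:ℝ) ^ 2 + (p.2:ℝ) ^ 2) ^ 4 = ((p.1:ℝ) ^ 2 + (p.2:ℝ) ^ 2) ^ 2 := by
      rw [show √((p.1:ℝ) ^ 2 + (p.2:ℝ) ^ 2) ^ 4 = (√((p.1:ℝ) ^ 2 + (p.2:ℝ) ^ 2) ^ 2) ^ 2 by ring, Real.sq_sqrt hq]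
    rw [mul_pow, this]; field_simp
  rw [e, Real.sqrt_div' _ (by positivity), Real.sqrt_sq (by positivity)]
  ring

lemma fph_zero_of_le (m : ℕ) (u : ℝ) (hu : 0 ≤ u) (h : u ^ 2 ≤ m) : fph m u = 0 := by
  unfold fph
  apply Real.sqrt_eq_zero_of_nonpos
  nlinarith [sq_nonneg u]

lemma MainS_poisson (x1 x2 : ℝ) (h1 : 0 < x1) (h12 : x1 ≤ x2) (T : ℕ) (hT : x2 ^ 2 ≤ T) (hT1 : 1 ≤ T) :
    Tendsto (fun N : ℕ => ∑ n ∈ Finset.range (N + 1), (r2 n : ℝ) * ∫ u in x1..x2, hn n u) atTop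
      (nhds (∫ u in x1..x2, MainS T u / u ^ 2)) := by
  have hft : ∀ p : ℤ × ℤ, 𝓕 (fun a : ℝ => 𝓕 (fun b : ℝ => Gc x1 x2 ⟨a, b⟩) (p.2:ℝ)) (p.1:ℝ)
      = ((∫ u in x1..x2, hn ((p.1 ^ 2 + p.2 ^ 2).toNat) u : ℝ) : ℂ) := by
    intro p
    rw [← ft_iter _ (Gc_int x1 x2 h1 h12), Gc_ft x1 x2 h1 h12, norm_mk]
    unfold hn
    rw [toNat_cast]
  have hsum : Summable (fun p : ℤ × ℤ => ∫ u in x1..x2, hn ((p.1 ^ 2 + p.2 ^ 2).toNat) u) := by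
    apply summable_Z2 (1 + 2 / x1 * (x2 - x1))
    intro p hp
    unfold hn
    rw [toNat_cast]
    apply Gc_decay x1 x2 h1 h12
    apply Real.sqrt_pos.2
    have : p.1 ≠ 0 ∨ p.2 ≠ 0 := by
      by_contra h; push Not at h; exact hp (Prod.ext h.1 h.2)
    rcases this with h | h
    · have : (p.1:ℝ) ≠ 0 := by exact_mod_cast h
      positivity
    · have : (p.2:ℝ) ≠ 0 := by exact_mod_cast h
      positivity
  have hx2T : x2 ≤ T := by
    have : (1:ℝ) ≤ T := by exact_mod_cast hT1
    nlinarith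
  have hpois := poisson2 (fun a b => Gc x1 x2 ⟨a, b⟩) (by
      have : Continuous (fun p : ℝ × ℝ => (⟨p.1, p.2⟩ : ℂ)) :=
        Complex.equivRealProdCLM.symm.continuous
      exact (Gc_cont x1 x2 h1).comp this) T (by
      intro a b hab
      apply Gc_zero x1 x2 h1 h12
      rcases hab with h | h
      · exact hx2T.trans (h.le.trans (Complex.abs_re_le_norm (⟨a, b⟩ : ℂ)))
      · exact hx2T.trans (h.le.trans (Complex.abs_im_le_norm (⟨a, b⟩ : ℂ)))) (by
      simp_rw [hft]
      exact_mod_cast hsum)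
  simp_rw [hft] at hpois
  rw [← Finset.sum_product'] at hpois
  have hl : ∑ x ∈ Finset.Icc (-(T:ℤ)) T ×ˢ Finset.Icc (-(T:ℤ)) T, Gc x1 x2 ⟨(x.1:ℝ), (x.2:ℝ)⟩
      = ((∫ u in x1..x2, MainS T u / u ^ 2 : ℝ) : ℂ) := by
    have hsub : disc T ⊆ Finset.Icc (-(T:ℤ)) T ×ˢ Finset.Icc (-(T:ℤ)) T := by
      intro p hp
      rw [mem_disc] at hp
      simp only [Finset.mem_product, Finset.mem_Icc]
      refine ⟨⟨?_, ?_⟩, ?_, ?_⟩ <;> nlinarith [sq_nonneg p.1, sq_nonneg p.2, sq_nonneg (p.1 - 1), sq_nonneg (p.2 - 1), sq_nonneg (p.1 + 1), sq_nonneg (p.2 + 1)]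
    rw [← Finset.sum_subset hsub]
    · simp_rw [Gc_term x1 x2 h1 h12]
      rw [← Complex.ofReal_sum, ← sum_r2_eq_sum_disc T (fun m => ∫ u in x1..x2, 2 * fph m u / u ^ 2)]
      congr 1
      unfold MainS
      simp_rw [Finset.sum_div]
      rw [intervalIntegral.integral_finsetSum]
      · apply Finset.sum_congr rfl
        intro m _
        rw [← intervalIntegral.integral_const_mul]
        congr 1; funext u; ring
      · intro m _
        apply ContinuousOn.intervalIntegrable
        rw [Set.uIcc_of_le h12]
        have := fph_cont m
        apply ContinuousOn.div (by fun_prop) (by fun_prop)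
        intro u hu
        have : 0 < u := by linarith [hu.1]
        positivity
    · intro p _ hp
      rw [mem_disc, not_le] at hp
      apply Gc_zero x1 x2 h1 h12
      rw [norm_mk]
      apply Real.le_sqrt_of_sq_le
      have : (T:ℝ) < (p.1:ℝ) ^ 2 + (p.2:ℝ) ^ 2 := by exact_mod_cast hp
      linarith
  have hpr : ∫ u in x1..x2, MainS T u / u ^ 2 = ∑' p : ℤ × ℤ, ∫ u in x1..x2, hn ((p.1 ^ 2 + p.2 ^ 2).toNat) u := by
    have h := hl.symm.trans hpois
    rw [← Complex.ofReal_tsum] at h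
    exact_mod_cast h
  rw [hpr]
  simp_rw [sum_r2_eq_sum_disc _ (fun n => ∫ u in x1..x2, hn n u)]
  refine hsum.hasSum.comp ?_
  apply tendsto_atTop_finset_of_monotone
  · intro a b hab p hp
    rw [mem_disc] at hp ⊢
    exact hp.trans (by exact_mod_cast hab)
  · intro p
    refine ⟨(p.1 ^ 2 + p.2 ^ 2).toNat, ?_⟩
    rw [mem_disc]
    exact Int.self_le_toNat _

lemma cos_int_bound' (t φ a b : ℝ) (ht : t ≠ 0) : |∫ u in a..b, Real.cos (t * u + φ)| ≤ 2 / |t| := by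
  have h := intervalIntegral.integral_comp_mul_add (a := a) (b := b) (f := Real.cos) ht φ
  rw [h, integral_cos, smul_eq_mul, abs_mul, abs_inv, ← div_eq_inv_mul]
  gcongr
  have := abs_sub (Real.sin (t * b + φ)) (Real.sin (t * a + φ))
  linarith [Real.abs_sin_le_one (t * b + φ), Real.abs_sin_le_one (t * a + φ)]

lemma coscos_int (n m : ℕ) (hnm : n ≠ m) (φ a b : ℝ) :
    |∫ u in a..b, Real.cos (2 * π * √n * u + φ) * Real.cos (2 * π * √m * u + φ)| ≤ 1 / |√n - √m| := by
  have hne : √(n:ℝ) - √m ≠ 0 := by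
    rw [sub_ne_zero]; intro h
    rw [Real.sqrt_inj (by positivity) (by positivity)] at h
    exact hnm (by exact_mod_cast h)
  have hpi := Real.pi_gt_three
  have e : ∀ u : ℝ, Real.cos (2 * π * √n * u + φ) * Real.cos (2 * π * √m * u + φ)
      = 1 / 2 * (Real.cos ((2 * π * (√n - √m)) * u + 0) + Real.cos ((2 * π * (√n + √m)) * u + 2 * φ)) := by
    intro u
    have h1 : (2 * π * (√n - √m)) * u + 0 = (2 * π * √n * u + φ) - (2 * π * √m * u + φ) := by ring
    have h2 : (2 * π * (√n + √m)) * u + 2 * φ = (2 * π * √n * u + φ) + (2 * π * √m * u + φ) := by ring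
    rw [h1, h2]
    generalize 2 * π * √n * u + φ = A
    generalize 2 * π * √m * u + φ = B
    rw [Real.cos_sub, Real.cos_add]; ring
  simp_rw [e]
  have hp : 0 < |√(n:ℝ) - √m| := abs_pos.2 hne
  have hle : |√(n:ℝ) - √m| ≤ √n + √m := by
    rw [abs_le]; constructor <;> linarith [Real.sqrt_nonneg (n:ℝ), Real.sqrt_nonneg (m:ℝ)]
  have hpos : 0 < √(n:ℝ) + √m := lt_of_lt_of_le hp hle
  rw [intervalIntegral.integral_const_mul, intervalIntegral.integral_add]
  rotate_left
  · apply Continuous.intervalIntegrable; fun_prop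
  · apply Continuous.intervalIntegrable; fun_prop
  have b1 := cos_int_bound' (2 * π * (√n - √m)) 0 a b (by positivity)
  have b2 := cos_int_bound' (2 * π * (√n + √m)) (2 * φ) a b (by positivity)
  rw [abs_mul, abs_of_pos (by positivity : 0 < 2 * π)] at b1 b2
  rw [abs_of_pos hpos] at b2
  have c1 : 2 / (2 * π * |√(n:ℝ) - √m|) ≤ 1 / |√(n:ℝ) - √m| := by
    rw [div_le_div_iff₀ (by positivity) hp]; nlinarith
  have c2 : 2 / (2 * π * (√(n:ℝ) + √m)) ≤ 1 / |√(n:ℝ) - √m| := by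
    rw [div_le_div_iff₀ (by positivity) hp]; nlinarith
  rw [abs_mul, abs_of_pos (by norm_num : (0:ℝ) < 1 / 2)]
  have := abs_add_le (∫ u in a..b, Real.cos ((2 * π * (√n - √m)) * u + 0)) (∫ u in a..b, Real.cos ((2 * π * (√n + √m)) * u + 2 * φ))
  linarith

/-- Mean square of a cosine polynomial. -/
lemma cos_ms (s : Finset ℕ) (c : ℕ → ℝ) (φ a b : ℝ) (hab : a ≤ b) :
    ∫ u in a..b, (∑ n ∈ s, c n * Real.cos (2 * π * √n * u + φ)) ^ 2
      ≤ (b - a) * ∑ n ∈ s, c n ^ 2 + ∑ n ∈ s, ∑ m ∈ s.erase n, |c n| * |c m| / |√n - √m| := by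
  have e : ∀ u : ℝ, (∑ n ∈ s, c n * Real.cos (2 * π * √n * u + φ)) ^ 2
      = ∑ n ∈ s, ∑ m ∈ s, (c n * c m) * (Real.cos (2 * π * √n * u + φ) * Real.cos (2 * π * √m * u + φ)) := by
    intro u
    rw [sq, Finset.sum_mul_sum]
    apply Finset.sum_congr rfl; intro n _
    apply Finset.sum_congr rfl; intro m _
    ring
  simp_rw [e]
  rw [intervalIntegral.integral_finsetSum]
  swap
  · intro n _; apply Continuous.intervalIntegrable; fun_prop
  rw [Finset.mul_sum, ← Finset.sum_add_distrib]
  apply Finset.sum_le_sum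
  intro n hn
  rw [intervalIntegral.integral_finsetSum]
  swap
  · intro n _; apply Continuous.intervalIntegrable; fun_prop
  rw [← Finset.add_sum_erase _ _ hn]
  apply add_le_add
  · rw [intervalIntegral.integral_const_mul]
    have : ∫ u in a..b, Real.cos (2 * π * √n * u + φ) * Real.cos (2 * π * √n * u + φ) ≤ ∫ u in a..b, (1:ℝ) := by
      apply intervalIntegral.integral_mono_on hab
      · apply Continuous.intervalIntegrable; fun_prop
      · apply Continuous.intervalIntegrable; fun_prop
      · intro u _; nlinarith [Real.cos_sq_le_one (2 * π * √n * u + φ)]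
    rw [intervalIntegral.integral_const, smul_eq_mul, mul_one] at this
    nlinarith [mul_self_nonneg (c n)]
  · apply Finset.sum_le_sum
    intro m hm
    have hne : n ≠ m := (Finset.ne_of_mem_erase hm).symm
    rw [intervalIntegral.integral_const_mul]
    refine (le_abs_self _).trans ?_
    rw [abs_mul, abs_mul, ← mul_one_div]
    exact mul_le_mul_of_nonneg_left (coscos_int n m hne φ a b) (by positivity)

lemma inv_sqrt_diff (n m : ℕ) (hnm : n ≠ m) :
    1 / |√(n:ℝ) - √m| ≤ 2 * √(max n m : ℕ) / |(n:ℝ) - m| := by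
  have hne : √(n:ℝ) - √m ≠ 0 := by
    rw [sub_ne_zero]; intro h
    rw [Real.sqrt_inj (by positivity) (by positivity)] at h
    exact hnm (by exact_mod_cast h)
  have hp : 0 < |√(n:ℝ) - √m| := abs_pos.2 hne
  have e : |(n:ℝ) - m| = |√(n:ℝ) - √m| * (√n + √m) := by
    rw [← abs_of_nonneg (by positivity : 0 ≤ √(n:ℝ) + √m), ← abs_mul]
    congr 1
    nlinarith [Real.mul_self_sqrt (Nat.cast_nonneg (α := ℝ) n), Real.mul_self_sqrt (Nat.cast_nonneg (α := ℝ) m)]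
  have hd : 0 < |(n:ℝ) - m| := by
    apply abs_pos.2; rw [sub_ne_zero]; exact_mod_cast hnm
  have h1 : √(n:ℝ) ≤ √(max n m : ℕ) := Real.sqrt_le_sqrt (by exact_mod_cast le_max_left n m)
  have h2 : √(m:ℝ) ≤ √(max n m : ℕ) := Real.sqrt_le_sqrt (by exact_mod_cast le_max_right n m)
  rw [div_le_div_iff₀ hp hd, e]
  nlinarith

lemma offdiag_one (n m : ℕ) (hn : 1 ≤ n) (hm : 1 ≤ m) (hnm : n < m) :
    (n:ℝ) ^ (-(7/8):ℝ) * (m:ℝ) ^ (-(7/8):ℝ) * (√m / |(n:ℝ) - m|)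
      ≤ (n:ℝ) ^ (-(17/16):ℝ) * |(n:ℝ) - m| ^ (-(19/16):ℝ) := by
  have hn0 : (0:ℝ) < n := by exact_mod_cast hn
  have hm0 : (0:ℝ) < m := by exact_mod_cast hm
  have hnm' : (n:ℝ) < m := by exact_mod_cast hnm
  have hd : |(n:ℝ) - m| = m - n := by rw [abs_sub_comm, abs_of_pos (by linarith)]
  rw [hd]
  set d : ℝ := m - n with hdd
  have hd0 : 0 < d := by linarith
  have e1 : (m:ℝ) ^ (-(7/8):ℝ) * √m = (m:ℝ) ^ (-(3/16):ℝ) * (m:ℝ) ^ (-(3/16):ℝ) := by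
    rw [Real.sqrt_eq_rpow, ← Real.rpow_add hm0, ← Real.rpow_add hm0]; norm_num
  have e2 : (m:ℝ) ^ (-(3/16):ℝ) ≤ (n:ℝ) ^ (-(3/16):ℝ) :=
    Real.rpow_le_rpow_of_nonpos hn0 hnm'.le (by norm_num)
  have e3 : (m:ℝ) ^ (-(3/16):ℝ) ≤ d ^ (-(3/16):ℝ) :=
    Real.rpow_le_rpow_of_nonpos hd0 (by linarith) (by norm_num)
  have e4 : (n:ℝ) ^ (-(17/16):ℝ) = (n:ℝ) ^ (-(7/8):ℝ) * (n:ℝ) ^ (-(3/16):ℝ) := by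
    rw [← Real.rpow_add hn0]; norm_num
  have e5 : d ^ (-(19/16):ℝ) = d ^ (-(3/16):ℝ) / d := by
    rw [← Real.rpow_sub_one hd0.ne']; norm_num
  rw [e4, e5]
  calc (n:ℝ) ^ (-(7/8):ℝ) * (m:ℝ) ^ (-(7/8):ℝ) * (√m / d)
      = (n:ℝ) ^ (-(7/8):ℝ) * ((m:ℝ) ^ (-(7/8):ℝ) * √m) / d := by ring
    _ = (n:ℝ) ^ (-(7/8):ℝ) * ((m:ℝ) ^ (-(3/16):ℝ) * (m:ℝ) ^ (-(3/16):ℝ)) / d := by rw [e1]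
    _ ≤ (n:ℝ) ^ (-(7/8):ℝ) * ((n:ℝ) ^ (-(3/16):ℝ) * d ^ (-(3/16):ℝ)) / d := by gcongr
    _ = _ := by ring

lemma offdiag_sum : ∃ K > (0:ℝ), ∀ s : Finset ℕ, (∀ n ∈ s, 1 ≤ n) →
    ∑ n ∈ s, ∑ m ∈ s.erase n, (n:ℝ) ^ (-(7/8):ℝ) * (m:ℝ) ^ (-(7/8):ℝ) / |√n - √m| ≤ K := by
  have hs1 : Summable (fun n : ℕ => (n:ℝ) ^ (-(17/16):ℝ)) := Real.summable_nat_rpow.2 (by norm_num)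
  have hs2 : Summable (fun k : ℤ => |(k:ℝ)| ^ (-(19/16):ℝ)) := Real.summable_abs_int_rpow (by norm_num)
  set Z1 := ∑' n : ℕ, (n:ℝ) ^ (-(17/16):ℝ) with hZ1
  set Z2 := ∑' k : ℤ, |(k:ℝ)| ^ (-(19/16):ℝ) with hZ2
  have hZ1n : 0 ≤ Z1 := tsum_nonneg fun n => by positivity
  have hZ2n : 0 ≤ Z2 := tsum_nonneg fun n => by positivity
  refine ⟨4 * (Z1 * Z2) + 1, by positivity, fun s hs => ?_⟩
  have hin : ∀ n : ℕ, ∑ m ∈ s, |(n:ℝ) - m| ^ (-(19/16):ℝ) ≤ Z2 := by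
    intro n
    have hinj : Set.InjOn (fun m : ℕ => (n:ℤ) - m) s := fun a _ b _ h => by simpa using h
    have : ∑ m ∈ s, |(n:ℝ) - m| ^ (-(19/16):ℝ) = ∑ k ∈ s.image (fun m : ℕ => (n:ℤ) - m), |(k:ℝ)| ^ (-(19/16):ℝ) := by
      rw [Finset.sum_image hinj]
      apply Finset.sum_congr rfl; intro m _; push_cast; rfl
    rw [this]
    exact hs2.sum_le_tsum _ fun k _ => by positivity
  have hout : ∑ n ∈ s, (n:ℝ) ^ (-(17/16):ℝ) ≤ Z1 := hs1.sum_le_tsum _ fun k _ => by positivity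
  have hterm : ∀ n ∈ s, ∀ m ∈ s.erase n, (n:ℝ) ^ (-(7/8):ℝ) * (m:ℝ) ^ (-(7/8):ℝ) / |√n - √m|
      ≤ 2 * ((n:ℝ) ^ (-(17/16):ℝ) * |(n:ℝ) - m| ^ (-(19/16):ℝ)) + 2 * ((m:ℝ) ^ (-(17/16):ℝ) * |(m:ℝ) - n| ^ (-(19/16):ℝ)) := by
    intro n hn m hm
    have hne : n ≠ m := (Finset.ne_of_mem_erase hm).symm
    have hms := Finset.mem_of_mem_erase hm
    have h := inv_sqrt_diff n m hne
    have p1 : 0 ≤ (n:ℝ) ^ (-(17/16):ℝ) * |(n:ℝ) - m| ^ (-(19/16):ℝ) := by positivity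
    have p2 : 0 ≤ (m:ℝ) ^ (-(17/16):ℝ) * |(m:ℝ) - n| ^ (-(19/16):ℝ) := by positivity
    have h2 : (n:ℝ) ^ (-(7/8):ℝ) * (m:ℝ) ^ (-(7/8):ℝ) / |√n - √m|
        ≤ (n:ℝ) ^ (-(7/8):ℝ) * (m:ℝ) ^ (-(7/8):ℝ) * (2 * √(max n m : ℕ) / |(n:ℝ) - m|) := by
      rw [← mul_one_div]
      exact mul_le_mul_of_nonneg_left h (by positivity)
    refine h2.trans ?_
    rcases lt_or_gt_of_ne hne with hlt | hlt
    · rw [max_eq_right hlt.le]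
      have := offdiag_one n m (hs n hn) (hs m hms) hlt
      calc _ = 2 * ((n:ℝ) ^ (-(7/8):ℝ) * (m:ℝ) ^ (-(7/8):ℝ) * (√m / |(n:ℝ) - m|)) := by ring
        _ ≤ _ := by linarith
    · rw [max_eq_left hlt.le]
      have := offdiag_one m n (hs m hms) (hs n hn) hlt
      calc _ = 2 * ((m:ℝ) ^ (-(7/8):ℝ) * (n:ℝ) ^ (-(7/8):ℝ) * (√n / |(m:ℝ) - n|)) := by
            rw [abs_sub_comm (n:ℝ) m]; ring
        _ ≤ _ := by linarith
  calc _ ≤ ∑ n ∈ s, ∑ m ∈ s.erase n, (2 * ((n:ℝ) ^ (-(17/16):ℝ) * |(n:ℝ) - m| ^ (-(19/16):ℝ)) + 2 * ((m:ℝ) ^ (-(17/16):ℝ) * |(m:ℝ) - n| ^ (-(19/16):ℝ))) :=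
        Finset.sum_le_sum fun n hn => Finset.sum_le_sum fun m hm => hterm n hn m hm
    _ ≤ ∑ n ∈ s, ∑ m ∈ s, (2 * ((n:ℝ) ^ (-(17/16):ℝ) * |(n:ℝ) - m| ^ (-(19/16):ℝ)) + 2 * ((m:ℝ) ^ (-(17/16):ℝ) * |(m:ℝ) - n| ^ (-(19/16):ℝ))) :=
        Finset.sum_le_sum fun n hn => Finset.sum_le_sum_of_subset_of_nonneg (Finset.erase_subset _ _) fun m _ _ => by positivity
    _ = 2 * (∑ n ∈ s, ∑ m ∈ s, (n:ℝ) ^ (-(17/16):ℝ) * |(n:ℝ) - m| ^ (-(19/16):ℝ))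
        + 2 * (∑ m ∈ s, ∑ n ∈ s, (m:ℝ) ^ (-(17/16):ℝ) * |(m:ℝ) - n| ^ (-(19/16):ℝ)) := by
        simp_rw [Finset.sum_add_distrib, ← Finset.mul_sum]
        congr 2
        simp_rw [Finset.mul_sum]
        exact Finset.sum_comm
    _ = 4 * ∑ n ∈ s, (n:ℝ) ^ (-(17/16):ℝ) * ∑ m ∈ s, |(n:ℝ) - m| ^ (-(19/16):ℝ) := by
        simp_rw [← Finset.mul_sum]; ring
    _ ≤ 4 * ∑ n ∈ s, (n:ℝ) ^ (-(17/16):ℝ) * Z2 := by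
        gcongr with n hn; exact hin n
    _ = 4 * ((∑ n ∈ s, (n:ℝ) ^ (-(17/16):ℝ)) * Z2) := by rw [Finset.sum_mul]
    _ ≤ 4 * (Z1 * Z2) := by gcongr
    _ ≤ _ := by linarith

lemma cs_const (a b c : ℝ) (hab : a < b) (f : ℝ → ℝ) (hf : ContinuousOn f (Set.Icc a b)) :
    ∫ u in a..b, f u ^ 2 ≤ (∫ u in a..b, f u) ^ 2 / (b - a) + ∫ u in a..b, (f u - c) ^ 2 := by
  have hf' : ContinuousOn f (Set.uIcc a b) := by rwa [Set.uIcc_of_le hab.le]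
  have e : ∫ u in a..b, (f u - c) ^ 2 = (∫ u in a..b, f u ^ 2) - 2 * c * (∫ u in a..b, f u) + c ^ 2 * (b - a) := by
    have : ∀ u, (f u - c) ^ 2 = (f u ^ 2 - 2 * c * f u) + c ^ 2 := fun u => by ring
    simp_rw [this]
    rw [intervalIntegral.integral_add, intervalIntegral.integral_sub, intervalIntegral.integral_const_mul,
      intervalIntegral.integral_const, smul_eq_mul]
    · ring
    · exact (hf'.pow 2).intervalIntegrable
    · exact (hf'.const_mul _).intervalIntegrable
    · exact ((hf'.pow 2).sub (hf'.const_mul _)).intervalIntegrable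
    · exact continuousOn_const.intervalIntegrable
  rw [e]
  have hb : 0 < b - a := by linarith
  have : 0 ≤ (∫ u in a..b, f u) ^ 2 / (b - a) - 2 * c * (∫ u in a..b, f u) + c ^ 2 * (b - a) := by
    have h : (∫ u in a..b, f u) ^ 2 / (b - a) - 2 * c * (∫ u in a..b, f u) + c ^ 2 * (b - a)
        = ((∫ u in a..b, f u) - c * (b - a)) ^ 2 / (b - a) := by field_simp; ring
    rw [h]; positivity
  linarith

lemma cs_int (a b : ℝ) (hab : a < b) (f : ℝ → ℝ) (hf : Continuous f) :
    (∫ u in a..b, f u) ^ 2 / (b - a) ≤ ∫ u in a..b, f u ^ 2 := by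
  set c := (∫ u in a..b, f u) / (b - a) with hc
  have hb : 0 < b - a := by linarith
  have h0 : 0 ≤ ∫ u in a..b, (f u - c) ^ 2 :=
    intervalIntegral.integral_nonneg hab.le fun u _ => sq_nonneg _
  have e : ∫ u in a..b, (f u - c) ^ 2 = (∫ u in a..b, f u ^ 2) - 2 * c * (∫ u in a..b, f u) + c ^ 2 * (b - a) := by
    have : ∀ u, (f u - c) ^ 2 = (f u ^ 2 - 2 * c * f u) + c ^ 2 := fun u => by ring
    simp_rw [this]
    rw [intervalIntegral.integral_add, intervalIntegral.integral_sub, intervalIntegral.integral_const_mul,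
      intervalIntegral.integral_const, smul_eq_mul]
    · ring
    all_goals apply Continuous.intervalIntegrable; fun_prop
  rw [e, hc] at h0
  have h2 : 2 * ((∫ u in a..b, f u) / (b - a)) * (∫ u in a..b, f u) = 2 * ((∫ u in a..b, f u) ^ 2 / (b - a)) := by ring
  have h3 : ((∫ u in a..b, f u) / (b - a)) ^ 2 * (b - a) = (∫ u in a..b, f u) ^ 2 / (b - a) := by field_simp
  rw [h2, h3] at h0
  linarith

lemma weak_l2 (a b : ℝ) (hab : a < b) (f : ℝ → ℝ) (hf : ContinuousOn f (Set.Icc a b)) (T : ℕ → ℝ → ℝ)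
    (hT : ∀ N, Continuous (T N))
    (hlim : ∀ x1 x2, a ≤ x1 → x1 ≤ x2 → x2 ≤ b →
      Tendsto (fun N => ∫ u in x1..x2, T N u) atTop (nhds (∫ u in x1..x2, f u)))
    (B : ℝ) (hB : ∀ᶠ N in atTop, ∫ u in a..b, T N u ^ 2 ≤ B) :
    ∫ u in a..b, f u ^ 2 ≤ B := by
  have hb : 0 < b - a := by linarith
  have key : ∀ ε > 0, ∫ u in a..b, f u ^ 2 ≤ B + ε ^ 2 * (b - a) := by
    intro ε hε
    have huc := isCompact_Icc.uniformContinuousOn_of_continuous hf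
    rw [Metric.uniformContinuousOn_iff] at huc
    obtain ⟨δ, hδ, hd⟩ := huc ε hε
    obtain ⟨k, hk⟩ := exists_nat_gt ((b - a) / δ)
    have hk0 : 0 < (k:ℝ) := lt_trans (by positivity) hk
    set h := (b - a) / k with hh
    have hh0 : 0 < h := by positivity
    have hhδ : h < δ := by rw [hh, div_lt_iff₀ hk0]; rw [div_lt_iff₀ hδ] at hk; linarith
    set x : ℕ → ℝ := fun i => a + i * h with hx
    have hx0 : x 0 = a := by simp [hx]
    have hxk : x k = b := by simp only [hx, hh]; field_simp; ring
    have hxs : ∀ i, x (i + 1) - x i = h := fun i => by simp only [hx]; push_cast; ring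
    have hxm : ∀ i, a ≤ x i := fun i => by simp only [hx]; nlinarith [Nat.cast_nonneg (α := ℝ) i]
    have hxb : ∀ i, i ≤ k → x i ≤ b := fun i hi => by
      rw [← hxk]; simp only [hx]
      have : (i:ℝ) ≤ k := by exact_mod_cast hi
      nlinarith
    have hsub : ∀ i < k, Set.Icc (x i) (x (i+1)) ⊆ Set.Icc a b := fun i hi =>
      Set.Icc_subset_Icc (hxm i) (hxb _ hi)
    have hlt : ∀ i, x i < x (i+1) := fun i => by linarith [hxs i]
    have hsumf : ∑ i ∈ Finset.range k, ∫ u in x i..x (i+1), f u ^ 2 = ∫ u in a..b, f u ^ 2 := by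
      rw [intervalIntegral.sum_integral_adjacent_intervals, hx0, hxk]
      intro i hi
      apply ContinuousOn.intervalIntegrable
      rw [Set.uIcc_of_le (hlt i).le]
      exact (hf.mono (hsub i hi)).pow 2
    have hsumT : ∀ N, ∑ i ∈ Finset.range k, ∫ u in x i..x (i+1), T N u ^ 2 = ∫ u in a..b, T N u ^ 2 := by
      intro N
      rw [intervalIntegral.sum_integral_adjacent_intervals, hx0, hxk]
      intro i hi
      apply Continuous.intervalIntegrable
      exact (hT N).pow 2
    have hpart : ∀ i ∈ Finset.range k, ∫ u in x i..x (i+1), f u ^ 2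
        ≤ (∫ u in x i..x (i+1), f u) ^ 2 / h + ε ^ 2 * h := by
      intro i hi
      rw [Finset.mem_range] at hi
      have h1 := cs_const (x i) (x (i+1)) (f (x i)) (hlt i) f (hf.mono (hsub i hi))
      rw [hxs] at h1
      have h2 : ∫ u in x i..x (i+1), (f u - f (x i)) ^ 2 ≤ ∫ u in x i..x (i+1), ε ^ 2 := by
        apply intervalIntegral.integral_mono_on (hlt i).le
        · apply ContinuousOn.intervalIntegrable
          rw [Set.uIcc_of_le (hlt i).le]
          exact ((hf.mono (hsub i hi)).sub continuousOn_const).pow 2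
        · exact continuousOn_const.intervalIntegrable
        · intro u hu
          have h3 := hd u (hsub i hi hu) (x i) (hsub i hi ⟨le_rfl, (hlt i).le⟩) (by
            rw [Real.dist_eq, abs_of_nonneg (by linarith [hu.1])]; linarith [hu.2, hxs i])
          rw [Real.dist_eq] at h3
          rw [← sq_abs]
          exact pow_le_pow_left₀ (abs_nonneg _) h3.le 2
      rw [intervalIntegral.integral_const, hxs, smul_eq_mul] at h2
      linarith
    have hl : Tendsto (fun N => ∑ i ∈ Finset.range k, (∫ u in x i..x (i+1), T N u) ^ 2 / h) atTop
        (nhds (∑ i ∈ Finset.range k, (∫ u in x i..x (i+1), f u) ^ 2 / h)) := by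
      apply tendsto_finsetSum
      intro i hi
      rw [Finset.mem_range] at hi
      exact ((hlim _ _ (hxm i) (hlt i).le (hxb _ hi)).pow 2).div_const h
    have hle : ∑ i ∈ Finset.range k, (∫ u in x i..x (i+1), f u) ^ 2 / h ≤ B := by
      apply le_of_tendsto hl
      filter_upwards [hB] with N hN
      refine le_trans ?_ hN
      rw [← hsumT N]
      apply Finset.sum_le_sum
      intro i _
      have := cs_int (x i) (x (i+1)) (hlt i) (T N) (hT N)
      rwa [hxs] at this
    calc ∫ u in a..b, f u ^ 2 = ∑ i ∈ Finset.range k, ∫ u in x i..x (i+1), f u ^ 2 := hsumf.symm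
      _ ≤ ∑ i ∈ Finset.range k, ((∫ u in x i..x (i+1), f u) ^ 2 / h + ε ^ 2 * h) := Finset.sum_le_sum hpart
      _ = ∑ i ∈ Finset.range k, (∫ u in x i..x (i+1), f u) ^ 2 / h + ε ^ 2 * (b - a) := by
        rw [Finset.sum_add_distrib, Finset.sum_const, Finset.card_range, nsmul_eq_mul, hh]
        congr 1; field_simp
      _ ≤ _ := by linarith
  have ht : Tendsto (fun ε : ℝ => B + ε ^ 2 * (b - a)) (nhdsWithin 0 (Set.Ioi 0)) (nhds (B + 0 ^ 2 * (b - a))) := by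
    apply Tendsto.mono_left _ nhdsWithin_le_nhds
    apply Continuous.tendsto; fun_prop
  have := ge_of_tendsto ht (by filter_upwards [self_mem_nhdsWithin] with ε hε using key ε hε)
  simpa using this

/-- Coefficients. -/
def cc (n : ℕ) : ℝ := (√2 / π) * (r2 n : ℝ) / n

/-- The truncated trigonometric polynomial. -/
def PY (Y : ℕ) (u : ℝ) : ℝ := -∑ n ∈ Finset.Icc 1 Y, cc n * Real.cos (2 * π * √n * u)

lemma PY_cont (Y : ℕ) : Continuous (PY Y) := by unfold PY; fun_prop

lemma s2pi_le : √2 / π ≤ 1 := by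
  have hs2 : √2 ≤ 2 := by rw [Real.sqrt_le_left (by norm_num)]; norm_num
  rw [div_le_one Real.pi_pos]; linarith [Real.pi_gt_three]

lemma cc_nonneg (n : ℕ) : 0 ≤ cc n := by unfold cc; positivity

lemma cc_le (n : ℕ) : cc n ≤ r2 n / n := by
  unfold cc
  have := s2pi_le
  gcongr
  have h : (0:ℝ) ≤ r2 n := by positivity
  nlinarith

lemma Eterm_bound : ∃ K > (0:ℝ), ∀ N : ℕ, ∀ u > 0,
    |∑ n ∈ Finset.Icc 1 N, (r2 n : ℝ) * (hn n u + (√2 / π) / n * Real.cos (2 * π * √n * u))| ≤ K / u := by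
  obtain ⟨K, hK1, hK⟩ := r2_le_rpow (1/8) (by norm_num)
  have hs1 : Summable (fun n : ℕ => (n:ℝ) ^ (-(11/8):ℝ)) := Real.summable_nat_rpow.2 (by norm_num)
  set Z := ∑' n : ℕ, (n:ℝ) ^ (-(11/8):ℝ) with hZ
  have hZ0 : 0 ≤ Z := tsum_nonneg fun n => by positivity
  refine ⟨2 * K * (Z + 1), by positivity, fun N u hu => ?_⟩
  have hterm : ∀ n ∈ Finset.Icc 1 N, |(r2 n : ℝ) * (hn n u + (√2 / π) / n * Real.cos (2 * π * √n * u))|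
      ≤ (2 * K / u) * (n:ℝ) ^ (-(11/8):ℝ) := by
    intro n hn1
    rw [Finset.mem_Icc] at hn1
    have hn0 : (0:ℝ) < n := by exact_mod_cast hn1.1
    have h := Phi_err u (√n) hu (Real.sqrt_pos.2 hn0)
    rw [Real.sq_sqrt hn0.le] at h
    rw [abs_mul, abs_of_nonneg (by positivity : (0:ℝ) ≤ r2 n)]
    have e : 2 / (u * √(n:ℝ) ^ 3) = 2 / u * (n:ℝ) ^ (-(3/2):ℝ) := by
      have : √(n:ℝ) ^ 3 = (n:ℝ) ^ ((3/2):ℝ) := by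
        rw [Real.sqrt_eq_rpow, ← Real.rpow_natCast, ← Real.rpow_mul hn0.le]; norm_num
      rw [this, Real.rpow_neg hn0.le]; field_simp
    rw [e] at h
    calc _ ≤ (K * (n:ℝ) ^ ((1/8):ℝ)) * (2 / u * (n:ℝ) ^ (-(3/2):ℝ)) :=
          mul_le_mul (hK n hn1.1) h (abs_nonneg _) (by positivity)
      _ = (2 * K / u) * ((n:ℝ) ^ ((1/8):ℝ) * (n:ℝ) ^ (-(3/2):ℝ)) := by ring
      _ = _ := by rw [← Real.rpow_add hn0]; norm_num
  calc _ ≤ ∑ n ∈ Finset.Icc 1 N, (2 * K / u) * (n:ℝ) ^ (-(11/8):ℝ) :=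
        (Finset.abs_sum_le_sum_abs _ _).trans (Finset.sum_le_sum hterm)
    _ = (2 * K / u) * ∑ n ∈ Finset.Icc 1 N, (n:ℝ) ^ (-(11/8):ℝ) := by rw [Finset.mul_sum]
    _ ≤ (2 * K / u) * Z := by
        gcongr; exact hs1.sum_le_tsum _ fun k _ => by positivity
    _ ≤ _ := by
        rw [div_mul_eq_mul_div]; gcongr; linarith

lemma Qtail_ms : ∃ K > (0:ℝ), ∀ X : ℝ, 1 ≤ X → ∀ Y N : ℕ, 1 ≤ Y →
    ∫ u in X..(3 * X), (∑ n ∈ Finset.Ioc Y N, cc n * Real.cos (2 * π * √n * u)) ^ 2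
      ≤ K * (X * (1 + Real.log Y) / Y + 1) := by
  obtain ⟨K, hK1, hK⟩ := r2_le_rpow (1/8) (by norm_num)
  obtain ⟨K2, hK2, hoff⟩ := offdiag_sum
  refine ⟨16000 + K ^ 2 * K2, by positivity, fun X hX Y N hY => ?_⟩
  have h := cos_ms (Finset.Ioc Y N) cc 0 X (3 * X) (by linarith)
  simp only [add_zero] at h
  refine h.trans ?_
  have hpos : ∀ n ∈ Finset.Ioc Y N, 1 ≤ n := fun n hn => by rw [Finset.mem_Ioc] at hn; omega
  have hlog : 0 ≤ Real.log Y := Real.log_nonneg (by exact_mod_cast hY)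
  have hY0 : (0:ℝ) < Y := by exact_mod_cast hY
  have d1 : ∑ n ∈ Finset.Ioc Y N, cc n ^ 2 ≤ 8000 * (1 + Real.log Y) / Y := by
    refine le_trans (Finset.sum_le_sum fun n _ => ?_) (sum_r2_sq_div_sq_le Y N hY)
    rw [← div_pow]
    exact pow_le_pow_left₀ (cc_nonneg n) (cc_le n) 2
  have hccK : ∀ n : ℕ, 1 ≤ n → |cc n| ≤ K * (n:ℝ) ^ (-(7/8):ℝ) := by
    intro n hn
    have hn0 : (0:ℝ) < n := by exact_mod_cast hn
    rw [abs_of_nonneg (cc_nonneg n)]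
    refine (cc_le n).trans ?_
    have : (n:ℝ) ^ (-(7/8):ℝ) = (n:ℝ) ^ ((1/8):ℝ) / n := by rw [← Real.rpow_sub_one hn0.ne']; norm_num
    rw [this, ← mul_div_assoc]
    gcongr
    exact hK n hn
  have d2 : ∑ n ∈ Finset.Ioc Y N, ∑ m ∈ (Finset.Ioc Y N).erase n, |cc n| * |cc m| / |√n - √m| ≤ K ^ 2 * K2 := by
    calc _ ≤ ∑ n ∈ Finset.Ioc Y N, ∑ m ∈ (Finset.Ioc Y N).erase n, K ^ 2 * ((n:ℝ) ^ (-(7/8):ℝ) * (m:ℝ) ^ (-(7/8):ℝ) / |√n - √m|) := by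
          apply Finset.sum_le_sum; intro n hn
          apply Finset.sum_le_sum; intro m hm
          rw [← mul_div_assoc]
          refine div_le_div_of_nonneg_right ?_ (abs_nonneg _)
          calc _ ≤ (K * (n:ℝ) ^ (-(7/8):ℝ)) * (K * (m:ℝ) ^ (-(7/8):ℝ)) :=
                mul_le_mul (hccK n (hpos n hn)) (hccK m (hpos m (Finset.mem_of_mem_erase hm))) (abs_nonneg _) (by positivity)
            _ = _ := by ring
      _ = K ^ 2 * ∑ n ∈ Finset.Ioc Y N, ∑ m ∈ (Finset.Ioc Y N).erase n, ((n:ℝ) ^ (-(7/8):ℝ) * (m:ℝ) ^ (-(7/8):ℝ) / |√n - √m|) := by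
          simp_rw [Finset.mul_sum]
      _ ≤ _ := by gcongr; exact hoff _ hpos
  have e1 : (3 * X - X) * ∑ n ∈ Finset.Ioc Y N, cc n ^ 2 ≤ 16000 * (X * (1 + Real.log Y) / Y) := by
    calc _ ≤ (3 * X - X) * (8000 * (1 + Real.log Y) / Y) := by
          apply mul_le_mul_of_nonneg_left d1; linarith
      _ = _ := by ring
  have p1 : 0 ≤ X * (1 + Real.log Y) / Y := by positivity
  have p2 : 0 ≤ K ^ 2 * K2 := by positivity
  nlinarith

lemma H_ms : ∃ K > (0:ℝ), ∀ X : ℝ, 1 ≤ X → ∀ Y T : ℕ, 1 ≤ Y → (3 * X) ^ 2 ≤ T →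
    ∫ u in X..(3 * X), (MainS T u / u ^ 2 - volB * u ^ 2 - PY Y u) ^ 2
      ≤ K * (X * (1 + Real.log Y) / Y + 1) := by
  obtain ⟨K1, hK1, hE⟩ := Eterm_bound
  obtain ⟨K2, hK2, hQ⟩ := Qtail_ms
  refine ⟨2 * K2 + 4 * K1 ^ 2, by positivity, fun X hX Y T hY hT => ?_⟩
  have hlog : 0 ≤ Real.log Y := Real.log_nonneg (by exact_mod_cast hY)
  have hX0 : 0 < X := by linarith
  have hT1 : 1 ≤ T := by
    have : (1:ℝ) ≤ T := by nlinarith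
    exact_mod_cast this
  have hhc := hn_cont
  have hPc := PY_cont Y
  have hpos : ∀ u ∈ Set.Icc X (3 * X), u ≠ 0 := fun u hu => by linarith [hu.1]
  have hMc : ContinuousOn (fun u => MainS T u / u ^ 2) (Set.Icc X (3 * X)) := by
    apply ContinuousOn.div
    · unfold MainS
      have := fun m => fph_cont m
      fun_prop
    · fun_prop
    · intro u hu; exact pow_ne_zero 2 (hpos u hu)
  apply weak_l2 X (3 * X) (by linarith) _ _ (fun N u => (∑ n ∈ Finset.Icc 1 N, (r2 n : ℝ) * hn n u) - PY Y u)
  · intro N; fun_prop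
  · intro x1 x2 h1 h12 h2
    have hp := MainS_poisson x1 x2 (by linarith) h12 T (le_trans (pow_le_pow_left₀ (by linarith) h2 2) hT) hT1
    have hsub : Set.uIcc x1 x2 ⊆ Set.Icc X (3 * X) := by
      rw [Set.uIcc_of_le h12]; exact Set.Icc_subset_Icc h1 h2
    have e1 : ∫ u in x1..x2, (MainS T u / u ^ 2 - volB * u ^ 2 - PY Y u)
        = (∫ u in x1..x2, MainS T u / u ^ 2) - (∫ u in x1..x2, hn 0 u) - ∫ u in x1..x2, PY Y u := by
      rw [← intervalIntegral.integral_sub, ← intervalIntegral.integral_sub]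
      · congr 1; funext u; simp [hn, Phi_zero]; ring
      · exact ((hMc.mono hsub).intervalIntegrable).sub ((hhc 0).intervalIntegrable _ _)
      · exact hPc.intervalIntegrable _ _
      · exact (hMc.mono hsub).intervalIntegrable
      · exact (hhc 0).intervalIntegrable _ _
    have e2 : ∀ N : ℕ, ∫ u in x1..x2, ((∑ n ∈ Finset.Icc 1 N, (r2 n : ℝ) * hn n u) - PY Y u)
        = (∑ n ∈ Finset.range (N + 1), (r2 n : ℝ) * ∫ u in x1..x2, hn n u) - (∫ u in x1..x2, hn 0 u) - ∫ u in x1..x2, PY Y u := by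
      intro N
      rw [range_eq_insert, Finset.sum_insert (by simp), r2_zero, intervalIntegral.integral_sub,
        intervalIntegral.integral_finsetSum]
      · simp_rw [intervalIntegral.integral_const_mul]; push_cast; ring
      · intro n _; apply Continuous.intervalIntegrable; fun_prop
      · apply Continuous.intervalIntegrable; fun_prop
      · apply Continuous.intervalIntegrable; fun_prop
    simp_rw [e1, e2]
    exact (hp.sub_const _).sub_const _
  · filter_upwards [eventually_ge_atTop Y] with N hN
    have hq := hQ X hX Y N hY
    set q := fun u => ∑ n ∈ Finset.Ioc Y N, cc n * Real.cos (2 * π * √n * u) with hqd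
    set E := fun u => ∑ n ∈ Finset.Icc 1 N, (r2 n : ℝ) * (hn n u + (√2 / π) / n * Real.cos (2 * π * √n * u)) with hEd
    have hqc : Continuous q := by simp only [hqd]; fun_prop
    have hEc : Continuous E := by simp only [hEd]; fun_prop
    have hdec : ∀ u, (∑ n ∈ Finset.Icc 1 N, (r2 n : ℝ) * hn n u) - PY Y u = E u - q u := by
      intro u
      have hs : Finset.Icc 1 N = Finset.Icc 1 Y ∪ Finset.Ioc Y N := by
        ext n; simp only [Finset.mem_Icc, Finset.mem_union, Finset.mem_Ioc]; omega
      have hdj : Disjoint (Finset.Icc 1 Y) (Finset.Ioc Y N) := by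
        rw [Finset.disjoint_left]; intro n h1 h2
        simp only [Finset.mem_Icc, Finset.mem_Ioc] at h1 h2; omega
      have h3 : ∑ n ∈ Finset.Icc 1 N, cc n * Real.cos (2 * π * √n * u) = - PY Y u + q u := by
        rw [hs, Finset.sum_union hdj]; simp [PY, hqd]
      have h4 : E u = (∑ n ∈ Finset.Icc 1 N, (r2 n : ℝ) * hn n u) + ∑ n ∈ Finset.Icc 1 N, cc n * Real.cos (2 * π * √n * u) := by
        simp only [hEd]
        rw [← Finset.sum_add_distrib]
        apply Finset.sum_congr rfl
        intro n _; unfold cc; ring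
      rw [h4, h3]; ring
    have hpt : ∀ u ∈ Set.Icc X (3 * X), ((∑ n ∈ Finset.Icc 1 N, (r2 n : ℝ) * hn n u) - PY Y u) ^ 2
        ≤ 2 * q u ^ 2 + 2 * (K1 / X) ^ 2 := by
      intro u hu
      rw [hdec]
      have h1 : |E u| ≤ K1 / X := (hE N u (by linarith [hu.1])).trans (by have := hu.1; gcongr)
      have h2 : E u ^ 2 ≤ (K1 / X) ^ 2 := by rw [← sq_abs]; exact pow_le_pow_left₀ (abs_nonneg _) h1 2
      nlinarith [sq_nonneg (E u + q u)]
    have hI : ∫ u in X..(3 * X), ((∑ n ∈ Finset.Icc 1 N, (r2 n : ℝ) * hn n u) - PY Y u) ^ 2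
        ≤ ∫ u in X..(3 * X), (2 * q u ^ 2 + 2 * (K1 / X) ^ 2) := by
      apply intervalIntegral.integral_mono_on (by linarith) _ _ hpt
      · apply Continuous.intervalIntegrable; fun_prop
      · apply Continuous.intervalIntegrable; fun_prop
    rw [intervalIntegral.integral_add (by apply Continuous.intervalIntegrable; fun_prop) (by apply Continuous.intervalIntegrable; fun_prop),
      intervalIntegral.integral_const_mul, intervalIntegral.integral_const, smul_eq_mul] at hI
    have e5 : (3 * X - X) * (2 * (K1 / X) ^ 2) ≤ 4 * K1 ^ 2 := by
      have : (3 * X - X) * (2 * (K1 / X) ^ 2) = 4 * K1 ^ 2 / X := by field_simp; ring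
      rw [this]; exact div_le_self (by positivity) hX
    have p1 : 0 ≤ X * (1 + Real.log Y) / Y := by positivity
    have p2 : 0 ≤ K1 ^ 2 := by positivity
    nlinarith
  · exact (hMc.sub (by fun_prop)).sub hPc.continuousOn

/-- Normalized remainder of the lattice point count. -/
def RR (x : ℝ) : ℝ := if 0 < x then ((latticeCount x : ℝ) - volB * x ^ 4) / x ^ 2 else 0

lemma sawtooth_abs (t : ℝ) : |sawtooth t| ≤ 1 := by
  unfold sawtooth
  have h1 := Int.floor_le t
  have h2 := Int.lt_floor_add_one t
  rw [abs_le]; constructor <;> linarith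

lemma Dsum_bdd (T : ℕ) (x : ℝ) : |Dsum T x| ≤ ∑ m ∈ Finset.range (T + 1), (r2 m : ℝ) := by
  unfold Dsum
  refine (Finset.abs_sum_le_sum_abs _ _).trans (Finset.sum_le_sum fun m _ => ?_)
  rw [abs_mul, abs_mul, abs_of_nonneg (by positivity : (0:ℝ) ≤ r2 m), abs_of_nonneg (ind_nonneg m x)]
  have h : ind m x * |sawtooth (fph m x)| ≤ 1 * 1 :=
    mul_le_mul (ind_le_one m x) (sawtooth_abs _) (abs_nonneg _) (by norm_num)
  have : (0:ℝ) ≤ r2 m := by positivity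
  nlinarith

lemma MainS_cont (T : ℕ) : Continuous (MainS T) := by
  unfold MainS
  have := fun m => fph_cont m
  fun_prop

lemma RR_eq (x : ℝ) (hx : 0 < x) (T : ℕ) (hT : x ^ 2 < T + 1) :
    RR x = (MainS T x - 2 * Dsum T x - volB * x ^ 4) / x ^ 2 := by
  unfold RR; rw [if_pos hx, latticeCount_eq x hx T hT]

lemma RR_meas : Measurable RR := by
  refine measurable_of_tendsto_metrizable (f := fun (n : ℕ) (x : ℝ) =>
    if 0 < x ∧ x ^ 2 < n + 1 then (MainS n x - 2 * Dsum n x - volB * x ^ 4) / x ^ 2 else 0) ?_ ?_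
  · intro n
    refine Measurable.ite ?_ ?_ measurable_const
    · exact (measurableSet_lt measurable_const measurable_id).inter
        (measurableSet_lt (f := fun x : ℝ => x ^ 2) (g := fun _ => (n : ℝ) + 1) (by fun_prop)
          measurable_const)
    · have h1 := (MainS_cont n).measurable
      have h2 := Dsum_meas n
      fun_prop
  · rw [tendsto_pi_nhds]
    intro x
    refine tendsto_const_nhds.congr' ?_
    obtain ⟨n0, hn0⟩ := exists_nat_gt (x ^ 2)
    filter_upwards [eventually_ge_atTop n0] with n hn
    have hlt : x ^ 2 < n + 1 := by
      have : (n0:ℝ) ≤ n := by exact_mod_cast hn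
      linarith
    by_cases hx : 0 < x
    · rw [if_pos ⟨hx, hlt⟩]; exact RR_eq x hx n hlt
    · rw [if_neg (fun h => hx h.1)]; unfold RR; rw [if_neg hx]

lemma RR_bdd (a b : ℝ) (ha : 0 < a) : ∃ M, ∀ x ∈ Set.Icc a b, |RR x| ≤ M := by
  obtain ⟨T, hT⟩ := exists_nat_gt (b ^ 2)
  have hc : ContinuousOn (fun x => (MainS T x - volB * x ^ 4) / x ^ 2) (Set.Icc a b) := by
    have h1 := MainS_cont T
    apply ContinuousOn.div (by fun_prop) (by fun_prop)
    intro x hx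
    have : 0 < x := lt_of_lt_of_le ha hx.1
    positivity
  obtain ⟨M, hM⟩ := isCompact_Icc.exists_bound_of_continuousOn hc
  refine ⟨M + 2 * (∑ m ∈ Finset.range (T + 1), (r2 m : ℝ)) / a ^ 2, fun x hx => ?_⟩
  have hx0 : 0 < x := lt_of_lt_of_le ha hx.1
  have hxT : x ^ 2 < T + 1 := by
    have := pow_le_pow_left₀ hx0.le hx.2 2
    linarith
  rw [RR_eq x hx0 T hxT]
  have e : (MainS T x - 2 * Dsum T x - volB * x ^ 4) / x ^ 2
      = (MainS T x - volB * x ^ 4) / x ^ 2 - 2 * Dsum T x / x ^ 2 := by ring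
  rw [e]
  refine (abs_sub _ _).trans ?_
  have h1 := hM x hx
  rw [Real.norm_eq_abs] at h1
  have h2 : |2 * Dsum T x / x ^ 2| ≤ 2 * (∑ m ∈ Finset.range (T + 1), (r2 m : ℝ)) / a ^ 2 := by
    rw [abs_div, abs_mul, abs_of_pos (by norm_num : (0:ℝ) < 2), abs_of_pos (by positivity : 0 < x ^ 2)]
    have := Dsum_bdd T x
    have h3 := hx.1
    have h0 : 0 ≤ |Dsum T x| := abs_nonneg _
    gcongr
  linarith

lemma ii_of_bdd_on {f : ℝ → ℝ} (hf : Measurable f) (C a b : ℝ) (hab : a ≤ b)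
    (h : ∀ x ∈ Set.Icc a b, |f x| ≤ C) : IntervalIntegrable f volume a b := by
  rw [intervalIntegrable_iff, Set.uIoc_of_le hab]
  refine Measure.integrableOn_of_bounded (M := C) ?_ hf.aestronglyMeasurable ?_
  · simp [Real.volume_Ioc]
  · filter_upwards [ae_restrict_mem measurableSet_Ioc] with x hx
    exact h x ⟨hx.1.le, hx.2⟩

lemma RP_meas (Y : ℕ) : Measurable (fun x => RR x - PY Y x) := RR_meas.sub (PY_cont Y).measurable

lemma RP_bdd (Y : ℕ) (a b : ℝ) (ha : 0 < a) : ∃ M, ∀ x ∈ Set.Icc a b, |RR x - PY Y x| ≤ M := by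
  obtain ⟨M1, h1⟩ := RR_bdd a b ha
  obtain ⟨M2, h2⟩ := isCompact_Icc.exists_bound_of_continuousOn (s := Set.Icc a b) (PY_cont Y).continuousOn
  refine ⟨M1 + M2, fun x hx => ?_⟩
  have := h2 x hx
  rw [Real.norm_eq_abs] at this
  linarith [abs_sub (RR x) (PY Y x), h1 x hx]

lemma RP_ii (Y : ℕ) (a b : ℝ) (ha : 0 < a) (hab : a ≤ b) :
    IntervalIntegrable (fun x => (RR x - PY Y x) ^ 2) volume a b := by
  obtain ⟨M, hM⟩ := RP_bdd Y a b ha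
  apply ii_of_bdd_on ((RP_meas Y).pow_const 2) (M ^ 2) a b hab
  intro x hx
  rw [abs_pow]
  exact pow_le_pow_left₀ (abs_nonneg _) (hM x hx) 2

lemma R_ms : ∃ K > (0:ℝ), ∀ X : ℝ, 1 ≤ X → ∀ Y : ℕ, 1 ≤ Y →
    ∫ u in X..(3 * X), (RR u - PY Y u) ^ 2
      ≤ K * (X * (1 + Real.log Y) / Y + X ^ ((1:ℝ)/2)) := by
  obtain ⟨K1, hK1, hH⟩ := H_ms
  obtain ⟨K2, hK2, hD⟩ := Dsum_mean
  refine ⟨2 * K1 + 8 * K2, by positivity, fun X hX Y hY => ?_⟩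
  have hX0 : 0 < X := by linarith
  set T := ⌊9 * X ^ 2⌋₊ with hTd
  have hT1 : (T:ℝ) ≤ 9 * X ^ 2 := Nat.floor_le (by positivity)
  have hT2 : 9 * X ^ 2 < T + 1 := Nat.lt_floor_add_one _
  have hTn : 1 ≤ T := by
    rw [hTd]; apply Nat.le_floor; push_cast; nlinarith
  have h1 := hH X hX Y (T + 1) hY (by push_cast; nlinarith)
  have h2 := hD X hX T hTn hT1
  have hpt : ∀ u ∈ Set.Icc X (3 * X), (RR u - PY Y u) ^ 2
      ≤ 2 * (MainS (T+1) u / u ^ 2 - volB * u ^ 2 - PY Y u) ^ 2 + 8 / X ^ 4 * Dsum T u ^ 2 := by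
    intro u hu
    have hu0 : 0 < u := by linarith [hu.1]
    have hu2 : u ^ 2 ≤ 9 * X ^ 2 := by nlinarith [hu.2]
    have e0 : MainS (T+1) u = MainS T u := by
      unfold MainS
      rw [Finset.sum_range_succ, fph_zero_of_le (T+1) u hu0.le (by push_cast; linarith)]; ring
    rw [RR_eq u hu0 T (by linarith), e0]
    have e : (MainS T u - 2 * Dsum T u - volB * u ^ 4) / u ^ 2 - PY Y u
        = (MainS T u / u ^ 2 - volB * u ^ 2 - PY Y u) - 2 * Dsum T u / u ^ 2 := by field_simp; ring
    rw [e]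
    set A := MainS T u / u ^ 2 - volB * u ^ 2 - PY Y u
    have h3 : (2 * Dsum T u / u ^ 2) ^ 2 ≤ 4 / X ^ 4 * Dsum T u ^ 2 := by
      have : (2 * Dsum T u / u ^ 2) ^ 2 = 4 / u ^ 4 * Dsum T u ^ 2 := by field_simp; ring
      rw [this]
      have := hu.1
      gcongr
    have h4 : 8 / X ^ 4 * Dsum T u ^ 2 = 2 * (4 / X ^ 4 * Dsum T u ^ 2) := by ring
    rw [h4]
    nlinarith [sq_nonneg (A + 2 * Dsum T u / u ^ 2)]
  have hPc := PY_cont Y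
  have hMc : ContinuousOn (fun u => (MainS (T+1) u / u ^ 2 - volB * u ^ 2 - PY Y u) ^ 2) (Set.uIcc X (3 * X)) := by
    rw [Set.uIcc_of_le (by linarith)]
    have hm := MainS_cont (T+1)
    have : ContinuousOn (fun u => MainS (T+1) u / u ^ 2) (Set.Icc X (3 * X)) := by
      apply ContinuousOn.div (by fun_prop) (by fun_prop)
      intro u hu
      have : 0 < u := by linarith [hu.1]
      positivity
    exact ((this.sub (by fun_prop)).sub hPc.continuousOn).pow 2
  have hDi : IntervalIntegrable (fun u => Dsum T u ^ 2) volume X (3 * X) := by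
    apply ii_of_bdd ((Dsum_meas T).pow_const 2) ((∑ m ∈ Finset.range (T + 1), (r2 m : ℝ)) ^ 2)
    intro x
    rw [abs_pow]; exact pow_le_pow_left₀ (abs_nonneg _) (Dsum_bdd T x) 2
  have hI := intervalIntegral.integral_mono_on (by linarith : X ≤ 3 * X) (RP_ii Y X (3 * X) hX0 (by linarith))
    ((hMc.intervalIntegrable.const_mul 2).add (hDi.const_mul (8 / X ^ 4))) hpt
  rw [intervalIntegral.integral_add (hMc.intervalIntegrable.const_mul 2) (hDi.const_mul (8 / X ^ 4)),
    intervalIntegral.integral_const_mul, intervalIntegral.integral_const_mul] at hI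
  have e3 : 8 / X ^ 4 * ∫ u in X..(3 * X), Dsum T u ^ 2 ≤ 8 * K2 * X ^ ((1:ℝ)/2) := by
    calc _ ≤ 8 / X ^ 4 * (K2 * (X ^ 4 * X ^ ((1:ℝ) / 2))) := by gcongr
      _ = _ := by field_simp
  have hx1 : 1 ≤ X ^ ((1:ℝ)/2) := Real.one_le_rpow hX (by norm_num)
  have hlog : 0 ≤ Real.log Y := Real.log_nonneg (by exact_mod_cast hY)
  have p1 : 0 ≤ X * (1 + Real.log Y) / Y := by positivity
  nlinarith

/-- Uniform convergence for slowly varying functions, additive form. -/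
lemma uct_add (g : ℝ → ℝ) (hg : Continuous g)
    (h : ∀ v : ℝ, Tendsto (fun u => g (u + v) - g u) atTop (nhds 0)) (ε : ℝ) (hε : 0 < ε) (b : ℝ) :
    ∀ᶠ u in atTop, ∀ v ∈ Set.Icc 0 b, |g (u + v) - g u| ≤ ε := by
  -- Baire
  obtain ⟨n, v0, hv0⟩ : ∃ n : ℕ, (interior {v : ℝ | ∀ u : ℝ, (n:ℝ) ≤ u → |g (u + v) - g u| ≤ ε / 3}).Nonempty := by
    refine nonempty_interior_of_iUnion_of_closed (f := fun n : ℕ => {v : ℝ | ∀ u : ℝ, (n:ℝ) ≤ u → |g (u + v) - g u| ≤ ε / 3}) ?_ ?_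
    · intro n
      have : {v : ℝ | ∀ u : ℝ, (n:ℝ) ≤ u → |g (u + v) - g u| ≤ ε / 3}
          = ⋂ u : ℝ, ⋂ _ : (n:ℝ) ≤ u, {v : ℝ | |g (u + v) - g u| ≤ ε / 3} := by
        ext v; simp
      rw [this]
      refine isClosed_iInter fun u => isClosed_iInter fun _ => ?_
      exact isClosed_le (by fun_prop) continuous_const
    · rw [Set.eq_univ_iff_forall]
      intro v
      have h1 := (h v).abs
      rw [abs_zero] at h1
      have h2 := h1.eventually (gt_mem_nhds (show (0:ℝ) < ε / 3 by positivity))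
      obtain ⟨u0, hu0⟩ := eventually_atTop.1 h2
      obtain ⟨n, hn⟩ := exists_nat_gt u0
      rw [Set.mem_iUnion]
      exact ⟨n, fun u hu => (hu0 u (by linarith)).le⟩
  obtain ⟨δ, hδ, hball⟩ := Metric.isOpen_iff.1 isOpen_interior v0 hv0
  have key : ∀ v : ℝ, |v| < δ → ∀ u : ℝ, n + v0 ≤ u → |g (u + v) - g u| ≤ 2 * (ε / 3) := by
    intro v hv u hu
    have h1 : v0 + v ∈ Metric.ball v0 δ := by
      rw [Metric.mem_ball, Real.dist_eq]; simpa using hv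
    have h2 := interior_subset (hball h1)
    have h3 := interior_subset hv0
    have h4 := h2 (u - v0) (by linarith)
    have h5 := h3 (u - v0) (by linarith)
    rw [show u - v0 + (v0 + v) = u + v by ring] at h4
    rw [show u - v0 + v0 = u by ring] at h5
    rw [abs_le] at *
    constructor <;> linarith [h4.1, h4.2, h5.1, h5.2]
  refine (isCompact_Icc (a := (0:ℝ)) (b := b)).induction_on
    (p := fun s => ∀ᶠ u in atTop, ∀ v ∈ s, |g (u + v) - g u| ≤ ε) (by simp) ?_ ?_ ?_
  · intro s t hst ht
    filter_upwards [ht] with u hu v hv using hu v (hst hv)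
  · intro s t hs ht
    filter_upwards [hs, ht] with u hu hu' v hv
    rcases hv with hv | hv
    · exact hu v hv
    · exact hu' v hv
  · intro v1 _
    refine ⟨Metric.ball v1 δ, mem_nhdsWithin_of_mem_nhds (Metric.ball_mem_nhds v1 hδ), ?_⟩
    have h1 := (h v1).abs
    rw [abs_zero] at h1
    have h2 := h1.eventually (gt_mem_nhds (show (0:ℝ) < ε / 3 by positivity))
    filter_upwards [h2, eventually_ge_atTop (n + v0 - v1)] with u hu hu' v hv
    rw [Metric.mem_ball, Real.dist_eq] at hv
    have h3 := key (v - v1) hv (u + v1) (by linarith)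
    rw [show u + v1 + (v - v1) = u + v by ring] at h3
    rw [abs_lt] at hu
    rw [abs_le] at *
    constructor <;> linarith [h3.1, h3.2, hu.1, hu.2]

lemma uct (ω : ℝ → ℝ) (hc : ContinuousOn ω (Set.Ioi 0)) (hpos : ∀ x, 0 < x → 0 < ω x)
    (hslow : ∀ l : ℝ, 0 < l → Tendsto (fun x => ω (l * x) / ω x) atTop (nhds 1))
    (ε : ℝ) (hε : 0 < ε) :
    ∀ᶠ X in atTop, ∀ x ∈ Set.Icc X (2 * X), |ω x - ω X| ≤ ε * ω X := by
  have hg : Continuous (fun u : ℝ => Real.log (ω (Real.exp u))) := by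
    have h1 : Continuous (fun u : ℝ => ω (Real.exp u)) :=
      hc.comp_continuous Real.continuous_exp (fun u => Real.exp_pos u)
    exact h1.log (fun u => (hpos _ (Real.exp_pos u)).ne')
  have h : ∀ v : ℝ, Tendsto (fun u => Real.log (ω (Real.exp (u + v))) - Real.log (ω (Real.exp u)))
      atTop (nhds 0) := by
    intro v
    have h1 := ((hslow _ (Real.exp_pos v)).comp Real.tendsto_exp_atTop).log one_ne_zero
    rw [Real.log_one] at h1
    refine h1.congr fun u => ?_
    simp only [Function.comp]
    rw [Real.log_div (hpos _ (by positivity)).ne' (hpos _ (by positivity)).ne', Real.exp_add,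
      mul_comm]
  have hlog : ∃ δ > 0, ∀ y : ℝ, |y| ≤ δ → |Real.exp y - 1| ≤ ε := by
    have h1 : Tendsto (fun y : ℝ => |Real.exp y - 1|) (nhds 0) (nhds 0) := by
      have : Continuous (fun y : ℝ => |Real.exp y - 1|) := by fun_prop
      simpa using this.tendsto 0
    have h2 := h1.eventually (gt_mem_nhds hε)
    obtain ⟨δ, hδ, hb⟩ := Metric.eventually_nhds_iff.1 h2
    refine ⟨δ / 2, by positivity, fun y hy => (hb ?_).le⟩
    rw [Real.dist_eq, sub_zero]; linarith
  obtain ⟨δ, hδ, hexp⟩ := hlog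
  have h3 := Real.tendsto_log_atTop.eventually (uct_add _ hg h δ hδ (Real.log 2))
  filter_upwards [h3, eventually_gt_atTop 0] with X hX hX0 x hx
  have hx0 : 0 < x := lt_of_lt_of_le hX0 hx.1
  have h4 := hX (Real.log (x / X)) ⟨Real.log_nonneg (by rw [le_div_iff₀ hX0]; linarith [hx.1]),
    Real.log_le_log (by positivity) (by rw [div_le_iff₀ hX0]; linarith [hx.2])⟩
  rw [Real.exp_add, Real.exp_log hX0, Real.exp_log (by positivity), mul_div_cancel₀ _ hX0.ne'] at h4
  have h5 := hexp _ h4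
  have hw := hpos X hX0
  rw [Real.exp_sub, Real.exp_log (hpos x hx0), Real.exp_log hw] at h5
  have : ω x - ω X = (ω x / ω X - 1) * ω X := by field_simp
  rw [this, abs_mul, abs_of_pos hw]
  exact mul_le_mul_of_nonneg_right h5 hw.le

/-- Lower bound for ω. -/
lemma omega_lower (ω : ℝ → ℝ) (hω : OmegaClass ω)
    (hslow : ∀ l : ℝ, 0 < l → Tendsto (fun x => ω (l * x) / ω x) atTop (nhds 1)) (α : ℝ) (hα : 0 < α) :
    ∀ᶠ X in atTop, X ^ (-α) ≤ ω X := by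
  have hc := hω.contDiff.continuousOn
  obtain ⟨c, hc0, hm⟩ := hω.mom2_lower (α / 2) (by positivity)
  have hsmall : ∀ᶠ X in atTop, ω X < 1 / 4 := hω.tendsto_zero.eventually (gt_mem_nhds (by norm_num))
  have hall : ∀ᶠ X in atTop, ∀ x, X ≤ x → ω x < 1 / 4 := by
    obtain ⟨X0, h⟩ := eventually_atTop.1 hsmall
    filter_upwards [eventually_ge_atTop X0] with X hX x hx using h x (by linarith)
  have hbig : ∀ᶠ X : ℝ in atTop, 32 / c ≤ X ^ (α / 2) :=
    (tendsto_rpow_atTop (by positivity : 0 < α / 2)).eventually_ge_atTop _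
  filter_upwards [uct ω hc hω.pos hslow 1 one_pos, hm, hall, hbig, eventually_gt_atTop 0]
    with X hX hmX hX1 hXb hX0
  have hw := hω.pos X hX0
  have hb : Mom 2 X ω ≤ 32 * ω X := by
    have h1 : ∀ x ∈ Set.uIoc X (2 * X), ‖(ω x * Real.log (ω x)) ^ 2‖ ≤ 32 * ω X := by
      intro x hx
      rw [Set.uIoc_of_le (by linarith)] at hx
      have hx0 : 0 < x := by linarith [hx.1]
      have hp := hω.pos x hx0
      have h2 := hX x ⟨hx.1.le, hx.2⟩
      have h3 : ω x ≤ 2 * ω X := by linarith [(abs_le.1 h2).2]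
      have h4 := hX1 x hx.1.le
      have h5 : |Real.log (ω x) * (ω x) ^ (1/2:ℝ)| < 1 / (1/2:ℝ) :=
        Real.abs_log_mul_self_rpow_lt (ω x) (1/2) hp (by linarith) (by norm_num)
      rw [← Real.sqrt_eq_rpow] at h5
      have h6 : (ω x * Real.log (ω x)) ^ 2 = ω x * (Real.log (ω x) * √(ω x)) ^ 2 := by
        rw [mul_pow, mul_pow, Real.sq_sqrt hp.le]; ring
      rw [Real.norm_eq_abs, abs_of_nonneg (by positivity), h6]
      have h7 : (Real.log (ω x) * √(ω x)) ^ 2 ≤ 4 := by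
        rw [← sq_abs]; nlinarith [abs_nonneg (Real.log (ω x) * √(ω x))]
      nlinarith
    have h2 := intervalIntegral.norm_integral_le_of_norm_le_const h1
    unfold Mom
    rw [show 2 * X - X = X by ring, abs_of_pos hX0] at h2
    have h3 := (le_abs_self _).trans h2
    rw [div_mul_eq_mul_div, one_mul, div_le_iff₀ hX0]; exact h3
  have h1 : c * X ^ (-(α/2)) ≤ 32 * ω X := hmX.trans hb
  have h2 : X ^ (-α) = X ^ (-(α/2)) / X ^ (α/2) := by
    rw [← Real.rpow_sub hX0]; congr 1; ring
  rw [h2, div_le_iff₀ (by positivity)]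
  have h3 : X ^ (-(α/2)) ≤ 32 / c * ω X := by
    rw [div_mul_eq_mul_div, le_div_iff₀ hc0]; linarith
  nlinarith

lemma sum_Icc_r2_sq_le (Y : ℕ) (hY : 1 ≤ Y) :
    ∑ n ∈ Finset.Icc 1 Y, (r2 n : ℝ) ^ 2 ≤ 2001 * Y * (1 + Real.log Y) := by
  have h := sum_range_r2_sq Y hY
  rw [range_eq_insert, Finset.sum_insert (by simp)] at h
  have : (0:ℝ) ≤ (r2 0 : ℝ) ^ 2 := by positivity
  linarith

lemma cos_ms' (Y : ℕ) (hY : 1 ≤ Y) (c : ℕ → ℝ) (B φ a b : ℝ) (hab : a ≤ b) (hB : 0 ≤ B)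
    (hc : ∀ n ∈ Finset.Icc 1 Y, |c n| ≤ B * r2 n) :
    ∫ u in a..b, (∑ n ∈ Finset.Icc 1 Y, c n * Real.cos (2 * π * √n * u + φ)) ^ 2
      ≤ (b - a) * ∑ n ∈ Finset.Icc 1 Y, c n ^ 2 + 162 * B ^ 2 * (Y:ℝ) ^ 3 := by
  refine (cos_ms _ c φ a b hab).trans (add_le_add le_rfl ?_)
  have hY1 : (1:ℝ) ≤ Y := by exact_mod_cast hY
  calc ∑ n ∈ Finset.Icc 1 Y, ∑ m ∈ (Finset.Icc 1 Y).erase n, |c n| * |c m| / |√n - √m|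
      ≤ ∑ n ∈ Finset.Icc 1 Y, ∑ m ∈ Finset.Icc 1 Y, (B * r2 n) * (B * r2 m) * (2 * Y) := by
        refine Finset.sum_le_sum fun n hn => ?_
        refine (Finset.sum_le_sum (g := fun m => (B * r2 n) * (B * r2 m) * (2 * (Y:ℝ))) fun m hm => ?_).trans
          (Finset.sum_le_sum_of_subset_of_nonneg (Finset.erase_subset _ _) fun m _ _ => by positivity)
        have hm' := Finset.mem_erase.1 hm
        have h1 := inv_sqrt_diff n m (Ne.symm hm'.1)
        have h2 : 2 * √(max n m : ℕ) / |(n:ℝ) - m| ≤ 2 * Y := by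
          have h3 : √(max n m : ℕ) ≤ Y := by
            rw [Real.sqrt_le_left (by positivity)]
            have : ((max n m : ℕ) : ℝ) ≤ Y := by
              exact_mod_cast max_le (Finset.mem_Icc.1 hn).2 (Finset.mem_Icc.1 hm'.2).2
            nlinarith
          have h4 : (1:ℝ) ≤ |(n:ℝ) - m| := by
            have : (1:ℤ) ≤ |(n:ℤ) - m| := Int.one_le_abs (by
              intro h; exact hm'.1 (by omega))
            exact_mod_cast this
          rw [div_le_iff₀ (by linarith)]
          nlinarith
        rw [div_eq_mul_one_div]
        refine mul_le_mul (mul_le_mul (hc n hn) (hc m hm'.2) (abs_nonneg _) (by positivity)) (h1.trans h2)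
          (by positivity) (by positivity)
    _ = B ^ 2 * 2 * Y * (∑ n ∈ Finset.Icc 1 Y, (r2 n : ℝ)) ^ 2 := by
        rw [sq (∑ n ∈ Finset.Icc 1 Y, (r2 n : ℝ)), Finset.sum_mul_sum, Finset.mul_sum]
        refine Finset.sum_congr rfl fun n _ => ?_
        rw [Finset.mul_sum]
        refine Finset.sum_congr rfl fun m _ => ?_
        ring
    _ ≤ B ^ 2 * 2 * Y * (9 * Y) ^ 2 := by
        refine mul_le_mul_of_nonneg_left ?_ (by positivity)
        exact pow_le_pow_left₀ (Finset.sum_nonneg fun _ _ => by positivity) (sum_Icc_r2_le Y) 2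
    _ = 162 * B ^ 2 * (Y:ℝ) ^ 3 := by ring

/-- The sine sum. -/
def SY (Y : ℕ) (x : ℝ) : ℝ := ∑ n ∈ Finset.Icc 1 Y, ((r2 n : ℝ) / √n) * Real.sin (2 * π * √n * x)

def QY (Y : ℕ) (x : ℝ) : ℝ :=
  ∑ n ∈ Finset.Icc 1 Y, (4 * √2 * π * (r2 n : ℝ)) * Real.cos (2 * π * √n * x)

lemma SY_cont (Y : ℕ) : Continuous (SY Y) := by unfold SY; fun_prop
lemma QY_cont (Y : ℕ) : Continuous (QY Y) := by unfold QY; fun_prop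

lemma PY_deriv (Y : ℕ) (x : ℝ) : HasDerivAt (PY Y) (2 * √2 * SY Y x) x := by
  unfold PY SY
  have h : ∀ n ∈ Finset.Icc 1 Y, HasDerivAt (fun u : ℝ => cc n * Real.cos (2 * π * √n * u))
      (cc n * (-Real.sin (2 * π * √n * x) * (2 * π * √n))) x := by
    intro n _
    have h1 : HasDerivAt (fun u : ℝ => 2 * π * √n * u) (2 * π * √n) x := by
      simpa using (hasDerivAt_id x).const_mul (2 * π * √n)
    exact (h1.cos).const_mul _
  refine (HasDerivAt.fun_sum h).neg.congr_deriv ?_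
  rw [Finset.mul_sum, ← Finset.sum_neg_distrib]
  refine Finset.sum_congr rfl fun n hn => ?_
  have hn0 : (0:ℝ) < n := by exact_mod_cast (Finset.mem_Icc.1 hn).1
  have hs : √(n:ℝ) ≠ 0 := (Real.sqrt_pos.2 hn0).ne'
  have hs2 : √(n:ℝ) ^ 2 = n := Real.sq_sqrt hn0.le
  unfold cc
  have : (r2 n : ℝ) / n = r2 n / √n / √n := by rw [div_div, ← sq, hs2]
  rw [mul_div_assoc, this]
  field_simp

lemma SY_deriv (Y : ℕ) (x : ℝ) : HasDerivAt (fun u => 2 * √2 * SY Y u) (QY Y x) x := by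
  unfold SY QY
  have h : ∀ n ∈ Finset.Icc 1 Y, HasDerivAt (fun u : ℝ => ((r2 n : ℝ) / √n) * Real.sin (2 * π * √n * u))
      (((r2 n : ℝ) / √n) * (Real.cos (2 * π * √n * x) * (2 * π * √n))) x := by
    intro n _
    have h1 : HasDerivAt (fun u : ℝ => 2 * π * √n * u) (2 * π * √n) x := by
      simpa using (hasDerivAt_id x).const_mul (2 * π * √n)
    exact (h1.sin).const_mul _
  refine ((HasDerivAt.fun_sum h).const_mul (2 * √2)).congr_deriv ?_
  rw [Finset.mul_sum]
  refine Finset.sum_congr rfl fun n hn => ?_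
  have hn0 : (0:ℝ) < n := by exact_mod_cast (Finset.mem_Icc.1 hn).1
  have hs : √(n:ℝ) ≠ 0 := (Real.sqrt_pos.2 hn0).ne'
  field_simp
  ring

lemma SY_ms (Y : ℕ) (hY : 1 ≤ Y) (a b : ℝ) (hab : a ≤ b) :
    ∫ x in a..b, SY Y x ^ 2 ≤ (b - a) * (4000 * (1 + Real.log Y) ^ 2) + 162 * (Y:ℝ) ^ 3 := by
  have h := cos_ms' Y hY (fun n => (r2 n : ℝ) / √n) 1 (-(π / 2)) a b hab zero_le_one ?_
  · have e : ∀ x : ℝ, SY Y x = ∑ n ∈ Finset.Icc 1 Y, ((r2 n : ℝ) / √n) * Real.cos (2 * π * √n * x + -(π / 2)) := by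
      intro x
      unfold SY
      refine Finset.sum_congr rfl fun n _ => ?_
      rw [← sub_eq_add_neg, Real.cos_sub_pi_div_two]
    simp_rw [e]
    refine h.trans ?_
    have h2 := sum_r2_sq_div_le Y hY
    have h3 : ∑ n ∈ Finset.Icc 1 Y, ((r2 n : ℝ) / √n) ^ 2 = ∑ n ∈ Finset.Icc 1 Y, (r2 n : ℝ) ^ 2 / (n:ℝ) := by
      refine Finset.sum_congr rfl fun n _ => ?_
      rw [div_pow, Real.sq_sqrt (by positivity)]
    rw [h3]
    have := mul_le_mul_of_nonneg_left h2 (sub_nonneg.2 hab)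
    linarith
  · intro n hn
    have hn0 : (1:ℝ) ≤ n := by exact_mod_cast (Finset.mem_Icc.1 hn).1
    rw [abs_of_nonneg (by positivity), one_mul]
    exact div_le_self (by positivity) (Real.one_le_sqrt.2 hn0)

lemma QY_ms (Y : ℕ) (hY : 1 ≤ Y) (a b : ℝ) (hab : a ≤ b) :
    ∫ x in a..b, QY Y x ^ 2 ≤ (b - a) * (10 ^ 6 * Y * (1 + Real.log Y)) + 10 ^ 5 * (Y:ℝ) ^ 3 := by
  have hY1 : (1:ℝ) ≤ Y := by exact_mod_cast hY
  have hl := Real.log_nonneg hY1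
  have hB : 4 * √2 * π ≤ 20 := by
    have := Real.pi_lt_d2
    have h2 : √2 < 1.42 := by rw [Real.sqrt_lt' (by norm_num)]; norm_num
    nlinarith [Real.pi_pos, Real.sqrt_nonneg (2:ℝ)]
  have hB0 : 0 ≤ 4 * √2 * π := by positivity
  have hB2 : (4 * √2 * π) ^ 2 ≤ 400 := by nlinarith
  have h := cos_ms' Y hY (fun n => 4 * √2 * π * (r2 n : ℝ)) (4 * √2 * π) 0 a b hab (by positivity) ?_
  · simp only [add_zero] at h
    unfold QY
    refine h.trans ?_
    have h3 : ∑ n ∈ Finset.Icc 1 Y, (4 * √2 * π * (r2 n : ℝ)) ^ 2 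
        = (4 * √2 * π) ^ 2 * ∑ n ∈ Finset.Icc 1 Y, (r2 n : ℝ) ^ 2 := by
      rw [Finset.mul_sum]; refine Finset.sum_congr rfl fun n _ => ?_
      ring
    rw [h3]
    have h4 : (4 * √2 * π) ^ 2 * ∑ n ∈ Finset.Icc 1 Y, (r2 n : ℝ) ^ 2 ≤ 400 * (2001 * Y * (1 + Real.log Y)) :=
      mul_le_mul hB2 (sum_Icc_r2_sq_le Y hY) (Finset.sum_nonneg fun _ _ => by positivity) (by norm_num)
    have h5 : (4 * √2 * π) ^ 2 * ∑ n ∈ Finset.Icc 1 Y, (r2 n : ℝ) ^ 2 ≤ 10 ^ 6 * Y * (1 + Real.log Y) := by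
      refine h4.trans ?_
      have : 0 ≤ (Y:ℝ) * (1 + Real.log Y) := by positivity
      nlinarith
    have h6 : 162 * (4 * √2 * π) ^ 2 * (Y:ℝ) ^ 3 ≤ 10 ^ 5 * (Y:ℝ) ^ 3 :=
      mul_le_mul_of_nonneg_right (by linarith) (by positivity)
    have := mul_le_mul_of_nonneg_left h5 (sub_nonneg.2 hab)
    linarith
  · intro n hn
    rw [abs_of_nonneg (by positivity)]

lemma taylor2 (f f' f'' : ℝ → ℝ) (h1 : ∀ x, HasDerivAt f (f' x) x) (h2 : ∀ x, HasDerivAt f' (f'' x) x)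
    (hc : Continuous f'') (x h H : ℝ) (hh : 0 ≤ h) (hH : h ≤ H) :
    (f (x + h) - f x - h * f' x) ^ 2 ≤ H ^ 3 * ∫ r in 0..H, f'' (x + r) ^ 2 := by
  set J := ∫ r in 0..H, f'' (x + r) ^ 2 with hJ
  have hc2 : Continuous (fun r => f'' (x + r) ^ 2) := by fun_prop
  have hJ0 : 0 ≤ J := intervalIntegral.integral_nonneg (by linarith) fun _ _ => sq_nonneg _
  have hH0 : 0 ≤ H := hh.trans hH
  have key : ∀ s ∈ Set.Icc 0 h, |f' (x + s) - f' x| ≤ √(H * J) := by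
    intro s hs
    rcases hs.1.eq_or_lt with h0 | h0
    · rw [← h0]; simp
    · have e : ∫ r in 0..s, f'' (x + r) = f' (x + s) - f' x := by
        have := intervalIntegral.integral_eq_sub_of_hasDerivAt (a := 0) (b := s)
          (f := fun r => f' (x + r)) (f' := fun r => f'' (x + r))
          (fun r _ => by simpa using (h2 (x + r)).comp_const_add x r)
          (Continuous.intervalIntegrable (by fun_prop) _ _)
        simpa using this
      have h3 := cs_int 0 s h0 (fun r => f'' (x + r)) (by fun_prop)
      rw [e, sub_zero, div_le_iff₀ h0] at h3
      have h4 : ∫ r in 0..s, f'' (x + r) ^ 2 ≤ J :=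
        intervalIntegral.integral_mono_interval le_rfl h0.le (hs.2.trans hH)
          (Eventually.of_forall fun _ => sq_nonneg _) (hc2.intervalIntegrable _ _)
      apply Real.abs_le_sqrt
      refine h3.trans ?_
      rw [mul_comm]
      exact mul_le_mul (hs.2.trans hH) h4 (intervalIntegral.integral_nonneg h0.le fun _ _ => sq_nonneg _) hH0
  have hk : ∀ s ∈ Set.Icc 0 h, HasDerivWithinAt (fun s => f (x + s) - s * f' x) (f' (x + s) - f' x) (Set.Icc 0 h) s := by
    intro s _
    have h3 : HasDerivAt (fun s => f (x + s)) (f' (x + s)) s := by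
      simpa using (h1 (x + s)).comp_const_add x s
    have h4 : HasDerivAt (fun s => s * f' x) (f' x) s := by
      simpa using (hasDerivAt_id s).mul_const (f' x)
    exact (h3.sub h4).hasDerivWithinAt
  have := (convex_Icc (0:ℝ) h).norm_image_sub_le_of_norm_hasDerivWithin_le hk
    (fun s hs => key s hs) (Set.left_mem_Icc.2 hh) (Set.right_mem_Icc.2 hh)
  simp only [add_zero, zero_mul, sub_zero, Real.norm_eq_abs, abs_of_nonneg hh] at this
  have h5 : |f (x + h) - f x - h * f' x| ≤ √(H * J) * H := by
    rw [show f (x + h) - f x - h * f' x = f (x + h) - h * f' x - f x by ring]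
    exact this.trans (mul_le_mul_of_nonneg_left hH (Real.sqrt_nonneg _))
  rw [← sq_abs]
  calc _ ≤ (√(H * J) * H) ^ 2 := pow_le_pow_left₀ (abs_nonneg _) h5 2
    _ = H ^ 3 * J := by rw [mul_pow, Real.sq_sqrt (by positivity)]; ring

lemma fubini_shift (F : ℝ → ℝ) (hF : Continuous F) (hF0 : ∀ x, 0 ≤ F x) (X H : ℝ) (hX : 1 ≤ X) (hH0 : 0 ≤ H)
    (hH : H ≤ 1) : ∫ x in X..(2 * X), ∫ r in 0..H, F (x + r) ≤ H * ∫ x in X..(3 * X), F x := by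
  rw [intervalIntegral_intervalIntegral_swap]
  · have h1 : ∀ r ∈ Set.Icc 0 H, ∫ x in X..(2 * X), F (x + r) ≤ ∫ x in X..(3 * X), F x := by
      intro r hr
      rw [intervalIntegral.integral_comp_add_right]
      exact intervalIntegral.integral_mono_interval (by linarith [hr.1]) (by linarith) (by linarith [hr.2])
        (Eventually.of_forall hF0) (hF.intervalIntegrable _ _)
    have h2 := intervalIntegral.integral_mono_on (μ := volume) (a := 0) (b := H)
      (f := fun r => ∫ x in X..(2 * X), F (x + r)) (g := fun _ => ∫ x in X..(3 * X), F x) hH0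
      (Continuous.intervalIntegrable (by
        simp_rw [intervalIntegral.integral_comp_add_right]
        have h3 : Continuous (fun y => ∫ x in 0..y, F x) :=
          intervalIntegral.continuous_primitive (fun a b => hF.intervalIntegrable a b) 0
        have : (fun r => ∫ x in (X + r)..(2 * X + r), F x)
            = fun r => (∫ x in 0..(2 * X + r), F x) - ∫ x in 0..(X + r), F x := by
          ext r
          rw [intervalIntegral.integral_interval_sub_left] <;> exact hF.intervalIntegrable _ _
        rw [this]
        exact (h3.comp (by fun_prop : Continuous fun r : ℝ => 2 * X + r)).sub
          (h3.comp (by fun_prop : Continuous fun r : ℝ => X + r))) _ _)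
      (by simp) h1
    refine h2.trans ?_
    simp
  · have hc : Continuous (Function.uncurry fun x r : ℝ => F (x + r)) := by
      unfold Function.uncurry; fun_prop
    rw [Set.uIoc_of_le (by linarith), Set.uIoc_of_le hH0]
    exact (hc.continuousOn.integrableOn_compact
        (isCompact_Icc.prod isCompact_Icc)).mono_set
      (Set.prod_mono Set.Ioc_subset_Icc_self Set.Ioc_subset_Icc_self)

def EE (ω : ℝ → ℝ) (x : ℝ) : ℝ := RR (x + ω x) * (1 + ω x / x) ^ 2 - RR x

lemma Ehat_eq (ω : ℝ → ℝ) (x : ℝ) (hx : 0 < x) (hw : 0 < ω x) : Ehat ω x = EE ω x := by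
  unfold Ehat Eshell EE RR
  rw [if_pos hx, if_pos (by linarith)]
  have h1 : ∑ j ∈ Finset.Icc 1 4, (Nat.choose 4 j : ℝ) * x ^ (4 - j) * ω x ^ j
      = (x + ω x) ^ 4 - x ^ 4 := by
    rw [show Finset.Icc 1 4 = {1, 2, 3, 4} from rfl]
    have : Nat.choose 4 2 = 6 := rfl
    have : Nat.choose 4 3 = 4 := rfl
    simp [*]
    ring
  rw [h1]
  have h2 : x + ω x ≠ 0 := by positivity
  have h3 : 1 + ω x / x = (x + ω x) / x := by field_simp
  rw [h3]
  field_simp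
  ring

lemma EE_meas (ω : ℝ → ℝ) (hc : Continuous ω) : Measurable (EE ω) := by
  have h1 := hc.measurable
  have h2 := RR_meas
  unfold EE
  have : Measurable (fun x => RR (x + ω x)) := h2.comp (by fun_prop)
  fun_prop

lemma cov_bound (ω : ℝ → ℝ) (hc : Continuous ω) (X : ℝ) (hX : 1 ≤ X)
    (hd : ∀ x ∈ Set.Icc X (2 * X), DifferentiableAt ℝ ω x ∧ |deriv ω x| < 1 / 2)
    (hp : ∀ x ∈ Set.Icc X (2 * X), 0 < ω x ∧ ω x ≤ 1)
    (F : ℝ → ℝ) (hF : Measurable F) (hF0 : ∀ x, 0 ≤ F x) (M : ℝ) (hM : ∀ x ∈ Set.Icc X (3 * X), |F x| ≤ M) :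
    ∫ x in X..(2 * X), F (x + ω x) ≤ 2 * ∫ x in X..(3 * X), F x := by
  have hder : ∀ x ∈ Set.Icc X (2 * X), HasDerivAt (fun x => x + ω x) (1 + deriv ω x) x := by
    intro x hx
    exact (hasDerivAt_id x).add (hd x hx).1.hasDerivAt
  have hmaps : ∀ x ∈ Set.Icc X (2 * X), x + ω x ∈ Set.Icc X (3 * X) := by
    intro x hx
    have := hp x hx
    constructor <;> linarith [hx.1, hx.2]
  have hinj : Set.InjOn (fun x => x + ω x) (Set.Icc X (2 * X)) := by
    refine (strictMonoOn_of_deriv_pos (convex_Icc _ _) (by fun_prop) ?_).injOn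
    intro x hx
    have hx' := interior_subset hx
    rw [(hder x hx').deriv]
    have := abs_lt.1 (hd x hx').2
    linarith
  have himg := integral_image_eq_integral_abs_deriv_smul measurableSet_Icc
    (fun x hx => (hder x hx).hasDerivWithinAt) hinj F
  have hFm : Measurable (fun x => F (x + ω x)) := hF.comp (by fun_prop)
  have hI : IntegrableOn F (Set.Icc X (3 * X)) := by
    refine Measure.integrableOn_of_bounded (M := M) (by simp) hF.aestronglyMeasurable ?_
    filter_upwards [ae_restrict_mem measurableSet_Icc] with x hx using hM x hx
  have hI2 : IntegrableOn (fun x => F (x + ω x)) (Set.Icc X (2 * X)) := by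
    refine Measure.integrableOn_of_bounded (M := M) (by simp) hFm.aestronglyMeasurable ?_
    filter_upwards [ae_restrict_mem measurableSet_Icc] with x hx using hM _ (hmaps x hx)
  have hI3 : IntegrableOn (fun x => |1 + deriv ω x| • F (x + ω x)) (Set.Icc X (2 * X)) := by
    refine Measure.integrableOn_of_bounded (M := 2 * M) (by simp)
      (((measurable_const.add (measurable_deriv ω)).abs.smul hFm).aestronglyMeasurable) ?_
    filter_upwards [ae_restrict_mem measurableSet_Icc] with x hx
    have h1 := hM _ (hmaps x hx)
    have h2 := abs_lt.1 (hd x hx).2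
    rw [norm_smul, Real.norm_eq_abs, Real.norm_eq_abs, abs_abs]
    refine mul_le_mul ?_ h1 (abs_nonneg _) (by norm_num)
    rw [abs_le]; constructor <;> linarith
  rw [intervalIntegral.integral_of_le (by linarith), intervalIntegral.integral_of_le (by linarith),
    ← integral_Icc_eq_integral_Ioc, ← integral_Icc_eq_integral_Ioc]
  calc ∫ x in Set.Icc X (2 * X), F (x + ω x)
      ≤ ∫ x in Set.Icc X (2 * X), 2 * (|1 + deriv ω x| • F (x + ω x)) := by
        refine setIntegral_mono_on hI2 (hI3.const_mul 2) measurableSet_Icc fun x hx => ?_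
        have h2 := abs_lt.1 (hd x hx).2
        rw [smul_eq_mul, abs_of_pos (by linarith)]
        nlinarith [hF0 (x + ω x)]
    _ = 2 * ∫ x in (fun x => x + ω x) '' Set.Icc X (2 * X), F x := by
        rw [integral_const_mul, himg]
    _ ≤ 2 * ∫ x in Set.Icc X (3 * X), F x := by
        refine mul_le_mul_of_nonneg_left ?_ (by norm_num)
        refine setIntegral_mono_set hI (Eventually.of_forall hF0) ?_
        have : (fun x => x + ω x) '' Set.Icc X (2 * X) ⊆ Set.Icc X (3 * X) := by
          rintro _ ⟨x, hx, rfl⟩; exact hmaps x hx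
        exact this.eventuallyLE

lemma PY_abs (Y : ℕ) (x : ℝ) : |PY Y x| ≤ 9 * Y := by
  unfold PY
  rw [abs_neg]
  refine (Finset.abs_sum_le_sum_abs _ _).trans ((Finset.sum_le_sum fun n hn => ?_).trans (sum_Icc_r2_le Y))
  have hn0 : (1:ℝ) ≤ n := by exact_mod_cast (Finset.mem_Icc.1 hn).1
  rw [abs_mul, abs_of_nonneg (cc_nonneg n)]
  calc cc n * |Real.cos (2 * π * √n * x)| ≤ cc n * 1 :=
        mul_le_mul_of_nonneg_left (Real.abs_cos_le_one _) (cc_nonneg n)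
    _ ≤ r2 n / n := by rw [mul_one]; exact cc_le n
    _ ≤ r2 n := div_le_self (by positivity) hn0

lemma sq5 (a b c d f : ℝ) : (a + b + c + d + f) ^ 2 ≤ 5 * (a ^ 2 + b ^ 2 + c ^ 2 + d ^ 2 + f ^ 2) := by
  linarith [sq_nonneg (a - b), sq_nonneg (a - c), sq_nonneg (a - d), sq_nonneg (a - f), sq_nonneg (b - c),
      sq_nonneg (b - d), sq_nonneg (b - f), sq_nonneg (c - d), sq_nonneg (c - f), sq_nonneg (d - f)]

lemma approx_pt (ω : ℝ → ℝ) (X x w ε : ℝ) (Y : ℕ) (hX : 1 ≤ X) (hx : x ∈ Set.Icc X (2 * X)) (hw : 0 < w)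
    (hw2 : w ≤ 1 / 2) (hε : ε ≤ 1) (hωx : 0 < ω x) (h : |ω x - w| ≤ ε * w) :
    (EE ω x - 2 * √2 * w * SY Y x) ^ 2 ≤ 5 * (19 * (RR (x + ω x) - PY Y (x + ω x)) ^ 2
      + (RR x - PY Y x) ^ 2 + 5832 * w ^ 2 * (Y:ℝ) ^ 2 / X ^ 2
      + (2 * w) ^ 3 * (∫ r in 0..(2 * w), QY Y (x + r) ^ 2)
      + 8 * ε ^ 2 * w ^ 2 * SY Y x ^ 2) := by
  set h' := ω x with hh'
  have hx0 : 0 < x := by linarith [hx.1]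
  have hle : h' ≤ 2 * w := by
    have := (abs_le.1 h).2
    nlinarith
  have h4 := taylor2 (PY Y) (fun u => 2 * √2 * SY Y u) (QY Y) (PY_deriv Y) (SY_deriv Y) (QY_cont Y) x h' (2 * w)
    hωx.le hle
  set T1 := RR (x + h') - PY Y (x + h') with hT1
  set T2 := RR x - PY Y x with hT2
  set T4 := PY Y (x + h') - PY Y x - h' * (2 * √2 * SY Y x) with hT4
  set q := (1 + h' / x) ^ 2 - 1 with hq
  have e : EE ω x - 2 * √2 * w * SY Y x
      = T1 + (-T2) + RR (x + h') * q + T4 + (h' - w) * (2 * √2 * SY Y x) := by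
    unfold EE
    rw [← hh', hT1, hT2, hT4, hq]; ring
  have hdx : h' / x ≤ 2 * w / X := div_le_div₀ (by positivity) hle (by linarith) hx.1
  have hdx0 : 0 ≤ h' / x := by positivity
  have hwX : 2 * w / X ≤ 1 := by rw [div_le_one (by linarith)]; linarith
  have hq0 : 0 ≤ q := by rw [hq]; nlinarith
  have hqle : q ≤ 6 * w / X := by
    have : 6 * w / X = 3 * (2 * w / X) := by ring
    rw [this, hq]; nlinarith
  have hqsq : q ^ 2 ≤ 36 * w ^ 2 / X ^ 2 := by
    have := pow_le_pow_left₀ hq0 hqle 2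
    rwa [div_pow, mul_pow, show (6:ℝ) ^ 2 = 36 by norm_num] at this
  have hq9 : q ^ 2 ≤ 9 := by
    have : q ≤ 3 := by
      refine hqle.trans ?_
      rw [div_le_iff₀ (by linarith)]; linarith
    nlinarith
  have hT3 : (RR (x + h') * q) ^ 2 ≤ 18 * T1 ^ 2 + 5832 * w ^ 2 * (Y:ℝ) ^ 2 / X ^ 2 := by
    have hP := PY_abs Y (x + h')
    have hP2 : PY Y (x + h') ^ 2 ≤ 81 * (Y:ℝ) ^ 2 := by
      rw [← sq_abs]
      have := pow_le_pow_left₀ (abs_nonneg _) hP 2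
      linarith
    have h1 : RR (x + h') ^ 2 ≤ 2 * T1 ^ 2 + 162 * (Y:ℝ) ^ 2 := by
      have : RR (x + h') = T1 + PY Y (x + h') := by rw [hT1]; ring
      rw [this]; nlinarith [sq_nonneg (T1 - PY Y (x + h'))]
    calc (RR (x + h') * q) ^ 2 = RR (x + h') ^ 2 * q ^ 2 := by ring
      _ ≤ (2 * T1 ^ 2 + 162 * (Y:ℝ) ^ 2) * q ^ 2 := mul_le_mul_of_nonneg_right h1 (sq_nonneg _)
      _ = 2 * T1 ^ 2 * q ^ 2 + 162 * (Y:ℝ) ^ 2 * q ^ 2 := by ring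
      _ ≤ 2 * T1 ^ 2 * 9 + 162 * (Y:ℝ) ^ 2 * (36 * w ^ 2 / X ^ 2) :=
        add_le_add (mul_le_mul_of_nonneg_left hq9 (by positivity))
          (mul_le_mul_of_nonneg_left hqsq (by positivity))
      _ = _ := by ring
  have hT5 : ((h' - w) * (2 * √2 * SY Y x)) ^ 2 ≤ 8 * ε ^ 2 * w ^ 2 * SY Y x ^ 2 := by
    have h1 : (h' - w) ^ 2 ≤ (ε * w) ^ 2 := by
      rw [← sq_abs]; exact pow_le_pow_left₀ (abs_nonneg _) h 2
    have h2 : (2 * √2 * SY Y x) ^ 2 = 8 * SY Y x ^ 2 := by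
      rw [mul_pow, mul_pow, Real.sq_sqrt (by norm_num)]; ring
    rw [mul_pow, h2]
    have := mul_le_mul_of_nonneg_right h1 (by positivity : 0 ≤ 8 * SY Y x ^ 2)
    linarith
  rw [e]
  refine (sq5 _ _ _ _ _).trans (mul_le_mul_of_nonneg_left ?_ (by norm_num))
  rw [neg_sq]
  linarith

lemma EE_bdd (ω : ℝ → ℝ) (X : ℝ) (hX : 1 ≤ X)
    (hp : ∀ x ∈ Set.Icc X (2 * X), 0 < ω x ∧ ω x ≤ 1) : ∃ M, ∀ x ∈ Set.Icc X (2 * X), |EE ω x| ≤ M := by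
  obtain ⟨M, hM⟩ := RR_bdd X (3 * X) (by linarith)
  refine ⟨M * 4 + M, fun x hx => ?_⟩
  have h := hp x hx
  have hx0 : 1 ≤ x := by linarith [hx.1]
  have h1 := hM (x + ω x) ⟨by linarith [hx.1], by linarith [hx.2]⟩
  have h2 := hM x ⟨by linarith [hx.1], by linarith [hx.2]⟩
  unfold EE
  refine (abs_sub _ _).trans (add_le_add ?_ h2)
  rw [abs_mul]
  have h3 : ω x / x ≤ 1 := by rw [div_le_one (by linarith)]; linarith
  have h4 : 0 ≤ ω x / x := div_nonneg h.1.le (by linarith)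
  refine mul_le_mul h1 ?_ (abs_nonneg _) ((abs_nonneg _).trans h1)
  rw [abs_of_nonneg (by positivity)]
  nlinarith

lemma sq_ii {f : ℝ → ℝ} (hf : Measurable f) (M a b : ℝ) (hab : a ≤ b)
    (h : ∀ x ∈ Set.Icc a b, |f x| ≤ M) : IntervalIntegrable (fun x => f x ^ 2) volume a b := by
  refine ii_of_bdd_on (hf.pow_const 2) (M ^ 2) a b hab fun x hx => ?_
  rw [abs_pow]
  exact pow_le_pow_left₀ (abs_nonneg _) (h x hx) 2

lemma cont_bdd {f : ℝ → ℝ} (hf : Continuous f) (a b : ℝ) : ∃ M, ∀ x ∈ Set.Icc a b, |f x| ≤ M :=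
  isCompact_Icc.exists_bound_of_continuousOn hf.continuousOn

lemma approx_int (ω : ℝ → ℝ) (hc : Continuous ω) (X w ε : ℝ) (Y : ℕ) (hX : 1 ≤ X) (hw : 0 < w)
    (hw2 : w ≤ 1 / 2) (hε0 : 0 ≤ ε) (hε : ε ≤ 1) (hY : 1 ≤ Y)
    (hd : ∀ x ∈ Set.Icc X (2 * X), DifferentiableAt ℝ ω x ∧ |deriv ω x| < 1 / 2)
    (hp : ∀ x ∈ Set.Icc X (2 * X), 0 < ω x)
    (h : ∀ x ∈ Set.Icc X (2 * X), |ω x - w| ≤ ε * w) :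
    ∫ x in X..(2 * X), (EE ω x - 2 * √2 * w * SY Y x) ^ 2 ≤
      5 * (39 * (∫ x in X..(3 * X), (RR x - PY Y x) ^ 2) + 5832 * w ^ 2 * (Y:ℝ) ^ 2 / X
        + 16 * w ^ 4 * (2 * X * (10 ^ 6 * Y * (1 + Real.log Y)) + 10 ^ 5 * (Y:ℝ) ^ 3)
        + 8 * ε ^ 2 * w ^ 2 * (X * (4000 * (1 + Real.log Y) ^ 2) + 162 * (Y:ℝ) ^ 3)) := by
  have hp' : ∀ x ∈ Set.Icc X (2 * X), 0 < ω x ∧ ω x ≤ 1 := by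
    intro x hx
    refine ⟨hp x hx, ?_⟩
    have := (abs_le.1 (h x hx)).2
    nlinarith
  have hX2 : X ≤ 2 * X := by linarith
  set Re := fun x => RR x - PY Y x with hRe
  have hRem : Measurable Re := RP_meas Y
  obtain ⟨M, hM⟩ := RP_bdd Y X (3 * X) (by linarith)
  have i1 : IntervalIntegrable (fun x => Re (x + ω x) ^ 2) volume X (2 * X) := by
    refine sq_ii (f := fun x => Re (x + ω x)) (hRem.comp (by fun_prop)) M _ _ hX2 fun x hx => ?_
    exact hM _ ⟨by linarith [hx.1, (hp' x hx).1], by linarith [hx.2, (hp' x hx).2]⟩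
  have i2 : IntervalIntegrable (fun x => Re x ^ 2) volume X (2 * X) :=
    sq_ii hRem M _ _ hX2 fun x hx => hM _ ⟨hx.1, by linarith [hx.2]⟩
  have i2' : IntervalIntegrable (fun x => Re x ^ 2) volume X (3 * X) :=
    sq_ii hRem M _ _ (by linarith) fun x hx => hM _ hx
  have hQc : Continuous (fun x => ∫ r in 0..(2 * w), QY Y (x + r) ^ 2) := by
    have hQ := QY_cont Y
    exact intervalIntegral.continuous_parametric_intervalIntegral_of_continuous' (by
      unfold Function.uncurry; fun_prop) 0 (2 * w)
  have i4 : IntervalIntegrable (fun x => ∫ r in 0..(2 * w), QY Y (x + r) ^ 2) volume X (2 * X) :=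
    hQc.intervalIntegrable _ _
  have i5 : IntervalIntegrable (fun x => SY Y x ^ 2) volume X (2 * X) :=
    ((SY_cont Y).pow 2).intervalIntegrable _ _
  have i0 : IntervalIntegrable (fun x => (EE ω x - 2 * √2 * w * SY Y x) ^ 2) volume X (2 * X) := by
    obtain ⟨M1, hM1⟩ := EE_bdd ω X hX hp'
    obtain ⟨M2, hM2⟩ := cont_bdd (f := fun x => 2 * √2 * w * SY Y x) (by have := SY_cont Y; fun_prop) X (2 * X)
    refine sq_ii (f := fun x => EE ω x - 2 * √2 * w * SY Y x)
      ((EE_meas ω hc).sub (by have := (SY_cont Y).measurable; fun_prop)) (M1 + M2) _ _ hX2 fun x hx => ?_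
    exact (abs_sub _ _).trans (add_le_add (hM1 x hx) (hM2 x hx))
  have b1 := cov_bound ω hc X hX hd hp' (fun x => Re x ^ 2) (hRem.pow_const 2) (fun _ => sq_nonneg _) (M ^ 2)
    (fun x hx => by rw [abs_pow]; exact pow_le_pow_left₀ (abs_nonneg _) (hM x hx) 2)
  have b2 : ∫ x in X..(2 * X), Re x ^ 2 ≤ ∫ x in X..(3 * X), Re x ^ 2 :=
    intervalIntegral.integral_mono_interval le_rfl hX2 (by linarith)
      (Eventually.of_forall fun _ => sq_nonneg _) i2'
  have b4 : ∫ x in X..(2 * X), ∫ r in 0..(2 * w), QY Y (x + r) ^ 2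
      ≤ 2 * w * ∫ x in X..(3 * X), QY Y x ^ 2 :=
    fubini_shift (fun x => QY Y x ^ 2) ((QY_cont Y).pow 2) (fun _ => sq_nonneg _) X (2 * w) hX (by linarith)
      (by linarith)
  have b4' := QY_ms Y hY X (3 * X) (by linarith)
  have b5 := SY_ms Y hY X (2 * X) hX2
  have hmono := intervalIntegral.integral_mono_on (μ := volume) hX2 i0
    ((((((i1.const_mul 19).add i2).add (intervalIntegrable_const (c := 5832 * w ^ 2 * (Y:ℝ) ^ 2 / X ^ 2))).add
      (i4.const_mul ((2 * w) ^ 3))).add (i5.const_mul (8 * ε ^ 2 * w ^ 2))).const_mul 5)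
    (fun x hx => approx_pt ω X x w ε Y hX hx hw hw2 hε (hp x hx) (h x hx))
  refine hmono.trans ?_
  rw [intervalIntegral.integral_const_mul]
  refine mul_le_mul_of_nonneg_left ?_ (by norm_num)
  rw [intervalIntegral.integral_add
      ((((i1.const_mul 19).add i2).add intervalIntegrable_const).add (i4.const_mul _)) (i5.const_mul _),
    intervalIntegral.integral_add (((i1.const_mul 19).add i2).add intervalIntegrable_const) (i4.const_mul _),
    intervalIntegral.integral_add ((i1.const_mul 19).add i2) intervalIntegrable_const,
    intervalIntegral.integral_add (i1.const_mul 19) i2, intervalIntegral.integral_const_mul,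
    intervalIntegral.integral_const_mul, intervalIntegral.integral_const_mul, intervalIntegral.integral_const]
  have c3 : (2 * X - X) • (5832 * w ^ 2 * (Y:ℝ) ^ 2 / X ^ 2) = 5832 * w ^ 2 * (Y:ℝ) ^ 2 / X := by
    rw [smul_eq_mul, show 2 * X - X = X by ring]
    field_simp
  rw [c3]
  have c4 : (2 * w) ^ 3 * (∫ x in X..(2 * X), ∫ r in 0..(2 * w), QY Y (x + r) ^ 2)
      ≤ 16 * w ^ 4 * (2 * X * (10 ^ 6 * Y * (1 + Real.log Y)) + 10 ^ 5 * (Y:ℝ) ^ 3) := by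
    calc _ ≤ (2 * w) ^ 3 * (2 * w * ∫ x in X..(3 * X), QY Y x ^ 2) :=
          mul_le_mul_of_nonneg_left b4 (by positivity)
      _ = 16 * w ^ 4 * ∫ x in X..(3 * X), QY Y x ^ 2 := by ring
      _ ≤ _ := by
        refine mul_le_mul_of_nonneg_left (b4'.trans (le_of_eq ?_)) (by positivity)
        ring
  have c5 : 8 * ε ^ 2 * w ^ 2 * (∫ x in X..(2 * X), SY Y x ^ 2)
      ≤ 8 * ε ^ 2 * w ^ 2 * (X * (4000 * (1 + Real.log Y) ^ 2) + 162 * (Y:ℝ) ^ 3) := by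
    refine mul_le_mul_of_nonneg_left (b5.trans (le_of_eq ?_)) (by positivity)
    ring
  linarith

set_option maxHeartbeats 800000 in
/-- Final quantitative L² approximation. -/
lemma approx_quant : ∃ K > (0:ℝ), ∀ (ω : ℝ → ℝ) (_ : Continuous ω) (X w ε : ℝ) (_ : 1 ≤ X) (_ : 0 < w)
    (_ : w ≤ 1 / 4) (_ : 0 ≤ ε) (_ : ε ≤ 1)
    (_ : ∀ x ∈ Set.Icc X (2 * X), DifferentiableAt ℝ ω x ∧ |deriv ω x| < 1 / 2)
    (_ : ∀ x ∈ Set.Icc X (2 * X), 0 < ω x)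
    (_ : ∀ x ∈ Set.Icc X (2 * X), |ω x - w| ≤ ε * w)
    (_ : X ^ (-(1/16):ℝ) ≤ w),
    (1 / X) * ∫ x in X..(2 * X), (EE ω x - 2 * √2 * w * SY ⌊w⁻¹ ^ 2⌋₊ x) ^ 2
      ≤ K * w ^ 2 * (-Real.log w + ε ^ 2 * (Real.log w) ^ 2) := by
  obtain ⟨K, hK, hR⟩ := R_ms
  refine ⟨1365 * K + 10 ^ 10, by positivity, ?_⟩
  intro ω hc X w ε hX hw hw4 hε0 hε hd hp h hXw
  set L := -Real.log w with hL
  have hX0 : 0 < X := by linarith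
  have hL1 : 1 ≤ L := by
    rw [hL, ← Real.log_inv, Real.le_log_iff_exp_le (by positivity)]
    have : (4:ℝ) ≤ w⁻¹ := by rw [le_inv_comm₀ (by norm_num) hw]; norm_num; linarith
    linarith [Real.exp_one_lt_d9]
  set Y := ⌊w⁻¹ ^ 2⌋₊ with hY
  have hwi : (16:ℝ) ≤ w⁻¹ ^ 2 := by
    have : (4:ℝ) ≤ w⁻¹ := by rw [le_inv_comm₀ (by norm_num) hw]; norm_num; linarith
    nlinarith
  have hYle : (Y:ℝ) ≤ w⁻¹ ^ 2 := Nat.floor_le (by positivity)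
  have hYge : w⁻¹ ^ 2 / 2 ≤ Y := by
    have := Nat.lt_floor_add_one (w⁻¹ ^ 2)
    rw [← hY] at this; linarith
  have hY8 : (8:ℝ) ≤ Y := by linarith
  have hY1 : 1 ≤ Y := by
    have : (1:ℝ) ≤ Y := by linarith
    exact_mod_cast this
  have hlog : 1 + Real.log Y ≤ 3 * L := by
    have : Real.log Y ≤ Real.log (w⁻¹ ^ 2) := Real.log_le_log (by linarith) hYle
    rw [Real.log_pow, Real.log_inv] at this
    push_cast at this
    linarith
  have hlog0 : 0 ≤ 1 + Real.log Y := by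
    have := Real.log_nonneg (by linarith : (1:ℝ) ≤ Y); linarith
  have hXh : X ^ (-(1/2):ℝ) ≤ w ^ 8 := by
    have : X ^ (-(1/2):ℝ) = (X ^ (-(1/16):ℝ)) ^ 8 := by
      rw [← Real.rpow_natCast, ← Real.rpow_mul hX0.le]; norm_num
    rw [this]
    exact pow_le_pow_left₀ (by positivity) hXw 8
  have hX1 : 1 / X ≤ w ^ 8 := by
    refine le_trans ?_ hXh
    rw [one_div, ← Real.rpow_neg_one]
    exact Real.rpow_le_rpow_of_exponent_le hX (by norm_num)
  have hX1' : 1 / X ≤ 1 := by rw [div_le_one hX0]; exact hX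
  have hm := approx_int ω hc X w ε Y hX hw (by linarith) hε0 hε hY1 hd hp h
  have hI := hR X hX Y hY1
  set I := ∫ x in X..(3 * X), (RR x - PY Y x) ^ 2 with hIdef
  have hwY : w ^ 2 * Y ≤ 1 := by
    have := mul_le_mul_of_nonneg_left hYle (by positivity : 0 ≤ w ^ 2)
    rwa [inv_pow, mul_inv_cancel₀ (by positivity)] at this
  have hI2 : (1 / X) * I ≤ 7 * K * L * w ^ 2 := by
    have h1 : (1 / X) * (K * (X * (1 + Real.log Y) / Y + X ^ ((1:ℝ)/2)))
        = K * ((1 + Real.log Y) / Y + X ^ (-(1/2):ℝ)) := by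
      have : X ^ (-(1/2):ℝ) = X ^ ((1:ℝ)/2) / X := by
        rw [← Real.rpow_sub_one hX0.ne']; norm_num
      rw [this]
      field_simp
    have h2 : (1 + Real.log Y) / Y ≤ 6 * L * w ^ 2 := by
      rw [div_le_iff₀ (by linarith)]
      have : 1 ≤ 2 * w ^ 2 * Y := by
        have := mul_le_mul_of_nonneg_left hYge (by positivity : 0 ≤ 2 * w ^ 2)
        rw [inv_pow] at this
        have e : 2 * w ^ 2 * ((w ^ 2)⁻¹ / 2) = 1 := by field_simp
        linarith
      nlinarith
    have h3 : w ^ 8 ≤ L * w ^ 2 := by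
      have : w ^ 8 ≤ w ^ 2 := pow_le_pow_of_le_one hw.le (by linarith) (by norm_num)
      nlinarith [sq_nonneg w]
    calc (1 / X) * I ≤ _ := mul_le_mul_of_nonneg_left hI (by positivity)
      _ = _ := h1
      _ ≤ K * (6 * L * w ^ 2 + L * w ^ 2) :=
        mul_le_mul_of_nonneg_left (add_le_add h2 (hXh.trans h3)) hK.le
      _ = _ := by ring
  have hY3X : (Y:ℝ) ^ 3 * (1 / X) ≤ w ^ 2 := by
    calc (Y:ℝ) ^ 3 * (1 / X) ≤ (w⁻¹ ^ 2) ^ 3 * w ^ 8 :=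
          mul_le_mul (pow_le_pow_left₀ (by positivity) hYle 3) hX1 (by positivity) (by positivity)
      _ = w ^ 2 := by field_simp
  have hY2X : (Y:ℝ) ^ 2 * (1 / X) ≤ 1 := by
    calc (Y:ℝ) ^ 2 * (1 / X) ≤ (w⁻¹ ^ 2) ^ 2 * w ^ 8 :=
          mul_le_mul (pow_le_pow_left₀ (by positivity) hYle 2) hX1 (by positivity) (by positivity)
      _ = w ^ 4 := by field_simp
      _ ≤ 1 := pow_le_one₀ hw.le (by linarith)
  have t3 : (1 / X) * (5832 * w ^ 2 * (Y:ℝ) ^ 2 / X) ≤ 5832 * w ^ 2 * L := by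
    calc (1 / X) * (5832 * w ^ 2 * (Y:ℝ) ^ 2 / X) = 5832 * w ^ 2 * ((Y:ℝ) ^ 2 * (1 / X)) * (1 / X) := by ring
      _ ≤ 5832 * w ^ 2 * 1 * L :=
        mul_le_mul (mul_le_mul_of_nonneg_left hY2X (by positivity)) (by linarith) (by positivity) (by positivity)
      _ = _ := by ring
  have hw21 : w ^ 2 ≤ 1 := pow_le_one₀ hw.le (by linarith)
  have t4 : (1 / X) * (16 * w ^ 4 * (2 * X * (10 ^ 6 * Y * (1 + Real.log Y)) + 10 ^ 5 * (Y:ℝ) ^ 3))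
      ≤ 10 ^ 8 * w ^ 2 * L := by
    calc _ = 32 * 10 ^ 6 * w ^ 2 * (w ^ 2 * Y) * (1 + Real.log Y)
            + 16 * 10 ^ 5 * w ^ 4 * ((Y:ℝ) ^ 3 * (1 / X)) := by field_simp; ring
      _ ≤ 32 * 10 ^ 6 * w ^ 2 * 1 * (3 * L) + 16 * 10 ^ 5 * w ^ 4 * w ^ 2 := by
        refine add_le_add (mul_le_mul (mul_le_mul_of_nonneg_left hwY (by positivity)) hlog hlog0 (by positivity))
          (mul_le_mul_of_nonneg_left hY3X (by positivity))
      _ ≤ 96 * 10 ^ 6 * w ^ 2 * L + 16 * 10 ^ 5 * w ^ 2 * L := by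
        have h1 : w ^ 4 ≤ 1 := pow_le_one₀ hw.le (by linarith)
        have h2 : w ^ 4 * w ^ 2 ≤ L * w ^ 2 := mul_le_mul_of_nonneg_right (by linarith) (by positivity)
        linarith
      _ ≤ _ := by
        have : 0 ≤ w ^ 2 * L := by positivity
        linarith
  have t5 : (1 / X) * (8 * ε ^ 2 * w ^ 2 * (X * (4000 * (1 + Real.log Y) ^ 2) + 162 * (Y:ℝ) ^ 3))
      ≤ 10 ^ 6 * w ^ 2 * (ε ^ 2 * L ^ 2) := by
    have h1 : (1 + Real.log Y) ^ 2 ≤ 9 * L ^ 2 := by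
      have := pow_le_pow_left₀ hlog0 hlog 2
      linarith
    have h2 : w ^ 2 ≤ L ^ 2 := by nlinarith
    calc _ = 8 * ε ^ 2 * w ^ 2 * (4000 * (1 + Real.log Y) ^ 2 + 162 * ((Y:ℝ) ^ 3 * (1 / X))) := by
          field_simp
      _ ≤ 8 * ε ^ 2 * w ^ 2 * (4000 * (9 * L ^ 2) + 162 * L ^ 2) :=
        mul_le_mul_of_nonneg_left (by linarith) (by positivity)
      _ ≤ _ := by
        have : 0 ≤ ε ^ 2 * w ^ 2 * L ^ 2 := by positivity
        linarith
  have hmX := mul_le_mul_of_nonneg_left hm (by positivity : 0 ≤ 1 / X)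
  generalize 5832 * w ^ 2 * (Y:ℝ) ^ 2 / X = A3 at hmX t3
  generalize 16 * w ^ 4 * (2 * X * (10 ^ 6 * Y * (1 + Real.log Y)) + 10 ^ 5 * (Y:ℝ) ^ 3) = A4 at hmX t4
  generalize 8 * ε ^ 2 * w ^ 2 * (X * (4000 * (1 + Real.log Y) ^ 2) + 162 * (Y:ℝ) ^ 3) = A5 at hmX t5
  refine hmX.trans ?_
  have hL2 : Real.log w ^ 2 = L ^ 2 := by rw [hL]; ring
  rw [hL2]
  have e1 : 0 ≤ w ^ 2 * L := by positivity
  have e2 : 0 ≤ w ^ 2 * (ε ^ 2 * L ^ 2) := by positivity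
  have e3 : 0 ≤ K * (w ^ 2 * (ε ^ 2 * L ^ 2)) := by positivity
  linarith

lemma approx_ev (ω : ℝ → ℝ) (hc : Continuous ω) (hpos : ∀ x, 0 < ω x) (h0 : Tendsto ω atTop (nhds 0))
    (hd : ∀ᶠ x in atTop, DifferentiableAt ℝ ω x ∧ |deriv ω x| < 1 / 2)
    (hu : ∀ ε > (0:ℝ), ∀ᶠ X in atTop, ∀ x ∈ Set.Icc X (2 * X), |ω x - ω X| ≤ ε * ω X)
    (hl : ∀ α > (0:ℝ), ∀ᶠ X in atTop, X ^ (-α) ≤ ω X) (η : ℝ) (hη : 0 < η) :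
    ∀ᶠ X in atTop, (1 / X) * ∫ x in X..(2 * X), (EE ω x - 2 * √2 * ω X * SY ⌊(ω X)⁻¹ ^ 2⌋₊ x) ^ 2
      ≤ η * (ω X * Real.log (ω X)) ^ 2 := by
  obtain ⟨K, hK, hA⟩ := approx_quant
  set ε := min 1 (√(η / (2 * K))) with hε
  have hε0 : 0 < ε := lt_min one_pos (Real.sqrt_pos.2 (by positivity))
  have hε2 : ε ^ 2 ≤ η / (2 * K) := by
    have := pow_le_pow_left₀ hε0.le (min_le_right 1 (√(η / (2 * K)))) 2
    rwa [Real.sq_sqrt (by positivity)] at this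
  have hdall : ∀ᶠ X in atTop, ∀ x, X ≤ x → DifferentiableAt ℝ ω x ∧ |deriv ω x| < 1 / 2 := by
    obtain ⟨X0, h⟩ := eventually_atTop.1 hd
    filter_upwards [eventually_ge_atTop X0] with X hX x hx using h x (by linarith)
  have hsmall := h0.eventually (gt_mem_nhds (show (0:ℝ) < 1/4 by norm_num))
  have hLbig : ∀ᶠ X in atTop, Real.log (ω X) ≤ -(2 * K / η) := by
    have : Tendsto (fun X => Real.log (ω X)) atTop atBot :=
      Real.tendsto_log_nhdsGT_zero.comp (tendsto_nhdsWithin_iff.2 ⟨h0, Eventually.of_forall hpos⟩)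
    exact this.eventually_le_atBot _
  filter_upwards [hdall, hsmall, hLbig, hu ε hε0, hl (1/16) (by norm_num), eventually_ge_atTop 1]
    with X h1 h2 h3 h4 h5 h6
  refine (hA ω hc X (ω X) ε h6 (hpos X) h2.le hε0.le (min_le_left _ _) (fun x hx => h1 x hx.1)
    (fun x _ => hpos x) h4 h5).trans ?_
  set L := Real.log (ω X)
  have hL0 : 0 ≤ -L := by have : 0 ≤ 2 * K / η := by positivity
                          linarith
  have e1 : K * (-L) ≤ η / 2 * L ^ 2 := by
    have : 2 * K ≤ η * (-L) := by
      have h := mul_le_mul_of_nonneg_left h3 hη.le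
      have e : η * -(2 * K / η) = -(2 * K) := by field_simp
      rw [e] at h; linarith
    nlinarith
  have e2 : K * (ε ^ 2 * L ^ 2) ≤ η / 2 * L ^ 2 := by
    have : K * ε ^ 2 ≤ η / 2 := by
      calc K * ε ^ 2 ≤ K * (η / (2 * K)) := mul_le_mul_of_nonneg_left hε2 hK.le
        _ = η / 2 := by field_simp
    nlinarith [sq_nonneg L]
  calc K * ω X ^ 2 * (-L + ε ^ 2 * L ^ 2) = ω X ^ 2 * (K * (-L) + K * (ε ^ 2 * L ^ 2)) := by ring
    _ ≤ ω X ^ 2 * (η * L ^ 2) := mul_le_mul_of_nonneg_left (by linarith) (by positivity)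
    _ = _ := by ring

/-- Adjoin `√p` to a subfield of the reals. -/
def adjS (K : Subfield ℝ) (p : ℕ) : Subfield ℝ where
  carrier := {z | ∃ x ∈ K, ∃ y ∈ K, z = x + y * √(p:ℝ)}
  mul_mem' := by
    rintro _ _ ⟨x, hx, y, hy, rfl⟩ ⟨x', hx', y', hy', rfl⟩
    refine ⟨x * x' + p * (y * y'), K.add_mem (K.mul_mem hx hx') (K.mul_mem (natCast_mem K p) (K.mul_mem hy hy')),
      x * y' + y * x', K.add_mem (K.mul_mem hx hy') (K.mul_mem hy hx'), ?_⟩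
    have : √(p:ℝ) * √(p:ℝ) = p := Real.mul_self_sqrt (by positivity)
    linear_combination (y * y') * this
  one_mem' := ⟨1, K.one_mem, 0, K.zero_mem, by simp⟩
  add_mem' := by
    rintro _ _ ⟨x, hx, y, hy, rfl⟩ ⟨x', hx', y', hy', rfl⟩
    exact ⟨x + x', K.add_mem hx hx', y + y', K.add_mem hy hy', by ring⟩
  zero_mem' := ⟨0, K.zero_mem, 0, K.zero_mem, by simp⟩
  neg_mem' := by
    rintro _ ⟨x, hx, y, hy, rfl⟩
    exact ⟨-x, K.neg_mem hx, -y, K.neg_mem hy, by ring⟩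
  inv_mem' := by
    rintro _ ⟨x, hx, y, hy, rfl⟩
    have hs : √(p:ℝ) * √(p:ℝ) = p := Real.mul_self_sqrt (by positivity)
    by_cases h : x ^ 2 - p * y ^ 2 = 0
    · have h1 : (x - y * √(p:ℝ)) * (x + y * √(p:ℝ)) = 0 := by linear_combination h - y ^ 2 * hs
      rcases mul_eq_zero.1 h1 with h2 | h2
      · refine ⟨(2 * x)⁻¹, K.inv_mem (K.mul_mem (ofNat_mem K 2) hx), 0, K.zero_mem, ?_⟩
        rw [zero_mul, add_zero]
        congr 1
        linarith
      · refine ⟨0, K.zero_mem, 0, K.zero_mem, ?_⟩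
        rw [h2]; simp
    · refine ⟨x * (x ^ 2 - p * y ^ 2)⁻¹, ?_, -y * (x ^ 2 - p * y ^ 2)⁻¹, ?_, ?_⟩
      · exact K.mul_mem hx (K.inv_mem (K.sub_mem (K.pow_mem hx 2) (K.mul_mem (natCast_mem K p) (K.pow_mem hy 2))))
      · exact K.mul_mem (K.neg_mem hy)
          (K.inv_mem (K.sub_mem (K.pow_mem hx 2) (K.mul_mem (natCast_mem K p) (K.pow_mem hy 2))))
      · have h1 : (x - y * √(p:ℝ)) * (x + y * √(p:ℝ)) = x ^ 2 - p * y ^ 2 := by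
          linear_combination (- y ^ 2) * hs
        have h2 : x + y * √(p:ℝ) ≠ 0 := by
          intro h2; rw [h2, mul_zero] at h1; exact h h1.symm
        rw [inv_eq_iff_eq_inv, eq_comm, inv_eq_iff_eq_inv, ← h1, mul_inv]
        have h3 : x - y * √(p:ℝ) ≠ 0 := by
          intro h3; rw [h3, zero_mul] at h1; exact h h1.symm
        field_simp
        ring

lemma mem_adjS (K : Subfield ℝ) (p : ℕ) (z : ℝ) : z ∈ adjS K p ↔ ∃ x ∈ K, ∃ y ∈ K, z = x + y * √(p:ℝ) :=
  Iff.rfl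

def sqK : List ℕ → Subfield ℝ
  | [] => (algebraMap ℚ ℝ).fieldRange
  | p :: P => adjS (sqK P) p

lemma sqrt_not_mem (P : List ℕ) (hP : ∀ p ∈ P, p.Prime) (hn : P.Nodup) :
    ∀ m : ℕ, Squarefree m → 1 < m → (∀ p ∈ P, ¬ p ∣ m) → √(m:ℝ) ∉ sqK P := by
  induction P with
  | nil =>
    intro m hm h1 _ h
    obtain ⟨q, hq⟩ := h
    have : Irrational √(m:ℝ) := by
      rw [irrational_sqrt_natCast_iff]
      rintro ⟨r, hr⟩
      have := hm r ⟨1, by rw [hr]; ring⟩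
      rw [Nat.isUnit_iff] at this
      subst this; omega
    exact this ⟨q, hq⟩
  | cons p P ih =>
    intro m hm h1 hd h
    have hp : p.Prime := hP p (by simp)
    have hpP : p ∉ P := (List.nodup_cons.1 hn).1
    have ih' := ih (fun q hq => hP q (by simp [hq])) (List.nodup_cons.1 hn).2
    obtain ⟨x, hx, y, hy, he⟩ := h
    have hsp : √(p:ℝ) * √(p:ℝ) = p := Real.mul_self_sqrt (by positivity)
    have hsm : √(m:ℝ) * √(m:ℝ) = m := Real.mul_self_sqrt (by positivity)
    have hp0 : √(p:ℝ) ∉ sqK P := by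
      refine ih' p hp.prime.squarefree hp.one_lt fun q hq hqp => ?_
      have := (Nat.prime_dvd_prime_iff_eq (hP q (by simp [hq])) hp).1 hqp
      exact hpP (this ▸ hq)
    have hm0 : √(m:ℝ) ∉ sqK P := ih' m hm h1 fun q hq => hd q (by simp [hq])
    by_cases hxy : x * y = 0
    · rcases mul_eq_zero.1 hxy with h0 | h0
      · have hpm : √((p * m : ℕ):ℝ) ∉ sqK P := by
          refine ih' (p * m) ?_ ?_ ?_
          · rw [Nat.squarefree_mul_iff]
            exact ⟨(Nat.Prime.coprime_iff_not_dvd hp).2 (hd p (by simp)), hp.prime.squarefree, hm⟩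
          · exact Nat.one_lt_mul_iff.2 ⟨hp.pos, by omega, Or.inl hp.one_lt⟩
          · intro q hq hqd
            have hqp := hP q (by simp [hq])
            rcases (Nat.Prime.dvd_mul hqp).1 hqd with h2 | h2
            · have := (Nat.prime_dvd_prime_iff_eq hqp hp).1 h2
              exact hpP (this ▸ hq)
            · exact hd q (by simp [hq]) h2
        apply hpm
        rw [Nat.cast_mul, Real.sqrt_mul (by positivity), he, h0, zero_add]
        have : √(p:ℝ) * (y * √(p:ℝ)) = p * y := by linear_combination y * hsp
        rw [this]
        exact (sqK P).mul_mem (natCast_mem _ p) hy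
      · apply hm0
        rw [he, h0, zero_mul, add_zero]; exact hx
    · apply hp0
      have h2 : √(p:ℝ) = (m - x ^ 2 - p * y ^ 2) * (2 * (x * y))⁻¹ := by
        have h3 : (m:ℝ) = x ^ 2 + p * y ^ 2 + 2 * (x * y) * √(p:ℝ) := by
          rw [he] at hsm
          linear_combination -hsm + y ^ 2 * hsp
        rw [eq_mul_inv_iff_mul_eq₀ (by simpa using hxy)]
        linear_combination -h3
      rw [h2]
      exact (sqK P).mul_mem ((sqK P).sub_mem ((sqK P).sub_mem (natCast_mem _ m) ((sqK P).pow_mem hx 2))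
        ((sqK P).mul_mem (natCast_mem _ p) ((sqK P).pow_mem hy 2)))
        ((sqK P).inv_mem ((sqK P).mul_mem (ofNat_mem _ 2) ((sqK P).mul_mem hx hy)))

lemma sqfree_div {p m : ℕ} (hp : p.Prime) (hm : Squarefree m) (h : p ∣ m) :
    Squarefree (m / p) ∧ ¬ p ∣ m / p ∧ m = p * (m / p) := by
  obtain ⟨r, rfl⟩ := h
  rw [Nat.mul_div_cancel_left _ hp.pos]
  rw [Nat.squarefree_mul_iff] at hm
  exact ⟨hm.2.2, (Nat.Prime.coprime_iff_not_dvd hp).1 hm.1, rfl⟩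

lemma sqrt_mem (P : List ℕ) (hP : ∀ p ∈ P, p.Prime) :
    ∀ m : ℕ, Squarefree m → (∀ p : ℕ, p.Prime → p ∣ m → p ∈ P) → √(m:ℝ) ∈ sqK P := by
  induction P with
  | nil =>
    intro m hm h
    have : m = 1 := by
      by_contra h1
      obtain ⟨p, hp, hd⟩ := Nat.exists_prime_and_dvd h1
      simpa using h p hp hd
    subst this
    simp only [Nat.cast_one, Real.sqrt_one]
    exact one_mem _
  | cons p P ih =>
    intro m hm h
    have hp : p.Prime := hP p (by simp)
    have ih' := ih (fun q hq => hP q (by simp [hq]))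
    by_cases hd : p ∣ m
    · obtain ⟨h1, h2, h3⟩ := sqfree_div hp hm hd
      have h4 := ih' (m / p) h1 (fun q hq hqd => by
        have := h q hq (hqd.trans (Nat.div_dvd_of_dvd hd))
        rcases List.mem_cons.1 this with h5 | h5
        · subst h5; exact absurd hqd h2
        · exact h5)
      refine ⟨0, (sqK P).zero_mem, _, h4, ?_⟩
      conv_lhs => rw [h3]
      rw [Nat.cast_mul, Real.sqrt_mul (by positivity)]
      ring
    · refine ⟨√(m:ℝ), ih' m hm (fun q hq hqd => ?_), 0, (sqK P).zero_mem, by ring⟩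
      rcases List.mem_cons.1 (h q hq hqd) with h5 | h5
      · subst h5; exact absurd hqd hd
      · exact h5

lemma sqrt_indep (P : List ℕ) (hP : ∀ p ∈ P, p.Prime) (hn : P.Nodup) :
    ∀ (A : Finset ℕ) (c : ℕ → ℚ), (∀ m ∈ A, Squarefree m ∧ ∀ p : ℕ, p.Prime → p ∣ m → p ∈ P) →
      ∑ m ∈ A, (c m : ℝ) * √(m:ℝ) = 0 → ∀ m ∈ A, c m = 0 := by
  induction P with
  | nil =>
    intro A c hA hs m hm
    have h1 : ∀ m ∈ A, m = 1 := by
      intro m hm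
      by_contra h1
      obtain ⟨p, hp, hd⟩ := Nat.exists_prime_and_dvd h1
      simpa using (hA m hm).2 p hp hd
    have hA1 : A = {1} := by
      ext k; rw [Finset.mem_singleton]
      exact ⟨h1 k, fun hk => by rw [hk, ← h1 m hm]; exact hm⟩
    rw [hA1] at hs
    simp at hs
    rw [h1 m hm]; exact hs
  | cons p P ih =>
    intro A c hA hs
    have hp : p.Prime := hP p (by simp)
    have hpP : p ∉ P := (List.nodup_cons.1 hn).1
    have hP' : ∀ q ∈ P, q.Prime := fun q hq => hP q (by simp [hq])
    have ih' := ih hP' (List.nodup_cons.1 hn).2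
    have hp0 : √(p:ℝ) ∉ sqK P := by
      refine sqrt_not_mem P hP' (List.nodup_cons.1 hn).2 p hp.prime.squarefree hp.one_lt fun q hq hqp => ?_
      have := (Nat.prime_dvd_prime_iff_eq (hP q (by simp [hq])) hp).1 hqp
      exact hpP (this ▸ hq)
    set A0 := A.filter (fun m => ¬ p ∣ m) with hA0
    set A1 := (A.filter (fun m => p ∣ m)).image (fun m => m / p) with hA1
    have hA0P : ∀ m ∈ A0, Squarefree m ∧ ∀ q : ℕ, q.Prime → q ∣ m → q ∈ P := by
      intro m hm
      obtain ⟨h1, h2⟩ := Finset.mem_filter.1 hm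
      refine ⟨(hA m h1).1, fun q hq hqd => ?_⟩
      rcases List.mem_cons.1 ((hA m h1).2 q hq hqd) with h5 | h5
      · subst h5; exact absurd hqd h2
      · exact h5
    have hA1P : ∀ m ∈ A1, Squarefree m ∧ ∀ q : ℕ, q.Prime → q ∣ m → q ∈ P := by
      intro m hm
      obtain ⟨r, hr, rfl⟩ := Finset.mem_image.1 hm
      obtain ⟨h1, h2⟩ := Finset.mem_filter.1 hr
      obtain ⟨h3, h4, h5⟩ := sqfree_div hp (hA r h1).1 h2
      refine ⟨h3, fun q hq hqd => ?_⟩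
      rcases List.mem_cons.1 ((hA r h1).2 q hq (hqd.trans (Nat.div_dvd_of_dvd h2))) with h6 | h6
      · subst h6; exact absurd hqd h4
      · exact h6
    have hsum1 : ∑ m ∈ A.filter (fun m => p ∣ m), (c m : ℝ) * √(m:ℝ)
        = √(p:ℝ) * ∑ m ∈ A1, (c (p * m) : ℝ) * √(m:ℝ) := by
      rw [hA1, Finset.sum_image, Finset.mul_sum]
      · refine Finset.sum_congr rfl fun m hm => ?_
        obtain ⟨h1, h2⟩ := Finset.mem_filter.1 hm
        obtain ⟨h3, h4, h5⟩ := sqfree_div hp (hA m h1).1 h2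
        rw [← h5]
        conv_lhs => rw [show √(m:ℝ) = √((p * (m / p) : ℕ) : ℝ) by rw [← h5]]
        rw [Nat.cast_mul, Real.sqrt_mul (by positivity)]
        ring
      · intro m hm m' hm' he
        obtain ⟨h1, h2⟩ := Finset.mem_filter.1 hm
        obtain ⟨h1', h2'⟩ := Finset.mem_filter.1 hm'
        rw [(sqfree_div hp (hA m h1).1 h2).2.2, (sqfree_div hp (hA m' h1').1 h2').2.2]
        simp only at he
        rw [he]
    set a := ∑ m ∈ A0, (c m : ℝ) * √(m:ℝ) with ha
    set b := ∑ m ∈ A1, (c (p * m) : ℝ) * √(m:ℝ) with hb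
    have hab : √(p:ℝ) * b + a = 0 := by
      rw [← hsum1, ha, hA0, Finset.sum_filter_add_sum_filter_not]; exact hs
    have hamem : a ∈ sqK P := (sqK P).sum_mem fun m hm =>
      (sqK P).mul_mem (SubfieldClass.ratCast_mem _ _) (sqrt_mem P hP' m (hA0P m hm).1 (hA0P m hm).2)
    have hbmem : b ∈ sqK P := (sqK P).sum_mem fun m hm =>
      (sqK P).mul_mem (SubfieldClass.ratCast_mem _ _) (sqrt_mem P hP' m (hA1P m hm).1 (hA1P m hm).2)
    have hb0 : b = 0 := by
      by_contra hb0
      apply hp0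
      have : √(p:ℝ) = -a * b⁻¹ := by
        rw [eq_mul_inv_iff_mul_eq₀ hb0]; linear_combination hab
      rw [this]
      exact (sqK P).mul_mem ((sqK P).neg_mem hamem) ((sqK P).inv_mem hbmem)
    have ha0 : a = 0 := by rw [hb0] at hab; simpa using hab
    have r0 := ih' A0 c hA0P ha0
    have r1 := ih' A1 (fun m => c (p * m)) hA1P hb0
    intro m hm
    by_cases hd : p ∣ m
    · have h1 : m / p ∈ A1 := Finset.mem_image.2 ⟨m, Finset.mem_filter.2 ⟨hm, hd⟩, rfl⟩
      have := r1 _ h1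
      rwa [Nat.mul_div_cancel' hd] at this
    · exact r0 m (Finset.mem_filter.2 ⟨hm, hd⟩)

/-- ℚ-linear independence of square roots of squarefree numbers. -/
lemma sqrt_lin_indep (A : Finset ℕ) (c : ℕ → ℚ) (hA : ∀ m ∈ A, Squarefree m)
    (h : ∑ m ∈ A, (c m : ℝ) * √(m:ℝ) = 0) : ∀ m ∈ A, c m = 0 := by
  refine sqrt_indep (A.biUnion Nat.primeFactors).toList ?_ (Finset.nodup_toList _) A c ?_ h
  · intro p hp
    rw [Finset.mem_toList, Finset.mem_biUnion] at hp
    obtain ⟨m, _, hm⟩ := hp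
    exact Nat.prime_of_mem_primeFactors hm
  · intro m hm
    refine ⟨hA m hm, fun p hp hd => ?_⟩
    rw [Finset.mem_toList, Finset.mem_biUnion]
    exact ⟨m, hm, Nat.mem_primeFactors.2 ⟨hp, hd, (hA m hm).ne_zero⟩⟩

open Polynomial in
lemma shift_poly (n : ℕ) (s : ℝ) (hs : s * s = n) (Q : ℤ[X]) : ∃ A B : ℤ[X],
    (Q.map (Int.castRingHom ℝ)).comp (X + C s)
      = A.map (Int.castRingHom ℝ) + C s * B.map (Int.castRingHom ℝ) ∧
    (Q.map (Int.castRingHom ℝ)).comp (X - C s)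
      = A.map (Int.castRingHom ℝ) - C s * B.map (Int.castRingHom ℝ) := by
  have hC : (C s : ℝ[X]) * C s = (n : ℝ[X]) := by rw [← C_mul, hs]; simp
  induction Q using Polynomial.induction_on with
  | C a => exact ⟨C a, 0, by simp, by simp⟩
  | add p q hp hq =>
    obtain ⟨A, B, h1, h2⟩ := hp
    obtain ⟨A', B', h1', h2'⟩ := hq
    refine ⟨A + A', B + B', ?_, ?_⟩
    · rw [Polynomial.map_add, add_comp, h1, h1']; simp only [Polynomial.map_add]; ring
    · rw [Polynomial.map_add, add_comp, h2, h2']; simp only [Polynomial.map_add]; ring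
  | monomial k a h =>
    obtain ⟨A, B, h1, h2⟩ := h
    refine ⟨A * X + (n : ℤ[X]) * B, A + B * X, ?_, ?_⟩
    · rw [pow_succ, ← mul_assoc, Polynomial.map_mul, mul_comp, h1]
      simp only [Polynomial.map_add, Polynomial.map_mul, Polynomial.map_X, Polynomial.map_natCast, X_comp]
      linear_combination (B.map (Int.castRingHom ℝ)) * hC
    · rw [pow_succ, ← mul_assoc, Polynomial.map_mul, mul_comp, h2]
      simp only [Polynomial.map_add, Polynomial.map_mul, Polynomial.map_X, Polynomial.map_natCast, X_comp]
      linear_combination (B.map (Int.castRingHom ℝ)) * hC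

def rts : List ℕ → Multiset ℝ
  | [] => {0}
  | n :: l => (rts l).map (fun s => s + √(n:ℝ)) + (rts l).map (fun s => s - √(n:ℝ))

lemma rts_card (l : List ℕ) : (rts l).card = 2 ^ l.length := by
  induction l with
  | nil => simp [rts]
  | cons n l ih => simp [rts, ih]; ring

lemma rts_abs (l : List ℕ) : ∀ s ∈ rts l, |s| ≤ (l.map (fun n : ℕ => √(n:ℝ))).sum := by
  induction l with
  | nil => simp [rts]
  | cons n l ih =>
    intro s hs
    simp only [rts, Multiset.mem_add, Multiset.mem_map] at hs
    rw [List.map_cons, List.sum_cons]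
    rcases hs with ⟨t, ht, rfl⟩ | ⟨t, ht, rfl⟩
    · have := ih t ht
      refine (abs_add_le _ _).trans ?_
      rw [abs_of_nonneg (Real.sqrt_nonneg _)]; linarith
    · have := ih t ht
      refine (abs_sub _ _).trans ?_
      rw [abs_of_nonneg (Real.sqrt_nonneg _)]; linarith

open Polynomial in
lemma rts_int (l : List ℕ) : ∃ Q : ℤ[X],
    Q.map (Int.castRingHom ℝ) = ((rts l).map (fun s => (X - C s : ℝ[X]))).prod := by
  induction l with
  | nil => exact ⟨X, by simp [rts]⟩
  | cons n l ih =>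
    obtain ⟨Q, hQ⟩ := ih
    have hs : √(n:ℝ) * √(n:ℝ) = n := Real.mul_self_sqrt (by positivity)
    obtain ⟨A, B, h1, h2⟩ := shift_poly n (√(n:ℝ)) hs Q
    have hC : (C (√(n:ℝ)) : ℝ[X]) * C (√(n:ℝ)) = (n : ℝ[X]) := by rw [← C_mul, hs]; simp
    refine ⟨A ^ 2 - n * B ^ 2, ?_⟩
    have e1 : ((rts l).map (fun s => (X - C (s + √(n:ℝ)) : ℝ[X]))).prod
        = (Q.map (Int.castRingHom ℝ)).comp (X - C (√(n:ℝ))) := by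
      rw [hQ, Polynomial.multiset_prod_comp, Multiset.map_map]
      congr 1
      refine Multiset.map_congr rfl fun s _ => ?_
      simp; ring
    have e2 : ((rts l).map (fun s => (X - C (s - √(n:ℝ)) : ℝ[X]))).prod
        = (Q.map (Int.castRingHom ℝ)).comp (X + C (√(n:ℝ))) := by
      rw [hQ, Polynomial.multiset_prod_comp, Multiset.map_map]
      congr 1
      refine Multiset.map_congr rfl fun s _ => ?_
      simp; ring
    simp only [rts, Multiset.map_add, Multiset.prod_add, Multiset.map_map, Function.comp_def]
    rw [e1, e2, h1, h2]
    simp only [Polynomial.map_sub, Polynomial.map_mul, Polynomial.map_pow, Polynomial.map_natCast]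
    linear_combination (B.map (Int.castRingHom ℝ)) ^ 2 * hC

open Polynomial in
lemma rts_prod (l : List ℕ) : 1 ≤ (((rts l).filter (fun s => s ≠ 0)).map (fun s => |s|)).prod := by
  obtain ⟨Q, hQ⟩ := rts_int l
  set R := rts l
  set R1 := R.filter (fun s => s ≠ 0) with hR1
  set k := (R.filter (fun s => s = 0)).card with hk
  have hsplit : R.filter (fun s => s = 0) + R1 = R := Multiset.filter_add_not _ R
  have h0 : ((R.filter (fun s => s = 0)).map (fun s => (X - C s : ℝ[X]))).prod = X ^ k := by
    have : (R.filter (fun s => s = 0)).map (fun s => (X - C s : ℝ[X]))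
        = (R.filter (fun s => s = 0)).map (fun _ => (X : ℝ[X])) := by
      refine Multiset.map_congr rfl fun s hs => ?_
      rw [(Multiset.mem_filter.1 hs).2]; simp
    rw [this, Multiset.map_const', Multiset.prod_replicate]
  have h1 : Q.map (Int.castRingHom ℝ) = X ^ k * (R1.map (fun s => (X - C s : ℝ[X]))).prod := by
    rw [hQ, ← hsplit, Multiset.map_add, Multiset.prod_add, h0]
  have h2 : ((Q.coeff k : ℤ) : ℝ) = (R1.map (fun s => -s)).prod := by
    have := congrArg (fun p => p.coeff k) h1
    simp only [coeff_map, coeff_X_pow_mul', le_refl, if_true, Nat.sub_self] at this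
    rw [coeff_zero_eq_eval_zero, Polynomial.eval_multiset_prod, Multiset.map_map] at this
    simpa [Function.comp_def] using this
  have h3 : |((Q.coeff k : ℤ) : ℝ)| = (R1.map (fun s => |s|)).prod := by
    rw [h2]
    have := map_multiset_prod (absHom : ℝ →*₀ ℝ) (R1.map (fun s => -s))
    rw [Multiset.map_map] at this
    simpa [Function.comp_def, absHom] using this
  rw [← h3]
  have h4 : Q.coeff k ≠ 0 := by
    intro h4
    rw [h4, Int.cast_zero] at h2
    have := Multiset.prod_eq_zero_iff.1 h2.symm
    obtain ⟨s, hs, hs0⟩ := Multiset.mem_map.1 this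
    exact (Multiset.mem_filter.1 hs).2 (neg_eq_zero.1 hs0)
  exact_mod_cast Int.one_le_abs h4

lemma rts_sep (l : List ℕ) (M : ℝ) (hM1 : 1 ≤ M) (hM : (l.map (fun n : ℕ => √(n:ℝ))).sum ≤ M) :
    ∀ s ∈ rts l, s ≠ 0 → 1 ≤ |s| * M ^ (2 ^ l.length) := by
  intro s hs hs0
  have h := rts_prod l
  have hm : s ∈ (rts l).filter (fun s => s ≠ 0) := Multiset.mem_filter.2 ⟨hs, hs0⟩
  obtain ⟨R, hR⟩ := Multiset.exists_cons_of_mem hm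
  rw [hR, Multiset.map_cons, Multiset.prod_cons] at h
  refine h.trans (mul_le_mul_of_nonneg_left ?_ (abs_nonneg _))
  have h1 : ∀ t ∈ R, |t| ≤ M := by
    intro t ht
    have : t ∈ (rts l).filter (fun s => s ≠ 0) := by rw [hR]; exact Multiset.mem_cons_of_mem ht
    exact (rts_abs l t (Multiset.mem_filter.1 this).1).trans hM
  have h2 : (R.map (fun s => |s|)).prod ≤ M ^ R.card := by
    clear hR h
    induction R using Multiset.induction_on with
    | empty => simp
    | cons a R ih =>
      rw [Multiset.map_cons, Multiset.prod_cons, Multiset.card_cons, pow_succ']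
      refine mul_le_mul (h1 a (Multiset.mem_cons_self a R)) (ih fun t ht => h1 t (Multiset.mem_cons_of_mem ht))
        ?_ (by linarith)
      exact Multiset.prod_nonneg (by simp)
  refine h2.trans (pow_le_pow_right₀ hM1 ?_)
  have h3 : R.card + 1 ≤ (rts l).card := by
    rw [← Multiset.card_cons s, ← hR]; exact Multiset.card_le_card (Multiset.filter_le _ _)
  rw [rts_card] at h3
  omega

def sg (b : Bool) : ℝ := if b then 1 else -1

lemma rts_mem (i : ℕ) (κ : Fin i → ℕ × Bool) :
    ∑ j, sg (κ j).2 * √((κ j).1 : ℝ) ∈ rts (List.ofFn fun j => (κ j).1) := by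
  induction i with
  | zero => simp [rts]
  | succ i ih =>
    rw [List.ofFn_succ, Fin.sum_univ_succ]
    have h := ih (fun j => κ j.succ)
    simp only [rts, Multiset.mem_add, Multiset.mem_map]
    cases hb : (κ 0).2
    · right; exact ⟨_, h, by simp [sg]; ring⟩
    · left; exact ⟨_, h, by simp [sg]; ring⟩

lemma sep (i Y : ℕ) (κ : Fin i → ℕ × Bool) (hκ : ∀ j, (κ j).1 ≤ Y)
    (h0 : ∑ j, sg (κ j).2 * √((κ j).1 : ℝ) ≠ 0) :
    1 ≤ |∑ j, sg (κ j).2 * √((κ j).1 : ℝ)| * ((i * Y + 1 : ℝ)) ^ (2 ^ i) := by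
  have := rts_sep (List.ofFn fun j => (κ j).1) (i * Y + 1) (by
      have : (0:ℝ) ≤ i * Y := by positivity
      linarith) ?_ _ (rts_mem i κ) h0
  · simpa using this
  · rw [List.map_ofFn, List.sum_ofFn]
    have : ∑ j : Fin i, ((fun n : ℕ => √(n:ℝ)) ∘ fun j => (κ j).1) j ≤ ∑ j : Fin i, (Y:ℝ) := by
      refine Finset.sum_le_sum fun j _ => ?_
      simp only [Function.comp]
      rw [Real.sqrt_le_left (by positivity)]
      have h1 : (((κ j).1 : ℕ):ℝ) ≤ Y := by exact_mod_cast hκ j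
      rcases Nat.eq_zero_or_pos Y with h2 | h2
      · have := hκ j
        have h3 : (κ j).1 = 0 := by omega
        rw [h3]; simp
      · have : (1:ℝ) ≤ Y := by exact_mod_cast h2
        nlinarith
    simp at this
    simp
    linarith

abbrev RA := AddMonoidAlgebra ℂ ℝ

/-- Gaussian moments with variance `V`. -/
def GG : ℕ → ℝ → ℝ
  | 0, _ => 1
  | 1, _ => 0
  | (i+2), V => (i+1) * V * GG i V

structure SD (B : ℕ → ℝ) (E : RA →ₗ[ℂ] ℂ) (f : ℕ → RA) (V : ℕ → ℝ) (A0 : Finset ℕ) : Prop where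
  one : E 1 = 1
  ind : ∀ A ⊆ A0, ∀ m ∈ A0, m ∉ A → ∀ k l : ℕ,
    E (f m ^ k * (∑ n ∈ A, f n) ^ l) = E (f m ^ k) * E ((∑ n ∈ A, f n) ^ l)
  a1 : ∀ m ∈ A0, E (f m) = 0
  a2 : ∀ m ∈ A0, E (f m ^ 2) = (V m : ℂ)
  V0 : ∀ m ∈ A0, 0 ≤ V m
  VB : ∀ m ∈ A0, V m ≤ B 2
  a3 : ∀ l ≥ 3, ∑ m ∈ A0, ‖E (f m ^ l)‖ ≤ B l

lemma stein_rec {B : ℕ → ℝ} {E : RA →ₗ[ℂ] ℂ} {f : ℕ → RA} {V : ℕ → ℝ} {A0 : Finset ℕ}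
    (h : SD B E f V A0) (A : Finset ℕ) (hA : A ⊆ A0) (i : ℕ) :
    E ((∑ n ∈ A, f n) ^ (i+1)) = ∑ m ∈ A, ∑ l ∈ Finset.range (i+1),
      E (f m ^ (l+1)) * E ((∑ n ∈ A.erase m, f n) ^ (i - l)) * (i.choose l : ℂ) := by
  rw [pow_succ', Finset.sum_mul, map_sum]
  refine Finset.sum_congr rfl fun m hm => ?_
  rw [← Finset.add_sum_erase A f hm, add_pow, Finset.mul_sum, map_sum]
  refine Finset.sum_congr rfl fun l _ => ?_
  have e : f m * (f m ^ l * (∑ n ∈ A.erase m, f n) ^ (i - l) * (i.choose l : RA))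
      = (i.choose l : ℂ) • (f m ^ (l+1) * (∑ n ∈ A.erase m, f n) ^ (i - l)) := by
    rw [Algebra.smul_def, map_natCast]; ring
  rw [e, map_smul, h.ind _ ((Finset.erase_subset _ _).trans hA) m (hA hm) (Finset.notMem_erase _ _),
    smul_eq_mul, mul_comm]

lemma GG_bd (i : ℕ) : ∃ g : ℝ, 0 ≤ g ∧ ∀ V s : ℝ, 0 ≤ V → 1 ≤ s → V ≤ s ^ 2 → |GG i V| ≤ g * s ^ i := by
  induction i using Nat.twoStepInduction with
  | zero => exact ⟨1, by norm_num, fun V s _ _ _ => by simp [GG]⟩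
  | one => exact ⟨0, by norm_num, fun V s _ _ _ => by simp [GG]⟩
  | more i ih _ =>
    obtain ⟨g, hg, h⟩ := ih
    refine ⟨(i+1) * g, by positivity, fun V s hV hs hVs => ?_⟩
    have := h V s hV hs hVs
    rw [GG, abs_mul, abs_mul, abs_of_nonneg (by positivity : (0:ℝ) ≤ (i:ℝ)+1), abs_of_nonneg hV]
    calc ((i:ℝ)+1) * V * |GG i V| ≤ ((i:ℝ)+1) * s^2 * (g * s^i) := by gcongr
      _ = _ := by ring

lemma GG_lip (B : ℝ) (hB : 0 ≤ B) (i : ℕ) : ∃ K : ℝ, 0 ≤ K ∧ ∀ V V' s : ℝ, 0 ≤ V' → V' ≤ V → V - V' ≤ B →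
    1 ≤ s → V ≤ s ^ 2 → |GG i V - GG i V'| * s ≤ K * s ^ i := by
  induction i using Nat.twoStepInduction with
  | zero => exact ⟨0, le_rfl, fun V V' s _ _ _ _ _ => by simp [GG]⟩
  | one => exact ⟨0, le_rfl, fun V V' s _ _ _ _ _ => by simp [GG]⟩
  | more i ih _ =>
    obtain ⟨K, hK, h⟩ := ih
    obtain ⟨g, hg, h'⟩ := GG_bd i
    refine ⟨(i+1) * (K + B * g), by positivity, fun V V' s hV' hVV hB' hs hVs => ?_⟩
    have h1 := h V V' s hV' hVV hB' hs hVs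
    have h2 := h' V' s hV' hs (hVV.trans hVs)
    have e : GG (i+2) V - GG (i+2) V' = (i+1) * (V * (GG i V - GG i V') + (V - V') * GG i V') := by
      simp only [GG]; ring
    have hV : 0 ≤ V := hV'.trans hVV
    rw [e, abs_mul, abs_of_nonneg (by positivity : (0:ℝ) ≤ (i:ℝ)+1)]
    have h3 : |V * (GG i V - GG i V') + (V - V') * GG i V'| ≤ V * |GG i V - GG i V'| + B * |GG i V'| := by
      refine (abs_add_le _ _).trans ?_
      rw [abs_mul, abs_mul, abs_of_nonneg hV, abs_of_nonneg (sub_nonneg.2 hVV)]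
      gcongr
    have hss : s ≤ s ^ 2 := by nlinarith
    calc _ ≤ ((i:ℝ)+1) * (V * |GG i V - GG i V'| + B * |GG i V'|) * s := by gcongr
      _ = ((i:ℝ)+1) * (V * (|GG i V - GG i V'| * s) + B * |GG i V'| * s) := by ring
      _ ≤ ((i:ℝ)+1) * (s^2 * (K * s^i) + B * (g * s^i) * s^2) := by gcongr
      _ = _ := by ring

lemma stein (B : ℕ → ℝ) (hB : ∀ i, 0 ≤ B i) (i : ℕ) : ∃ C : ℝ, 0 ≤ C ∧
    ∀ (E : RA →ₗ[ℂ] ℂ) (f : ℕ → RA) (V : ℕ → ℝ) (A0 : Finset ℕ), SD B E f V A0 →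
    ∀ A ⊆ A0, ∀ s : ℝ, 1 ≤ s → ∑ m ∈ A, V m ≤ s ^ 2 →
    ‖E ((∑ m ∈ A, f m) ^ i) - (GG i (∑ m ∈ A, V m) : ℂ)‖ * s ≤ C * s ^ i := by
  induction i using Nat.strong_induction_on with
  | _ i ih =>
  rcases i with _ | i
  · exact ⟨0, le_rfl, fun E f V A0 h A _ s _ _ => by simp [GG, h.one]⟩
  have hb : ∀ k ∈ Finset.range (i+1), ∃ D : ℝ, 0 ≤ D ∧
      ∀ (E : RA →ₗ[ℂ] ℂ) (f : ℕ → RA) (V : ℕ → ℝ) (A0 : Finset ℕ), SD B E f V A0 →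
      ∀ A ⊆ A0, ∀ s : ℝ, 1 ≤ s → ∑ m ∈ A, V m ≤ s ^ 2 → 
      ‖E ((∑ m ∈ A, f m) ^ k)‖ ≤ D * s ^ k := by
    intro k hk
    obtain ⟨C, hC, h⟩ := ih k (Finset.mem_range.1 hk)
    obtain ⟨g, hg, h'⟩ := GG_bd k
    refine ⟨C + g, by positivity, fun E f V A0 hS A hA s hs hV => ?_⟩
    have h1 := h E f V A0 hS A hA s hs hV
    have h2 := h' _ s (Finset.sum_nonneg fun m hm => hS.V0 m (hA hm)) hs hV
    have h3 : ‖E ((∑ m ∈ A, f m) ^ k)‖ ≤ ‖E ((∑ m ∈ A, f m) ^ k) - (GG k (∑ m ∈ A, V m) : ℂ)‖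
        + |GG k (∑ m ∈ A, V m)| := by
      have := norm_add_le (E ((∑ m ∈ A, f m) ^ k) - (GG k (∑ m ∈ A, V m) : ℂ)) (GG k (∑ m ∈ A, V m) : ℂ)
      rwa [sub_add_cancel, Complex.norm_real, Real.norm_eq_abs] at this
    have h4 : ‖E ((∑ m ∈ A, f m) ^ k) - (GG k (∑ m ∈ A, V m) : ℂ)‖ ≤
      ‖E ((∑ m ∈ A, f m) ^ k) - (GG k (∑ m ∈ A, V m) : ℂ)‖ * s := le_mul_of_one_le_right (norm_nonneg _) hs
    linarith
  choose! D hD0 hD using hb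
  rcases i with _ | i
  · refine ⟨0, le_rfl, fun E f V A0 h A hA s _ _ => ?_⟩
    have : E (∑ m ∈ A, f m) = 0 := by
      rw [map_sum]; exact Finset.sum_eq_zero fun m hm => h.a1 m (hA hm)
    simp [GG, this]
  obtain ⟨C1, hC1, h1⟩ := ih i (by omega)
  obtain ⟨K, hK, hKl⟩ := GG_lip (B 2) (hB 2) i
  set W : ℝ := ∑ l ∈ Finset.range i, B (l+3) * D (i - (l + 1)) * ((i+1).choose (l+2)) with hW
  have hW0 : 0 ≤ W := Finset.sum_nonneg fun l hl => by
    have := hD0 (i - (l+1)) (Finset.mem_range.2 (by omega))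
    have := hB (l+3)
    positivity
  refine ⟨(i+1) * (C1 + K) + W, by positivity, fun E f V A0 h A hA s hs hV => ?_⟩
  have hVA0 : 0 ≤ ∑ m ∈ A, V m := Finset.sum_nonneg fun m hm => h.V0 m (hA hm)
  have hs0 : 0 ≤ s := by linarith
  have hVe : ∀ m ∈ A, ∑ n ∈ A.erase m, V n = (∑ n ∈ A, V n) - V m := fun m hm => by
    rw [← Finset.add_sum_erase A V hm]; ring
  have hVe' : ∀ m ∈ A, ∑ n ∈ A.erase m, V n ≤ s ^ 2 := fun m hm => by
    have := h.V0 m (hA hm); rw [hVe m hm]; linarith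
  have hsub : ∀ m, A.erase m ⊆ A0 := fun m => (Finset.erase_subset _ _).trans hA
  have key : E ((∑ m ∈ A, f m) ^ (i+2)) - (GG (i+2) (∑ m ∈ A, V m) : ℂ)
      = ∑ m ∈ A, ((V m : ℂ) * (i+1) * (E ((∑ n ∈ A.erase m, f n) ^ i) - (GG i (∑ n ∈ A, V n) : ℂ))
        + ∑ l ∈ Finset.range i, E (f m ^ (l+3)) * E ((∑ n ∈ A.erase m, f n) ^ (i - (l + 1))) * ((i+1).choose (l+2) : ℂ)) := by
    rw [stein_rec h A hA (i+1)]
    have eG : (GG (i+2) (∑ m ∈ A, V m) : ℂ) = ∑ m ∈ A, (V m : ℂ) * (i+1) * (GG i (∑ n ∈ A, V n) : ℂ) := by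
      rw [← Finset.sum_mul, ← Finset.sum_mul]; simp only [GG]; push_cast; ring
    rw [eG, ← Finset.sum_sub_distrib]
    refine Finset.sum_congr rfl fun m hm => ?_
    rw [Finset.sum_range_succ', Finset.sum_range_succ']
    simp only [zero_add, pow_one, h.a1 m (hA hm), h.a2 m (hA hm)]
    have : ∀ l ∈ Finset.range i, E (f m ^ (l + 1 + 1 + 1)) * E ((∑ n ∈ A.erase m, f n) ^ (i + 1 - (l + 1 + 1))) * ((i+1).choose (l + 1 + 1) : ℂ)
      = E (f m ^ (l+3)) * E ((∑ n ∈ A.erase m, f n) ^ (i - (l + 1))) * ((i+1).choose (l+2) : ℂ) := by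
      intro l hl
      rw [show i + 1 - (l+1+1) = i - (l+1) by omega]
    rw [Finset.sum_congr rfl this]
    simp
    ring
  rw [key]
  have hm : ∀ m ∈ A, ‖(V m : ℂ) * (i+1) * (E ((∑ n ∈ A.erase m, f n) ^ i) - (GG i (∑ n ∈ A, V n) : ℂ))‖ * s
      ≤ V m * ((i+1) * ((C1 + K) * s ^ i)) := by
    intro m hm
    have e1 := h1 E f V A0 h (A.erase m) (hsub m) s hs (hVe' m hm)
    have e2 := hKl (∑ n ∈ A, V n) (∑ n ∈ A.erase m, V n) s
      (Finset.sum_nonneg fun n hn => h.V0 n (hsub m hn)) (by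
        have := h.V0 m (hA hm); rw [hVe m hm]; linarith) (by
        have := h.VB m (hA hm); rw [hVe m hm]; linarith) hs hV
    have e3 : ‖E ((∑ n ∈ A.erase m, f n) ^ i) - (GG i (∑ n ∈ A, V n) : ℂ)‖ ≤
        ‖E ((∑ n ∈ A.erase m, f n) ^ i) - (GG i (∑ n ∈ A.erase m, V n) : ℂ)‖
        + |GG i (∑ n ∈ A, V n) - GG i (∑ n ∈ A.erase m, V n)| := by
      have := norm_sub_le (E ((∑ n ∈ A.erase m, f n) ^ i) - (GG i (∑ n ∈ A.erase m, V n) : ℂ))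
        (((GG i (∑ n ∈ A, V n) - GG i (∑ n ∈ A.erase m, V n) : ℝ)) : ℂ)
      rw [Complex.norm_real, Real.norm_eq_abs] at this
      refine le_trans (le_of_eq ?_) this
      congr 1; push_cast; ring
    have e4 : ‖(V m : ℂ) * (i+1)‖ = V m * (i+1) := by
      rw [norm_mul, Complex.norm_real, Real.norm_of_nonneg (h.V0 m (hA hm))]
      congr 1
      exact_mod_cast Complex.norm_natCast (i+1)
    rw [norm_mul, e4]
    have := h.V0 m (hA hm)
    have e5 : ‖E ((∑ n ∈ A.erase m, f n) ^ i) - (GG i (∑ n ∈ A, V n) : ℂ)‖ * s ≤ (C1 + K) * s ^ i := by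
      refine (mul_le_mul_of_nonneg_right e3 hs0).trans ?_
      rw [add_mul, add_mul]
      exact add_le_add e1 e2
    calc _ = V m * ((i+1) * (‖E ((∑ n ∈ A.erase m, f n) ^ i) - (GG i (∑ n ∈ A, V n) : ℂ)‖ * s)) := by ring
      _ ≤ _ := by
        exact mul_le_mul_of_nonneg_left (mul_le_mul_of_nonneg_left e5 (by positivity)) this
  have hl : ∀ m ∈ A, ‖∑ l ∈ Finset.range i, E (f m ^ (l+3)) * E ((∑ n ∈ A.erase m, f n) ^ (i - (l + 1))) * ((i+1).choose (l+2) : ℂ)‖ * s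
      ≤ ∑ l ∈ Finset.range i, ‖E (f m ^ (l+3))‖ * (D (i - (l+1)) * ((i+1).choose (l+2)) * s ^ i) := by
    intro m hm
    refine (mul_le_mul_of_nonneg_right (norm_sum_le _ _) hs0).trans ?_
    rw [Finset.sum_mul]
    refine Finset.sum_le_sum fun l hl => ?_
    have hl' := Finset.mem_range.1 hl
    have e1 := hD (i - (l+1)) (Finset.mem_range.2 (by omega)) E f V A0 h (A.erase m) (hsub m) s hs (hVe' m hm)
    have e2 := hD0 (i - (l+1)) (Finset.mem_range.2 (by omega))
    rw [norm_mul, norm_mul, Complex.norm_natCast]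
    have e3 : s ^ (i - (l+1)) * s ≤ s ^ i := by
      rw [← pow_succ]; exact pow_le_pow_right₀ hs (by omega)
    calc _ ≤ ‖E (f m ^ (l+3))‖ * (D (i - (l+1)) * s ^ (i - (l+1))) * ((i+1).choose (l+2)) * s := by gcongr
      _ = ‖E (f m ^ (l+3))‖ * (D (i - (l+1)) * ((i+1).choose (l+2)) * (s ^ (i - (l+1)) * s)) := by ring
      _ ≤ _ := by gcongr
  refine (mul_le_mul_of_nonneg_right (norm_sum_le _ _) hs0).trans ?_
  rw [Finset.sum_mul]
  have hfin : ∀ m ∈ A, ‖(V m : ℂ) * (i+1) * (E ((∑ n ∈ A.erase m, f n) ^ i) - (GG i (∑ n ∈ A, V n) : ℂ))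
        + ∑ l ∈ Finset.range i, E (f m ^ (l+3)) * E ((∑ n ∈ A.erase m, f n) ^ (i - (l + 1))) * ((i+1).choose (l+2) : ℂ)‖ * s
      ≤ V m * ((i+1) * ((C1 + K) * s ^ i)) + ∑ l ∈ Finset.range i, ‖E (f m ^ (l+3))‖ * (D (i - (l+1)) * ((i+1).choose (l+2)) * s ^ i) := by
    intro m hm'
    have := mul_le_mul_of_nonneg_right (norm_add_le ((V m : ℂ) * (i+1) * (E ((∑ n ∈ A.erase m, f n) ^ i) - (GG i (∑ n ∈ A, V n) : ℂ))) (∑ l ∈ Finset.range i, E (f m ^ (l+3)) * E ((∑ n ∈ A.erase m, f n) ^ (i - (l + 1))) * ((i+1).choose (l+2) : ℂ))) hs0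
    have a := hm m hm'
    have b := hl m hm'
    linarith
  refine (Finset.sum_le_sum hfin).trans ?_
  rw [Finset.sum_add_distrib, ← Finset.sum_mul, Finset.sum_comm]
  have hW1 : ∑ l ∈ Finset.range i, ∑ m ∈ A, ‖E (f m ^ (l+3))‖ * (D (i - (l+1)) * ((i+1).choose (l+2)) * s ^ i)
      ≤ W * s ^ i := by
    rw [hW, Finset.sum_mul]
    refine Finset.sum_le_sum fun l hl => ?_
    have hl' := Finset.mem_range.1 hl
    have e2 := hD0 (i - (l+1)) (Finset.mem_range.2 (by omega))
    rw [← Finset.sum_mul]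
    have e4 : ∑ m ∈ A, ‖E (f m ^ (l+3))‖ ≤ B (l+3) :=
      (Finset.sum_le_sum_of_subset_of_nonneg hA fun _ _ _ => norm_nonneg _).trans (h.a3 (l+3) (by omega))
    calc _ ≤ B (l+3) * (D (i - (l+1)) * ((i+1).choose (l+2)) * s ^ i) := by gcongr
      _ = _ := by ring
  have hs2 : s ^ i ≤ s ^ (i+2) := pow_le_pow_right₀ hs (by omega)
  calc _ ≤ s^2 * ((i+1) * ((C1 + K) * s ^ i)) + W * s ^ i := by gcongr
    _ ≤ s^2 * ((i+1) * ((C1 + K) * s ^ i)) + W * s ^ (i+2) := by gcongr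
    _ = _ := by ring

/-- constant coefficient -/
def c0 : RA →ₗ[ℂ] ℂ := (Finsupp.lapply (0:ℝ)).comp (AddMonoidAlgebra.coeffLinearEquiv ℂ).toLinearMap

lemma c0_single (x : ℝ) (a : ℂ) : c0 (AddMonoidAlgebra.single x a) = if x = 0 then a else 0 := by
  classical
  simp only [c0, LinearMap.comp_apply, LinearEquiv.coe_coe, Finsupp.lapply_apply,
    AddMonoidAlgebra.coeffLinearEquiv_apply, AddMonoidAlgebra.coeff_single, Finsupp.single_apply]

lemma prod_single {ι : Type*} (s : Finset ι) (l : ι → ℝ) (c : ι → ℂ) :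
    ∏ i ∈ s, (AddMonoidAlgebra.single (l i) (c i) : RA) = AddMonoidAlgebra.single (∑ i ∈ s, l i) (∏ i ∈ s, c i) := by
  classical
  induction s using Finset.induction_on with
  | empty => simp [AddMonoidAlgebra.one_def]
  | insert a s ha ih =>
    rw [Finset.prod_insert ha, Finset.sum_insert ha, Finset.prod_insert ha, ih,
      AddMonoidAlgebra.single_mul_single]

lemma pow_expand {J : Type*} (s : Finset J) (l : J → ℝ) (c : J → ℂ) (k : ℕ) :
    (∑ p ∈ s, (AddMonoidAlgebra.single (l p) (c p) : RA)) ^ k =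
      ∑ κ ∈ Fintype.piFinset (fun _ : Fin k => s), AddMonoidAlgebra.single (∑ i, l (κ i)) (∏ i, c (κ i)) := by
  rw [Finset.sum_pow']
  exact Finset.sum_congr rfl fun κ _ => prod_single _ _ _

lemma c0_pow {J : Type*} (s : Finset J) (l : J → ℝ) (c : J → ℂ) (k : ℕ) :
    c0 ((∑ p ∈ s, (AddMonoidAlgebra.single (l p) (c p) : RA)) ^ k) =
      ∑ κ ∈ Fintype.piFinset (fun _ : Fin k => s), if ∑ i, l (κ i) = 0 then ∏ i, c (κ i) else 0 := by
  rw [pow_expand, map_sum]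
  exact Finset.sum_congr rfl fun κ _ => c0_single _ _

lemma c0_ind {J : Type*} (s t : Finset J) (l : J → ℝ) (c : J → ℂ) (k k' : ℕ)
    (h : ∀ κ ∈ Fintype.piFinset (fun _ : Fin k => s), ∀ κ' ∈ Fintype.piFinset (fun _ : Fin k' => t),
      (∑ i, l (κ i)) + ∑ i, l (κ' i) = 0 → ∑ i, l (κ i) = 0) :
    c0 ((∑ p ∈ s, (AddMonoidAlgebra.single (l p) (c p) : RA)) ^ k * (∑ p ∈ t, (AddMonoidAlgebra.single (l p) (c p) : RA)) ^ k')
    = c0 ((∑ p ∈ s, (AddMonoidAlgebra.single (l p) (c p) : RA)) ^ k)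
      * c0 ((∑ p ∈ t, (AddMonoidAlgebra.single (l p) (c p) : RA)) ^ k') := by
  rw [c0_pow, c0_pow, pow_expand, pow_expand, Finset.sum_mul_sum, Finset.sum_mul_sum, map_sum]
  refine Finset.sum_congr rfl fun κ hκ => ?_
  rw [map_sum]
  refine Finset.sum_congr rfl fun κ' hκ' => ?_
  rw [AddMonoidAlgebra.single_mul_single, c0_single]
  have := h κ hκ κ' hκ'
  by_cases h1 : ∑ i, l (κ i) = 0
  · by_cases h2 : ∑ i, l (κ' i) = 0
    · simp [h1, h2]
    · simp [h1, h2]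
  · rw [if_neg (fun h2 => h1 (this h2)), if_neg h1, zero_mul]

/-- squarefree part -/
def sf (n : ℕ) : ℕ := (Nat.sq_mul_squarefree n).choose
def kk (n : ℕ) : ℕ := (Nat.sq_mul_squarefree n).choose_spec.choose
lemma kk_sf (n : ℕ) : kk n ^ 2 * sf n = n := (Nat.sq_mul_squarefree n).choose_spec.choose_spec.1
lemma sf_sq (n : ℕ) : Squarefree (sf n) := (Nat.sq_mul_squarefree n).choose_spec.choose_spec.2
lemma sqrt_sf (n : ℕ) : √(n:ℝ) = kk n * √(sf n : ℝ) := by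
  have h : (n:ℝ) = (kk n : ℝ)^2 * sf n := by exact_mod_cast (kk_sf n).symm
  rw [h, Real.sqrt_mul (by positivity), Real.sqrt_sq (by positivity)]

def lam (p : ℕ × Bool) : ℝ := sg p.2 * √(p.1 : ℝ)
def bb (n : ℕ) : ℝ := r2 n / √(n:ℝ)
def czz (p : ℕ × Bool) : ℂ := (sg p.2 * bb p.1 / 2 : ℝ) * (-Complex.I)
def JJ (Y : ℕ) (A : Finset ℕ) : Finset (ℕ × Bool) := ((Finset.Icc 1 Y).filter fun n => sf n ∈ A) ×ˢ Finset.univ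
def FF (Y : ℕ) (A : Finset ℕ) : RA := ∑ p ∈ JJ Y A, AddMonoidAlgebra.single (lam p) (czz p)
def A0 (Y : ℕ) : Finset ℕ := (Finset.Icc 1 Y).image sf
def VV (Y m : ℕ) : ℝ := (1/2) * ∑ n ∈ (Finset.Icc 1 Y).filter (fun n => sf n = m), bb n ^ 2

lemma FF_sum (Y : ℕ) (A : Finset ℕ) : ∑ m ∈ A, FF Y {m} = FF Y A := by
  unfold FF JJ
  simp only [Finset.sum_product, Finset.mem_singleton]
  rw [← Finset.sum_fiberwise_of_maps_to (s := (Finset.Icc 1 Y).filter fun n => sf n ∈ A) (t := A) (g := sf)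
    (fun n hn => (Finset.mem_filter.1 hn).2)]
  refine Finset.sum_congr rfl fun m hm => Finset.sum_congr ?_ fun _ _ => rfl
  ext n; simp only [Finset.mem_filter]
  constructor
  · rintro ⟨h1, h2⟩; exact ⟨⟨h1, h2 ▸ hm⟩, h2⟩
  · rintro ⟨⟨h1, _⟩, h2⟩; exact ⟨h1, h2⟩

lemma lam_rep (Y : ℕ) (A : Finset ℕ) (k : ℕ) (κ : Fin k → ℕ × Bool)
    (hκ : κ ∈ Fintype.piFinset (fun _ : Fin k => JJ Y A)) :
    ∃ z : ℕ → ℚ, ∑ i, lam (κ i) = ∑ m ∈ A, (z m : ℝ) * √(m:ℝ) := by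
  refine ⟨fun m => ∑ i, if sf (κ i).1 = m then (if (κ i).2 then (kk (κ i).1 : ℚ) else -(kk (κ i).1 : ℚ)) else 0, ?_⟩
  push_cast
  simp only [Finset.sum_mul]
  rw [Finset.sum_comm]
  refine Finset.sum_congr rfl fun i _ => ?_
  have h1 := Fintype.mem_piFinset.1 hκ i
  simp only [JJ, Finset.mem_product, Finset.mem_filter] at h1
  rw [Finset.sum_eq_single (sf (κ i).1)]
  · rw [if_pos rfl, lam, sqrt_sf]
    cases (κ i).2 <;> simp [sg]
  · intro m _ hm
    rw [if_neg hm.symm]; simp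
  · intro h; exact absurd h1.1.2 h

lemma FF_ind (Y : ℕ) (A : Finset ℕ) (hA : A ⊆ A0 Y) (m : ℕ) (hm0 : m ∈ A0 Y) (hm : m ∉ A) (k l : ℕ) :
    c0 (FF Y {m} ^ k * FF Y A ^ l) = c0 (FF Y {m} ^ k) * c0 (FF Y A ^ l) := by
  refine c0_ind _ _ lam czz k l fun κ hκ κ' hκ' h => ?_
  obtain ⟨z, hz⟩ := lam_rep Y {m} k κ hκ
  obtain ⟨z', hz'⟩ := lam_rep Y A l κ' hκ'
  rw [Finset.sum_singleton] at hz
  have hsq : ∀ n ∈ insert m A, Squarefree n := by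
    intro n hn
    have : n ∈ A0 Y := by
      rcases Finset.mem_insert.1 hn with rfl | h
      · exact hm0
      · exact hA h
    obtain ⟨a, _, rfl⟩ := Finset.mem_image.1 this
    exact sf_sq a
  have := sqrt_lin_indep (insert m A) (fun n => if n = m then z m else z' n) hsq (by
    rw [Finset.sum_insert hm, if_pos rfl, ← hz, ← h, hz']
    congr 1
    refine Finset.sum_congr rfl fun n hn => ?_
    rw [if_neg (show ¬ n = m from fun e => hm (e ▸ hn))]) m (Finset.mem_insert_self _ _)
  rw [if_pos rfl] at this
  rw [hz, this]; simp

lemma lam_eq_zero {Y : ℕ} {A : Finset ℕ} {p : ℕ × Bool} (hp : p ∈ JJ Y A) : lam p ≠ 0 := by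
  simp only [JJ, Finset.mem_product, Finset.mem_filter, Finset.mem_Icc] at hp
  have : 0 < √(p.1:ℝ) := Real.sqrt_pos.2 (by exact_mod_cast hp.1.1.1)
  unfold lam
  cases p.2 <;> simp [sg] <;> linarith

lemma FF_a1 (Y m : ℕ) : c0 (FF Y {m}) = 0 := by
  rw [FF, map_sum]
  refine Finset.sum_eq_zero fun p hp => ?_
  rw [c0_single, if_neg (lam_eq_zero hp)]

lemma lam_inj {p q : ℕ × Bool} (hp : 1 ≤ p.1) (hq : 1 ≤ q.1) (h : lam p = lam q) : p = q := by
  have hp' : 0 < √(p.1:ℝ) := Real.sqrt_pos.2 (by exact_mod_cast hp)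
  have hq' : 0 < √(q.1:ℝ) := Real.sqrt_pos.2 (by exact_mod_cast hq)
  obtain ⟨n, b⟩ := p
  obtain ⟨m, c⟩ := q
  simp only [lam] at *
  have key : √(n:ℝ) = √(m:ℝ) → n = m := fun e => by
    have := (Real.sqrt_inj (by positivity) (by positivity)).1 e
    exact_mod_cast this
  cases b <;> cases c <;> simp [sg] at h ⊢
  · exact h
  · linarith
  · linarith
  · exact h

lemma FF_a2 (Y m : ℕ) : c0 (FF Y {m} ^ 2) = (VV Y m : ℂ) := by
  rw [FF, sq, Finset.sum_mul_sum, map_sum]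
  have h : ∀ p ∈ JJ Y {m}, c0 (∑ q ∈ JJ Y {m}, AddMonoidAlgebra.single (lam p) (czz p) * AddMonoidAlgebra.single (lam q) (czz q))
      = ((bb p.1 ^ 2 / 4 : ℝ) : ℂ) := by
    intro p hp
    have hp' := hp
    simp only [JJ, Finset.mem_product, Finset.mem_filter, Finset.mem_Icc] at hp'
    have hl : lam (p.1, !p.2) = - lam p := by
      unfold lam; cases p.2 <;> simp [sg]
    rw [map_sum, Finset.sum_eq_single (p.1, !p.2)]
    · rw [AddMonoidAlgebra.single_mul_single, c0_single, hl, add_neg_cancel, if_pos rfl]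
      have : ∀ b, sg b * sg (!b) = -1 := by intro b; cases b <;> simp [sg]
      simp only [czz]
      have h2 : ((sg p.2 * bb p.1 / 2 : ℝ) : ℂ) * (-Complex.I) * (((sg (!p.2) * bb p.1 / 2 : ℝ) : ℂ) * (-Complex.I))
        = (((sg p.2 * sg (!p.2)) * (bb p.1 ^ 2 / 4) : ℝ) : ℂ) * (Complex.I * Complex.I) := by push_cast; ring
      rw [h2, this, Complex.I_mul_I]; push_cast; ring
    · intro q hq hne
      rw [AddMonoidAlgebra.single_mul_single, c0_single, if_neg]
      intro h0
      simp only [JJ, Finset.mem_product, Finset.mem_filter, Finset.mem_Icc] at hq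
      exact hne (lam_inj hq.1.1.1 hp'.1.1.1 (by rw [hl]; linarith))
    · intro h; exact absurd (by simpa [JJ] using hp) h
  rw [Finset.sum_congr rfl h, JJ, Finset.sum_product]
  simp only [Finset.sum_const, Finset.card_univ, Fintype.card_bool, VV, Finset.mem_singleton]
  push_cast
  rw [Finset.mul_sum]
  refine Finset.sum_congr rfl fun n _ => ?_
  simp; ring

lemma VV_sum (Y : ℕ) : ∑ m ∈ A0 Y, VV Y m = (1/2) * ∑ n ∈ Finset.Icc 1 Y, (r2 n : ℝ) ^ 2 / n := by
  unfold VV A0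
  rw [← Finset.mul_sum, Finset.sum_fiberwise_of_maps_to (fun n hn => Finset.mem_image_of_mem _ hn)]
  congr 1
  refine Finset.sum_congr rfl fun n _ => ?_
  rw [bb, div_pow, Real.sq_sqrt (by positivity)]

lemma min_prod (k : ℕ) (c : Fin (k+2) → ℝ) (hc : ∀ i, 0 ≤ c i) :
    ∏ i, c i ≤ ∑ j : Fin (k+2), ∏ i : Fin (k+1), c (j.succAbove i) ^ (1 + 1 / ((k:ℝ)+1)) := by
  obtain ⟨j, hj⟩ := Finite.exists_min c
  have h0 : ∀ j : Fin (k+2), 0 ≤ ∏ i : Fin (k+1), c (j.succAbove i) ^ (1 + 1 / ((k:ℝ)+1)) :=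
    fun j => Finset.prod_nonneg fun i _ => Real.rpow_nonneg (hc _) _
  refine le_trans ?_ (Finset.single_le_sum (fun j _ => h0 j) (Finset.mem_univ j))
  rw [Fin.prod_univ_succAbove _ j]
  have e : ∀ i : Fin (k+1), c (j.succAbove i) ^ (1 + 1 / ((k:ℝ)+1))
      = c (j.succAbove i) ^ (1 / ((k:ℝ)+1)) * c (j.succAbove i) := fun i => by
    rw [add_comm (1:ℝ), Real.rpow_add_of_nonneg (hc _) (by positivity) (by norm_num), Real.rpow_one]
  simp only [e, Finset.prod_mul_distrib]
  refine mul_le_mul_of_nonneg_right ?_ (Finset.prod_nonneg fun i _ => hc _)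
  calc c j = ∏ i : Fin (k+1), c j ^ (1 / ((k:ℝ)+1)) := by
        rw [Finset.prod_const, Finset.card_univ, Fintype.card_fin, ← Real.rpow_natCast, ← Real.rpow_mul (hc j)]
        push_cast
        rw [one_div_mul_cancel (by positivity), Real.rpow_one]
    _ ≤ _ := Finset.prod_le_prod (fun i _ => Real.rpow_nonneg (hc _) _)
        fun i _ => Real.rpow_le_rpow (hc _) (hj _) (by positivity)

lemma hy {J : Type*} [DecidableEq J] (K : Finset J) (l : J → ℝ) (hl : Set.InjOn l K) (c : J → ℝ) (hc : ∀ p, 0 ≤ c p) (k : ℕ) :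
    ∑ κ ∈ Fintype.piFinset (fun _ : Fin (k+2) => K), (if ∑ i, l (κ i) = 0 then ∏ i, c (κ i) else 0)
    ≤ (k+2) * (∑ p ∈ K, c p ^ (1 + 1 / ((k:ℝ)+1))) ^ (k+1) := by
  rw [← Finset.sum_filter]
  refine (Finset.sum_le_sum fun κ _ => min_prod k (fun i => c (κ i)) fun i => hc _).trans ?_
  rw [Finset.sum_comm]
  have : ∀ j : Fin (k+2), ∑ κ ∈ (Fintype.piFinset (fun _ : Fin (k+2) => K)).filter (fun κ => ∑ i, l (κ i) = 0),
      ∏ i : Fin (k+1), c (κ (j.succAbove i)) ^ (1 + 1 / ((k:ℝ)+1)) ≤ (∑ p ∈ K, c p ^ (1 + 1 / ((k:ℝ)+1))) ^ (k+1) := by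
    intro j
    rw [Finset.sum_pow']
    have hinj : Set.InjOn (fun (κ : Fin (k+2) → J) (i : Fin (k+1)) => κ (j.succAbove i))
        ((Fintype.piFinset (fun _ : Fin (k+2) => K)).filter (fun κ => ∑ i, l (κ i) = 0)) := by
      intro κ hκ κ' hκ' h
      simp only [Finset.coe_filter, Set.mem_ofPred_eq, Fintype.mem_piFinset] at hκ hκ'
      have h1 : ∀ i, κ (j.succAbove i) = κ' (j.succAbove i) := fun i => congrFun h i
      have h2 : l (κ j) = l (κ' j) := by
        have a := hκ.2
        have b := hκ'.2
        rw [Fin.sum_univ_succAbove _ j] at a b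
        simp only [h1] at a
        linarith
      funext i
      rcases Fin.eq_self_or_eq_succAbove j i with rfl | ⟨i', rfl⟩
      · exact hl (hκ.1 _) (hκ'.1 _) h2
      · exact h1 i'
    rw [← Finset.sum_image (f := fun κ' : Fin (k+1) → J => ∏ i, c (κ' i) ^ (1 + 1 / ((k:ℝ)+1))) hinj]
    refine Finset.sum_le_sum_of_subset_of_nonneg ?_ fun κ _ _ => Finset.prod_nonneg fun i _ => Real.rpow_nonneg (hc _) _
    intro κ' h
    obtain ⟨κ, hκ, rfl⟩ := Finset.mem_image.1 h
    have := (Finset.mem_filter.1 hκ).1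
    rw [Fintype.mem_piFinset] at this ⊢
    exact fun i => this _
  refine (Finset.sum_le_sum fun j _ => this j).trans ?_
  simp

lemma bb_nonneg (n : ℕ) : 0 ≤ bb n := by unfold bb; positivity

lemma czz_norm (p : ℕ × Bool) : ‖czz p‖ = bb p.1 / 2 := by
  have : |sg p.2| = 1 := by cases p.2 <;> simp [sg]
  rw [czz, norm_mul, Complex.norm_real, norm_neg, Complex.norm_I, mul_one, Real.norm_eq_abs, abs_div, abs_mul, this,
    abs_of_nonneg (bb_nonneg _)]
  simp

lemma c0_FF_hy (Y m k : ℕ) : ‖c0 (FF Y {m} ^ (k+2))‖ ≤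
    (k+2) * (2 * ∑ n ∈ (Finset.Icc 1 Y).filter (fun n => sf n = m), bb n ^ (1 + 1 / ((k:ℝ)+1))) ^ (k+1) := by
  rw [FF, c0_pow]
  refine (norm_sum_le _ _).trans ?_
  have h1 : ∀ κ ∈ Fintype.piFinset (fun _ : Fin (k+2) => JJ Y {m}),
      ‖(if ∑ i, lam (κ i) = 0 then ∏ i, czz (κ i) else 0 : ℂ)‖ ≤
      if ∑ i, lam (κ i) = 0 then ∏ i, bb (κ i).1 else 0 := by
    intro κ _
    split_ifs
    · rw [norm_prod]
      refine Finset.prod_le_prod (fun i _ => norm_nonneg _) fun i _ => ?_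
      rw [czz_norm]; linarith [bb_nonneg (κ i).1]
    · simp
  refine (Finset.sum_le_sum h1).trans ?_
  refine (hy (JJ Y {m}) lam ?_ (fun p => bb p.1) (fun p => bb_nonneg _) k).trans (le_of_eq ?_)
  · intro p hp q hq h
    simp only [JJ, Finset.coe_product, Set.mem_prod, Finset.mem_coe, Finset.mem_filter, Finset.mem_Icc] at hp hq
    exact lam_inj hp.1.1.1 hq.1.1.1 h
  · congr 2
    rw [JJ, Finset.sum_product]
    simp only [Finset.sum_const, Finset.card_univ, Fintype.card_bool, Finset.mem_singleton]
    rw [Finset.mul_sum]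
    simp

lemma kk_pos {n : ℕ} (hn : 1 ≤ n) : 1 ≤ kk n ∧ 1 ≤ sf n := by
  have := kk_sf n
  constructor
  · by_contra h
    have : kk n = 0 := by omega
    simp_all
  · by_contra h
    have : sf n = 0 := by omega
    simp_all

lemma aml (k : ℕ) : ∃ B : ℝ, 0 ≤ B ∧ ∀ Y m : ℕ, 1 ≤ m →
    ‖c0 (FF Y {m} ^ (k+2))‖ ≤ B * (m:ℝ) ^ (-((k:ℝ)/2 + 3/4)) := by
  set e : ℝ := 1 + 1 / (2 * ((k:ℝ)+1)) with he
  set p : ℝ := 1 + 1 / ((k:ℝ)+1) with hp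
  have hk1 : (0:ℝ) < (k:ℝ) + 1 := by positivity
  obtain ⟨C, hC1, hC⟩ := r2_le_rpow (1 / (4 * ((k:ℝ)+2))) (by positivity)
  have hsum : Summable fun j : ℕ => (j:ℝ) ^ (-e) := by
    rw [Real.summable_nat_rpow]
    have : 0 < 1 / (2 * ((k:ℝ)+1)) := by positivity
    rw [he]; linarith
  set T : ℝ := ∑' j : ℕ, (j:ℝ) ^ (-e) with hT
  have hT0 : 0 ≤ T := tsum_nonneg fun j => by positivity
  have hp0 : 0 ≤ p := by rw [hp]; positivity
  refine ⟨(k+2) * (2 * (C ^ p * T)) ^ (k+1), by positivity, fun Y m hm => ?_⟩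
  have hm0 : (0:ℝ) < m := by exact_mod_cast hm
  have hbb : ∀ n : ℕ, 1 ≤ n → bb n ^ p ≤ C ^ p * (n:ℝ) ^ (-(e/2)) := by
    intro n hn
    have hn0 : (0:ℝ) < n := by exact_mod_cast hn
    have h1 : bb n ≤ C * (n:ℝ) ^ (1 / (4 * ((k:ℝ)+2)) - 1/2) := by
      rw [bb, Real.sqrt_eq_rpow, Real.rpow_sub hn0, ← mul_div_assoc]
      exact div_le_div_of_nonneg_right (hC n hn) (by positivity)
    refine (Real.rpow_le_rpow (bb_nonneg n) h1 hp0).trans (le_of_eq ?_)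
    rw [Real.mul_rpow (by linarith) (by positivity), ← Real.rpow_mul hn0.le]
    congr 2
    rw [he, hp]; field_simp; ring
  have hs : ∑ n ∈ (Finset.Icc 1 Y).filter (fun n => sf n = m), bb n ^ p ≤ C ^ p * T * (m:ℝ) ^ (-(e/2)) := by
    have h2 : ∀ n ∈ (Finset.Icc 1 Y).filter (fun n => sf n = m), bb n ^ p ≤ C ^ p * (m:ℝ) ^ (-(e/2)) * (kk n : ℝ) ^ (-e) := by
      intro n hn
      obtain ⟨h3, h4⟩ := Finset.mem_filter.1 hn
      have hn1 := (Finset.mem_Icc.1 h3).1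
      refine (hbb n hn1).trans (le_of_eq ?_)
      have h5 : (n:ℝ) = (kk n : ℝ) ^ (2:ℝ) * m := by
        have := kk_sf n
        rw [h4] at this
        rw [show (2:ℝ) = ((2:ℕ):ℝ) by norm_num, Real.rpow_natCast]
        exact_mod_cast this.symm
      conv_lhs => rw [h5, Real.mul_rpow (by positivity) hm0.le, ← Real.rpow_mul (by positivity)]
      rw [show (2:ℝ) * -(e/2) = -e by ring]; ring
    refine (Finset.sum_le_sum h2).trans ?_
    rw [← Finset.mul_sum]
    have h6 : ∑ n ∈ (Finset.Icc 1 Y).filter (fun n => sf n = m), (kk n : ℝ) ^ (-e) ≤ T := by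
      have hinj : Set.InjOn kk ((Finset.Icc 1 Y).filter (fun n => sf n = m) : Finset ℕ) := by
        intro a ha b hb hab
        have ha' := (Finset.mem_filter.1 ha).2
        have hb' := (Finset.mem_filter.1 hb).2
        rw [← kk_sf a, ← kk_sf b, ha', hb', hab]
      rw [← Finset.sum_image (f := fun j : ℕ => (j:ℝ) ^ (-e)) hinj]
      exact hsum.sum_le_tsum _ fun j _ => by positivity
    calc _ ≤ C ^ p * (m:ℝ) ^ (-(e/2)) * T := by gcongr
      _ = _ := by ring
  refine (c0_FF_hy Y m k).trans ?_
  have h7 : (2 * (C ^ p * T * (m:ℝ) ^ (-(e/2)))) ^ (k+1) = (2 * (C ^ p * T)) ^ (k+1) * (m:ℝ) ^ (-((k:ℝ)/2 + 3/4)) := by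
    rw [← mul_assoc, mul_pow]
    congr 1
    rw [← Real.rpow_natCast, ← Real.rpow_mul hm0.le]
    congr 1
    rw [he]; push_cast; field_simp; ring
  rw [mul_assoc, ← h7]
  have h0 : 0 ≤ ∑ n ∈ (Finset.Icc 1 Y).filter (fun n => sf n = m), bb n ^ p :=
    Finset.sum_nonneg fun n _ => Real.rpow_nonneg (bb_nonneg n) _
  gcongr

lemma exists_SD : ∃ B : ℕ → ℝ, (∀ i, 0 ≤ B i) ∧ ∀ Y : ℕ, SD B c0 (fun m => FF Y {m}) (VV Y) (A0 Y) := by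
  choose b hb0 hb using aml
  have hsum : Summable fun j : ℕ => (j:ℝ) ^ (-(5/4:ℝ)) := by
    rw [Real.summable_nat_rpow]; norm_num
  set T : ℝ := ∑' j : ℕ, (j:ℝ) ^ (-(5/4:ℝ)) with hT
  have hT0 : 0 ≤ T := tsum_nonneg fun j => by positivity
  have hA : ∀ Y, ∀ m ∈ A0 Y, 1 ≤ m := by
    intro Y m hm
    obtain ⟨n, hn, rfl⟩ := Finset.mem_image.1 hm
    exact (kk_pos (Finset.mem_Icc.1 hn).1).2
  have hV0 : ∀ Y m, 0 ≤ VV Y m := fun Y m => by unfold VV; positivity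
  refine ⟨fun l => b (l-2) * (1 + T), fun i => mul_nonneg (hb0 _) (by linarith), fun Y => ?_⟩
  refine ⟨?_, ?_, fun m _ => FF_a1 Y m, fun m _ => FF_a2 Y m, fun m _ => hV0 Y m, ?_, ?_⟩
  · rw [AddMonoidAlgebra.one_def, c0_single, if_pos rfl]
  · intro A hA' m hm hmA k l
    rw [FF_sum]
    exact FF_ind Y A hA' m hm hmA k l
  · intro m hm
    have h := hb 0 Y m (hA Y m hm)
    rw [zero_add, FF_a2, Complex.norm_real, Real.norm_of_nonneg (hV0 Y m)] at h
    refine h.trans ?_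
    have h1 : (1:ℝ) ≤ m := by exact_mod_cast hA Y m hm
    have := hb0 0
    refine mul_le_mul_of_nonneg_left ?_ (hb0 0)
    have : (m:ℝ) ^ (-(((0:ℕ):ℝ)/2 + 3/4)) ≤ 1 := Real.rpow_le_one_of_one_le_of_nonpos h1 (by norm_num)
    linarith
  · intro l hl
    obtain ⟨k, rfl⟩ : ∃ k, l = k + 3 := ⟨l - 3, by omega⟩
    have h1 : ∀ m ∈ A0 Y, ‖c0 (FF Y {m} ^ (k+3))‖ ≤ b (k+1) * (m:ℝ) ^ (-(5/4:ℝ)) := by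
      intro m hm
      refine (hb (k+1) Y m (hA Y m hm)).trans ?_
      refine mul_le_mul_of_nonneg_left ?_ (hb0 _)
      refine Real.rpow_le_rpow_of_exponent_le (by exact_mod_cast hA Y m hm) ?_
      have : (0:ℝ) ≤ k := by positivity
      push_cast; linarith
    refine (Finset.sum_le_sum h1).trans ?_
    rw [← Finset.mul_sum]
    refine mul_le_mul_of_nonneg_left ?_ (hb0 _)
    have := hsum.sum_le_tsum (A0 Y) fun j _ => by positivity
    linarith

def Vt (Y : ℕ) : ℝ := ∑ m ∈ A0 Y, VV Y m

lemma JJ_A0 (Y : ℕ) : JJ Y (A0 Y) = Finset.Icc 1 Y ×ˢ Finset.univ := by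
  rw [JJ, Finset.filter_true_of_mem fun n hn => show sf n ∈ A0 Y from Finset.mem_image_of_mem sf hn]

lemma SY_exp (Y : ℕ) (x : ℝ) : ((SY Y x : ℝ) : ℂ) =
    ∑ p ∈ JJ Y (A0 Y), czz p * Complex.exp (((2 * π * lam p : ℝ) : ℂ) * Complex.I * x) := by
  rw [JJ_A0, Finset.sum_product, SY]
  push_cast
  refine Finset.sum_congr rfl fun n _ => ?_
  rw [Fintype.sum_bool]
  simp only [czz, lam, sg, bb]
  rw [Complex.sin]
  simp
  have e1 : -(2 * (π:ℂ) * (√(n:ℝ):ℂ) * x * Complex.I) = -(2 * π * (√(n:ℝ):ℂ) * Complex.I * x) := by ring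
  have e2 : (2 * (π:ℂ) * (√(n:ℝ):ℂ) * x * Complex.I) = (2 * π * (√(n:ℝ):ℂ) * Complex.I * x) := by ring
  rw [e1, e2]
  ring

lemma SY_pow_exp (Y i : ℕ) (x : ℝ) : ((SY Y x ^ i : ℝ) : ℂ) =
    ∑ κ ∈ Fintype.piFinset (fun _ : Fin i => JJ Y (A0 Y)), (∏ j, czz (κ j)) *
      Complex.exp (((2 * π * ∑ j, lam (κ j) : ℝ) : ℂ) * Complex.I * x) := by
  rw [Complex.ofReal_pow, SY_exp, Finset.sum_pow']
  refine Finset.sum_congr rfl fun κ _ => ?_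
  rw [Finset.prod_mul_distrib, ← Complex.exp_sum]
  congr 2
  push_cast
  rw [Finset.mul_sum, Finset.sum_mul, Finset.sum_mul]

lemma exp_avg (L X : ℝ) (hX : 0 < X) (D : ℝ) (hD : L ≠ 0 → 1 ≤ |L| * D) (hD0 : 0 ≤ D) :
    ‖(1 / X : ℂ) * (∫ x in X..(2*X), Complex.exp (((2 * π * L : ℝ) : ℂ) * Complex.I * (x:ℂ))) - (if L = 0 then 1 else 0)‖
      ≤ D / X := by
  by_cases hL : L = 0
  · have hXc : (X:ℂ) ≠ 0 := by exact_mod_cast hX.ne'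
    simp [hL]
    have : (X:ℂ)⁻¹ * (2 * X - X) - 1 = 0 := by field_simp; ring
    rw [this]; simp; positivity
  · rw [if_neg hL, sub_zero]
    have hc : ((2 * π * L : ℝ) : ℂ) * Complex.I ≠ 0 :=
      mul_ne_zero (by exact_mod_cast (by have := Real.pi_pos; positivity)) Complex.I_ne_zero
    have hcn : ‖((2 * π * L : ℝ) : ℂ) * Complex.I‖ = ‖2 * π * L‖ := by
      rw [norm_mul, Complex.norm_I, mul_one, Complex.norm_real]
    rw [integral_exp_mul_complex hc, norm_mul, norm_div _ (((2 * π * L : ℝ) : ℂ) * Complex.I), hcn]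
    have h1 : ∀ y : ℝ, ‖Complex.exp (((2 * π * L : ℝ) : ℂ) * Complex.I * (y:ℂ))‖ = 1 := by
      intro y
      have := Complex.norm_exp_ofReal_mul_I (2 * π * L * y)
      rw [← this]; congr 2; push_cast; ring
    have h2 : ‖Complex.exp (((2 * π * L : ℝ) : ℂ) * Complex.I * ((2 * X : ℝ):ℂ)) - Complex.exp (((2 * π * L : ℝ) : ℂ) * Complex.I * (X:ℂ))‖ ≤ 2 := by
      refine (norm_sub_le _ _).trans ?_
      rw [h1, h1]; norm_num
    have h3 : ‖(1 / X : ℂ)‖ = 1 / X := by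
      rw [norm_div, norm_one, Complex.norm_real, Real.norm_of_nonneg hX.le]
    rw [h3, Real.norm_eq_abs, abs_mul, abs_of_nonneg (by positivity : (0:ℝ) ≤ 2 * π)]
    have hL' : 0 < |L| := abs_pos.2 hL
    have hpi := Real.pi_gt_three
    have h4 : ‖Complex.exp (((2 * π * L : ℝ) : ℂ) * Complex.I * ((2 * X : ℝ):ℂ)) - Complex.exp (((2 * π * L : ℝ) : ℂ) * Complex.I * (X:ℂ))‖ / (2 * π * |L|) ≤ D := by
      rw [div_le_iff₀ (by positivity)]
      refine h2.trans ?_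
      have := hD hL
      nlinarith
    calc _ ≤ 1 / X * D := by gcongr
      _ = _ := by ring

lemma sum_czz (Y : ℕ) : ∑ p ∈ JJ Y (A0 Y), ‖czz p‖ ≤ 9 * Y := by
  simp only [czz_norm]
  rw [JJ_A0, Finset.sum_product]
  refine le_trans ?_ (sum_Icc_r2_le Y)
  refine Finset.sum_le_sum fun n hn => ?_
  have h1 : (1:ℝ) ≤ √(n:ℝ) := by
    rw [Real.one_le_sqrt]; exact_mod_cast (Finset.mem_Icc.1 hn).1
  have : bb n ≤ r2 n := div_le_self (by positivity) h1
  simp; linarith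

lemma mom_eval (i Y : ℕ) (X : ℝ) (hX : 0 < X) :
    ‖(((1 / X) * ∫ x in X..(2*X), SY Y x ^ i : ℝ) : ℂ) - c0 (FF Y (A0 Y) ^ i)‖ ≤
      (9 * Y) ^ i * ((i * Y + 1) ^ (2 ^ i) / X) := by
  have e1 : (((1 / X) * ∫ x in X..(2*X), SY Y x ^ i : ℝ) : ℂ) =
      ∑ κ ∈ Fintype.piFinset (fun _ : Fin i => JJ Y (A0 Y)), (∏ j, czz (κ j)) *
      ((1 / X : ℂ) * ∫ x in X..(2*X), Complex.exp (((2 * π * ∑ j, lam (κ j) : ℝ) : ℂ) * Complex.I * (x:ℂ))) := by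
    rw [Complex.ofReal_mul, ← intervalIntegral.integral_ofReal]
    simp only [SY_pow_exp]
    rw [intervalIntegral.integral_finsetSum, Finset.mul_sum]
    · refine Finset.sum_congr rfl fun κ _ => ?_
      rw [intervalIntegral.integral_const_mul]; push_cast; ring
    · intro κ _
      exact (by fun_prop : Continuous _).intervalIntegrable _ _
  rw [e1, FF, c0_pow, ← Finset.sum_sub_distrib]
  refine (norm_sum_le _ _).trans ?_
  have h : ∀ κ ∈ Fintype.piFinset (fun _ : Fin i => JJ Y (A0 Y)), ‖(∏ j, czz (κ j)) *
      ((1 / X : ℂ) * ∫ x in X..(2*X), Complex.exp (((2 * π * ∑ j, lam (κ j) : ℝ) : ℂ) * Complex.I * (x:ℂ)))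
      - (if ∑ j, lam (κ j) = 0 then ∏ j, czz (κ j) else 0)‖ ≤ (∏ j, ‖czz (κ j)‖) * ((i * Y + 1) ^ (2 ^ i) / X) := by
    intro κ hκ
    rw [Fintype.mem_piFinset] at hκ
    have hD := sep i Y κ (fun j => by
      have := hκ j
      rw [JJ_A0] at this
      exact (Finset.mem_Icc.1 (Finset.mem_product.1 this).1).2)
    have := exp_avg (∑ j, lam (κ j)) X hX ((i * Y + 1) ^ (2 ^ i)) hD (by positivity)
    have e2 : (∏ j, czz (κ j)) * ((1 / X : ℂ) * ∫ x in X..(2*X), Complex.exp (((2 * π * ∑ j, lam (κ j) : ℝ) : ℂ) * Complex.I * (x:ℂ)))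
      - (if ∑ j, lam (κ j) = 0 then ∏ j, czz (κ j) else 0)
      = (∏ j, czz (κ j)) * ((1 / X : ℂ) * (∫ x in X..(2*X), Complex.exp (((2 * π * ∑ j, lam (κ j) : ℝ) : ℂ) * Complex.I * (x:ℂ)))
      - (if ∑ j, lam (κ j) = 0 then 1 else 0)) := by
      split_ifs <;> ring
    rw [e2, norm_mul, norm_prod]
    exact mul_le_mul_of_nonneg_left this (by positivity)
  refine (Finset.sum_le_sum h).trans ?_
  rw [← Finset.sum_mul, ← Finset.sum_pow' (JJ Y (A0 Y)) (fun p => ‖czz p‖) i]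
  have := sum_czz Y
  gcongr

lemma GG_scale (i : ℕ) (V : ℝ) (hV : 0 ≤ V) : GG i V = GG i 1 * √V ^ i := by
  induction i using Nat.twoStepInduction with
  | zero => simp [GG]
  | one => simp [GG]
  | more i ih _ =>
    simp only [GG]
    rw [ih, pow_add, Real.sq_sqrt hV]; ring

lemma mom_gauss (i : ℕ) : ∃ C : ℝ, 0 ≤ C ∧ ∀ (Y : ℕ) (X : ℝ), 0 < X → 1 ≤ Vt Y →
    |(1 / X) * (∫ x in X..(2*X), (SY Y x / √(Vt Y)) ^ i) - GG i 1| ≤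
      C / √(Vt Y) + (9 * Y) ^ i * ((i * Y + 1) ^ (2 ^ i) / X) := by
  obtain ⟨B, hB, hSD⟩ := exists_SD
  obtain ⟨C, hC, h⟩ := stein B hB i
  refine ⟨C, hC, fun Y X hX hV => ?_⟩
  set s := √(Vt Y) with hs
  have hs1 : 1 ≤ s := Real.one_le_sqrt.2 hV
  have hs0 : 0 < s := by linarith
  have h1 := h c0 _ _ _ (hSD Y) (A0 Y) (Finset.Subset.refl _) s hs1 (by rw [hs, Real.sq_sqrt (by linarith)]; exact le_rfl)
  rw [FF_sum] at h1
  change ‖_ - ((GG i (Vt Y) : ℝ) : ℂ)‖ * s ≤ _ at h1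
  have h2 := mom_eval i Y X hX
  set a : ℝ := (1 / X) * ∫ x in X..(2*X), SY Y x ^ i with ha
  set R : ℝ := (9 * Y) ^ i * ((i * Y + 1) ^ (2 ^ i) / X) with hR
  have hR0 : 0 ≤ R := by positivity
  have h3 : |a - GG i (Vt Y)| ≤ R + ‖c0 (FF Y (A0 Y) ^ i) - ((GG i (Vt Y) : ℝ) : ℂ)‖ := by
    rw [← Real.norm_eq_abs, ← Complex.norm_real, Complex.ofReal_sub]
    refine le_trans (le_of_eq ?_) ((norm_add_le _ _).trans (add_le_add_left h2 _))
    congr 1; ring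
  have h4 : ‖c0 (FF Y (A0 Y) ^ i) - ((GG i (Vt Y) : ℝ) : ℂ)‖ ≤ C * s ^ i / s := by
    rw [le_div_iff₀ hs0]; exact h1
  have e : (1 / X) * (∫ x in X..(2*X), (SY Y x / s) ^ i) - GG i 1 = (a - GG i (Vt Y)) / s ^ i := by
    rw [GG_scale i (Vt Y) (by linarith), ← hs]
    simp only [div_pow, intervalIntegral.integral_div]
    rw [ha]; field_simp
  rw [e, abs_div, abs_of_nonneg (by positivity : 0 ≤ s ^ i), div_le_iff₀ (by positivity)]
  have h5 : R ≤ R * s ^ i := le_mul_of_one_le_right hR0 (one_le_pow₀ hs1)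
  calc _ ≤ R + C * s ^ i / s := h3.trans (add_le_add_right h4 _)
    _ ≤ R * s ^ i + C * s ^ i / s := add_le_add_left h5 _
    _ = _ := by ring

lemma Vt_ge (Y : ℕ) (hY : 256 ≤ Y) : Real.log Y ^ 2 / 1024 ≤ Vt Y := by
  have := sum_r2_sq_div_ge Y hY
  rw [Vt, VV_sum]; linarith

lemma Vt_tendsto : Tendsto Vt atTop atTop := by
  have h : Tendsto (fun Y : ℕ => Real.log Y ^ 2 / 1024) atTop atTop :=
    ((tendsto_pow_atTop (by norm_num)).comp (Real.tendsto_log_atTop.comp tendsto_natCast_atTop_atTop)).atTop_div_const (by norm_num)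
  refine tendsto_atTop_mono' _ ?_ h
  filter_upwards [eventually_ge_atTop 256] with Y hY using Vt_ge Y hY

lemma mom_tendsto (Yf : ℝ → ℕ) (h1 : Tendsto Yf atTop atTop)
    (h2 : ∀ α > (0:ℝ), ∀ᶠ X in atTop, (Yf X : ℝ) ≤ X ^ α) (i : ℕ) :
    Tendsto (fun X => (1 / X) * (∫ x in X..(2*X), (SY (Yf X) x / √(Vt (Yf X))) ^ i)) atTop (nhds (GG i 1)) := by
  obtain ⟨C, hC, h⟩ := mom_gauss i
  have hV := Vt_tendsto.comp h1
  have hlim1 : Tendsto (fun X => C / √(Vt (Yf X))) atTop (nhds 0) :=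
    tendsto_const_nhds.div_atTop (Real.tendsto_sqrt_atTop.comp hV)
  set N := i + 2 ^ i with hN
  have hNpos : (0:ℝ) < N := by
    have : 0 < N := by rw [hN]; positivity
    exact_mod_cast this
  have hlim2 : Tendsto (fun X : ℝ => 9 ^ i * (i + 1) ^ (2 ^ i) * X ^ (-(1/2:ℝ))) atTop (nhds 0) := by
    have := (tendsto_rpow_neg_atTop (by norm_num : (0:ℝ) < 1/2)).const_mul ((9:ℝ) ^ i * ((i:ℝ) + 1) ^ (2 ^ i))
    simpa using this
  rw [← tendsto_sub_nhds_zero_iff, tendsto_zero_iff_abs_tendsto_zero]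
  refine squeeze_zero' (Eventually.of_forall fun X => abs_nonneg _) ?_ (by simpa using hlim1.add hlim2)
  filter_upwards [hV.eventually_ge_atTop 1, h2 (1 / (2 * N)) (by positivity), eventually_gt_atTop 0,
    h1.eventually_ge_atTop 1] with X hX1 hX2 hX0 hY1
  refine (h (Yf X) X hX0 hX1).trans (add_le_add_right ?_ _)
  have hY1' : (1:ℝ) ≤ Yf X := by exact_mod_cast hY1
  have h3 : ((i:ℝ) * Yf X + 1) ≤ (i + 1) * Yf X := by linarith
  have h4 : (Yf X : ℝ) ^ N ≤ X ^ (1/2:ℝ) := by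
    calc (Yf X : ℝ) ^ N ≤ (X ^ (1 / (2 * (N:ℝ)))) ^ N := by gcongr
      _ = _ := by
        rw [← Real.rpow_natCast, ← Real.rpow_mul hX0.le]
        congr 1; field_simp
  calc (9 * (Yf X:ℝ)) ^ i * ((i * Yf X + 1) ^ (2 ^ i) / X) ≤ (9 * (Yf X:ℝ)) ^ i * (((i + 1) * Yf X) ^ (2 ^ i) / X) := by gcongr
    _ = 9 ^ i * (i + 1) ^ (2 ^ i) * ((Yf X:ℝ) ^ N / X) := by rw [hN, mul_pow, mul_pow, pow_add]; ring
    _ ≤ 9 ^ i * (i + 1) ^ (2 ^ i) * (X ^ (1/2:ℝ) / X) := by gcongr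
    _ = _ := by
      congr 1
      rw [show -(2:ℝ)⁻¹ = 1/2 - 1 by norm_num, Real.rpow_sub hX0, Real.rpow_one]

/-! ### Taylor bound for the imaginary exponential -/

theorem taylor_aux (c : ℂ) (hc : ‖c‖ = 1) (hre : c.re = 0) (N : ℕ) :
    ∀ u : ℝ, 0 ≤ u → ‖Complex.exp (c * u) - ∑ k ∈ Finset.range N, (c * u) ^ k / (k.factorial : ℂ)‖
      ≤ u ^ N / (N.factorial : ℝ) := by
  induction N with
  | zero =>
    intro u _
    simp [Complex.norm_exp, hre]
  | succ N ih =>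
    intro u hu
    have hder : ∀ x : ℝ, HasDerivAt (fun v : ℝ => Complex.exp (c * v)
        - ∑ k ∈ Finset.range (N+1), (c * v) ^ k / (k.factorial : ℂ))
        (c * (Complex.exp (c * x) - ∑ k ∈ Finset.range N, (c * x) ^ k / (k.factorial : ℂ))) x := by
      intro x
      have hl : HasDerivAt (fun v : ℝ => c * (v:ℂ)) c x := by
        simpa using (Complex.ofRealCLM.hasDerivAt (x := x)).const_mul c
      have h1 := hl.cexp
      have h2 : HasDerivAt (fun v : ℝ => ∑ k ∈ Finset.range (N+1), (c * v) ^ k / (k.factorial : ℂ))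
          (∑ k ∈ Finset.range (N+1), ((k:ℂ) * (c * x) ^ (k-1) * c) / (k.factorial : ℂ)) x := by
        apply HasDerivAt.fun_sum
        intro k _
        exact (hl.fun_pow k).div_const _
      refine (h1.fun_sub h2).congr_deriv (Eq.symm ?_)
      rw [Finset.sum_range_succ', mul_sub, Finset.mul_sum]
      simp only [Nat.cast_zero, zero_mul, zero_div, add_zero]
      congr 1
      · ring
      · refine Finset.sum_congr rfl fun k _ => ?_
        rw [Nat.factorial_succ, Nat.add_sub_cancel]
        have : (k.factorial : ℂ) ≠ 0 := by exact_mod_cast k.factorial_ne_zero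
        have h3 : ((k:ℂ) + 1) ≠ 0 := by exact_mod_cast (Nat.succ_ne_zero k)
        push_cast
        field_simp
    have hB : ∀ x : ℝ, HasDerivAt (fun v : ℝ => v ^ (N+1) / ((N+1).factorial : ℝ)) (x ^ N / (N.factorial : ℝ)) x := by
      intro x
      refine ((hasDerivAt_pow (N+1) x).div_const _).congr_deriv (Eq.symm ?_)
      rw [Nat.factorial_succ, Nat.add_sub_cancel]
      have : (N.factorial : ℝ) ≠ 0 := by exact_mod_cast N.factorial_ne_zero
      push_cast
      field_simp
    refine image_norm_le_of_norm_deriv_right_le_deriv_boundary (a := 0) (b := u)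
      (f := fun v : ℝ => Complex.exp (c * v) - ∑ k ∈ Finset.range (N+1), (c * v) ^ k / (k.factorial : ℂ))
      (fun x _ => (hder x).continuousAt.continuousWithinAt)
      (fun x _ => (hder x).hasDerivWithinAt) ?_ hB ?_ (Set.right_mem_Icc.2 hu)
    · simp [Finset.sum_range_succ']
    · intro x hx
      rw [norm_mul, hc, one_mul]
      exact ih x hx.1

theorem taylor_exp (y : ℝ) (N : ℕ) :
    ‖Complex.exp (y * Complex.I) - ∑ k ∈ Finset.range N, (y * Complex.I) ^ k / (k.factorial : ℂ)‖
      ≤ |y| ^ N / (N.factorial : ℝ) := by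
  rcases le_total 0 y with h | h
  · have := taylor_aux Complex.I (by simp) (by simp) N y h
    rw [abs_of_nonneg h]
    simpa only [mul_comm] using this
  · have := taylor_aux (-Complex.I) (by simp) (by simp) N (-y) (by linarith)
    rw [abs_of_nonpos h]
    have e : -Complex.I * ((-y : ℝ):ℂ) = y * Complex.I := by push_cast; ring
    rw [e] at this
    exact this

theorem GG_even (j : ℕ) : GG (2*j) 1 / ((2*j).factorial : ℝ) = 1 / (2 ^ j * (j.factorial : ℝ)) := by
  induction j with
  | zero => simp [GG]
  | succ j ih =>
    have e : 2 * (j+1) = 2*j + 2 := by ring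
    have h1 : ((2*j).factorial : ℝ) ≠ 0 := by exact_mod_cast Nat.factorial_ne_zero _
    have h2 : (j.factorial : ℝ) ≠ 0 := by exact_mod_cast Nat.factorial_ne_zero _
    rw [e, Nat.factorial_succ, Nat.factorial_succ, Nat.factorial_succ, GG]
    rw [div_eq_div_iff h1 (by positivity)] at ih
    rw [div_eq_div_iff (by positivity) (by positivity)]
    push_cast
    linear_combination (2 * (2*(j:ℝ)+1) * (j+1)) * ih

theorem GG_odd (j : ℕ) : GG (2*j+1) 1 = 0 := by
  induction j with
  | zero => simp [GG]
  | succ j ih =>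
    have e : 2 * (j+1) + 1= (2*j + 1) + 2 := by ring
    rw [e, GG, ih, mul_zero]

theorem GG_series (t : ℝ) (K : ℕ) : ∑ k ∈ Finset.range (2*K), (t * Complex.I) ^ k / (k.factorial : ℂ) * ((GG k 1 : ℝ):ℂ)
    = ∑ j ∈ Finset.range K, ((-(t^2/2) : ℝ) : ℂ) ^ j / (j.factorial : ℂ) := by
  induction K with
  | zero => simp
  | succ K ih =>
    rw [show 2*(K+1) = 2*K+1+1 by ring, Finset.sum_range_succ, Finset.sum_range_succ, ih, GG_odd,
      Finset.sum_range_succ]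
    have h1 : ((2*K).factorial : ℂ) ≠ 0 := by exact_mod_cast Nat.factorial_ne_zero _
    have h2 : (K.factorial : ℂ) ≠ 0 := by exact_mod_cast Nat.factorial_ne_zero _
    have h := congrArg (fun r : ℝ => (r:ℂ)) (GG_even K)
    push_cast at h
    simp only [Complex.ofReal_zero, mul_zero, add_zero]
    congr 1
    rw [div_mul_eq_mul_div, mul_div_assoc, h, pow_mul, mul_pow, Complex.I_sq]
    push_cast
    rw [show (-((t:ℂ)^2/2)) = (t^2 * -1) * (1/2) by ring, mul_pow (_ * _), one_div_pow]
    field_simp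

/-- averaged characteristic function converges -/
theorem char_tendsto (S : ℝ → ℝ → ℝ) (hS : ∀ X, Continuous (S X))
    (hm : ∀ i : ℕ, Tendsto (fun X => (1/X) * (∫ x in X..(2*X), S X x ^ i)) atTop (nhds (GG i 1))) (t : ℝ) :
    Tendsto (fun X : ℝ => ((1/X : ℝ):ℂ) * (∫ x in X..(2*X), Complex.exp (((t * S X x : ℝ):ℂ) * Complex.I)))
      atTop (nhds (((Real.exp (-(t^2/2)) : ℝ)):ℂ)) := by
  rw [Metric.tendsto_atTop']
  intro ε hε
  -- choose K
  have hser : Tendsto (fun K => ∑ j ∈ Finset.range K, ((-(t^2/2) : ℝ) : ℂ) ^ j / (j.factorial : ℂ)) atTop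
      (nhds (((Real.exp (-(t^2/2)) : ℝ)):ℂ)) := by
    have := (NormedSpace.expSeries_div_hasSum_exp (𝔸 := ℂ) ((-(t^2/2) : ℝ) : ℂ)).tendsto_sum_nat
    rw [← Complex.exp_eq_exp_ℂ] at this
    rw [Complex.ofReal_exp]
    exact this
  have htail : Tendsto (fun K : ℕ => (t^2/2)^K / (K.factorial : ℝ)) atTop (nhds 0) :=
    FloorSemiring.tendsto_pow_div_factorial_atTop _
  obtain ⟨K, hK1, hK2⟩ := ((hser.eventually (Metric.ball_mem_nhds _ (by positivity : 0 < ε/4))).and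
    (htail.eventually (gt_mem_nhds (by positivity : 0 < ε/4)))).exists
  rw [dist_eq_norm] at hK1
  -- the moments
  have hA : Tendsto (fun X : ℝ => ∑ k ∈ Finset.range (2*K), (t * Complex.I) ^ k / (k.factorial : ℂ) *
      (((1/X) * (∫ x in X..(2*X), S X x ^ k) : ℝ):ℂ)) atTop
      (nhds (∑ j ∈ Finset.range K, ((-(t^2/2) : ℝ) : ℂ) ^ j / (j.factorial : ℂ))) := by
    rw [← GG_series]
    refine tendsto_finsetSum _ fun k _ => ?_
    exact ((Complex.continuous_ofReal.tendsto _).comp (hm k)).const_mul _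
  have hB : Tendsto (fun X : ℝ => t^(2*K) / ((2*K).factorial : ℝ) * ((1/X) * (∫ x in X..(2*X), S X x ^ (2*K)))) atTop
      (nhds ((t^2/2)^K / (K.factorial : ℝ))) := by
    have := (hm (2*K)).const_mul (t^(2*K) / ((2*K).factorial : ℝ))
    convert this using 2
    rw [div_mul_eq_mul_div, mul_div_assoc, GG_even, pow_mul, div_pow]
    field_simp
  have hev : ∀ᶠ X : ℝ in atTop, dist (((1/X : ℝ):ℂ) * (∫ x in X..(2*X), Complex.exp (((t * S X x : ℝ):ℂ) * Complex.I)))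
      (((Real.exp (-(t^2/2)) : ℝ)):ℂ) < ε := by
    filter_upwards [hA.eventually (Metric.ball_mem_nhds _ (by positivity : 0 < ε/4)),
      hB.eventually (gt_mem_nhds (lt_of_lt_of_eq hK2 rfl)), eventually_gt_atTop 0] with X h1 h2 hX
    rw [dist_eq_norm] at h1 ⊢
    have hc : Continuous (fun x => ((t * S X x : ℝ):ℂ) * Complex.I) := by
      have := hS X; fun_prop
    have e1 : ∑ k ∈ Finset.range (2*K), (t * Complex.I) ^ k / (k.factorial : ℂ) *
        (((1/X) * (∫ x in X..(2*X), S X x ^ k) : ℝ):ℂ) =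
        ((1/X : ℝ):ℂ) * (∫ x in X..(2*X), ∑ k ∈ Finset.range (2*K), (((t * S X x : ℝ):ℂ) * Complex.I) ^ k / (k.factorial : ℂ)) := by
      rw [intervalIntegral.integral_finsetSum, Finset.mul_sum]
      · refine Finset.sum_congr rfl fun k _ => ?_
        rw [Complex.ofReal_mul, ← intervalIntegral.integral_ofReal, mul_left_comm, ← intervalIntegral.integral_const_mul]
        congr 2
        ext x
        push_cast
        ring
      · intro k _
        exact ((hc.pow k).div_const _).intervalIntegrable _ _
    have e2 : ‖((1/X : ℝ):ℂ) * (∫ x in X..(2*X), Complex.exp (((t * S X x : ℝ):ℂ) * Complex.I)) -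
        ∑ k ∈ Finset.range (2*K), (t * Complex.I) ^ k / (k.factorial : ℂ) *
        (((1/X) * (∫ x in X..(2*X), S X x ^ k) : ℝ):ℂ)‖ ≤
        t^(2*K) / ((2*K).factorial : ℝ) * ((1/X) * (∫ x in X..(2*X), S X x ^ (2*K))) := by
      have hcs : Continuous (fun x => ∑ k ∈ Finset.range (2*K), (((t * S X x : ℝ):ℂ) * Complex.I) ^ k / (k.factorial : ℂ)) :=
        continuous_finsetSum _ fun k _ => (hc.pow k).div_const _
      have hce : Continuous (fun x => Complex.exp (((t * S X x : ℝ):ℂ) * Complex.I)) := Complex.continuous_exp.comp hc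
      rw [e1, ← mul_sub, ← intervalIntegral.integral_sub (hce.intervalIntegrable _ _) (hcs.intervalIntegrable _ _),
        norm_mul, Complex.norm_real, Real.norm_of_nonneg (by positivity : 0 ≤ 1/X), mul_left_comm,
        ← intervalIntegral.integral_const_mul]
      refine mul_le_mul_of_nonneg_left ?_ (by positivity)
      refine intervalIntegral.norm_integral_le_of_norm_le (by linarith) (ae_of_all _ fun x _ => ?_) ?_
      · refine (taylor_exp (t * S X x) (2*K)).trans (le_of_eq ?_)
        rw [pow_mul, sq_abs, ← pow_mul, mul_pow]; ring
      · exact ((continuous_const.mul ((hS X).pow _))).intervalIntegrable _ _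
    have h2' := h2
    set A := ((1/X : ℝ):ℂ) * (∫ x in X..(2*X), Complex.exp (((t * S X x : ℝ):ℂ) * Complex.I))
    set B := ∑ k ∈ Finset.range (2*K), (t * Complex.I) ^ k / (k.factorial : ℂ) *
        (((1/X) * (∫ x in X..(2*X), S X x ^ k) : ℝ):ℂ)
    set C := ∑ j ∈ Finset.range K, ((-(t^2/2) : ℝ) : ℂ) ^ j / (j.factorial : ℂ)
    calc ‖A - _‖ = ‖(A - B) + (B - C) + (C - ((Real.exp (-(t^2/2)) : ℝ):ℂ))‖ := by congr 1; ring
      _ ≤ ‖A - B‖ + ‖B - C‖ + ‖C - ((Real.exp (-(t^2/2)) : ℝ):ℂ)‖ := norm_add₃_le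
      _ < ε := by linarith
  obtain ⟨N, hN⟩ := eventually_atTop.1 hev
  exact ⟨N, fun X hX => hN X hX.le⟩

/-! ### From `L²` approximation to characteristic functions -/

theorem exp_diff (u v : ℝ) : ‖Complex.exp ((u:ℂ) * Complex.I) - Complex.exp ((v:ℂ) * Complex.I)‖ ≤ |u - v| := by
  have e : Complex.exp ((u:ℂ) * Complex.I) - Complex.exp ((v:ℂ) * Complex.I)
      = Complex.exp ((v:ℂ) * Complex.I) * (Complex.exp (Complex.I * ((u - v : ℝ):ℂ)) - 1) := by
    rw [mul_sub, ← Complex.exp_add, mul_one]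
    congr 2
    push_cast; ring
  rw [e, norm_mul, Complex.norm_exp_ofReal_mul_I, one_mul]
  exact norm_exp_I_mul_ofReal_sub_one_le

theorem char_transfer (E : ℝ → ℝ) (hE : Measurable E)
    (hb : ∀ᶠ X : ℝ in atTop, ∃ M, ∀ x ∈ Set.Icc X (2*X), |E x| ≤ M)
    (S : ℝ → ℝ → ℝ) (hS : ∀ X, Continuous (S X))
    (hm : ∀ i : ℕ, Tendsto (fun X => (1/X) * (∫ x in X..(2*X), S X x ^ i)) atTop (nhds (GG i 1)))
    (a : ℝ → ℝ) (ha : ∀ᶠ X in atTop, 0 < a X)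
    (hδ : Tendsto (fun X => (1/X) * (∫ x in X..(2*X), (E x / a X - S X x) ^ 2)) atTop (nhds 0)) (t : ℝ) :
    Tendsto (fun X : ℝ => ((1/X : ℝ):ℂ) * (∫ x in X..(2*X),
        Complex.exp (((t * (E x / √((1/X) * (∫ x in X..(2*X), E x ^ 2))) : ℝ):ℂ) * Complex.I)))
      atTop (nhds (((Real.exp (-(t^2/2)) : ℝ)):ℂ)) := by
  set δ : ℝ → ℝ := fun X => (1/X) * (∫ x in X..(2*X), (E x / a X - S X x) ^ 2) with hδd
  set s2 : ℝ → ℝ := fun X => (1/X) * (∫ x in X..(2*X), S X x ^ 2) with hs2d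
  set q : ℝ → ℝ := fun X => (1/X) * (∫ x in X..(2*X), (E x / a X) ^ 2) with hqd
  set κ : ℝ → ℝ := fun X => √(δ X) + 1 / X with hκd
  have hs2 : Tendsto s2 atTop (nhds 1) := by
    have := hm 2
    rw [show GG 2 1 = 1 by simp [GG]] at this
    exact this
  have hsδ : Tendsto (fun X => √(δ X)) atTop (nhds 0) := by
    have := (Real.continuous_sqrt.tendsto 0).comp hδ
    rw [Real.sqrt_zero] at this
    exact this
  have hκ : Tendsto κ atTop (nhds 0) := by
    have := hsδ.add (tendsto_const_nhds.div_atTop tendsto_id : Tendsto (fun X : ℝ => (1:ℝ)/X) atTop (nhds 0))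
    rw [add_zero] at this
    exact this
  -- pointwise facts
  have base : ∀ᶠ X : ℝ in atTop, 0 < X ∧ 0 < a X ∧ 0 ≤ δ X ∧ 0 < κ X ∧ δ X / κ X ≤ √(δ X) ∧
      IntervalIntegrable (fun x => E x / a X) volume X (2*X) ∧
      IntervalIntegrable (fun x => (E x / a X) ^ 2) volume X (2*X) ∧
      IntervalIntegrable (fun x => (E x / a X - S X x) ^ 2) volume X (2*X) := by
    filter_upwards [eventually_gt_atTop 0, ha, hb] with X hX haX hbX
    obtain ⟨M, hM⟩ := hbX
    obtain ⟨M', hM'⟩ := cont_bdd (hS X) X (2*X)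
    have hδ0 : 0 ≤ δ X := by
      refine mul_nonneg (by positivity) (intervalIntegral.integral_nonneg (by linarith) fun x _ => sq_nonneg _)
    have hκ0 : 0 < κ X := by
      have := Real.sqrt_nonneg (δ X)
      have h2 : 0 < 1 / X := by positivity
      simp only [hκd]; linarith
    have h1 : ∀ x ∈ Set.Icc X (2*X), |E x / a X| ≤ M / a X := by
      intro x hx
      rw [abs_div, abs_of_pos haX]
      exact div_le_div_of_nonneg_right (hM x hx) haX.le
    refine ⟨hX, haX, hδ0, hκ0, ?_, ii_of_bdd_on (hE.div_const _) (M / a X) _ _ (by linarith) h1,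
      sq_ii (hE.div_const _) (M / a X) _ _ (by linarith) h1,
      sq_ii ((hE.div_const _).sub (hS X).measurable) (M / a X + M') _ _ (by linarith) fun x hx => ?_⟩
    · rw [div_le_iff₀ hκ0]
      calc δ X = √(δ X) * √(δ X) := (Real.mul_self_sqrt hδ0).symm
        _ ≤ √(δ X) * κ X := by
          refine mul_le_mul_of_nonneg_left ?_ (Real.sqrt_nonneg _)
          have h2 : 0 < 1 / X := by positivity
          simp only [hκd]; linarith
    · exact (abs_sub _ _).trans (add_le_add (h1 x hx) (hM' x hx))
  have hq : Tendsto q atTop (nhds 1) := by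
    have h0 : Tendsto (fun X => δ X + √(δ X) + κ X * s2 X) atTop (nhds 0) := by
      have := (hδ.add hsδ).add (hκ.mul hs2)
      simpa using this
    have h1 : Tendsto (fun X => q X - s2 X) atTop (nhds 0) := by
      rw [tendsto_zero_iff_abs_tendsto_zero]
      refine squeeze_zero' (Eventually.of_forall fun X => abs_nonneg _) ?_ h0
      filter_upwards [base] with X ⟨hX, haX, hδ0, hκ0, hδκ, i1, i2, i3⟩
      have i4 : IntervalIntegrable (fun x => S X x ^ 2) volume X (2*X) := ((hS X).pow 2).intervalIntegrable _ _
      have hX' : X ≤ 2 * X := by linarith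
      have pt : ∀ x, |(E x / a X)^2 - S X x ^ 2| ≤ (1 + (κ X)⁻¹) * (E x / a X - S X x) ^ 2 + κ X * S X x ^ 2 := by
        intro x
        set D := E x / a X - S X x with hD
        have e : (E x / a X)^2 - S X x ^ 2 = D ^ 2 + 2 * D * S X x := by rw [hD]; ring
        have e2 : |2 * D * S X x| ≤ (κ X)⁻¹ * D ^ 2 + κ X * S X x ^ 2 := by
          have hk : (κ X)⁻¹ * κ X = 1 := inv_mul_cancel₀ hκ0.ne'
          have hki : 0 < (κ X)⁻¹ := inv_pos.2 hκ0
          have p1 : 0 ≤ (κ X)⁻¹ * (D - κ X * S X x) ^ 2 := by positivity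
          have p2 : 0 ≤ (κ X)⁻¹ * (D + κ X * S X x) ^ 2 := by positivity
          have q1 : (κ X)⁻¹ * (D - κ X * S X x) ^ 2 = (κ X)⁻¹ * D ^ 2 - 2 * D * S X x + κ X * S X x ^ 2 := by
            linear_combination (- 2 * D * S X x + κ X * S X x ^ 2) * hk
          have q2 : (κ X)⁻¹ * (D + κ X * S X x) ^ 2 = (κ X)⁻¹ * D ^ 2 + 2 * D * S X x + κ X * S X x ^ 2 := by
            linear_combination (2 * D * S X x + κ X * S X x ^ 2) * hk
          rw [abs_le]; constructor <;> linarith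
        rw [e]
        have e3 := abs_add_le (D^2) (2 * D * S X x)
        rw [abs_of_nonneg (sq_nonneg D)] at e3
        linarith
      have e : q X - s2 X = (1/X) * (∫ x in X..(2*X), ((E x / a X)^2 - S X x ^ 2)) := by
        simp only [hqd, hs2d]
        rw [intervalIntegral.integral_sub i2 i4, mul_sub]
      rw [Function.comp, e, abs_mul, abs_of_pos (by positivity : 0 < 1/X)]
      have h5 : |∫ x in X..(2*X), ((E x / a X)^2 - S X x ^ 2)| ≤
          ∫ x in X..(2*X), ((1 + (κ X)⁻¹) * (E x / a X - S X x) ^ 2 + κ X * S X x ^ 2) := by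
        rw [← Real.norm_eq_abs]
        refine intervalIntegral.norm_integral_le_of_norm_le hX' (ae_of_all _ fun x _ => ?_)
          ((i3.const_mul _).add (i4.const_mul _))
        rw [Real.norm_eq_abs]; exact pt x
      rw [intervalIntegral.integral_add (i3.const_mul _) (i4.const_mul _), intervalIntegral.integral_const_mul,
        intervalIntegral.integral_const_mul] at h5
      calc _ ≤ (1/X) * _ := mul_le_mul_of_nonneg_left h5 (by positivity)
        _ = δ X + δ X / κ X + κ X * s2 X := by simp only [hδd, hs2d]; ring
        _ ≤ _ := by linarith
    simpa using h1.add hs2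
  have hρ : Tendsto (fun X => √(q X)) atTop (nhds 1) := by
    have := (Real.continuous_sqrt.tendsto 1).comp hq
    rw [Real.sqrt_one] at this
    exact this
  have hρi : Tendsto (fun X => (√(q X))⁻¹) atTop (nhds 1) := by
    simpa using hρ.inv₀ one_ne_zero
  have hlim : Tendsto (fun X => |t| * ((√(q X))⁻¹ * (κ X + √(δ X)) + |(√(q X))⁻¹ - 1| * (1 + s2 X))) atTop (nhds 0) := by
    have := ((hρi.mul (hκ.add hsδ)).add ((hρi.sub_const 1).abs.mul (hs2.const_add 1))).const_mul |t|
    simpa using this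
  have hmain := char_tendsto S hS hm t
  have hdiff : Tendsto (fun X : ℝ => ((1/X : ℝ):ℂ) * (∫ x in X..(2*X),
        Complex.exp (((t * (E x / √((1/X) * (∫ x in X..(2*X), E x ^ 2))) : ℝ):ℂ) * Complex.I)) -
        ((1/X : ℝ):ℂ) * (∫ x in X..(2*X), Complex.exp (((t * S X x : ℝ):ℂ) * Complex.I))) atTop (nhds 0) := by
    refine squeeze_zero_norm' ?_ hlim
    filter_upwards [base, hρ.eventually (lt_mem_nhds zero_lt_one)] with X ⟨hX, haX, hδ0, hκ0, hδκ, i1, i2, i3⟩ hρ0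
    have hX' : X ≤ 2 * X := by linarith
    set ρ := √(q X) with hρd
    have hσ : √((1/X) * (∫ x in X..(2*X), E x ^ 2)) = a X * ρ := by
      have : (1/X) * (∫ x in X..(2*X), E x ^ 2) = a X ^ 2 * q X := by
        simp only [hqd, div_pow]
        rw [intervalIntegral.integral_div]
        field_simp
      rw [this, Real.sqrt_mul (sq_nonneg _), Real.sqrt_sq haX.le]
    rw [hσ, ← mul_sub]
    have hmeas : ∀ f : ℝ → ℝ, Measurable f →
        IntervalIntegrable (fun x => Complex.exp (((f x : ℝ):ℂ) * Complex.I)) volume X (2*X) := by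
      intro f hf
      rw [intervalIntegrable_iff]
      refine Measure.integrableOn_of_bounded (M := 1) (by simp) ?_ (ae_of_all _ fun x => ?_)
      · exact (Complex.measurable_exp.comp ((Complex.measurable_ofReal.comp hf).mul_const _)).aestronglyMeasurable
      · rw [Complex.norm_exp_ofReal_mul_I]
    rw [← intervalIntegral.integral_sub (hmeas _ ((hE.div_const _).const_mul _)) (hmeas _ ((hS X).measurable.const_mul _)),
      norm_mul, Complex.norm_real, Real.norm_of_nonneg (by positivity : 0 ≤ 1/X)]
    have i4 : IntervalIntegrable (fun x => S X x ^ 2) volume X (2*X) := ((hS X).pow 2).intervalIntegrable _ _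
    have hpt : ∀ x, ‖Complex.exp (((t * (E x / (a X * ρ)) : ℝ):ℂ) * Complex.I) - Complex.exp (((t * S X x : ℝ):ℂ) * Complex.I)‖ ≤
        |t| * ρ⁻¹ * (κ X)⁻¹ * (E x / a X - S X x) ^ 2 + |t| * |ρ⁻¹ - 1| * S X x ^ 2 + |t| * (ρ⁻¹ * κ X + |ρ⁻¹ - 1|) := by
      intro x
      refine (exp_diff _ _).trans ?_
      set D := E x / a X - S X x with hD
      have e : t * (E x / (a X * ρ)) - t * S X x = t * (ρ⁻¹ * D + (ρ⁻¹ - 1) * S X x) := by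
        rw [hD]; field_simp; ring
      rw [e, abs_mul]
      have hki : 0 < (κ X)⁻¹ := inv_pos.2 hκ0
      have hk : (κ X)⁻¹ * κ X = 1 := inv_mul_cancel₀ hκ0.ne'
      have b1 : |D| ≤ κ X + (κ X)⁻¹ * D ^ 2 := by
        have p1 : 0 ≤ (κ X)⁻¹ * (|D| - κ X) ^ 2 := by positivity
        have q1 : (κ X)⁻¹ * (|D| - κ X) ^ 2 = (κ X)⁻¹ * D ^ 2 - 2 * |D| + κ X := by
          have := sq_abs D
          linear_combination (- 2 * |D| + κ X) * hk + (κ X)⁻¹ * this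
        have := abs_nonneg D
        linarith
      have b2 : |S X x| ≤ 1 + S X x ^ 2 := by
        nlinarith [sq_nonneg (|S X x| - 1), sq_abs (S X x), abs_nonneg (S X x)]
      have hri : 0 < ρ⁻¹ := inv_pos.2 hρ0
      calc |t| * |ρ⁻¹ * D + (ρ⁻¹ - 1) * S X x| ≤ |t| * (ρ⁻¹ * |D| + |ρ⁻¹ - 1| * |S X x|) := by
            refine mul_le_mul_of_nonneg_left ((abs_add_le _ _).trans (le_of_eq ?_)) (abs_nonneg _)
            rw [abs_mul, abs_mul, abs_of_pos hri]
        _ ≤ |t| * (ρ⁻¹ * (κ X + (κ X)⁻¹ * D ^ 2) + |ρ⁻¹ - 1| * (1 + S X x ^ 2)) := by gcongr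
        _ = _ := by ring
    have h5 := intervalIntegral.norm_integral_le_of_norm_le hX' (ae_of_all volume fun x (_ : x ∈ Set.Ioc X (2*X)) => hpt x)
      (((i3.const_mul _).add (i4.const_mul _)).add intervalIntegrable_const)
    rw [intervalIntegral.integral_add ((i3.const_mul _).add (i4.const_mul _)) intervalIntegrable_const,
      intervalIntegral.integral_add (i3.const_mul _) (i4.const_mul _), intervalIntegral.integral_const_mul,
        intervalIntegral.integral_const_mul, intervalIntegral.integral_const, smul_eq_mul] at h5
    calc _ ≤ (1/X) * _ := mul_le_mul_of_nonneg_left h5 (by positivity)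
      _ = |t| * (ρ⁻¹ * (κ X + δ X / κ X) + |ρ⁻¹ - 1| * (1 + s2 X)) := by
        simp only [hδd, hs2d]; field_simp; ring
      _ ≤ _ := by gcongr
  simpa using hdiff.add hmain

/-! ### Lévy continuity -/

theorem levy_avg (U : ℝ → ℝ → ℝ) (hU : ∀ X, Measurable (U X))
    (h : ∀ t : ℝ, Tendsto (fun X : ℝ => ((1/X : ℝ):ℂ) * (∫ x in X..(2*X),
        Complex.exp (((t * U X x : ℝ):ℂ) * Complex.I))) atTop (nhds (((Real.exp (-(t^2/2)) : ℝ)):ℂ))) (t : ℝ) :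
    Tendsto (fun X => (1 / X) * (volume {x ∈ Set.Ioo X (2 * X) | U X x < t}).toReal) atTop
      (nhds ((1 / √(2 * π)) * ∫ α in Set.Iio t, Real.exp (-α ^ 2 / 2))) := by
  apply tendsto_of_seq_tendsto
  intro Xs hXs
  -- base measures
  let Z : ℕ → ℝ := fun n => max (Xs n) 1
  have hZ : ∀ n, 0 < Z n := fun n => lt_of_lt_of_le one_pos (le_max_right _ _)
  have hZe : ∀ᶠ n in atTop, Z n = Xs n := by
    filter_upwards [hXs.eventually_ge_atTop 1] with n hn
    exact max_eq_left hn
  let ν : ℕ → Measure ℝ := fun n => ENNReal.ofReal (1 / Z n) • volume.restrict (Set.Ioc (Z n) (2 * Z n))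
  have hν : ∀ n, IsProbabilityMeasure (ν n) := by
    intro n
    constructor
    simp only [ν, Measure.smul_apply, Measure.restrict_apply MeasurableSet.univ, Set.univ_inter, Real.volume_Ioc,
      smul_eq_mul]
    have := hZ n
    rw [← ENNReal.ofReal_mul (by positivity), show 1 / Z n * (2 * Z n - Z n) = 1 by field_simp; ring, ENNReal.ofReal_one]
  let μ : ℕ → ProbabilityMeasure ℝ := fun n =>
    ⟨(ν n).map (U (Z n)), by have := hν n; exact Measure.isProbabilityMeasure_map (hU _).aemeasurable⟩
  let μ₀ : ProbabilityMeasure ℝ := ⟨ProbabilityTheory.gaussianReal 0 1, inferInstance⟩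
  have hconv : Tendsto μ atTop (nhds μ₀) := by
    apply ProbabilityMeasure.tendsto_of_tendsto_charFun
    intro s
    have e0 : charFun (μ₀ : Measure ℝ) s = ((Real.exp (-(s^2/2)) : ℝ):ℂ) := by
      change charFun (ProbabilityTheory.gaussianReal 0 1) s = _
      rw [ProbabilityTheory.charFun_gaussianReal]
      push_cast
      congr 1
      simp
    rw [e0]
    refine ((h s).comp hXs).congr' ?_
    filter_upwards [hZe] with n hn
    change _ = charFun ((ν n).map (U (Z n))) s
    have hz := hZ n
    rw [charFun_apply_real, integral_map (hU _).aemeasurable (by fun_prop)]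
    simp only [ν]
    rw [integral_smul_measure, ENNReal.toReal_ofReal (by positivity), ← intervalIntegral.integral_of_le (by linarith)]
    simp only [Function.comp, hn, Complex.real_smul]
    push_cast
    rfl
  have hfr : (μ₀ : Measure ℝ) (frontier (Set.Iio t)) = 0 := by
    rw [frontier_Iio]
    change ProbabilityTheory.gaussianReal 0 1 {t} = 0
    exact (ProbabilityTheory.gaussianReal_absolutelyContinuous 0 one_ne_zero) (by simp)
  have hlim := ProbabilityMeasure.tendsto_measure_of_null_frontier_of_tendsto' hconv hfr
  have hlim2 := (ENNReal.tendsto_toReal (measure_ne_top (μ₀ : Measure ℝ) (Set.Iio t))).comp hlim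
  have e1 : ((μ₀ : Measure ℝ) (Set.Iio t)).toReal = (1 / √(2 * π)) * ∫ α in Set.Iio t, Real.exp (-α ^ 2 / 2) := by
    change (ProbabilityTheory.gaussianReal 0 1 (Set.Iio t)).toReal = _
    rw [ProbabilityTheory.gaussianReal_apply_eq_integral 0 one_ne_zero, ENNReal.toReal_ofReal
      (setIntegral_nonneg measurableSet_Iio fun x _ => ProbabilityTheory.gaussianPDFReal_nonneg _ _ _),
      ← integral_const_mul]
    refine integral_congr_ae (ae_of_all _ fun x => ?_)
    simp [ProbabilityTheory.gaussianPDFReal]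
  rw [← e1]
  refine hlim2.congr' ?_
  filter_upwards [hZe] with n hn
  have hz := hZ n
  change (((ν n).map (U (Z n))) (Set.Iio t)).toReal = _
  rw [Measure.map_apply (hU _) measurableSet_Iio]
  simp only [ν, Measure.smul_apply, smul_eq_mul]
  rw [ENNReal.toReal_mul, ENNReal.toReal_ofReal (by positivity)]
  rw [← restrict_Ioo_eq_restrict_Ioc, Measure.restrict_apply ((hU _) measurableSet_Iio), hn]
  congr 3
  ext x
  simp [and_comm]

/-! ### The main theorem -/

theorem limiting_distribution_gaussian (ω : ℝ → ℝ) (hω : OmegaClass ω)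
    (hslow : ∀ l : ℝ, 0 < l → Tendsto (fun x => ω (l * x) / ω x) atTop (nhds 1)) :
    ∀ t : ℝ,
      Tendsto (fun X => (1 / X) *
          (volume {x ∈ Set.Ioo X (2 * X) | Ehat ω x / sigmaShell ω X < t}).toReal)
        atTop
        (nhds ((1 / Real.sqrt (2 * Real.pi)) * ∫ α in Set.Iio t, Real.exp (-α ^ 2 / 2))) := by
  have hco := hω.contDiff.continuousOn
  set w : ℝ → ℝ := fun x => ω (max x 1) with hw
  have hwe : ∀ x, 1 ≤ x → w x = ω x := fun x hx => by rw [hw]; simp only [max_eq_left hx]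
  have hwE : ∀ᶠ x in atTop, w x = ω x := (eventually_ge_atTop 1).mono hwe
  have hwc : Continuous w := hco.comp_continuous (by fun_prop) fun x =>
    lt_of_lt_of_le one_pos (le_max_right x 1)
  have hwpos : ∀ x, 0 < w x := fun x => hω.pos _ (lt_of_lt_of_le one_pos (le_max_right x 1))
  have hw0 : Tendsto w atTop (nhds 0) := hω.tendsto_zero.congr' (hwE.mono fun x hx => hx.symm)
  have hwd : ∀ᶠ x in atTop, DifferentiableAt ℝ w x ∧ |deriv w x| < 1 / 2 := by
    filter_upwards [hω.deriv_small, eventually_gt_atTop 1] with x hx hx1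
    have hev : w =ᶠ[nhds x] ω := (lt_mem_nhds hx1).mono fun y hy => hwe y hy.le
    have hdx : DifferentiableAt ℝ ω x :=
      (hω.contDiff.differentiableOn (by norm_num)).differentiableAt (Ioi_mem_nhds (by linarith))
    exact ⟨hdx.congr_of_eventuallyEq hev, by rw [hev.deriv_eq]; exact hx⟩
  have hwu : ∀ ε > (0:ℝ), ∀ᶠ X in atTop, ∀ x ∈ Set.Icc X (2 * X), |w x - w X| ≤ ε * w X := by
    intro ε hε
    filter_upwards [uct ω hco hω.pos hslow ε hε, eventually_ge_atTop 1] with X h hX x hx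
    rw [hwe x (hX.trans hx.1), hwe X hX]
    exact h x hx
  have hwl : ∀ α > (0:ℝ), ∀ᶠ X in atTop, X ^ (-α) ≤ w X := by
    intro α hα
    filter_upwards [omega_lower ω hω hslow α hα, hwE] with X h h2
    rwa [h2]
  set Yf : ℝ → ℕ := fun X => ⌊(w X)⁻¹ ^ 2⌋₊ with hYf
  have hwinv : Tendsto (fun X => (w X)⁻¹) atTop atTop :=
    tendsto_inv_nhdsGT_zero.comp (tendsto_nhdsWithin_iff.2 ⟨hw0, Eventually.of_forall hwpos⟩)
  have hY1 : Tendsto Yf atTop atTop :=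
    tendsto_nat_floor_atTop.comp ((tendsto_pow_atTop two_ne_zero).comp hwinv)
  have hY2 : ∀ α > (0:ℝ), ∀ᶠ X in atTop, (Yf X:ℝ) ≤ X ^ α := by
    intro α hα
    filter_upwards [hwl (α/2) (by positivity), eventually_gt_atTop 0] with X h hX
    have h1 : (w X)⁻¹ ≤ X ^ (α/2) := by
      rw [inv_le_comm₀ (hwpos X) (by positivity), ← Real.rpow_neg hX.le]
      exact h
    calc (Yf X:ℝ) ≤ (w X)⁻¹ ^ 2 := Nat.floor_le (sq_nonneg _)
      _ ≤ (X ^ (α/2)) ^ 2 := by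
        have := (inv_pos.2 (hwpos X)).le
        gcongr
      _ = X ^ α := by
        rw [← Real.rpow_natCast, ← Real.rpow_mul hX.le]
        congr 1; push_cast; ring
  set S : ℝ → ℝ → ℝ := fun X x => SY (Yf X) x / √(Vt (Yf X)) with hSd
  have hS : ∀ X, Continuous (S X) := fun X => (SY_cont _).div_const _
  have hm := mom_tendsto Yf hY1 hY2
  set a : ℝ → ℝ := fun X => 2 * √2 * w X * √(Vt (Yf X)) with had
  have hVpos : ∀ᶠ X in atTop, 0 < Vt (Yf X) := (Vt_tendsto.comp hY1).eventually_gt_atTop 0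
  have ha : ∀ᶠ X in atTop, 0 < a X := by
    filter_upwards [hVpos] with X hV
    have h1 := hwpos X
    have h2 := Real.sqrt_pos.2 hV
    simp only [had]; positivity
  have hbd : ∀ᶠ X : ℝ in atTop, ∃ M, ∀ x ∈ Set.Icc X (2*X), |EE w x| ≤ M := by
    have h1 : ∀ᶠ X : ℝ in atTop, ∀ x, X ≤ x → w x ≤ 1 :=
      eventually_forall_ge_atTop.2 (hw0.eventually (ge_mem_nhds one_pos))
    filter_upwards [h1, eventually_ge_atTop 1] with X h hX
    exact EE_bdd w X hX fun x hx => ⟨hwpos x, h x hx.1⟩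
  -- comparison of `w log w` and `a`
  have hcmp : ∀ᶠ X in atTop, (w X * Real.log (w X)) ^ 2 ≤ 128 * a X ^ 2 := by
    filter_upwards [hwinv.eventually_ge_atTop 2, hY1.eventually_ge_atTop 256, hVpos] with X h1 h2 hV
    have hYge : (w X)⁻¹ ≤ Yf X := by
      have := (Nat.lt_floor_add_one ((w X)⁻¹ ^ 2)).le
      change _ ≤ (Yf X:ℝ) + 1 at this
      nlinarith
    have hlog : Real.log (w X) ^ 2 ≤ Real.log (Yf X) ^ 2 := by
      rw [← neg_sq (Real.log (w X)), ← Real.log_inv]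
      have h3 : 0 ≤ Real.log (w X)⁻¹ := Real.log_nonneg (by linarith)
      have h4 : Real.log (w X)⁻¹ ≤ Real.log (Yf X) := Real.log_le_log (by linarith) hYge
      gcongr
    have hVge := Vt_ge (Yf X) h2
    have e : a X ^ 2 = 8 * w X ^ 2 * Vt (Yf X) := by
      simp only [had]
      rw [mul_pow, mul_pow, mul_pow, Real.sq_sqrt (by norm_num), Real.sq_sqrt hV.le]
      ring
    rw [e, mul_pow]
    nlinarith [sq_nonneg (w X)]
  have hδ : Tendsto (fun X => (1/X) * (∫ x in X..(2*X), (EE w x / a X - S X x) ^ 2)) atTop (nhds 0) := by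
    rw [Metric.tendsto_nhds]
    intro ε hε
    filter_upwards [approx_ev w hwc hwpos hw0 hwd hwu hwl (ε/256) (by positivity), hcmp, ha, hVpos,
      eventually_gt_atTop 0] with X h1 h2 h3 h4 hX
    have e : ∀ x, (EE w x / a X - S X x) ^ 2 =
        (EE w x - 2 * √2 * w X * SY ⌊(w X)⁻¹ ^ 2⌋₊ x) ^ 2 / a X ^ 2 := by
      intro x
      have h5 := Real.sqrt_pos.2 h4
      have h6 : S X x = (2 * √2 * w X * SY ⌊(w X)⁻¹ ^ 2⌋₊ x) / a X := by
        simp only [hSd, had]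
        have := hwpos X
        have h8 : (0:ℝ) < √2 := by positivity
        change SY (Yf X) x / _ = (2 * √2 * w X * SY (Yf X) x) / _
        field_simp
      rw [h6, ← sub_div, div_pow]
    have h7 : 0 ≤ (1/X) * (∫ x in X..(2*X), (EE w x / a X - S X x) ^ 2) :=
      mul_nonneg (by positivity) (intervalIntegral.integral_nonneg (by linarith) fun x _ => sq_nonneg _)
    rw [Real.dist_eq, sub_zero, abs_of_nonneg h7]
    simp only [e]
    rw [intervalIntegral.integral_div, ← mul_div_assoc, div_lt_iff₀ (by positivity)]
    have h9 : 0 < a X ^ 2 := by positivity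
    nlinarith
  have hU : ∀ X, Measurable (fun x => EE w x / √((1/X) * (∫ x in X..(2*X), EE w x ^ 2))) :=
    fun X => (EE_meas w hwc).div_const _
  intro t
  have hfin := levy_avg (fun X x => EE w x / √((1/X) * (∫ x in X..(2*X), EE w x ^ 2))) hU
    (fun s => char_transfer (EE w) (EE_meas w hwc) hbd S hS hm a ha hδ s) t
  refine hfin.congr' ?_
  filter_upwards [eventually_ge_atTop 1] with X hX
  have hEq : ∀ x, X ≤ x → EE w x = Ehat ω x := by
    intro x hx
    have hx1 : 1 ≤ x := hX.trans hx
    rw [Ehat_eq ω x (by linarith) (hω.pos x (by linarith))]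
    simp only [EE, hwe x hx1]
  have hσ : √((1/X) * (∫ x in X..(2*X), EE w x ^ 2)) = sigmaShell ω X := by
    unfold sigmaShell
    congr 2
    refine intervalIntegral.integral_congr fun x hx => ?_
    rw [Set.uIcc_of_le (by linarith)] at hx
    simp only [hEq x hx.1]
  congr 4
  ext x
  simp only [hσ]
  constructor
  · rintro ⟨h1, h2⟩
    exact ⟨h1, by rw [← hEq x h1.1.le]; exact h2⟩
  · rintro ⟨h1, h2⟩
    exact ⟨h1, by rw [hEq x h1.1.le]; exact h2⟩
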